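/- Let F be a field of characteristic ≠ 2 such that −1 = a² + b² for some a, b ∈ F. Then the stabilization map O(n,F) → O(n+1,F) induces an isomorphism H_d(O(n,F); ℤ) → H_d(O(n+1,F); ℤ) whenever 2d ≤ n − 4, and a surjection whenever 2d ≤ n − 3. Moreover, if −1 = a² for some a ∈ F, then the map is an isomorphism whenever 2d ≤ n − 2 and a surjection whenever 2d ≤ n − 1. -/

import Mathlib

/-! # Group homology via the inhomogeneous bar complex (trivial coefficients) -/

namespace GroupHomologyBar

variable (G : Type) [Group G] (A : Type) [AddCommGroup A]

/-- Inhomogeneous `n`-chains of `G` with coefficients in `A`. -/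
abbrev chains (n : ℕ) : Type := (Fin n → G) →₀ A

/-- The differential of the inhomogeneous bar complex with trivial `G`-action on the
coefficients, sending `[g₁|…|g_{n+1}] ⊗ a` to
`[g₂|…|g_{n+1}] ⊗ a + ∑ⱼ (-1)^{j+1} [g₁|…|gⱼg_{j+1}|…|g_{n+1}] ⊗ a`
(the last summand of the sum being `(-1)^{n+1} [g₁|…|g_n] ⊗ a`). -/
noncomputable def d (n : ℕ) : chains G A (n + 1) →ₗ[ℤ] chains G A n :=
  Finsupp.lsum ℤ fun g =>
    (Finsupp.lsingle (Fin.tail g) : A →ₗ[ℤ] chains G A n)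
      + ∑ j : Fin (n + 1),
          ((-1 : ℤ) ^ ((j : ℕ) + 1)) • Finsupp.lsingle (Fin.contractNth j (· * ·) g)

/-- The `n`-cycles. -/
noncomputable def cycles : (n : ℕ) → Submodule ℤ (chains G A n)
  | 0 => ⊤
  | (n + 1) => LinearMap.ker (d G A n)

/-- The `n`-boundaries, viewed as a submodule of the `n`-cycles. -/
noncomputable def boundaries (n : ℕ) : Submodule ℤ (cycles G A n) :=
  Submodule.comap (cycles G A n).subtype (LinearMap.range (d G A n))

/-- The group homology `H_n(G; A)` of `G` with trivial coefficients in `A`. -/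
abbrev Homology (n : ℕ) : Type := cycles G A n ⧸ boundaries G A n

variable {G}
variable {G' : Type} [Group G']

/-- The map on chains induced by a group homomorphism. -/
noncomputable def chainsMap (φ : G →* G') (n : ℕ) : chains G A n →ₗ[ℤ] chains G' A n :=
  Finsupp.lmapDomain A ℤ fun v => φ ∘ v

lemma chainsMap_single (φ : G →* G') {n : ℕ} (v : Fin n → G) (a : A) :
    chainsMap A φ n (Finsupp.single v a) = Finsupp.single (φ ∘ v) a := by
  simp [chainsMap, Finsupp.mapDomain_single]

lemma d_single {n : ℕ} (g : Fin (n + 1) → G) (a : A) :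
    d G A n (Finsupp.single g a)
      = Finsupp.single (Fin.tail g) a
        + ∑ j : Fin (n + 1),
            ((-1 : ℤ) ^ ((j : ℕ) + 1)) • Finsupp.single (Fin.contractNth j (· * ·) g) a := by
  simp [d, Finsupp.lsum_single]

lemma d_chainsMap (φ : G →* G') (n : ℕ) :
    (d G' A n).comp (chainsMap A φ (n + 1)) = (chainsMap A φ n).comp (d G A n) := by
  apply Finsupp.lhom_ext
  intro g a
  have hc : ∀ j : Fin (n + 1),
      φ ∘ Fin.contractNth j (· * ·) g = Fin.contractNth j (· * ·) (φ ∘ g) := by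
    intro j
    funext k
    simp only [Function.comp_apply, Fin.contractNth]
    split_ifs <;> simp
  simp only [LinearMap.comp_apply, chainsMap_single, d_single, map_add, map_sum, map_smul,
    chainsMap_single, Fin.comp_tail, hc]

lemma chainsMap_mem_cycles (φ : G →* G') (n : ℕ) :
    ∀ x ∈ cycles G A n, chainsMap A φ n x ∈ cycles G' A n := by
  intro x hx
  cases n with
  | zero => trivial
  | succ n =>
    simp only [cycles, LinearMap.mem_ker] at hx ⊢
    have := congrArg (fun L : chains G A (n + 1) →ₗ[ℤ] chains G' A n => L x) (d_chainsMap A φ n)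
    simp only [LinearMap.comp_apply] at this
    rw [this, hx, map_zero]

/-- The map on cycles induced by a group homomorphism. -/
noncomputable def cyclesMap (φ : G →* G') (n : ℕ) : cycles G A n →ₗ[ℤ] cycles G' A n :=
  (chainsMap A φ n).restrict (chainsMap_mem_cycles A φ n)

/-- The map `H_n(G; A) → H_n(G'; A)` on group homology induced by a group
homomorphism `φ : G →* G'`. -/
noncomputable def inducedMap (φ : G →* G') (n : ℕ) :
    Homology G A n →ₗ[ℤ] Homology G' A n :=
  Submodule.mapQ _ _ (cyclesMap A φ n) (by
    rintro ⟨x, hx⟩ hmem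
    simp only [boundaries, Submodule.mem_comap, Submodule.subtype_apply,
      LinearMap.mem_range] at hmem ⊢
    obtain ⟨y, hy⟩ := hmem
    refine ⟨chainsMap A φ (n + 1) y, ?_⟩
    have := congrArg (fun L : chains G A (n + 1) →ₗ[ℤ] chains G' A n => L y) (d_chainsMap A φ n)
    simp only [LinearMap.comp_apply] at this
    rw [this, hy]
    rfl)

end GroupHomologyBar

section Isometries

variable (F : Type) [Field F] {W : Type} [AddCommGroup W] [Module F W]

/-- The group of linear automorphisms of a vector space `V` preserving a
function `Q : V → F` (e.g. a quadratic form). -/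
def quadIsoms {V : Type} [AddCommGroup V] [Module F V] (Q : V → F) :
    Subgroup (V ≃ₗ[F] V) where
  carrier := {g | ∀ v, Q (g v) = Q v}
  one_mem' := fun _ => rfl
  mul_mem' := fun {a b} ha hb v => by
    rw [show (a * b) v = a (b v) from rfl, ha, hb]
  inv_mem' := fun {a} ha v => by
    rw [show (a⁻¹ : V ≃ₗ[F] V) v = a.symm v from rfl, ← ha (a.symm v), a.apply_symm_apply]

/-- The group of linear automorphisms of a vector space `V` preserving a
pairing `ω : V → V → F` (e.g. a bilinear or sesquilinear form). -/
def bilinIsoms {V : Type} [AddCommGroup V] [Module F V] (ω : V → V → F) :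
    Subgroup (V ≃ₗ[F] V) where
  carrier := {g | ∀ v w, ω (g v) (g w) = ω v w}
  one_mem' := fun _ _ => rfl
  mul_mem' := fun {a b} ha hb v w => by
    rw [show (a * b) v = a (b v) from rfl, show (a * b) w = a (b w) from rfl, ha, hb]
  inv_mem' := fun {a} ha v w => by
    rw [show (a⁻¹ : V ≃ₗ[F] V) v = a.symm v from rfl,
      show (a⁻¹ : V ≃ₗ[F] V) w = a.symm w from rfl,
      ← ha (a.symm v) (a.symm w), a.apply_symm_apply, a.apply_symm_apply]

/-- The "orthogonal sum" form `x ↦ ∑ i, q (x i)` on `W^n`. -/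
def sumForm (q : W → F) (n : ℕ) (x : Fin n → W) : F := ∑ i, q (x i)

/-- The "orthogonal sum" pairing `(x, y) ↦ ∑ i, β (x i) (y i)` on `W^n`. -/
def pairForm (β : W → W → F) (n : ℕ) (x y : Fin n → W) : F := ∑ i, β (x i) (y i)

/-- The linear equivalence `W^{n+1} ≃ W^n × W` splitting off the last coordinate. -/
def lastSplit (n : ℕ) : (Fin (n + 1) → W) ≃ₗ[F] (Fin n → W) × W where
  toLinearMap := (LinearMap.funLeft F W Fin.castSucc).prod (LinearMap.proj (Fin.last n))
  invFun p := Fin.snoc p.1 p.2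
  left_inv x := Fin.snoc_init_self x
  right_inv p := by
    refine Prod.ext (funext fun i => ?_) ?_
    · exact @Fin.snoc_castSucc n (fun _ => W) p.2 p.1 i
    · exact @Fin.snoc_last n (fun _ => W) p.2 p.1

lemma lastSplit_symm_apply (n : ℕ) (p : Fin n → W) (w : W) :
    (lastSplit F n).symm (p, w) = Fin.snoc p w := rfl

/-- Extension of an automorphism of `W^n` to `W^{n+1}` by the identity on the
added last coordinate. -/
def stabAut (n : ℕ) (g : (Fin n → W) ≃ₗ[F] (Fin n → W)) :
    (Fin (n + 1) → W) ≃ₗ[F] (Fin (n + 1) → W) :=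
  (lastSplit F n).trans ((g.prodCongr (LinearEquiv.refl F W)).trans (lastSplit F n).symm)

lemma stabAut_symm_apply (n : ℕ) (g : (Fin n → W) ≃ₗ[F] (Fin n → W))
    (p : Fin n → W) (w : W) :
    stabAut F n g ((lastSplit F n).symm (p, w)) = (lastSplit F n).symm (g p, w) := by
  simp [stabAut, LinearEquiv.trans_apply, LinearEquiv.apply_symm_apply, LinearEquiv.prodCongr_apply]

lemma sumForm_snoc (q : W → F) (n : ℕ) (p : Fin n → W) (w : W) :
    sumForm F q (n + 1) ((lastSplit F n).symm (p, w)) = sumForm F q n p + q w := by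
  simp [sumForm, lastSplit_symm_apply, Fin.sum_univ_castSucc, Fin.snoc_castSucc, Fin.snoc_last]

lemma pairForm_snoc (β : W → W → F) (n : ℕ) (p p' : Fin n → W) (w w' : W) :
    pairForm F β (n + 1) ((lastSplit F n).symm (p, w)) ((lastSplit F n).symm (p', w'))
      = pairForm F β n p p' + β w w' := by
  simp [pairForm, lastSplit_symm_apply, Fin.sum_univ_castSucc, Fin.snoc_castSucc, Fin.snoc_last]

/-- The stabilization homomorphism on the isometry group of the form `sumForm q n`,
extending an isometry by the identity on the added summand. -/
def quadStab (q : W → F) (n : ℕ) :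
    quadIsoms F (sumForm F q n) →* quadIsoms F (sumForm F q (n + 1)) where
  toFun g := ⟨stabAut F n g.1, by
    intro v
    obtain ⟨⟨p, w⟩, rfl⟩ : ∃ x, (lastSplit F n).symm x = v :=
      ⟨lastSplit F n v, (lastSplit F n).symm_apply_apply v⟩
    rw [stabAut_symm_apply, sumForm_snoc, sumForm_snoc, g.2 p]⟩
  map_one' := by
    refine Subtype.ext (LinearEquiv.ext fun v => ?_)
    show stabAut F n 1 v = v
    obtain ⟨⟨p, w⟩, rfl⟩ : ∃ x, (lastSplit F n).symm x = v :=
      ⟨lastSplit F n v, (lastSplit F n).symm_apply_apply v⟩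
    rw [stabAut_symm_apply]
    rfl
  map_mul' g h := by
    refine Subtype.ext (LinearEquiv.ext fun v => ?_)
    show stabAut F n (g.1 * h.1) v = stabAut F n g.1 (stabAut F n h.1 v)
    obtain ⟨⟨p, w⟩, rfl⟩ : ∃ x, (lastSplit F n).symm x = v :=
      ⟨lastSplit F n v, (lastSplit F n).symm_apply_apply v⟩
    rw [stabAut_symm_apply, stabAut_symm_apply, stabAut_symm_apply]
    rfl

/-- The stabilization homomorphism on the isometry group of the pairing `pairForm β n`,
extending an isometry by the identity on the added summand. -/
def bilinStab (β : W → W → F) (n : ℕ) :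
    bilinIsoms F (pairForm F β n) →* bilinIsoms F (pairForm F β (n + 1)) where
  toFun g := ⟨stabAut F n g.1, by
    intro v v'
    obtain ⟨⟨p, w⟩, rfl⟩ : ∃ x, (lastSplit F n).symm x = v :=
      ⟨lastSplit F n v, (lastSplit F n).symm_apply_apply v⟩
    obtain ⟨⟨p', w'⟩, rfl⟩ : ∃ x, (lastSplit F n).symm x = v' :=
      ⟨lastSplit F n v', (lastSplit F n).symm_apply_apply v'⟩
    rw [stabAut_symm_apply, stabAut_symm_apply, pairForm_snoc, pairForm_snoc, g.2 p p']⟩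
  map_one' := by
    refine Subtype.ext (LinearEquiv.ext fun v => ?_)
    show stabAut F n 1 v = v
    obtain ⟨⟨p, w⟩, rfl⟩ : ∃ x, (lastSplit F n).symm x = v :=
      ⟨lastSplit F n v, (lastSplit F n).symm_apply_apply v⟩
    rw [stabAut_symm_apply]
    rfl
  map_mul' g h := by
    refine Subtype.ext (LinearEquiv.ext fun v => ?_)
    show stabAut F n (g.1 * h.1) v = stabAut F n g.1 (stabAut F n h.1 v)
    obtain ⟨⟨p, w⟩, rfl⟩ : ∃ x, (lastSplit F n).symm x = v :=
      ⟨lastSplit F n v, (lastSplit F n).symm_apply_apply v⟩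
    rw [stabAut_symm_apply, stabAut_symm_apply, stabAut_symm_apply]
    rfl

end Isometries

namespace OStab

section FinsuppBasics

/-- Free abelian group on a type. -/
abbrev Z (α : Type) : Type := α →₀ ℤ

/-- Basis element. -/
noncomputable def e {α : Type} (a : α) : Z α := Finsupp.single a 1

/-- Linear extension. -/
noncomputable def L {α M : Type} [AddCommGroup M] (f : α → M) : Z α →ₗ[ℤ] M :=
  Finsupp.linearCombination ℤ f

@[simp] lemma L_e {α M : Type} [AddCommGroup M] (f : α → M) (a : α) : L f (e a) = f a := by
  simp [L, e]

lemma hom_ext {α M : Type} [AddCommGroup M] {φ ψ : Z α →ₗ[ℤ] M}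
    (h : ∀ a, φ (e a) = ψ (e a)) : φ = ψ := by
  apply Finsupp.lhom_ext'
  intro a
  apply LinearMap.ext_ring
  exact h a

lemma hom_ext_apply {α M : Type} [AddCommGroup M] {φ ψ : Z α →ₗ[ℤ] M}
    (h : ∀ a, φ (e a) = ψ (e a)) (z : Z α) : φ z = ψ z := by
  rw [hom_ext h]

/-- Pushforward. -/
noncomputable def mp {α β : Type} (f : α → β) : Z α →ₗ[ℤ] Z β := L (fun a => e (f a))

@[simp] lemma mp_e {α β : Type} (f : α → β) (a : α) : mp f (e a) = e (f a) := by
  simp [mp]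

lemma mp_mp {α β γ : Type} (f : α → β) (g : β → γ) (z : Z α) :
    mp g (mp f z) = mp (g ∘ f) z := by
  have : (mp g).comp (mp f) = mp (g ∘ f) := hom_ext (by intro a; simp)
  exact congrArg (fun φ => φ z) this

lemma mp_id {α : Type} (z : Z α) : mp (fun a : α => a) z = z := by
  have : mp (fun a : α => a) = LinearMap.id := hom_ext (by intro a; simp)
  rw [this]; rfl

/-- Elements supported on a set. -/
def sup {α : Type} (s : Set α) : Submodule ℤ (Z α) := Finsupp.supported ℤ ℤ s

lemma e_mem {α : Type} {s : Set α} {a : α} (h : a ∈ s) : e a ∈ sup s :=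
  Finsupp.single_mem_supported ℤ 1 h

lemma e_mem_iff {α : Type} {s : Set α} {a : α} : e a ∈ sup s ↔ a ∈ s := by
  constructor
  · intro h
    have := (Finsupp.mem_supported ℤ (e a)).1 h
    apply this
    simp [e]
  · exact e_mem

lemma sup_eq_span {α : Type} (s : Set α) : sup s = Submodule.span ℤ (Set.image e s) :=
  Finsupp.supported_eq_span_single ℤ s

lemma sup_le {α : Type} {s : Set α} {N : Submodule ℤ (Z α)} (h : ∀ a ∈ s, e a ∈ N) :
    sup s ≤ N := by
  rw [sup_eq_span, Submodule.span_le]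
  rintro _ ⟨a, ha, rfl⟩
  exact h a ha

lemma map_mem {α M : Type} [AddCommGroup M] {s : Set α} {N : Submodule ℤ M}
    (φ : Z α →ₗ[ℤ] M) (h : ∀ a ∈ s, φ (e a) ∈ N) {z : Z α} (hz : z ∈ sup s) : φ z ∈ N := by
  have : sup s ≤ N.comap φ := sup_le (fun a ha => h a ha)
  exact this hz

lemma eq_on_sup {α M : Type} [AddCommGroup M] {s : Set α}
    {φ ψ : Z α →ₗ[ℤ] M} (h : ∀ a ∈ s, φ (e a) = ψ (e a)) {z : Z α} (hz : z ∈ sup s) :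
    φ z = ψ z := by
  have := map_mem (N := ⊥) (φ - ψ) (s := s) (by intro a ha; simp [h a ha]) hz
  simpa [sub_eq_zero] using this

lemma sup_mono {α : Type} {s t : Set α} (h : s ⊆ t) : sup s ≤ sup t :=
  Finsupp.supported_mono h

lemma mem_sup_iff {α : Type} {s : Set α} {z : Z α} : z ∈ sup s ↔ ∀ a, z a ≠ 0 → a ∈ s := by
  rw [sup, Finsupp.mem_supported]
  constructor
  · intro h a ha; exact h (by simpa using ha)
  · intro h a ha; exact h a (by simpa using ha)

lemma mp_mem {α β : Type} {f : α → β} {s : Set α} {t : Set β} (h : ∀ a ∈ s, f a ∈ t)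
    {z : Z α} (hz : z ∈ sup s) : mp f z ∈ sup t :=
  map_mem (mp f) (fun a ha => by rw [mp_e]; exact e_mem (h a ha)) hz

open Classical in
/-- Restriction to a subset. -/
noncomputable def res {α : Type} (s : Set α) : Z α →ₗ[ℤ] Z α :=
  L (fun a => if a ∈ s then e a else 0)

open Classical in
lemma res_e {α : Type} (s : Set α) (a : α) : res s (e a) = if a ∈ s then e a else 0 := by
  simp [res]

lemma res_e_of {α : Type} {s : Set α} {a : α} (h : a ∈ s) : res s (e a) = e a := by
  simp [res, h]

lemma res_e_not {α : Type} {s : Set α} {a : α} (h : a ∉ s) : res s (e a) = 0 := by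
  simp [res, h]

lemma res_mem {α : Type} {s t : Set α} {z : Z α} (hz : z ∈ sup t) : res s z ∈ sup (t ∩ s) := by
  classical
  refine map_mem (res s) (fun a ha => ?_) hz
  by_cases h : a ∈ s
  · rw [res_e_of h]; exact e_mem ⟨ha, h⟩
  · rw [res_e_not h]; exact zero_mem _

lemma res_eq_self {α : Type} {s : Set α} {z : Z α} (hz : z ∈ sup s) : res s z = z := by
  have := eq_on_sup (φ := res s) (ψ := LinearMap.id) (s := s)
    (fun a ha => by rw [res_e_of ha]; rfl) hz
  simpa using this

lemma res_eq_zero {α : Type} {s t : Set α} (h : ∀ a ∈ t, a ∉ s) {z : Z α} (hz : z ∈ sup t) :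
    res s z = 0 := by
  have := eq_on_sup (φ := res s) (ψ := 0) (s := t)
    (fun a ha => by rw [res_e_not (h a ha)]; rfl) hz
  simpa using this

lemma res_add_compl {α : Type} (s : Set α) (z : Z α) : res s z + res sᶜ z = z := by
  have : res s + res sᶜ = LinearMap.id := hom_ext (by
    intro a
    by_cases h : a ∈ s
    · have : a ∉ sᶜ := fun h' => h' h
      simp [res_e_of h, res_e_not this]
    · have h' : a ∈ sᶜ := h
      simp [res_e_not h, res_e_of h'])
  exact congrArg (fun φ => φ z) this

open Classical in
/-- Decomposition of a chain along a labelling. -/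
lemma sum_res_fiber {α ι : Type} (lab : α → ι) (z : Z α) :
    z = ∑ i ∈ z.support.image lab, res {a | lab a = i} z := by
  have key : ∀ S : Finset ι, ∀ z ∈ sup {a | lab a ∈ S}, z = ∑ i ∈ S, res {a | lab a = i} z := by
    intro S z hz
    have := eq_on_sup (φ := LinearMap.id) (ψ := ∑ i ∈ S, res {a | lab a = i})
      (s := {a | lab a ∈ S}) (fun a ha => by
        simp only [LinearMap.id_apply, LinearMap.sum_apply]
        rw [Finset.sum_eq_single (lab a)]
        · exact (res_e_of (s := {a' | lab a' = lab a}) rfl).symm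
        · intro b _ hb
          exact res_e_not (fun h => hb h.symm)
        · intro h; exact absurd ha h) hz
    simpa using this
  apply key
  rw [mem_sup_iff]
  intro a ha
  simp only [Set.mem_setOf_eq, Finset.mem_image]
  exact ⟨a, by simpa using ha, rfl⟩

end FinsuppBasics

section ListComplex

variable {α β : Type}

/-- Prepend a vertex. -/
noncomputable def cs (x : α) : Z (List α) →ₗ[ℤ] Z (List α) := mp (List.cons x)

@[simp] lemma cs_e (x : α) (l : List α) : cs x (e l) = e (x :: l) := by simp [cs]

lemma cs_mem {x : α} {P Q : List α → Prop} (h : ∀ l, P l → Q (x :: l))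
    {z : Z (List α)} (hz : z ∈ sup {l | P l}) : cs x z ∈ sup {l | Q l} :=
  mp_mem (fun l hl => h l hl) hz

/-- Differential of a tuple. -/
noncomputable def dl : List α → Z (List α)
  | [] => 0
  | x :: l => e l - cs x (dl l)

/-- The simplicial differential on tuples. -/
noncomputable def d : Z (List α) →ₗ[ℤ] Z (List α) := L dl

@[simp] lemma d_nil : d (e ([] : List α)) = 0 := by simp [d, dl]

lemma d_cons (x : α) (l : List α) : d (e (x :: l)) = e l - cs x (d (e l)) := by simp [d, dl]

lemma d_cs (x : α) (u : Z (List α)) : d (cs x u) = u - cs x (d u) := by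
  have : d.comp (cs x) = LinearMap.id - (cs x).comp d := hom_ext (by
    intro l; simp [d_cons])
  exact congrArg (fun φ => φ u) this

lemma d_d (u : Z (List α)) : d (d u) = 0 := by
  have : (d (α := α)).comp d = 0 := hom_ext (by
    intro l
    induction l with
    | nil => simp
    | cons x l ih =>
      simp only [LinearMap.comp_apply, LinearMap.zero_apply] at ih ⊢
      rw [d_cons, map_sub, d_cs, ih]; simp)
  exact congrArg (fun φ => φ u) this

lemma d_map (f : α → β) (u : Z (List α)) : d (mp (List.map f) u) = mp (List.map f) (d u) := by
  have : d.comp (mp (List.map f)) = (mp (List.map f)).comp d := hom_ext (by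
    intro l
    induction l with
    | nil => simp
    | cons x l ih =>
      simp only [LinearMap.comp_apply, mp_e, List.map_cons] at ih ⊢
      rw [d_cons, d_cons, map_sub, ih]
      congr 1
      · simp
      · rw [cs, cs, mp_mp, mp_mp]; rfl)
  exact congrArg (fun φ => φ u) this

lemma d_e_mem (l : List α) :
    d (e l) ∈ sup {l' : List α | l'.Sublist l ∧ l'.length + 1 = l.length} := by
  induction l with
  | nil => simp
  | cons x l ih =>
    rw [d_cons]
    refine Submodule.sub_mem _ (e_mem ⟨List.sublist_cons_self x l, by simp⟩) ?_
    exact cs_mem (fun l' h => ⟨List.Sublist.cons_cons x h.1, by simp [h.2]⟩) ih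

lemma d_mem {P Q : List α → Prop} (h : ∀ l l', P l → l'.Sublist l → l'.length + 1 = l.length → Q l')
    {z : Z (List α)} (hz : z ∈ sup {l | P l}) : d z ∈ sup {l | Q l} :=
  map_mem d (fun l hl => sup_mono (fun l' h' => h l l' hl h'.1 h'.2) (d_e_mem l)) hz

/-- Prism operator for a vertex map. -/
noncomputable def prl (f : α → α) : List α → Z (List α)
  | [] => 0
  | x :: l => e (x :: f x :: l.map f) - cs x (prl f l)

noncomputable def pr (f : α → α) : Z (List α) →ₗ[ℤ] Z (List α) := L (prl f)

lemma pr_cons (f : α → α) (x : α) (l : List α) :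
    pr f (e (x :: l)) = e (x :: f x :: l.map f) - cs x (pr f (e l)) := by simp [pr, prl]

@[simp] lemma pr_nil (f : α → α) : pr f (e ([] : List α)) = 0 := by simp [pr, prl]

lemma pr_cs (f : α → α) (x : α) (u : Z (List α)) :
    pr f (cs x u) = cs x (cs (f x) (mp (List.map f) u)) - cs x (pr f u) := by
  have : (pr f).comp (cs x) = (cs x).comp ((cs (f x)).comp (mp (List.map f))) - (cs x).comp (pr f) :=
    hom_ext (by intro l; simp [pr_cons])
  exact congrArg (fun φ => φ u) this

lemma pr_homotopy (f : α → α) (u : Z (List α)) :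
    d (pr f u) + pr f (d u) = mp (List.map f) u - u := by
  have : d.comp (pr f) + (pr f).comp d = mp (List.map f) - LinearMap.id := hom_ext (by
    intro l
    induction l with
    | nil => simp
    | cons x l ih =>
      simp only [LinearMap.comp_apply, LinearMap.add_apply, LinearMap.sub_apply, mp_e,
        LinearMap.id_apply, List.map_cons] at ih ⊢
      have h1 : d (pr f (e l)) = e (l.map f) - e l - pr f (d (e l)) := by rw [← ih]; abel
      rw [pr_cons, d_cons, map_sub, map_sub, d_cons, d_cs, pr_cs, d_cons, h1, ← d_map, mp_e]
      simp only [map_sub, cs_e]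
      abel)
  exact congrArg (fun φ => φ u) this

lemma pr_e_mem (f : α → α) (l : List α) :
    pr f (e l) ∈ sup {l' : List α | l'.length = l.length + 1 ∧
      (∀ y ∈ l', y ∈ l ∨ ∃ x ∈ l, y = f x) ∧ ∃ x ∈ l, x ∈ l' ∧ f x ∈ l'} := by
  induction l with
  | nil => simp
  | cons x l ih =>
    rw [pr_cons]
    refine Submodule.sub_mem _ (e_mem ⟨by simp, ?_, x, by simp, by simp, by simp⟩) ?_
    · intro y hy
      simp only [List.mem_cons, List.mem_map] at hy ⊢
      rcases hy with rfl | rfl | ⟨a, ha, rfl⟩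
      · simp
      · right; exact ⟨x, by simp, rfl⟩
      · right; exact ⟨a, by simp [ha], rfl⟩
    · refine cs_mem (fun l' h => ⟨by simp [h.1], ?_, ?_⟩) ih
      · intro y hy
        simp only [List.mem_cons] at hy ⊢
        rcases hy with rfl | hy
        · simp
        · rcases h.2.1 y hy with h' | ⟨a, ha, rfl⟩
          · simp [h']
          · right; exact ⟨a, by simp [ha], rfl⟩
      · obtain ⟨a, ha, h1, h2⟩ := h.2.2
        exact ⟨a, by simp [ha], by simp [h1], by simp [h2]⟩

end ListComplex

end OStab

namespace OStab

/-- Diagonal action on lists. -/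
instance listAction {G X : Type} [Group G] [MulAction G X] : MulAction G (List X) where
  smul g l := l.map (fun x => g • x)
  one_smul l := by
    show l.map (fun x => (1 : G) • x) = l
    simp
  mul_smul a b l := by
    show l.map (fun x => (a * b) • x) = (l.map (fun x => b • x)).map (fun x => a • x)
    simp [List.map_map, Function.comp_def, mul_smul]

lemma smul_list {G X : Type} [Group G] [MulAction G X] (g : G) (l : List X) :
    g • l = l.map (fun x => g • x) := rfl

@[simp] lemma smul_list_nil {G X : Type} [Group G] [MulAction G X] (g : G) :
    g • ([] : List X) = [] := rfl

@[simp] lemma smul_list_cons {G X : Type} [Group G] [MulAction G X] (g : G) (x : X) (l : List X) :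
    g • (x :: l) = g • x :: g • l := rfl

@[simp] lemma smul_list_append {G X : Type} [Group G] [MulAction G X] (g : G) (l l' : List X) :
    g • (l ++ l') = g • l ++ g • l' := by simp [smul_list]

@[simp] lemma smul_list_length {G X : Type} [Group G] [MulAction G X] (g : G) (l : List X) :
    (g • l).length = l.length := by simp [smul_list]

lemma mem_smul_list {G X : Type} [Group G] [MulAction G X] (g : G) (l : List X) (y : X) :
    y ∈ g • l ↔ ∃ x ∈ l, g • x = y := by simp [smul_list]

section Bar

set_option linter.unusedSectionVars false

variable {G : Type} [Group G] {X Y W : Type} [MulAction G X] [MulAction G Y] [MulAction G W]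

/-- Cell associated with a base point and a tuple of vertices. -/
noncomputable def nul (x : X) : List G → Z (X × List G)
  | [] => 0
  | g :: l => e (g⁻¹ • x, l.map (fun p => g⁻¹ * p))

noncomputable def nu (x : X) : Z (List G) →ₗ[ℤ] Z (X × List G) := L (nul x)

@[simp] lemma nu_nil (x : X) : nu x (e ([] : List G)) = 0 := by simp [nu, nul]

lemma nu_cons (x : X) (g : G) (l : List G) :
    nu x (e (g :: l)) = e (g⁻¹ • x, l.map (fun p => g⁻¹ * p)) := by simp [nu, nul]

lemma nu_one (x : X) (l : List G) : nu x (e (1 :: l)) = e (x, l) := by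
  simp [nu_cons]

lemma nu_smul (k : G) (x : X) (u : Z (List G)) :
    nu (k • x) (mp (List.map (fun p => k * p)) u) = nu x u := by
  have : (nu (k • x)).comp (mp (List.map (fun p => k * p))) = nu (G := G) x := hom_ext (by
    intro l
    cases l with
    | nil => simp
    | cons g l =>
      simp only [LinearMap.comp_apply, mp_e, List.map_cons, nu_cons]
      congr 2
      · simp [mul_smul]
      · simp [Function.comp_def, mul_assoc])
  exact congrArg (fun φ => φ u) this

/-- Bar differential. -/
noncomputable def bd : Z (X × List G) →ₗ[ℤ] Z (X × List G) :=
  L (fun c => nu c.1 (d (e (1 :: c.2))))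

lemma bd_e (x : X) (l : List G) : bd (e (x, l)) = nu x (d (e (1 :: l))) := by simp [bd]

lemma bd_nu (x : X) (u : Z (List G)) : bd (nu x u) = nu x (d u) := by
  have : (bd).comp (nu x) = (nu (G := G) x).comp d := hom_ext (by
    intro l
    cases l with
    | nil => simp
    | cons g l =>
      simp only [LinearMap.comp_apply]
      rw [nu_cons, bd_e, ← nu_smul g⁻¹ x (d (e (g :: l))), ← d_map, mp_e]
      simp)
  exact congrArg (fun φ => φ u) this

lemma bd_bd (z : Z (X × List G)) : bd (bd z) = 0 := by
  have : (bd (G := G) (X := X)).comp bd = 0 := hom_ext (by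
    rintro ⟨x, l⟩
    simp only [LinearMap.comp_apply, bd_e, bd_nu, d_d]; simp)
  exact congrArg (fun φ => φ z) this

/-- Extension of a linear map on base points. -/
noncomputable def T (G : Type) (φ : X → Z Y) : Z (X × List G) →ₗ[ℤ] Z (Y × List G) :=
  L (fun c => mp (fun y => (y, c.2)) (φ c.1))

lemma T_e (φ : X → Z Y) (x : X) (l : List G) :
    T G φ (e (x, l)) = mp (fun y => (y, l)) (φ x) := by simp [T]

lemma T_T (φ : X → Z Y) (ψ : Y → Z W) (z : Z (X × List G)) :
    T G ψ (T G φ z) = T G (fun x => L ψ (φ x)) z := by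
  have : (T G ψ).comp (T G φ) = T G (fun x => L ψ (φ x)) := hom_ext (by
    rintro ⟨x, l⟩
    simp only [LinearMap.comp_apply, T_e]
    have : (T G ψ).comp (mp (fun y => (y, l))) = (mp (fun y => (y, l))).comp (L ψ) :=
      hom_ext (by intro y; simp [T_e])
    exact congrArg (fun χ => χ (φ x)) this)
  exact congrArg (fun χ => χ z) this

lemma T_add (φ ψ : X → Z Y) (z : Z (X × List G)) :
    T G (fun x => φ x + ψ x) z = T G φ z + T G ψ z := by
  have : T G (fun x => φ x + ψ x) = T G φ + T G ψ := hom_ext (by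
    rintro ⟨x, l⟩; simp [T_e])
  exact congrArg (fun χ => χ z) this

lemma T_sub (φ ψ : X → Z Y) (z : Z (X × List G)) :
    T G (fun x => φ x - ψ x) z = T G φ z - T G ψ z := by
  have : T G (fun x => φ x - ψ x) = T G φ - T G ψ := hom_ext (by
    rintro ⟨x, l⟩; simp [T_e])
  exact congrArg (fun χ => χ z) this

lemma T_id (z : Z (X × List G)) : T G (fun x => e x) z = z := by
  have : T G (fun x : X => e x) = LinearMap.id := hom_ext (by
    rintro ⟨x, l⟩; simp [T_e])
  exact congrArg (fun χ => χ z) this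

/-- Equivariance of a linear map on base points. -/
def Eqv (G : Type) [Group G] {X Y : Type} [MulAction G X] [MulAction G Y] (φ : X → Z Y) : Prop :=
  ∀ (g : G) (x : X), φ (g • x) = mp (fun y => g • y) (φ x)

lemma T_nu {φ : X → Z Y} (h : Eqv G φ) (x : X) (u : Z (List G)) :
    T G φ (nu x u) = L (fun y => nu y u) (φ x) := by
  have : (T G φ).comp (nu x) = L (fun l => L (fun y => nu y (e l)) (φ x)) := hom_ext (by
    intro l
    cases l with
    | nil =>
      have h0 : L (fun y : Y => nu y (e ([] : List G))) = 0 := hom_ext (by intro y; simp)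
      simp only [LinearMap.comp_apply, L_e, h0]
      simp
    | cons g l =>
      simp only [LinearMap.comp_apply, nu_cons, T_e, L_e]
      rw [h, mp_mp]
      rfl)
  have h2 : ∀ c : Z Y, L (fun l : List G => L (fun y => nu y (e l)) c) u
      = L (fun y => nu y u) c := by
    intro c
    induction c using Finsupp.induction_linear with
    | zero => simp only [map_zero]; 
              have : L (fun l : List G => (0 : Z (Y × List G))) = 0 := hom_ext (by simp)
              rw [this]; rfl
    | add f g hf hg =>
      simp only [map_add]
      rw [← hf, ← hg, ← LinearMap.add_apply]
      congr 1
      exact hom_ext (by simp)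
    | single y n =>
      have hs : Finsupp.single y n = n • e y := by simp [e]
      rw [hs]
      simp only [map_smul, L_e]
      have : L (fun l : List G => n • nu y (e l)) = n • nu y := hom_ext (by simp)
      rw [this]; rfl
  rw [← h2, ← this]; rfl

lemma bd_T {φ : X → Z Y} (h : Eqv G φ) (z : Z (X × List G)) : bd (T G φ z) = T G φ (bd z) := by
  have : (bd).comp (T G φ) = (T G φ).comp bd := hom_ext (by
    rintro ⟨x, l⟩
    simp only [LinearMap.comp_apply, bd_e]
    rw [T_nu h, T_e]
    have : (bd).comp (mp (fun y => (y, l))) = L (fun y : Y => nu y (d (e ((1 : G) :: l)))) :=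
      hom_ext (by intro y; simp [bd_e])
    exact congrArg (fun χ => χ (φ x)) this)
  exact congrArg (fun χ => χ z) this

/-- Vertex translation. -/
def st (s : X → G) (x : X) (p : G) : G := p * s (p⁻¹ • x)

/-- Translation operator. -/
noncomputable def Mv (s : X → G) : Z (X × List G) →ₗ[ℤ] Z (X × List G) :=
  L (fun c => nu c.1 (mp (List.map (st s c.1)) (e (1 :: c.2))))

/-- Homotopy operator. -/
noncomputable def Pv (s : X → G) : Z (X × List G) →ₗ[ℤ] Z (X × List G) :=
  L (fun c => nu c.1 (pr (st s c.1) (e (1 :: c.2))))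

lemma Mv_e (s : X → G) (x : X) (l : List G) :
    Mv s (e (x, l)) = nu x (e (st s x 1 :: l.map (st s x))) := by simp [Mv]

lemma Pv_e (s : X → G) (x : X) (l : List G) :
    Pv s (e (x, l)) = nu x (pr (st s x) (e (1 :: l))) := by simp [Pv]

lemma pr_conj {α : Type} (f g k : α → α) (h : ∀ x, g (k x) = k (f x)) (u : Z (List α)) :
    pr g (mp (List.map k) u) = mp (List.map k) (pr f u) := by
  have : (pr g).comp (mp (List.map k)) = (mp (List.map k)).comp (pr f) := hom_ext (by
    intro l
    induction l with
    | nil => simp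
    | cons x l ih =>
      simp only [LinearMap.comp_apply, mp_e, List.map_cons] at ih ⊢
      rw [pr_cons, pr_cons, map_sub, ih]
      congr 1
      · simp [h, Function.comp_def]
      · rw [cs, cs, mp_mp, mp_mp]; rfl)
  exact congrArg (fun χ => χ u) this

lemma Pv_nu (s : X → G) (x : X) (u : Z (List G)) : Pv s (nu x u) = nu x (pr (st s x) u) := by
  have : (Pv s).comp (nu x) = (nu x).comp (pr (st s x)) := hom_ext (by
    intro l
    cases l with
    | nil => simp
    | cons g l =>
      simp only [LinearMap.comp_apply]
      rw [nu_cons, Pv_e, ← nu_smul g⁻¹ x (pr _ (e (g :: l))),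
        ← pr_conj (st s x) (st s (g⁻¹ • x)) (fun p => g⁻¹ * p)]
      · simp
      · intro p
        simp [st, mul_smul, mul_assoc])
  exact congrArg (fun χ => χ u) this

lemma Pv_homotopy (s : X → G) (z : Z (X × List G)) :
    bd (Pv s z) + Pv s (bd z) = Mv s z - z := by
  have : (bd).comp (Pv s) + (Pv s).comp bd = Mv s - LinearMap.id := hom_ext (by
    rintro ⟨x, l⟩
    simp only [LinearMap.comp_apply, LinearMap.add_apply, LinearMap.sub_apply, LinearMap.id_apply]
    rw [bd_e, Pv_nu, Pv_e, bd_nu, ← map_add, pr_homotopy, map_sub, nu_one]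
    simp [Mv_e])
  exact congrArg (fun χ => χ z) this

lemma Pv_T {φ : X → Z Y} (h : Eqv G φ) (s : X → G) (s' : Y → G)
    (hs : ∀ x, φ x ∈ sup {y | ∀ g : G, s' (g • y) = s (g • x)}) (z : Z (X × List G)) :
    Pv s' (T G φ z) = T G φ (Pv s z) := by
  have : (Pv s').comp (T G φ) = (T G φ).comp (Pv s) := hom_ext (by
    rintro ⟨x, l⟩
    simp only [LinearMap.comp_apply, Pv_e]
    rw [T_nu h, T_e]
    have := eq_on_sup (φ := (Pv s').comp (mp (fun y => (y, l))))
      (ψ := L (fun y : Y => nu y (pr (st s x) (e (1 :: l))))) (fun y hy => by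
        simp only [LinearMap.comp_apply, mp_e, L_e, Pv_e]
        congr 3
        funext p
        simp [st, hy p⁻¹]) (hs x)
    exact this)
  exact congrArg (fun χ => χ z) this

lemma Mv_conj {γ : X → G} (h : ∀ (k : G) (x : X), γ (k • x) = k * γ x * k⁻¹) (z : Z (X × List G)) :
    Mv γ z = T G (fun x => e ((γ x)⁻¹ • x)) z := by
  have : Mv γ = T G (fun x => e ((γ x)⁻¹ • x)) := hom_ext (by
    rintro ⟨x, l⟩
    rw [Mv_e, T_e, nu_cons, mp_e]
    simp [st, h, Function.comp_def, ← mul_assoc, mul_smul])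
  exact congrArg (fun χ => χ z) this

/-- Cells over an invariant set of base points, of given length. -/
def Cells (G : Type) {X : Type} (A : Set X) (n : ℕ) : Set (X × List G) :=
  {c | c.1 ∈ A ∧ c.2.length = n}

lemma nu_mem {A : Set X} (hA : ∀ (g : G) x, x ∈ A → g • x ∈ A) {x : X} (hx : x ∈ A) {n : ℕ}
    {u : Z (List G)} (hu : u ∈ sup {l | l.length = n + 1}) : nu x u ∈ sup (Cells G A n) := by
  refine map_mem (nu x) (fun l hl => ?_) hu
  cases l with
  | nil => simp
  | cons g l =>
    rw [nu_cons]
    refine e_mem ⟨hA _ _ hx, ?_⟩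
    simpa using hl

lemma Pv_mem {A : Set X} (hA : ∀ (g : G) x, x ∈ A → g • x ∈ A) (s : X → G) {n : ℕ}
    {z : Z (X × List G)} (hz : z ∈ sup (Cells G A n)) : Pv s z ∈ sup (Cells G A (n + 1)) := by
  refine map_mem _ ?_ hz
  rintro ⟨x, l⟩ ⟨hx, hl⟩
  rw [Pv_e]
  refine nu_mem hA hx (sup_mono ?_ (pr_e_mem _ _))
  rintro l' ⟨h, -⟩
  simp only [List.length_cons] at h
  simp only at hl
  show l'.length = _
  omega

lemma bd_mem {A : Set X} (hA : ∀ (g : G) x, x ∈ A → g • x ∈ A) {n : ℕ}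
    {z : Z (X × List G)} (hz : z ∈ sup (Cells G A (n + 1))) : bd z ∈ sup (Cells G A n) := by
  refine map_mem _ ?_ hz
  rintro ⟨x, l⟩ ⟨hx, hl⟩
  rw [bd_e]
  refine nu_mem hA hx (sup_mono ?_ (d_e_mem _))
  rintro l' ⟨-, h⟩
  simp only [List.length_cons] at h
  simp only at hl
  show l'.length = _
  omega

lemma bd_zero {A : Set X}
    {z : Z (X × List G)} (hz : z ∈ sup (Cells G A 0)) : bd z = 0 := by
  have := eq_on_sup (φ := bd) (ψ := (0 : Z (X × List G) →ₗ[ℤ] Z (X × List G))) (s := Cells G A 0) (by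
    rintro ⟨x, l⟩ ⟨hx, hl⟩
    have : l = [] := List.length_eq_zero_iff.1 hl
    subst this
    simp [bd_e, d_cons]) hz
  simpa using this

lemma T_mem {φ : X → Z Y} {A : Set X} {A' : Set Y} (h : ∀ x ∈ A, φ x ∈ sup A') {n : ℕ}
    {z : Z (X × List G)} (hz : z ∈ sup (Cells G A n)) : T G φ z ∈ sup (Cells G A' n) := by
  refine map_mem _ ?_ hz
  rintro ⟨x, l⟩ ⟨hx, hl⟩
  rw [T_e]
  exact mp_mem (t := Cells G A' n) (fun y hy => ⟨hy, hl⟩) (h x hx)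

end Bar

end OStab

namespace OStab

section Cone

set_option linter.unusedSectionVars false

variable {G : Type} [Group G] {H X Y Y' W : Type} [MulAction G H] [MulAction G Y] [MulAction G Y']
  [MulAction G W] [MulAction G X]

/-- Degree of the cone coordinate. -/
def odeg (o : Option H) : ℕ := if o.isSome then 1 else 0

@[simp] lemma odeg_none : odeg (none : Option H) = 0 := rfl
@[simp] lemma odeg_some (h : H) : odeg (some h) = 1 := rfl
@[simp] lemma odeg_smul (g : G) (o : Option H) : odeg (g • o) = odeg o := by
  cases o <;> rfl

@[simp] lemma smul_none' (g : G) : g • (none : Option H) = none := rfl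
@[simp] lemma smul_some' (g : G) (h : H) : g • (some h) = some (g • h) := rfl

/-- Forgetting the cone coordinate. -/
noncomputable def dlt : Option H × Y → Z (Option H × Y)
  | (none, _) => 0
  | (some _, y) => e (none, y)

/-- Sign. -/
noncomputable def sg : Option H × Y → Z (Option H × Y)
  | (none, y) => e (none, y)
  | (some h, y) => - e (some h, y)

lemma dlt_eqv : Eqv G (dlt (H := H) (Y := Y)) := by
  rintro g ⟨o, y⟩
  cases o <;> simp [dlt, Prod.smul_mk]

lemma sg_eqv : Eqv G (sg (H := H) (Y := Y)) := by
  rintro g ⟨o, y⟩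
  cases o <;> simp [sg, Prod.smul_mk]

abbrev CC (G H Y : Type) : Type := Z ((Option H × Y) × List G)

/-- Cone differential. -/
noncomputable def D : CC G H Y →ₗ[ℤ] CC G H Y :=
  T G dlt + (T G sg).comp bd

lemma D_apply (z : CC G H Y) : D z = T G dlt z + T G sg (bd z) := rfl

lemma T_zero' (φ : X → Z W) (h : ∀ x, φ x = 0) (z : Z (X × List G)) : T G φ z = 0 := by
  have : T G φ = 0 := hom_ext (by rintro ⟨x, l⟩; simp [T_e, h])
  rw [this]; rfl

lemma T_congr {φ ψ : X → Z W} (h : ∀ x, φ x = ψ x) (z : Z (X × List G)) : T G φ z = T G ψ z := by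
  have : φ = ψ := funext h
  rw [this]

lemma T_neg (φ : X → Z W) (z : Z (X × List G)) : T G (fun x => - φ x) z = - T G φ z := by
  have : T G (fun x => - φ x) = - T G φ := hom_ext (by rintro ⟨x, l⟩; simp [T_e])
  rw [this]; rfl

lemma dlt_dlt (z : CC G H Y) : T G dlt (T G dlt z) = 0 := by
  rw [T_T]
  apply T_zero'
  rintro ⟨o, y⟩
  cases o <;> simp [dlt]

lemma sg_sg (z : CC G H Y) : T G sg (T G sg z) = z := by
  rw [T_T]
  conv_rhs => rw [← T_id z]
  apply T_congr
  rintro ⟨o, y⟩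
  cases o <;> simp [sg]

lemma dlt_sg (z : CC G H Y) : T G dlt (T G sg z) = - T G dlt z := by
  rw [T_T, ← T_neg]
  apply T_congr
  rintro ⟨o, y⟩
  cases o <;> simp [sg, dlt]

lemma sg_dlt (z : CC G H Y) : T G sg (T G dlt z) = T G dlt z := by
  rw [T_T]
  apply T_congr
  rintro ⟨o, y⟩
  cases o <;> simp [sg, dlt]

lemma D_D (z : CC G H Y) : D (D z) = 0 := by
  simp only [D_apply, map_add, bd_T dlt_eqv, bd_T sg_eqv, bd_bd, dlt_dlt, dlt_sg, sg_dlt, map_zero]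
  abel

/-- Map of cones induced by a linear map of bases. -/
noncomputable def oφ (φ : Y → Z Y') (x : Option H × Y) : Z (Option H × Y') :=
  mp (fun y => (x.1, y)) (φ x.2)

noncomputable def TY (φ : Y → Z Y') : CC G H Y →ₗ[ℤ] CC G H Y' := T G (oφ φ)

lemma oφ_eqv {φ : Y → Z Y'} (h : Eqv G φ) : Eqv G (oφ (H := H) φ) := by
  rintro g ⟨o, y⟩
  simp only [oφ, Prod.smul_mk]
  rw [h, mp_mp, mp_mp]
  rfl

lemma TY_e (φ : Y → Z Y') (o : Option H) (y : Y) (l : List G) :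
    TY φ (e ((o, y), l)) = mp (fun y' => ((o, y'), l)) (φ y) := by
  rw [TY, T_e, oφ, mp_mp]; rfl

lemma TY_TY (φ : Y → Z Y') (ψ : Y' → Z W) (z : CC G H Y) :
    TY ψ (TY φ z) = TY (fun x => L ψ (φ x)) z := by
  rw [TY, TY, T_T, TY]
  apply T_congr
  rintro ⟨o, y⟩
  have : (L (oφ ψ)).comp (mp (fun y' => (o, y'))) = (mp (fun y' => (o, y'))).comp (L ψ) :=
    hom_ext (by intro y; simp [oφ])
  exact congrArg (fun χ => χ (φ y)) this

lemma TY_congr {φ ψ : Y → Z Y'} (h : ∀ x, φ x = ψ x) (z : CC G H Y) : TY φ z = TY ψ z := by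
  have : φ = ψ := funext h
  rw [this]

lemma TY_add (φ ψ : Y → Z Y') (z : CC G H Y) :
    TY (fun y => φ y + ψ y) z = TY φ z + TY ψ z := by
  rw [TY, TY, TY, ← T_add]
  apply T_congr; intro x; simp [oφ]

lemma TY_sub (φ ψ : Y → Z Y') (z : CC G H Y) :
    TY (fun y => φ y - ψ y) z = TY φ z - TY ψ z := by
  rw [TY, TY, TY, ← T_sub]
  apply T_congr; intro x; simp [oφ]

lemma TY_neg (φ : Y → Z Y') (z : CC G H Y) :
    TY (fun y => - φ y) z = - TY φ z := by
  rw [TY, TY, ← T_neg]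
  apply T_congr; intro x; simp [oφ]

lemma TY_id (z : CC G H Y) : TY (fun y => e y) z = z := by
  rw [TY]
  conv_rhs => rw [← T_id z]
  apply T_congr; intro x; simp [oφ]

lemma TY_zero (φ : Y → Z Y') (h : ∀ y, φ y = 0) (z : CC G H Y) : TY φ z = 0 := by
  rw [TY]; apply T_zero'; intro x; simp [oφ, h]

lemma D_TY {φ : Y → Z Y'} (h : Eqv G φ) (z : CC G H Y) : D (TY φ z) = TY φ (D z) := by
  simp only [D_apply, map_add, TY, bd_T (oφ_eqv h)]
  congr 1
  · rw [T_T, T_T]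
    apply T_congr
    rintro ⟨o, y⟩
    cases o with
    | none =>
      have : (L dlt).comp (mp (fun y' : Y' => ((none : Option H), y'))) = 0 :=
        hom_ext (by intro y; simp [dlt])
      simpa [oφ, dlt] using congrArg (fun χ => χ (φ y)) this
    | some h =>
      have : (L dlt).comp (mp (fun y' : Y' => (some h, y'))) = mp (fun y' : Y' => (none, y')) :=
        hom_ext (by intro y; simp [dlt])
      simpa [oφ, dlt] using congrArg (fun χ => χ (φ y)) this
  · rw [T_T, T_T]
    apply T_congr
    rintro ⟨o, y⟩
    cases o with
    | none =>
      have : (L sg).comp (mp (fun y' : Y' => ((none : Option H), y')))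
          = mp (fun y' : Y' => ((none : Option H), y')) :=
        hom_ext (by intro y; simp [sg])
      simpa [oφ, sg] using congrArg (fun χ => χ (φ y)) this
    | some h =>
      have : (L sg).comp (mp (fun y' : Y' => (some h, y'))) = - mp (fun y' : Y' => (some h, y')) :=
        hom_ext (by intro y; simp [sg])
      simpa [oφ, sg] using congrArg (fun χ => χ (φ y)) this

/-- Cells of the cone. -/
def CCell (G : Type) {H Y : Type} (A : Set (Option H × Y)) (q : ℕ) :
    Set ((Option H × Y) × List G) :=
  {c | c.1 ∈ A ∧ c.2.length + odeg c.1.1 = q}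

/-- Chains of the cone. -/
def Ch (G : Type) {H Y : Type} (A : Set (Option H × Y)) (q : ℕ) : Submodule ℤ (CC G H Y) :=
  sup (CCell G A q)

/-- Admissible sets of base cells. -/
structure Adm (G : Type) [Group G] {H Y : Type} [MulAction G H] [MulAction G Y]
    (A : Set (Option H × Y)) : Prop where
  inv : ∀ (g : G) x, x ∈ A → g • x ∈ A
  down : ∀ o y, (o, y) ∈ A → (none, y) ∈ A

lemma Ch_of_cells {A A' : Set (Option H × Y)} (k : ℕ) {n q : ℕ}
    (hA : ∀ x ∈ A', x ∈ A ∧ odeg x.1 = k) (hq : n + k = q)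
    {z : CC G H Y} (hz : z ∈ sup (Cells G A' n)) : z ∈ Ch G A q := by
  refine sup_mono ?_ hz
  rintro ⟨x, l⟩ ⟨hx, hl⟩
  refine ⟨(hA x hx).1, ?_⟩
  simp only at hl
  simp only [hl, (hA x hx).2, hq]

lemma cell_sub {A : Set (Option H × Y)} {x : Option H × Y} {l : List G} (hx : x ∈ A) :
    (e (x, l) : CC G H Y) ∈ sup (Cells G {x' | x' ∈ A ∧ odeg x'.1 = odeg x.1} l.length) :=
  e_mem ⟨⟨hx, rfl⟩, rfl⟩

lemma inv_fib {A : Set (Option H × Y)} (hA : Adm G A) (k : ℕ) :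
    ∀ (g : G) x, x ∈ {x' | x' ∈ A ∧ odeg x'.1 = k} → g • x ∈ {x' | x' ∈ A ∧ odeg x'.1 = k} := by
  rintro g ⟨o, y⟩ ⟨h1, h2⟩
  exact ⟨hA.inv g _ h1, by simpa [Prod.smul_mk] using h2⟩

lemma sg_Ch {A : Set (Option H × Y)} {q : ℕ} {z : CC G H Y} (hz : z ∈ Ch G A q) :
    T G sg z ∈ Ch G A q := by
  refine map_mem _ ?_ hz
  rintro ⟨⟨o, y⟩, l⟩ hc
  rw [T_e]
  cases o with
  | none => simpa [sg, Ch] using e_mem hc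
  | some h => simpa [sg, Ch] using e_mem hc

lemma Pv_Ch {A : Set (Option H × Y)} (hA : Adm G A) (s : Option H × Y → G) {q : ℕ}
    {z : CC G H Y} (hz : z ∈ Ch G A q) : Pv s z ∈ Ch G A (q + 1) := by
  refine map_mem _ ?_ hz
  rintro ⟨x, l⟩ ⟨hx, hl⟩
  refine Ch_of_cells (odeg x.1) (fun x' h => h) ?_ (Pv_mem (inv_fib hA _) s (cell_sub hx))
  simp only at hl; omega

lemma dlt_Ch {A : Set (Option H × Y)} (hA : Adm G A) {q : ℕ}
    {z : CC G H Y} (hz : z ∈ Ch G A (q + 1)) : T G dlt z ∈ Ch G A q := by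
  refine map_mem _ ?_ hz
  rintro ⟨⟨o, y⟩, l⟩ ⟨h1, h2⟩
  rw [T_e]
  cases o with
  | none => simp [dlt]
  | some h =>
    simp only [dlt, mp_e]
    refine e_mem ⟨hA.down _ _ h1, ?_⟩
    simpa using h2

lemma bd_Ch {A : Set (Option H × Y)} (hA : Adm G A) {q : ℕ}
    {z : CC G H Y} (hz : z ∈ Ch G A (q + 1)) : bd z ∈ Ch G A q := by
  refine map_mem _ ?_ hz
  rintro ⟨⟨o, y⟩, l⟩ ⟨h1, h2⟩
  have h := cell_sub (G := G) (l := l) h1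
  cases l with
  | nil => rw [bd_zero h]; exact zero_mem _
  | cons g l =>
    refine Ch_of_cells (odeg o) (fun x' h => h) ?_ (bd_mem (inv_fib hA _) h)
    simp only [List.length_cons] at h2; omega

lemma D_Ch {A : Set (Option H × Y)} (hA : Adm G A) {q : ℕ}
    {z : CC G H Y} (hz : z ∈ Ch G A (q + 1)) : D z ∈ Ch G A q :=
  add_mem (dlt_Ch hA hz) (sg_Ch (bd_Ch hA hz))

lemma D_Ch_zero {A : Set (Option H × Y)}
    {z : CC G H Y} (hz : z ∈ Ch G A 0) : D z = 0 := by
  have := eq_on_sup (φ := D) (ψ := (0 : CC G H Y →ₗ[ℤ] CC G H Y)) (s := CCell G A 0) (by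
    rintro ⟨⟨o, y⟩, l⟩ ⟨h1, h2⟩
    cases o with
    | some h => simp at h2
    | none =>
      have : l = [] := List.length_eq_zero_iff.1 (by simpa using h2)
      subst this
      rw [D_apply, bd_e, T_e]
      simp [dlt, d_cons]) hz
  simpa using this

lemma TY_Ch {φ : Y → Z Y'} {A : Set (Option H × Y)} {A' : Set (Option H × Y')}
    (h : ∀ o y, (o, y) ∈ A → φ y ∈ sup {y' | (o, y') ∈ A'}) {q : ℕ}
    {z : CC G H Y} (hz : z ∈ Ch G A q) : TY φ z ∈ Ch G A' q := by
  refine map_mem _ ?_ hz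
  rintro ⟨⟨o, y⟩, l⟩ ⟨h1, h2⟩
  rw [TY_e]
  exact mp_mem (t := CCell G A' q) (fun y' hy => ⟨hy, h2⟩) (h o y h1)

/-- Two maps agreeing on allowed cells. -/
lemma TY_eq_on {φ ψ : Y → Z Y'} {A : Set (Option H × Y)}
    (h : ∀ o y, (o, y) ∈ A → φ y = ψ y) {q : ℕ}
    {z : CC G H Y} (hz : z ∈ Ch G A q) : TY φ z = TY ψ z := by
  refine eq_on_sup ?_ hz
  rintro ⟨⟨o, y⟩, l⟩ ⟨h1, h2⟩
  rw [TY_e, TY_e, h o y h1]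

lemma Ch_mono {A A' : Set (Option H × Y)} (h : A ⊆ A') (q : ℕ) : Ch G A q ≤ Ch G A' q :=
  sup_mono (fun _ hc => ⟨h hc.1, hc.2⟩)

/-- Cone homotopy. -/
lemma Pv_D (s : Y → G) (z : CC G H Y) :
    D (T G sg (Pv (fun x => s x.2) z)) + T G sg (Pv (fun x => s x.2) (D z))
      = Mv (fun x => s x.2) z - z := by
  have h1 : ∀ w : CC G H Y, Pv (fun x => s x.2) (T G dlt w) = T G dlt (Pv (fun x => s x.2) w) := by
    intro w
    refine Pv_T dlt_eqv _ _ ?_ w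
    rintro ⟨o, y⟩
    cases o with
    | none => simp [dlt]
    | some h => exact e_mem (fun g => rfl)
  have h2 : ∀ w : CC G H Y, Pv (fun x => s x.2) (T G sg w) = T G sg (Pv (fun x => s x.2) w) := by
    intro w
    refine Pv_T sg_eqv _ _ ?_ w
    rintro ⟨o, y⟩
    cases o with
    | none => exact e_mem (fun g => rfl)
    | some h => exact Submodule.neg_mem _ (e_mem (fun g => rfl))
  rw [← Pv_homotopy]
  simp only [D_apply, map_add, dlt_sg, bd_T sg_eqv, sg_sg, h1, h2, sg_dlt]
  abel

/-- The gamma lemma. -/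
lemma gamma {A : Set (Option H × Y)} {A' : Set (Option H × Y')} (hA : Adm G A)
    (γ : Y → G) (hγ : ∀ (k : G) y, γ (k • y) = k * γ y * k⁻¹)
    (hfix : ∀ h y, (some h, y) ∈ A → γ y • h = h)
    {f : Y → Z Y'} (hf : Eqv G f)
    (hfA : ∀ o y, (o, y) ∈ A → f y ∈ sup {y' | (o, y') ∈ A'}) {q : ℕ}
    {z : CC G H Y} (hz : z ∈ Ch G A q) (hD : D z = 0) :
    ∃ w ∈ Ch G A' (q + 1), D w = TY (fun y => f ((γ y)⁻¹ • y)) z - TY f z := by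
  refine ⟨TY f (T G sg (Pv (fun x => γ x.2) z)), TY_Ch hfA (sg_Ch (Pv_Ch hA _ hz)), ?_⟩
  rw [D_TY hf]
  have h := Pv_D γ z
  rw [hD, map_zero, map_zero, add_zero] at h
  rw [h, map_sub]
  congr 1
  rw [Mv_conj (fun k x => hγ k x.2)]
  rw [← LinearMap.comp_apply]
  refine eq_on_sup (s := CCell G A q) ?_ hz
  rintro ⟨⟨o, y⟩, l⟩ ⟨h1, h2⟩
  have : (γ y)⁻¹ • o = o := by
    cases o with
    | none => rfl
    | some h =>
      have h3 : (γ y)⁻¹ • h = h := by rw [inv_smul_eq_iff]; exact (hfix h y h1).symm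
      rw [smul_some', h3]
  simp only [LinearMap.comp_apply, T_e, Prod.smul_mk, mp_e, TY_e, this]

end Cone

end OStab

namespace OStab

/-- Double complex lemma. -/
lemma DS {M : Type} [AddCommGroup M] (dd DD : M →ₗ[ℤ] M) (C : ℕ → ℕ → Submodule ℤ M)
    (hd : ∀ n q x, x ∈ C (n + 1) q → dd x ∈ C n q)
    (hD : ∀ n q x, x ∈ C n (q + 1) → DD x ∈ C n q)
    (hD0 : ∀ n x, x ∈ C n 0 → DD x = 0)
    (hdd : ∀ x, dd (dd x) = 0) (hDD : ∀ x, DD (DD x) = 0) (hc : ∀ x, dd (DD x) = DD (dd x))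
    (c : ℕ)
    (hrow : ∀ n q, n + q + 1 = c → ∀ x ∈ C n q, dd x = 0 → ∃ y ∈ C (n + 1) q, dd y = x)
    (hkill : ∀ n q, n + q = c → 2 ≤ n → ∀ x ∈ C n q, DD x = 0 →
      ∃ x' y, y ∈ C n (q + 1) ∧ x = dd x' + DD y)
    (hx0 : ∀ q x, x ∈ C 0 q → dd x = 0)
    (q : ℕ) (hq : q + 1 = c) (x : M) (hx : x ∈ C 0 q) (hDx : DD x = 0) :
    ∃ u ∈ C 1 q, DD u = 0 ∧ dd u = x := by
  have key : ∀ q j, 1 ≤ j → j + q = c → ∀ u ∈ C j q, dd (DD u) = 0 →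
      ∃ u' ∈ C j q, DD u' = 0 ∧ dd u' = dd u := by
    intro q
    induction q with
    | zero => intro j _ _ u hu _; exact ⟨u, hu, hD0 j u hu, rfl⟩
    | succ q ih =>
      intro j hj hjc u hu h0
      obtain ⟨v, hv, hv2⟩ := hrow j q (by omega) (DD u) (hD j q u hu) h0
      obtain ⟨v', hv', h1, h2⟩ := ih (j + 1) (by omega) (by omega) v hv
        (by rw [hc, hv2, hDD])
      obtain ⟨x', y, hy, h3⟩ := hkill (j + 1) q (by omega) (by omega) v' hv' h1
      refine ⟨u - dd y, Submodule.sub_mem _ hu (hd _ _ _ hy), ?_, ?_⟩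
      · have h4 : dd v' = dd (DD y) := by rw [h3, map_add, hdd, zero_add]
        rw [map_sub, ← hc, ← h4, h2, hv2, sub_self]
      · rw [map_sub, hdd, sub_zero]
  obtain ⟨u, hu, rfl⟩ := hrow 0 q (by omega) x hx (hx0 q x hx)
  obtain ⟨u', h1, h2, h3⟩ := key q 1 le_rfl (by omega) u hu (by rw [hc, hDx])
  exact ⟨u', h1, h2, h3⟩

end OStab

namespace OStab

section Geometry

set_option linter.unusedSectionVars false

variable {F V : Type} [Field F] [AddCommGroup V] [Module F V] [FiniteDimensional F V]
  (B : V →ₗ[F] V →ₗ[F] F)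

/-- Span of a list. -/
def sp (F : Type) {V : Type} [Field F] [AddCommGroup V] [Module F V] (t : List V) :
    Submodule F V := Submodule.span F {x | x ∈ t}

/-- Rank of a list. -/
noncomputable def rk (F : Type) {V : Type} [Field F] [AddCommGroup V] [Module F V] (t : List V) :
    ℕ := Module.finrank F (sp F t)

/-- Totally isotropic subspaces. -/
def IsoSp (W : Submodule F V) : Prop := ∀ x ∈ W, ∀ y ∈ W, B x y = 0

/-- Mutually orthogonal isotropic lists. -/
def Ok (t : List V) : Prop := ∀ x ∈ t, ∀ y ∈ t, B x y = 0

lemma mem_sp {t : List V} {x : V} (h : x ∈ t) : x ∈ sp F t := Submodule.subset_span h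

lemma sp_le {t : List V} {W : Submodule F V} (h : ∀ x ∈ t, x ∈ W) : sp F t ≤ W :=
  Submodule.span_le.2 h

lemma rk_le {t : List V} {W : Submodule F V} (h : ∀ x ∈ t, x ∈ W) : rk F t ≤ Module.finrank F W :=
  Submodule.finrank_mono (sp_le h)

lemma rk_le_length (t : List V) : rk F t ≤ t.length := by
  classical
  have : ({x | x ∈ t} : Set V) = (t.toFinset : Set V) := by ext; simp
  unfold rk sp
  rw [this]
  exact (finrank_span_finset_le_card _).trans (List.toFinset_card_le t)

lemma rk_mono {t t' : List V} (h : ∀ x ∈ t, x ∈ t') : rk F t ≤ rk F t' :=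
  rk_le (fun x hx => mem_sp (h x hx))

lemma iso_sp {t : List V} (h : Ok B t) : IsoSp B (sp F t) := by
  intro x hx y hy
  have h1 : sp F t ≤ LinearMap.ker (B.flip y) := by
    apply sp_le
    intro a ha
    have h2 : sp F t ≤ LinearMap.ker (B a) := sp_le (fun b hb => h a ha b hb)
    simpa using h2 hy
  simpa using h1 hx

/-- Chains on mutually orthogonal lists in `S` of length `n` and rank at most `r`. -/
def TSet (S : Set V) (n r : ℕ) : Set (List V) :=
  {t | t.length = n ∧ (∀ x ∈ t, x ∈ S) ∧ Ok B t ∧ rk F t ≤ r}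

def TL (S : Set V) (n r : ℕ) : Submodule ℤ (Z (List V)) := sup (TSet B S n r)

variable {B}

lemma TL_mono {S S' : Set V} (h : S ⊆ S') {n r r' : ℕ} (hr : r ≤ r') : TL B S n r ≤ TL B S' n r' :=
  sup_mono (fun _ ht => ⟨ht.1, fun x hx => h (ht.2.1 x hx), ht.2.2.1, ht.2.2.2.trans hr⟩)

lemma Ok_sub {t t' : List V} (h : Ok B t) (hs : ∀ x ∈ t', x ∈ t) : Ok B t' :=
  fun x hx y hy => h x (hs x hx) y (hs y hy)

lemma d_TL {S : Set V} {n r : ℕ} {z : Z (List V)} (hz : z ∈ TL B S (n + 1) r) :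
    d z ∈ TL B S n r := by
  refine d_mem (P := fun t => t ∈ TSet B S (n + 1) r) (Q := fun t => t ∈ TSet B S n r) ?_ hz
  rintro l l' ⟨h1, h2, h3, h4⟩ hs hl
  have hm : ∀ x ∈ l', x ∈ l := fun x hx => hs.subset hx
  exact ⟨by omega, fun x hx => h2 x (hm x hx), Ok_sub h3 hm, (rk_mono hm).trans h4⟩

lemma d_TL_zero {S : Set V} {r : ℕ} {z : Z (List V)} (hz : z ∈ TL B S 0 r) : d z = 0 := by
  have := eq_on_sup (φ := d) (ψ := (0 : Z (List V) →ₗ[ℤ] Z (List V))) (s := TSet B S 0 r) (by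
    rintro l ⟨h, -⟩
    have : l = [] := List.length_eq_zero_iff.1 h
    subst this; simp) hz
  simpa using this

lemma res_d_sp {S : Set V} {n r : ℕ} {z : Z (List V)} (hz : z ∈ TL B S n r)
    {W : Submodule F V} (hW : Module.finrank F W = r) :
    res {t | sp F t = W} (d z) = res {t | sp F t = W} (d (res {t | sp F t = W} z)) := by
  refine eq_on_sup (φ := (res {t | sp F t = W}).comp d)
    (ψ := (res {t | sp F t = W}).comp (d.comp (res {t | sp F t = W}))) (s := TSet B S n r) ?_ hz
  rintro t ⟨-, -, -, h⟩
  simp only [LinearMap.comp_apply]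
  by_cases ht : sp F t = W
  · rw [res_e_of (s := {t | sp F t = W}) ht]
  · rw [res_e_not (s := {t | sp F t = W}) ht, map_zero, map_zero]
    refine res_eq_zero ?_ (d_e_mem t)
    rintro l ⟨hl, -⟩ (h2 : sp F l = W)
    apply ht
    symm
    apply Submodule.eq_of_le_of_finrank_le
    · rw [← h2]; exact sp_le (fun x hx => mem_sp (hl.subset hx))
    · rw [hW]; exact h

lemma res_TL {S : Set V} {n r : ℕ} {z : Z (List V)} (hz : z ∈ TL B S n r) (s : Set (List V)) :
    res s z ∈ TL B S n r := sup_mono (fun _ h => h.1) (res_mem hz)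

lemma TL_succ_zero {S : Set V} (h0 : (0 : V) ∉ S) {n : ℕ} {z : Z (List V)}
    (hz : z ∈ TL B S (n + 1) 0) : z = 0 := by
  have : z ∈ sup (∅ : Set (List V)) := by
    refine sup_mono ?_ hz
    rintro t ⟨h1, h2, -, h4⟩
    cases t with
    | nil => simp at h1
    | cons x t =>
      exfalso
      have h5 : sp F (x :: t) = ⊥ := Submodule.finrank_eq_zero.1 (Nat.le_zero.1 h4)
      have h6 : x ∈ sp F (x :: t) := mem_sp (by simp)
      rw [h5, Submodule.mem_bot] at h6
      exact h0 (h6 ▸ h2 x (by simp))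
  have h := res_eq_self this
  rw [← h]
  exact res_eq_zero (t := ∅) (by simp) this

theorem EJ (r : ℕ) : ∀ (S0 S' : Set V), S0 ⊆ S' → (0 : V) ∉ S' → ∀ (n : ℕ) (z : Z (List V)),
    z ∈ TL B S0 n r → d z = 0 →
    (r < n ∨ (n = r ∧ ∃ x ∈ TL B S' (n + 1) r, d x = z)) →
    ∃ y ∈ TL B S0 (n + 1) r, d y = z := by
  induction r with
  | zero =>
    intro S0 S' hS h0 n z hz hd hh
    have h0' : (0 : V) ∉ S0 := fun h => h0 (hS h)
    have : z = 0 := by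
      rcases hh with hn | ⟨hn, x, hx, hx2⟩
      · obtain ⟨m, rfl⟩ : ∃ m, n = m + 1 := ⟨n - 1, by omega⟩
        exact TL_succ_zero h0' hz
      · rw [← hx2, TL_succ_zero h0 hx, map_zero]
    exact ⟨0, zero_mem _, by simp [this]⟩
  | succ r ih =>
    intro S0 S' hS h0 n z hz hd hh
    obtain ⟨n', rfl⟩ : ∃ m, n = m + 1 := ⟨n - 1, by omega⟩
    have claim : ∀ W : Submodule F V, ∃ η ∈ TL B S0 (n' + 1) r,
        ∃ y ∈ TL B S0 (n' + 1 + 1) (r + 1), res {t | sp F t = W} z = η + d y := by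
      intro W
      by_cases hzW : res {t | sp F t = W} z = 0
      · exact ⟨0, zero_mem _, 0, zero_mem _, by simp [hzW]⟩
      obtain ⟨t, ht⟩ : ∃ t, (res {t | sp F t = W} z) t ≠ 0 := by
        by_contra hcon
        push Not at hcon
        exact hzW (Finsupp.ext hcon)
      have hmem := res_mem (s := {t | sp F t = W}) hz
      obtain ⟨⟨t1, t2, t3, t4⟩, (t5 : sp F t = W)⟩ := mem_sup_iff.1 hmem t ht
      by_cases hWr : Module.finrank F W ≤ r
      · refine ⟨_, ?_, 0, zero_mem _, by rw [map_zero, add_zero]⟩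
        refine sup_mono ?_ hmem
        rintro l ⟨⟨h1, h2, h3, h4⟩, (h5 : sp F l = W)⟩
        exact ⟨h1, h2, h3, by rw [rk, h5]; exact hWr⟩
      have hW : Module.finrank F W = r + 1 := by
        have : rk F t = Module.finrank F W := by rw [rk, t5]
        omega
      have hiso : IsoSp B W := t5 ▸ iso_sp B t3
      obtain ⟨a, ha⟩ : ∃ a, a ∈ t := by
        cases t with
        | nil => simp at t1
        | cons a t => exact ⟨a, by simp⟩
      have haW : a ∈ W := t5 ▸ mem_sp ha
      have small : ∀ (S : Set V) (m : ℕ) (u : Z (List V)), u ∈ TL B S (m + 1) (r + 1) →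
          res {t | sp F t = W}ᶜ (d (res {t | sp F t = W} u)) ∈ TL B (S ∩ W) m r := by
        intro S m u hu
        have h1 : res {t | sp F t = W} u ∈ TL B (S ∩ W) (m + 1) (r + 1) := by
          refine sup_mono ?_ (res_mem hu)
          rintro l ⟨⟨h1, h2, h3, h4⟩, (h5 : sp F l = W)⟩
          exact ⟨h1, fun x hx => ⟨h2 x hx, h5 ▸ mem_sp hx⟩, h3, h4⟩
        refine sup_mono ?_ (res_mem (d_TL h1))
        rintro l ⟨⟨h1, h2, h3, h4⟩, h5⟩
        refine ⟨h1, h2, h3, ?_⟩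
        by_contra hcon
        apply h5
        apply Submodule.eq_of_le_of_finrank_le (sp_le (fun x hx => (h2 x hx).2))
        have : rk F l = r + 1 := by omega
        rw [hW, ← this]; rfl
      have hdz : d (res {t | sp F t = W} z) = res {t | sp F t = W}ᶜ (d (res {t | sp F t = W} z)) := by
        have h1 := res_add_compl {t | sp F t = W} (d (res {t | sp F t = W} z))
        rw [← res_d_sp hz hW, hd, map_zero, zero_add] at h1
        exact h1.symm
      have hih := ih (S0 ∩ W) (S' ∩ W) (Set.inter_subset_inter_left _ hS) (fun h => h0 h.1) n'
        (d (res {t | sp F t = W} z)) (hdz ▸ small S0 n' z hz) (d_d _) (by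
          rcases hh with hn | ⟨hn, x, hx, hx2⟩
          · left; omega
          · right
            refine ⟨by omega, - res {t | sp F t = W}ᶜ (d (res {t | sp F t = W} x)),
              Submodule.neg_mem _ (small S' (n' + 1) x hx), ?_⟩
            have h1 := res_add_compl {t | sp F t = W} (d (res {t | sp F t = W} x))
            rw [← res_d_sp hx hW, hx2] at h1
            have h2 := congrArg d h1
            rw [map_add, d_d] at h2
            rw [map_neg]
            exact (eq_neg_of_add_eq_zero_left h2).symm)
      obtain ⟨η, hη, hη2⟩ := hih
      refine ⟨η, TL_mono Set.inter_subset_left le_rfl hη,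
        cs a (res {t | sp F t = W} z - η), ?_, ?_⟩
      · have h1 : res {t | sp F t = W} z - η ∈ sup {l : List V | l.length = n' + 1 ∧
            ∀ x ∈ l, x ∈ S0 ∧ x ∈ W} := by
          refine Submodule.sub_mem _ (sup_mono ?_ hmem) (sup_mono ?_ hη)
          · rintro l ⟨⟨h1, h2, h3, h4⟩, (h5 : sp F l = W)⟩
            exact ⟨h1, fun x hx => ⟨h2 x hx, h5 ▸ mem_sp hx⟩⟩
          · rintro l ⟨h1, h2, h3, h4⟩
            exact ⟨h1, h2⟩
        refine cs_mem (Q := fun l => l ∈ TSet B S0 (n' + 1 + 1) (r + 1)) ?_ h1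
        rintro l ⟨h1, h2⟩
        have h3 : ∀ x ∈ a :: l, x ∈ S0 ∧ x ∈ W := by
          intro x hx
          rcases List.mem_cons.1 hx with rfl | hx
          · exact ⟨t2 x ha, haW⟩
          · exact h2 x hx
        refine ⟨by simp [h1], fun x hx => (h3 x hx).1,
          fun x hx y hy => hiso x (h3 x hx).2 y (h3 y hy).2, ?_⟩
        rw [← hW]
        exact rk_le (fun x hx => (h3 x hx).2)
      · rw [d_cs, map_sub, hη2, sub_self, map_zero]; abel
    choose η hη y hy hzy using claim
    have hsum := sum_res_fiber (fun t : List V => sp F t) z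
    classical
    set I := z.support.image (fun t : List V => sp F t)
    have hz' : z = ∑ W ∈ I, η W + d (∑ W ∈ I, y W) := by
      rw [map_sum, ← Finset.sum_add_distrib]
      conv_lhs => rw [hsum]
      apply Finset.sum_congr (by congr!)
      intro W _
      exact hzy W
    obtain ⟨y', hy', hy2⟩ := ih S0 S' hS h0 (n' + 1) (∑ W ∈ I, η W)
      (Submodule.sum_mem _ (fun W _ => hη W)) (by
        have h1 := congrArg d hz'
        rw [map_add, d_d, add_zero, hd] at h1
        exact h1.symm) (by left; omega)
    refine ⟨y' + ∑ W ∈ I, y W, Submodule.add_mem _ (TL_mono subset_rfl (by omega) hy')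
      (Submodule.sum_mem _ (fun W _ => hy W)), ?_⟩
    rw [map_add, hy2]
    exact hz'.symm

end Geometry

end OStab

namespace OStab

section LemmaU

set_option linter.unusedSectionVars false

variable {F V : Type} [Field F] [AddCommGroup V] [Module F V] [FiniteDimensional F V]

/-- Setting for adding new vertices. -/
structure USet (B : V →ₗ[F] V →ₗ[F] F) (v : V) (S0 S' : Set V) : Prop where
  symm : ∀ x y, B x y = B y x
  sub : S0 ⊆ S'
  zero : (0 : V) ∉ S'
  sc0 : ∀ x ∈ S0, ∀ c : F, c ≠ 0 → c • x ∈ S0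
  sc' : ∀ x ∈ S', ∀ c : F, c ≠ 0 → c • x ∈ S'
  bv : ∀ w ∈ S', w ∉ S0 → B v w ≠ 0
  pi : ∀ w ∈ S', w ∉ S0 → B v w = 1 → ∀ x ∈ S', B w x = 0 →
    x - B v x • w = 0 ∨ x - B v x • w ∈ S0

/-- New normalized vertices. -/
def Nw (B : V →ₗ[F] V →ₗ[F] F) (v : V) (S0 S' : Set V) : Set V :=
  {w | w ∈ S' ∧ w ∉ S0 ∧ B v w = 1}

/-- Vertices orthogonal to `v` and `w`. -/
def Lk (B : V →ₗ[F] V →ₗ[F] F) (v w : V) (S0 : Set V) : Set V :=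
  {y | y ∈ S0 ∧ B v y = 0 ∧ B w y = 0}

def DepSet (B : V →ₗ[F] V →ₗ[F] F) (S : Set V) (n : ℕ) : Set (List V) :=
  {t | t.length = n ∧ (∀ x ∈ t, x ∈ S) ∧ Ok B t ∧ rk F t < n}

def ThSet (B : V →ₗ[F] V →ₗ[F] F) (v : V) (S0 S' : Set V) (n : ℕ) : Set (List V) :=
  {t | ∃ w l, t = w :: l ∧ l.length + 1 = n ∧ w ∈ Nw B v S0 S' ∧
    (∀ y ∈ l, y ∈ Lk B v w S0) ∧ Ok B t}

/-- Reduced chains. -/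
noncomputable def RR (B : V →ₗ[F] V →ₗ[F] F) (v : V) (S0 S' : Set V) (n : ℕ) : Submodule ℤ (Z (List V)) :=
  TL B S0 n n ⊔ sup (ThSet B v S0 S' n) ⊔ sup (DepSet B S' n) ⊔
    (sup (DepSet B S' (n + 1))).map d

variable {B : V →ₗ[F] V →ₗ[F] F} {v : V} {S0 S' : Set V} {n : ℕ}

lemma RR_A : TL B S0 n n ≤ RR B v S0 S' n :=
  (le_sup_left.trans le_sup_left).trans le_sup_left

lemma RR_T : sup (ThSet B v S0 S' n) ≤ RR B v S0 S' n :=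
  (le_sup_right.trans le_sup_left).trans le_sup_left

lemma RR_D : sup (DepSet B S' n) ≤ RR B v S0 S' n :=
  le_sup_right.trans le_sup_left

lemma RR_dD {u : Z (List V)} (hu : u ∈ sup (DepSet B S' (n + 1))) : d u ∈ RR B v S0 S' n :=
  (le_sup_right : _ ≤ RR B v S0 S' n) (Submodule.mem_map_of_mem hu)

lemma rk_lt {t : List V} (t'' : List V) (h : ∀ x ∈ t, x ∈ sp F t'') (hl : t''.length < t.length) :
    rk F t < t.length :=
  ((rk_le h).trans (rk_le_length t'')).trans_lt hl

lemma Ok_of_sp {l t : List V} (h : Ok B l) (ht : ∀ x ∈ t, x ∈ sp F l) : Ok B t :=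
  fun x hx y hy => iso_sp B h x (ht x hx) y (ht y hy)

lemma mkDep {S : Set V} {t : List V} (t'' : List V) (hO : Ok B t'')
    (hS : ∀ x ∈ t, x ∈ S) (h : ∀ x ∈ t, x ∈ sp F t'') (hl : t''.length < t.length)
    (hn : t.length = n) : t ∈ DepSet B S n :=
  ⟨hn, hS, Ok_of_sp hO h, hn ▸ rk_lt t'' h hl⟩

lemma face_mem {P : List V → Prop} (l : List V)
    (h : ∀ l', (∀ x ∈ l', x ∈ l) → l'.length + 1 = l.length → P l') : d (e l) ∈ sup {t | P t} :=
  sup_mono (fun l' hl => h l' (fun x hx => hl.1.subset hx) hl.2) (d_e_mem l)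

lemma spc {a : V} {t : List V} : a ∈ sp F (a :: t) := mem_sp (by simp)

lemma sp_mono' {t t' : List V} (h : ∀ x ∈ t, x ∈ t') : sp F t ≤ sp F t' :=
  sp_le (fun x hx => mem_sp (h x hx))

lemma face_cs2 {s : Set (List V)} (x y : V) (l : List V)
    (h : ∀ l', (∀ a ∈ l', a ∈ l) → l'.length + 1 = l.length → x :: y :: l' ∈ s) :
    cs x (cs y (d (e l))) ∈ sup s := by
  have h1 := face_mem (P := fun t => x :: y :: t ∈ s) l h
  refine map_mem ((cs x).comp (cs y)) (fun t ht => ?_) h1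
  simp only [LinearMap.comp_apply, cs_e]
  exact e_mem ht

lemma face_cs3 {s : Set (List V)} (x y z : V) (l : List V)
    (h : ∀ l', (∀ a ∈ l', a ∈ l) → l'.length + 1 = l.length → x :: y :: z :: l' ∈ s) :
    cs x (cs y (cs z (d (e l)))) ∈ sup s := by
  have h1 := face_mem (P := fun t => x :: y :: z :: t ∈ s) l h
  refine map_mem ((cs x).comp ((cs y).comp (cs z))) (fun t ht => ?_) h1
  simp only [LinearMap.comp_apply, cs_e]
  exact e_mem ht

/-- Scaling the head. -/
lemma RR_scale {x : V} {l : List V} (hx : ∀ y ∈ x :: l, y ∈ S') (hO : Ok B (x :: l)) {c : F}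
    (hcx : c • x ∈ S') (hn : l.length + 1 = n) :
    e (x :: l) - e (c • x :: l) ∈ RR B v S0 S' n := by
  rw [List.forall_mem_cons] at hx
  have h1 : d (e (x :: c • x :: l)) ∈ RR B v S0 S' n := by
    refine RR_dD (e_mem ?_)
    refine mkDep (x :: l) hO ?_ ?_ (by simp) (by simp [hn])
    · simp only [List.forall_mem_cons]
      exact ⟨hx.1, hcx, hx.2⟩
    · simp only [List.forall_mem_cons]
      exact ⟨spc, Submodule.smul_mem _ _ spc, fun y hy => mem_sp (by simp [hy])⟩
  have h2 : cs x (cs (c • x) (d (e l))) ∈ RR B v S0 S' n := by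
    refine RR_D (face_cs2 _ _ _ ?_)
    intro l' hl' hlen
    refine mkDep (x :: l') (Ok_sub hO ?_) ?_ ?_ (by simp) (by simp; omega)
    · simp only [List.forall_mem_cons]
      exact ⟨by simp, fun y hy => by simp [hl' y hy]⟩
    · simp only [List.forall_mem_cons]
      exact ⟨hx.1, hcx, fun y hy => hx.2 y (hl' y hy)⟩
    · simp only [List.forall_mem_cons]
      exact ⟨spc, Submodule.smul_mem _ _ spc, fun y hy => mem_sp (by simp [hy])⟩
  have h3 : e (x :: l) - e (c • x :: l)
      = cs x (cs (c • x) (d (e l))) - d (e (x :: c • x :: l)) := by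
    rw [d_cons, d_cons]; simp only [map_sub, cs_e]; abel
  rw [h3]
  exact Submodule.sub_mem _ h2 h1

/-- Dependence of prisms. -/
lemma pr_dep (w : V) (c : V → F) (l : List V) :
    pr (fun y => y - c y • w) (e l) ∈ sup {l' : List V | l'.length = l.length + 1 ∧
      (∀ y ∈ l', y ∈ l ∨ ∃ x ∈ l, y = x - c x • w) ∧
      ∃ l'' : List V, l''.length = l.length ∧ (∀ y ∈ l'', y ∈ l ∨ ∃ x ∈ l, y = x - c x • w) ∧
        ∀ y ∈ l', y ∈ sp F (w :: l'')} := by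
  induction l with
  | nil => simp
  | cons x l ih =>
    rw [pr_cons]
    have hmap : ∀ y ∈ (x - c x • w) :: l.map (fun y => y - c y • w),
        y ∈ x :: l ∨ ∃ x' ∈ x :: l, y = x' - c x' • w := by
      intro y hy
      right
      simp only [List.mem_cons, List.mem_map] at hy
      rcases hy with rfl | ⟨a, ha, rfl⟩
      · exact ⟨x, by simp, rfl⟩
      · exact ⟨a, by simp [ha], rfl⟩
    refine Submodule.sub_mem _ (e_mem ⟨by simp, ?_, (x - c x • w) :: l.map (fun y => y - c y • w),
      by simp, hmap, ?_⟩) ?_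
    · intro y hy
      rcases List.mem_cons.1 hy with rfl | hy
      · left; simp
      · exact hmap y hy
    · intro y hy
      rcases List.mem_cons.1 hy with rfl | hy
      · have h1 : y - c y • w ∈ sp F (w :: (y - c y • w) :: l.map (fun y => y - c y • w)) :=
          mem_sp (by simp)
        have h2 : w ∈ sp F (w :: (y - c y • w) :: l.map (fun y => y - c y • w)) :=
          mem_sp (by simp)
        have h3 := Submodule.add_mem _ h1 (Submodule.smul_mem _ (c y) h2)
        simpa only [sub_add_cancel] using h3
      · exact mem_sp (List.mem_cons_of_mem _ hy)
    · refine cs_mem ?_ ih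
      rintro l' ⟨h1, h2, l'', h3, h4, h5⟩
      have aux : ∀ y, (y ∈ l ∨ ∃ x ∈ l, y = x - c x • w) →
          (y ∈ x :: l ∨ ∃ x' ∈ x :: l, y = x' - c x' • w) := by
        rintro y (h | ⟨a, ha, rfl⟩)
        · left; simp [h]
        · right; exact ⟨a, by simp [ha], rfl⟩
      refine ⟨by simp [h1], ?_, x :: l'', by simp [h3], ?_, ?_⟩
      · intro y hy
        rcases List.mem_cons.1 hy with rfl | hy
        · left; simp
        · exact aux y (h2 y hy)
      · intro y hy
        rcases List.mem_cons.1 hy with rfl | hy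
        · left; simp
        · exact aux y (h4 y hy)
      · intro y hy
        rcases List.mem_cons.1 hy with rfl | hy
        · exact mem_sp (by simp)
        · refine sp_mono' ?_ (h5 y hy)
          intro a ha
          simp only [List.mem_cons] at ha ⊢
          tauto

/-- New vertices cannot be killed against old ones. -/
lemma USet.ne (h : USet B v S0 S') {w x : V} (hw : w ∈ Nw B v S0 S') (hx : x ∈ S0)
    : x - B v x • w ≠ 0 := by
  intro h0
  have hx' : x = B v x • w := sub_eq_zero.1 h0
  have hc : B v x ≠ 0 := by
    intro hc
    rw [hc, zero_smul] at hx'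
    exact h.zero (hx' ▸ h.sub hx)
  apply hw.2.1
  have := h.sc0 x hx (B v x)⁻¹ (inv_ne_zero hc)
  rw [hx', smul_smul] at this
  have h2 : B v (B v x • w) = B v x := by rw [map_smul, hw.2.2]; simp
  rw [h2, inv_mul_cancel₀ hc, one_smul] at this
  exact this

/-- A new head followed by old vertices. -/
lemma RR_new (h : USet B v S0 S') {w : V} {l : List V} (hw : w ∈ Nw B v S0 S')
    (hl : ∀ y ∈ l, y ∈ S0) (hO : Ok B (w :: l)) (hn : l.length + 1 = n) :
    e (w :: l) ∈ RR B v S0 S' n := by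
  have hwl : ∀ y ∈ l, B w y = 0 := fun y hy => hO w (by simp) y (by simp [hy])
  have hpi : ∀ y ∈ l, y - B v y • w ∈ S0 := by
    intro y hy
    rcases h.pi w hw.1 hw.2.1 hw.2.2 y (h.sub (hl y hy)) (hwl y hy) with h1 | h1
    · exact absurd h1 (h.ne hw (hl y hy))
    · exact h1
  have hspw : ∀ y ∈ l, y - B v y • w ∈ sp F (w :: l) := fun y hy =>
    Submodule.sub_mem _ (mem_sp (by simp [hy])) (Submodule.smul_mem _ _ spc)
  have gen : ∀ l1 : List V, (∀ y ∈ l1, y ∈ l) →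
      pr (fun y => y - B v y • w) (e l1) ∈ sup {t | t ∈ TSet B S0 (l1.length + 1) (l1.length + 1) ∧
        w :: t ∈ DepSet B S' (l1.length + 2)} := by
    intro l1 hl1
    refine sup_mono ?_ (pr_dep w (fun y => B v y) l1)
    rintro t ⟨h1, h2, l'', h3, h4, h5⟩
    have hS : ∀ y, (y ∈ l1 ∨ ∃ x ∈ l1, y = x - B v x • w) → y ∈ S0 := by
      rintro y (hy | ⟨a, ha, rfl⟩)
      · exact hl y (hl1 y hy)
      · exact hpi a (hl1 a ha)
    have hsp : ∀ y, (y ∈ l1 ∨ ∃ x ∈ l1, y = x - B v x • w) → y ∈ sp F (w :: l) := by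
      rintro y (hy | ⟨a, ha, rfl⟩)
      · exact mem_sp (by simp [hl1 y hy])
      · exact hspw a (hl1 a ha)
    refine ⟨⟨h1, fun y hy => hS y (h2 y hy), Ok_of_sp hO (fun y hy => hsp y (h2 y hy)), ?_⟩, ?_⟩
    · exact h1 ▸ rk_le_length t
    · refine mkDep (w :: l'') (Ok_of_sp hO ?_) ?_ ?_ (by simp; omega) (by simp; omega)
      · rw [List.forall_mem_cons]
        exact ⟨spc, fun y hy => hsp y (h4 y hy)⟩
      · rw [List.forall_mem_cons]
        exact ⟨hw.1, fun y hy => h.sub (hS y (h2 y hy))⟩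
      · rw [List.forall_mem_cons]
        exact ⟨spc, h5⟩
  have h1 : pr (fun y => y - B v y • w) (e l) ∈ RR B v S0 S' n :=
    RR_A (sup_mono (fun t ht => hn ▸ ht.1) (gen l (fun _ h => h)))
  have h2 : d (cs w (pr (fun y => y - B v y • w) (e l))) ∈ RR B v S0 S' n := by
    refine RR_dD (cs_mem (Q := fun t => t ∈ DepSet B S' (n + 1)) (fun t ht => ?_)
      (gen l (fun _ h => h)))
    rw [← hn]; exact ht.2
  have h3 : cs w (pr (fun y => y - B v y • w) (d (e l))) ∈ RR B v S0 S' n := by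
    refine RR_D ?_
    refine map_mem ((cs w).comp (pr (fun y => y - B v y • w))) ?_ (d_e_mem l)
    rintro l1 ⟨hl1, hlen⟩
    simp only [LinearMap.comp_apply]
    refine cs_mem (Q := fun t => t ∈ DepSet B S' n) (fun t ht => ?_)
      (gen l1 (fun x hx => hl1.subset hx))
    have : n = l1.length + 2 := by omega
    rw [this]; exact ht.2
  have h4 : e (w :: l.map (fun y => y - B v y • w)) ∈ RR B v S0 S' n := by
    refine RR_T (e_mem ⟨w, _, rfl, by simpa using hn, hw, ?_, ?_⟩)
    · simp only [List.mem_map]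
      rintro _ ⟨y, hy, rfl⟩
      refine ⟨hpi y hy, ?_, ?_⟩
      · simp [hw.2.2]
      · have : B w w = 0 := hO w (by simp) w (by simp)
        simp [hwl y hy, this]
    · refine Ok_of_sp hO ?_
      simp only [List.forall_mem_cons, List.mem_map]
      refine ⟨spc, ?_⟩
      rintro _ ⟨y, hy, rfl⟩
      exact hspw y hy
  have h5 := pr_homotopy (fun y => y - B v y • w) (e l)
  have h6 : e (w :: l) = e (w :: l.map (fun y => y - B v y • w))
      - pr (fun y => y - B v y • w) (e l) + d (cs w (pr (fun y => y - B v y • w) (e l)))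
      - cs w (pr (fun y => y - B v y • w) (d (e l))) := by
    have h7 : d (pr (fun y => y - B v y • w) (e l)) = e (l.map (fun y => y - B v y • w)) - e l
      - pr (fun y => y - B v y • w) (d (e l)) := by rw [eq_sub_iff_add_eq, h5, mp_e]
    rw [d_cs, h7]
    simp only [map_sub, cs_e]
    abel
  rw [h6]
  exact Submodule.sub_mem _ (Submodule.add_mem _ (Submodule.sub_mem _ h4 h1) h2) h3

lemma RR_old_new (h : USet B v S0 S') {w x : V} {l : List V} (hw : w ∈ Nw B v S0 S')
    (hx : x ∈ S0) (hl : ∀ y ∈ l, y ∈ Lk B v w S0) (hO : Ok B (x :: w :: l))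
    (hn : l.length + 2 = n) : e (x :: w :: l) ∈ RR B v S0 S' n := by
  have hwx : B w x = 0 := hO w (by simp) x (by simp)
  have hww : B w w = 0 := hO w (by simp) w (by simp)
  have hx' : x - B v x • w ∈ S0 := by
    rcases h.pi w hw.1 hw.2.1 hw.2.2 x (h.sub hx) hwx with h1 | h1
    · exact absurd h1 (h.ne hw hx)
    · exact h1
  set x' := x - B v x • w with hx'def
  have hxx' : ∀ l' : List V, x ∈ sp F (w :: x' :: l') := by
    intro l'
    have h3 := Submodule.add_mem (sp F (w :: x' :: l')) (mem_sp (x := x') (by simp))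
      (Submodule.smul_mem _ (B v x) spc)
    simpa only [hx'def, sub_add_cancel] using h3
  have hx'sp : ∀ l' : List V, x' ∈ sp F (x :: w :: l') := fun l' =>
    Submodule.sub_mem _ spc (Submodule.smul_mem _ _ (mem_sp (by simp)))
  have hlS : ∀ y ∈ l, y ∈ S' := fun y hy => h.sub (hl y hy).1
  have hOk' : ∀ l', (∀ y ∈ l', y ∈ l) → Ok B (w :: x' :: l') := by
    intro l' hl'
    refine Ok_of_sp hO ?_
    simp only [List.forall_mem_cons]
    exact ⟨mem_sp (by simp), hx'sp l, fun y hy => mem_sp (by simp [hl' y hy])⟩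
  -- first relation
  have r1 : e (w :: x :: l) ∈ RR B v S0 S' n := by
    have a1 : d (e (w :: x :: x' :: l)) ∈ RR B v S0 S' n := by
      refine RR_dD (e_mem (mkDep (w :: x' :: l) (hOk' l (fun _ h => h)) ?_ ?_
        (by simp) (by simp; omega)))
      · simp only [List.forall_mem_cons]
        exact ⟨hw.1, h.sub hx, h.sub hx', hlS⟩
      · simp only [List.forall_mem_cons]
        exact ⟨spc, hxx' l, mem_sp (by simp), fun y hy => mem_sp (by simp [hy])⟩
    have a2 : cs w (cs x (cs x' (d (e l)))) ∈ RR B v S0 S' n := by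
      refine RR_D (face_cs3 _ _ _ _ ?_)
      intro l' hl' hlen
      refine mkDep (w :: x' :: l') (hOk' l' hl') ?_ ?_ (by simp) (by simp; omega)
      · simp only [List.forall_mem_cons]
        exact ⟨hw.1, h.sub hx, h.sub hx', fun y hy => hlS y (hl' y hy)⟩
      · simp only [List.forall_mem_cons]
        exact ⟨spc, hxx' l', mem_sp (by simp), fun y hy => mem_sp (by simp [hy])⟩
    have a3 : e (x :: x' :: l) ∈ RR B v S0 S' n := by
      refine RR_A (e_mem ⟨by simp; omega, ?_, Ok_of_sp hO ?_, ?_⟩)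
      · simp only [List.forall_mem_cons]
        exact ⟨hx, hx', fun y hy => (hl y hy).1⟩
      · simp only [List.forall_mem_cons]
        exact ⟨spc, hx'sp l, fun y hy => mem_sp (by simp [hy])⟩
      · refine (rk_le_length _).trans (by simp; omega)
    have a4 : e (w :: x' :: l) ∈ RR B v S0 S' n := by
      refine RR_T (e_mem ⟨w, x' :: l, rfl, by simp; omega, hw, ?_, hOk' l (fun _ h => h)⟩)
      simp only [List.forall_mem_cons]
      exact ⟨⟨hx', by simp [hx'def, hw.2.2], by simp [hx'def, hwx, hww]⟩, hl⟩
    have a5 : e (w :: x :: l) = d (e (w :: x :: x' :: l)) + cs w (cs x (cs x' (d (e l))))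
        - e (x :: x' :: l) + e (w :: x' :: l) := by
      rw [d_cons, d_cons, d_cons]; simp only [map_sub, cs_e]; abel
    rw [a5]
    exact Submodule.add_mem _ (Submodule.sub_mem _ (Submodule.add_mem _ a1 a2) a3) a4
  -- second relation
  have b1 : d (e (x :: w :: x :: l)) ∈ RR B v S0 S' n := by
    refine RR_dD (e_mem (mkDep (x :: w :: l) hO ?_ ?_ (by simp) (by simp; omega)))
    · simp only [List.forall_mem_cons]
      exact ⟨h.sub hx, hw.1, h.sub hx, hlS⟩
    · simp only [List.forall_mem_cons]
      exact ⟨spc, mem_sp (by simp), spc, fun y hy => mem_sp (by simp [hy])⟩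
  have b2 : cs x (cs w (cs x (d (e l)))) ∈ RR B v S0 S' n := by
    refine RR_D (face_cs3 _ _ _ _ ?_)
    intro l' hl' hlen
    refine mkDep (x :: w :: l') (Ok_sub hO ?_) ?_ ?_ (by simp) (by simp; omega)
    · simp only [List.forall_mem_cons]
      exact ⟨by simp, by simp, fun y hy => by simp [hl' y hy]⟩
    · simp only [List.forall_mem_cons]
      exact ⟨h.sub hx, hw.1, h.sub hx, fun y hy => hlS y (hl' y hy)⟩
    · simp only [List.forall_mem_cons]
      exact ⟨spc, mem_sp (by simp), spc, fun y hy => mem_sp (by simp [hy])⟩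
  have b3 : e (x :: x :: l) ∈ RR B v S0 S' n := by
    refine RR_D (e_mem (mkDep (x :: l) (Ok_sub hO ?_) ?_ ?_ (by simp) (by simp; omega)))
    · simp only [List.forall_mem_cons]
      exact ⟨by simp, fun y hy => by simp [hy]⟩
    · simp only [List.forall_mem_cons]
      exact ⟨h.sub hx, h.sub hx, hlS⟩
    · simp only [List.forall_mem_cons]
      exact ⟨spc, spc, fun y hy => mem_sp (by simp [hy])⟩
  have b5 : e (x :: w :: l) = d (e (x :: w :: x :: l)) + cs x (cs w (cs x (d (e l))))
      + e (x :: x :: l) - e (w :: x :: l) := by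
    rw [d_cons, d_cons, d_cons]; simp only [map_sub, cs_e]; abel
  rw [b5]
  exact Submodule.sub_mem _ (Submodule.add_mem _ (Submodule.add_mem _ b1 b2) b3) r1

lemma USet.link (h : USet B v S0 S') (x : V) :
    USet B v (S0 ∩ {y | B x y = 0}) (S' ∩ {y | B x y = 0}) where
  symm := h.symm
  sub := Set.inter_subset_inter_left _ h.sub
  zero := fun h0 => h.zero h0.1
  sc0 := fun y hy c hc => ⟨h.sc0 y hy.1 c hc, by
    have : B x y = 0 := hy.2
    simp [this]⟩
  sc' := fun y hy c hc => ⟨h.sc' y hy.1 c hc, by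
    have : B x y = 0 := hy.2
    simp [this]⟩
  bv := fun w hw hw0 => h.bv w hw.1 (fun h1 => hw0 ⟨h1, hw.2⟩)
  pi := fun w hw hw0 hvw y hy hwy => by
    rcases h.pi w hw.1 (fun h1 => hw0 ⟨h1, hw.2⟩) hvw y hy.1 hwy with h1 | h1
    · exact Or.inl h1
    · refine Or.inr ⟨h1, ?_⟩
      have h2 : B x y = 0 := hy.2
      have h3 : B x w = 0 := hw.2
      simp [h2, h3]

lemma USet.norm (h : USet B v S0 S') {x : V} (hx : x ∈ S') (hx0 : x ∉ S0) :
    (B v x)⁻¹ • x ∈ Nw B v S0 S' := by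
  have hb := h.bv x hx hx0
  refine ⟨h.sc' x hx _ (inv_ne_zero hb), fun h1 => hx0 ?_, by simp [hb]⟩
  have := h.sc0 _ h1 (B v x) hb
  rwa [smul_smul, mul_inv_cancel₀ hb, one_smul] at this

/-- Prepending any vertex to a vertex list headed by a new vertex. -/
lemma RR_any_new (h : USet B v S0 S') {w x : V} {l : List V} (hw : w ∈ Nw B v S0 S')
    (hx : x ∈ S') (hl : ∀ y ∈ l, y ∈ Lk B v w S0) (hO : Ok B (x :: w :: l))
    (hn : l.length + 2 = n) : e (x :: w :: l) ∈ RR B v S0 S' n := by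
  by_cases hx0 : x ∈ S0
  · exact RR_old_new h hw hx0 hl hO hn
  have hlS : ∀ y ∈ l, y ∈ S' := fun y hy => h.sub (hl y hy).1
  have hN := h.norm hx hx0
  have hsc := RR_scale (v := v) (S0 := S0) (n := n) (l := w :: l) (x := x) (S' := S')
    (c := (B v x)⁻¹) (by simp only [List.forall_mem_cons]; exact ⟨hx, hw.1, hlS⟩) hO hN.1
    (by simp; omega)
  set a := (B v x)⁻¹ • x with ha
  have hasp : ∀ l' : List V, a ∈ sp F (x :: l') := fun l' => Submodule.smul_mem _ _ spc
  have hO' : Ok B (a :: w :: l) := Ok_of_sp hO (by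
    simp only [List.forall_mem_cons]
    exact ⟨hasp _, mem_sp (by simp), fun y hy => mem_sp (by simp [hy])⟩)
  have haw : B a w = 0 := hO' a (by simp) w (by simp)
  suffices hmain : e (a :: w :: l) ∈ RR B v S0 S' n by
    have := Submodule.add_mem _ hsc hmain
    rwa [sub_add_cancel] at this
  have hu : w - B v w • a = w - a := by rw [hw.2.2, one_smul]
  have husp : ∀ l' : List V, w - a ∈ sp F (a :: w :: l') := fun l' =>
    Submodule.sub_mem _ (mem_sp (by simp)) spc
  rcases h.pi a hN.1 hN.2.1 hN.2.2 w hw.1 haw with h1 | h1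
  · rw [hu] at h1
    have : a = w := (sub_eq_zero.1 h1).symm
    refine RR_D (e_mem (mkDep (w :: l) (Ok_sub hO ?_) ?_ ?_ (by simp) (by simp; omega)))
    · simp only [List.forall_mem_cons]
      exact ⟨by simp, fun y hy => by simp [hy]⟩
    · simp only [List.forall_mem_cons]
      exact ⟨hN.1, hw.1, hlS⟩
    · simp only [List.forall_mem_cons]
      exact ⟨by rw [this]; exact spc, spc, fun y hy => mem_sp (by simp [hy])⟩
  rw [hu] at h1
  have hla : ∀ y ∈ l, y ∈ Lk B v a S0 := fun y hy =>
    ⟨(hl y hy).1, (hl y hy).2.1, hO' a (by simp) y (by simp [hy])⟩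
  have c1 : e ((w - a) :: w :: l) ∈ RR B v S0 S' n := RR_old_new h hw h1 hl (Ok_of_sp hO' (by
    simp only [List.forall_mem_cons]
    exact ⟨husp _, mem_sp (by simp), fun y hy => mem_sp (by simp [hy])⟩)) hn
  have c2 : e ((w - a) :: a :: l) ∈ RR B v S0 S' n := RR_old_new h hN h1 hla (Ok_of_sp hO' (by
    simp only [List.forall_mem_cons]
    exact ⟨husp _, spc, fun y hy => mem_sp (by simp [hy])⟩)) hn
  have c3 : d (e ((w - a) :: a :: w :: l)) ∈ RR B v S0 S' n := by
    refine RR_dD (e_mem (mkDep (a :: w :: l) hO' ?_ ?_ (by simp) (by simp; omega)))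
    · simp only [List.forall_mem_cons]
      exact ⟨h.sub h1, hN.1, hw.1, hlS⟩
    · simp only [List.forall_mem_cons]
      exact ⟨husp l, spc, mem_sp (by simp), fun y hy => mem_sp (by simp [hy])⟩
  have c4 : cs (w - a) (cs a (cs w (d (e l)))) ∈ RR B v S0 S' n := by
    refine RR_D (face_cs3 _ _ _ _ ?_)
    intro l' hl' hlen
    refine mkDep (a :: w :: l') (Ok_sub hO' ?_) ?_ ?_ (by simp) (by simp; omega)
    · simp only [List.forall_mem_cons]
      exact ⟨by simp, by simp, fun y hy => by simp [hl' y hy]⟩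
    · simp only [List.forall_mem_cons]
      exact ⟨h.sub h1, hN.1, hw.1, fun y hy => hlS y (hl' y hy)⟩
    · simp only [List.forall_mem_cons]
      exact ⟨husp l', spc, mem_sp (by simp), fun y hy => mem_sp (by simp [hy])⟩
  have c5 : e (a :: w :: l) = d (e ((w - a) :: a :: w :: l)) + cs (w - a) (cs a (cs w (d (e l))))
      + e ((w - a) :: w :: l) - e ((w - a) :: a :: l) := by
    rw [d_cons, d_cons, d_cons]; simp only [map_sub, cs_e]; abel
  rw [c5]
  exact Submodule.sub_mem _ (Submodule.add_mem _ (Submodule.add_mem _ c3 c4) c1) c2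

lemma Ok_cons {x : V} {l : List V} (h : USet B v S0 S') (hx : B x x = 0) (hl : Ok B l)
    (hxl : ∀ y ∈ l, B x y = 0) : Ok B (x :: l) := by
  intro a ha b hb
  rcases List.mem_cons.1 ha with h1 | h1
  · rcases List.mem_cons.1 hb with h2 | h2
    · rw [h1, h2]; exact hx
    · rw [h1]; exact hxl b h2
  · rcases List.mem_cons.1 hb with h2 | h2
    · rw [h2, h.symm]; exact hxl a h1
    · exact hl a h1 b h2

lemma rk_cons_le (x : V) (l : List V) : rk F (x :: l) ≤ rk F l + 1 := by
  have : sp F (x :: l) = F ∙ x ⊔ sp F l := by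
    unfold sp
    rw [← Submodule.span_union]
    congr 1
    ext y; simp
  unfold rk
  rw [this]
  have h1 := Submodule.finrank_add_le_finrank_add_finrank (F ∙ x) (sp F l)
  have h2 : Module.finrank F (F ∙ x) ≤ 1 := by
    simpa using finrank_span_le_card (R := F) ({x} : Set V)
  omega

lemma Dep_cons (h : USet B v S0 S') {x : V} (hx : x ∈ S') (hxx : B x x = 0) {l : List V}
    (hl : l ∈ DepSet B (S' ∩ {y | B x y = 0}) n) : x :: l ∈ DepSet B S' (n + 1) := by
  obtain ⟨h1, h2, h3, h4⟩ := hl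
  refine ⟨by simp [h1], ?_, Ok_cons h hxx h3 (fun y hy => (h2 y hy).2), ?_⟩
  · simp only [List.forall_mem_cons]
    exact ⟨hx, fun y hy => (h2 y hy).1⟩
  · have := rk_cons_le (F := F) x l
    omega

lemma RR_cons (h : USet B v S0 S') {x : V} (hx : x ∈ S') (hxx : B x x = 0) {u : Z (List V)}
    (hu : u ∈ RR B v (S0 ∩ {y | B x y = 0}) (S' ∩ {y | B x y = 0}) n) :
    cs x u ∈ RR B v S0 S' (n + 1) := by
  suffices hle : RR B v (S0 ∩ {y | B x y = 0}) (S' ∩ {y | B x y = 0}) n ≤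
      (RR B v S0 S' (n + 1)).comap (cs x) from hle hu
  refine _root_.sup_le (_root_.sup_le (_root_.sup_le ?_ ?_) ?_) ?_
  · refine sup_le ?_
    rintro l ⟨h1, h2, h3, h4⟩
    show cs x (e l) ∈ RR B v S0 S' (n + 1)
    rw [cs_e]
    have hO : Ok B (x :: l) := Ok_cons h hxx h3 (fun y hy => (h2 y hy).2)
    by_cases hx0 : x ∈ S0
    · refine RR_A (e_mem ⟨by simp [h1], ?_, hO, (rk_le_length _).trans (by simp [h1])⟩)
      simp only [List.forall_mem_cons]
      exact ⟨hx0, fun y hy => (h2 y hy).1⟩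
    · have hN := h.norm hx hx0
      have hsc := RR_scale (v := v) (S0 := S0) (n := n + 1) (l := l) (x := x) (S' := S')
        (c := (B v x)⁻¹) (by
          simp only [List.forall_mem_cons]; exact ⟨hx, fun y hy => h.sub (h2 y hy).1⟩) hO hN.1
        (by omega)
      have hnew := RR_new (n := n + 1) h hN (l := l) (fun y hy => (h2 y hy).1) (Ok_of_sp hO (by
        simp only [List.forall_mem_cons]
        exact ⟨Submodule.smul_mem _ _ spc, fun y hy => mem_sp (by simp [hy])⟩)) (by omega)
      have := Submodule.add_mem _ hsc hnew
      rwa [sub_add_cancel] at this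
  · refine sup_le ?_
    rintro _ ⟨w, l, rfl, h1, h2, h3, h4⟩
    show cs x (e (w :: l)) ∈ RR B v S0 S' (n + 1)
    rw [cs_e]
    refine RR_any_new h (w := w) ⟨h2.1.1, fun h5 => h2.2.1 ⟨h5, h2.1.2⟩, h2.2.2⟩ hx ?_ ?_ (by omega)
    · intro y hy
      exact ⟨(h3 y hy).1.1, (h3 y hy).2.1, (h3 y hy).2.2⟩
    · refine Ok_cons h hxx h4 ?_
      simp only [List.forall_mem_cons]
      exact ⟨h2.1.2, fun y hy => (h3 y hy).1.2⟩
  · refine sup_le ?_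
    intro l hl
    show cs x (e l) ∈ RR B v S0 S' (n + 1)
    rw [cs_e]
    exact RR_D (e_mem (Dep_cons h hx hxx hl))
  · rw [Submodule.map_le_iff_le_comap]
    intro u hu
    show cs x (d u) ∈ RR B v S0 S' (n + 1)
    have h1 : cs x (d u) = u - d (cs x u) := by rw [d_cs]; abel
    rw [h1]
    refine Submodule.sub_mem _ (RR_D (sup_mono ?_ hu)) (RR_dD ?_)
    · rintro l ⟨h1, h2, h3⟩
      exact ⟨h1, fun y hy => (h2 y hy).1, h3⟩
    · exact cs_mem (P := fun l => l ∈ DepSet B (S' ∩ {y | B x y = 0}) (n + 1))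
        (Q := fun l => l ∈ DepSet B S' (n + 1 + 1)) (fun l hl => Dep_cons h hx hxx hl) hu

lemma Red_list (t : List V) : ∀ (S0 S' : Set V), USet B v S0 S' → (∀ x ∈ t, x ∈ S') → Ok B t →
    e t ∈ RR B v S0 S' t.length := by
  induction t with
  | nil =>
    intro S0 S' h _ hO
    exact RR_A (e_mem ⟨rfl, by simp, hO, rk_le_length _⟩)
  | cons x t ih =>
    intro S0 S' h ht hO
    rw [List.forall_mem_cons] at ht
    have := RR_cons h ht.1 (hO x (by simp) x (by simp)) (ih _ _ (h.link x)
      (fun y hy => ⟨ht.2 y hy, hO x (by simp) y (by simp [hy])⟩)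
      (Ok_sub hO (fun y hy => by simp [hy])))
    rwa [cs_e] at this

lemma Red (h : USet B v S0 S') {r : ℕ} {z : Z (List V)} (hz : z ∈ TL B S' n r) :
    z ∈ RR B v S0 S' n := by
  have : TL B S' n r ≤ RR B v S0 S' n := sup_le (by
    rintro t ⟨h1, h2, h3, -⟩
    rw [← h1]; exact Red_list t S0 S' h h2 h3)
  exact this hz

end LemmaU

end OStab

namespace OStab

section Rho

set_option linter.unusedSectionVars false

variable {F V : Type} [Field F] [AddCommGroup V] [Module F V] [FiniteDimensional F V]

open Classical in
noncomputable def chiL (f : V → V) : List V → Z (List V)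
  | [] => e []
  | x :: l => if f x = 0 then 0 else cs (f x) (chiL f l)

noncomputable def chi (f : V → V) : Z (List V) →ₗ[ℤ] Z (List V) := L (chiL f)

open Classical in
noncomputable def rhoL (f : V → V) : List V → Z (List V)
  | [] => 0
  | x :: l => if f x = 0 then chiL f l else - cs (f x) (rhoL f l)

noncomputable def rho (f : V → V) : Z (List V) →ₗ[ℤ] Z (List V) := L (rhoL f)

variable {f : V → V}

lemma chi_nil : chi f (e []) = e [] := by simp [chi, chiL]
lemma rho_nil : rho f (e []) = 0 := by simp [rho, rhoL]
lemma chi_z {x : V} {l : List V} (h : f x = 0) : chi f (e (x :: l)) = 0 := by simp [chi, chiL, h]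
lemma chi_nz {x : V} {l : List V} (h : f x ≠ 0) : chi f (e (x :: l)) = cs (f x) (chi f (e l)) := by
  simp [chi, chiL, h]
lemma rho_z {x : V} {l : List V} (h : f x = 0) : rho f (e (x :: l)) = chi f (e l) := by
  simp [chi, rho, rhoL, h]
lemma rho_nz {x : V} {l : List V} (h : f x ≠ 0) : rho f (e (x :: l)) = - cs (f x) (rho f (e l)) := by
  simp [rho, rhoL, h]
lemma chi_cz {x : V} (u : Z (List V)) (h : f x = 0) : chi f (cs x u) = 0 := by
  have := hom_ext_apply (φ := (chi f).comp (cs x)) (ψ := 0) (by intro l; simp [chi_z h]) u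
  simpa using this
lemma chi_cnz {x : V} (u : Z (List V)) (h : f x ≠ 0) : chi f (cs x u) = cs (f x) (chi f u) := by
  have := hom_ext_apply (φ := (chi f).comp (cs x)) (ψ := (cs (f x)).comp (chi f))
    (by intro l; simp [chi_nz h]) u
  simpa using this
lemma rho_cz {x : V} (u : Z (List V)) (h : f x = 0) : rho f (cs x u) = chi f u := by
  have := hom_ext_apply (φ := (rho f).comp (cs x)) (ψ := chi f) (by intro l; simp [rho_z h]) u
  simpa using this
lemma rho_cnz {x : V} (u : Z (List V)) (h : f x ≠ 0) : rho f (cs x u) = - cs (f x) (rho f u) := by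
  have := hom_ext_apply (φ := (rho f).comp (cs x)) (ψ := -(cs (f x)).comp (rho f))
    (by intro l; simp [rho_nz h]) u
  simpa using this

lemma chi_d (u : Z (List V)) : chi f (d u) = d (chi f u) + rho f u := by
  have := hom_ext_apply (φ := (chi f).comp d) (ψ := d.comp (chi f) + rho f) (by
    intro l
    induction l with
    | nil => simp [chi_nil, rho_nil]
    | cons x l ih =>
      simp only [LinearMap.comp_apply, LinearMap.add_apply] at ih ⊢
      rw [d_cons, map_sub]
      by_cases h : f x = 0
      · rw [chi_z h, rho_z h, chi_cz _ h]; simp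
      · rw [chi_nz h, rho_nz h, chi_cnz _ h, ih, d_cs, map_add]; abel) u
  simpa using this

lemma rho_d (u : Z (List V)) : rho f (d u) = - d (rho f u) := by
  have h1 := chi_d (f := f) (d u)
  rw [d_d, map_zero, chi_d, map_add, d_d, zero_add] at h1
  exact (neg_eq_of_add_eq_zero_right h1.symm).symm

lemma chi_mem (l : List V) : chi f (e l) ∈ sup {l' : List V | l'.length = l.length ∧
    ∀ y ∈ l', y ≠ 0 ∧ ∃ x ∈ l, y = f x} := by
  induction l with
  | nil => rw [chi_nil]; exact e_mem (by simp)
  | cons x l ih =>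
    by_cases h : f x = 0
    · rw [chi_z h]; exact zero_mem _
    · rw [chi_nz h]
      refine cs_mem (fun l' hl' => ?_) ih
      refine ⟨by simp [hl'.1], ?_⟩
      rw [List.forall_mem_cons]
      exact ⟨⟨h, x, by simp, rfl⟩, fun y hy => ⟨(hl'.2 y hy).1, by
        obtain ⟨a, ha, hb⟩ := (hl'.2 y hy).2
        exact ⟨a, by simp [ha], hb⟩⟩⟩

lemma rho_mem (l : List V) : rho f (e l) ∈ sup {l' : List V | l'.length + 1 = l.length ∧
    ∀ y ∈ l', y ≠ 0 ∧ ∃ x ∈ l, y = f x} := by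
  induction l with
  | nil => rw [rho_nil]; exact zero_mem _
  | cons x l ih =>
    by_cases h : f x = 0
    · rw [rho_z h]
      refine sup_mono ?_ (chi_mem l)
      rintro l' ⟨h1, h2⟩
      exact ⟨by simp [h1], fun y hy => ⟨(h2 y hy).1, by
        obtain ⟨a, ha, hb⟩ := (h2 y hy).2
        exact ⟨a, by simp [ha], hb⟩⟩⟩
    · rw [rho_nz h]
      refine Submodule.neg_mem _ (cs_mem (fun l' hl' => ?_) ih)
      refine ⟨by simp [← hl'.1], ?_⟩
      rw [List.forall_mem_cons]
      exact ⟨⟨h, x, by simp, rfl⟩, fun y hy => ⟨(hl'.2 y hy).1, by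
        obtain ⟨a, ha, hb⟩ := (hl'.2 y hy).2
        exact ⟨a, by simp [ha], hb⟩⟩⟩

lemma rho_eq_zero (l : List V) (h : ∀ x ∈ l, f x ≠ 0) : rho f (e l) = 0 := by
  induction l with
  | nil => exact rho_nil
  | cons x l ih =>
    rw [rho_nz (h x (by simp)), ih (fun y hy => h y (by simp [hy])), map_zero, neg_zero]

lemma chi_id (l : List V) (h : ∀ x ∈ l, f x = x ∧ x ≠ 0) : chi f (e l) = e l := by
  induction l with
  | nil => exact chi_nil
  | cons x l ih =>
    have hx := h x (by simp)
    rw [chi_nz (by rw [hx.1]; exact hx.2), ih (fun y hy => h y (by simp [hy])), hx.1, cs_e]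

variable {B : V →ₗ[F] V →ₗ[F] F} {v : V} {S0 S' : Set V}

def Ex (B : V →ₗ[F] V →ₗ[F] F) (S : Set V) (n : ℕ) : Prop :=
  ∀ z ∈ TL B S n n, d z = 0 → ∃ y ∈ TL B S (n + 1) (n + 1), d y = z

/-- projection -/
noncomputable def pw (B : V →ₗ[F] V →ₗ[F] F) (v w : V) (y : V) : V := y - B v y • w

lemma rho_S0 (h : USet B v S0 S') {w : V} (hw : w ∈ Nw B v S0 S') {n r : ℕ} {u : Z (List V)}
    (hu : u ∈ TL B S0 n r) : rho (pw B v w) u = 0 := by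
  have := map_mem (N := ⊥) (rho (pw B v w)) (s := TSet B S0 n r) (fun l hl => by
    rw [rho_eq_zero (f := pw B v w) l (fun x hx => h.ne hw (hl.2.1 x hx))]; simp) hu
  simpa using this

lemma rho_key (h : USet B v S0 S') {w : V} (hw : w ∈ Nw B v S0 S') {n r : ℕ} {l : List V}
    (hl : l ∈ TSet B S' (n + 1) r) : rho (pw B v w) (e l) ∈
      sup {l' | l' ∈ TSet B (Lk B v w S0) n n ∧ w :: l' ∈ TSet B S' (n + 1) r} := by
  obtain ⟨h1, h2, h3, h4⟩ := hl
  by_cases hz : ∀ x ∈ l, pw B v w x ≠ 0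
  · rw [rho_eq_zero l hz]; exact zero_mem _
  push Not at hz
  obtain ⟨x, hx, hx0⟩ := hz
  have hx' : x = B v x • w := sub_eq_zero.1 hx0
  have hc : B v x ≠ 0 := by
    intro hc
    rw [hc, zero_smul] at hx'
    exact h.zero (hx' ▸ h2 x hx)
  have hwsp : w ∈ sp F l := by
    have : w = (B v x)⁻¹ • x := by
      nth_rewrite 2 [hx']; rw [smul_smul, inv_mul_cancel₀ hc, one_smul]
    rw [this]; exact Submodule.smul_mem _ _ (mem_sp hx)
  have hiso := iso_sp B h3
  refine sup_mono ?_ (rho_mem l)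
  rintro l' ⟨k1, k2⟩
  have hsp : ∀ y ∈ w :: l', y ∈ sp F l := by
    rw [List.forall_mem_cons]
    refine ⟨hwsp, fun y hy => ?_⟩
    obtain ⟨-, a, ha, rfl⟩ := k2 y hy
    exact Submodule.sub_mem _ (mem_sp ha) (Submodule.smul_mem _ _ hwsp)
  have hOk : Ok B (w :: l') := Ok_of_sp h3 hsp
  have hLk : ∀ y ∈ l', y ∈ Lk B v w S0 := by
    intro y hy
    obtain ⟨hy0, a, ha, rfl⟩ := k2 y hy
    refine ⟨?_, ?_, hOk w (by simp) _ (by simp [hy])⟩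
    · exact (h.pi w hw.1 hw.2.1 hw.2.2 a (h2 a ha) (hiso _ hwsp _ (mem_sp ha))).resolve_left hy0
    · simp [pw, hw.2.2]
  refine ⟨⟨by omega, hLk, Ok_sub hOk (fun y hy => by simp [hy]),
    (rk_le_length l').trans (by omega)⟩, ⟨by simp; omega, ?_, hOk, ?_⟩⟩
  · rw [List.forall_mem_cons]
    exact ⟨hw.1, fun y hy => h.sub (hLk y hy).1⟩
  · exact (rk_le hsp).trans h4

lemma rho_Lk (h : USet B v S0 S') {w : V} (hw : w ∈ Nw B v S0 S') {n r : ℕ} {u : Z (List V)}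
    (hu : u ∈ TL B S' (n + 1) r) : rho (pw B v w) u ∈ TL B (Lk B v w S0) n n :=
  map_mem _ (fun _ hl => sup_mono (fun _ k => k.1) (rho_key h hw hl)) hu

lemma cs_rho (h : USet B v S0 S') {w : V} (hw : w ∈ Nw B v S0 S') {n r : ℕ} {u : Z (List V)}
    (hu : u ∈ TL B S' (n + 1) r) : cs w (rho (pw B v w) u) ∈ TL B S' (n + 1) r :=
  map_mem ((cs w).comp (rho (pw B v w))) (fun _ hl =>
    cs_mem (P := fun l' => l' ∈ TSet B (Lk B v w S0) n n ∧ w :: l' ∈ TSet B S' (n + 1) r)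
      (Q := fun l' => l' ∈ TSet B S' (n + 1) r) (fun _ hl' => hl'.2) (rho_key h hw hl)) hu

lemma Dep_eq {S : Set V} {n : ℕ} : sup (DepSet B S (n + 1)) = TL B S (n + 1) n := by
  unfold TL
  congr 1
  ext t
  simp [DepSet, TSet, Nat.lt_succ_iff]

/-- Structure of the Θ part. -/
lemma Th_struct (h : USet B v S0 S') {n : ℕ} {Θ : Z (List V)}
    (hΘ : Θ ∈ sup (ThSet B v S0 S' (n + 1))) : ∃ (s : Finset V) (f : V → Z (List V)),
      (∀ w ∈ s, w ∈ Nw B v S0 S') ∧ (∀ w ∈ s, f w ∈ TL B (Lk B v w S0) n n) ∧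
      Θ = ∑ w ∈ s, cs w (f w) ∧ ∀ w ∈ s, rho (pw B v w) Θ = f w := by
  let Φ : (V →₀ Z (List V)) →ₗ[ℤ] Z (List V) := Finsupp.lsum ℤ (fun w => cs w)
  let K : Submodule ℤ (V →₀ Z (List V)) :=
    { carrier := {f | ∀ w, (w ∉ Nw B v S0 S' → f w = 0) ∧ f w ∈ TL B (Lk B v w S0) n n}
      zero_mem' := fun w => ⟨fun _ => rfl, zero_mem _⟩
      add_mem' := fun {a b} ha hb w => ⟨fun hw => by simp [(ha w).1 hw, (hb w).1 hw],
        Submodule.add_mem _ (ha w).2 (hb w).2⟩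
      smul_mem' := fun c a ha w => ⟨fun hw => by simp [(ha w).1 hw],
        Submodule.smul_mem _ _ (ha w).2⟩ }
  have hK : sup (ThSet B v S0 S' (n + 1)) ≤ K.map Φ := by
    refine sup_le ?_
    rintro _ ⟨w, l, rfl, h1, h2, h3, h4⟩
    refine ⟨Finsupp.single w (e l), fun w' => ?_, by simp [Φ]⟩
    by_cases hw : w = w'
    · subst hw
      refine ⟨fun h' => absurd h2 h', ?_⟩
      rw [Finsupp.single_eq_same]
      exact e_mem ⟨by omega, h3, Ok_sub h4 (fun y hy => by simp [hy]),
        (rk_le_length l).trans (by omega)⟩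
    · rw [Finsupp.single_eq_of_ne (Ne.symm hw)]
      exact ⟨fun _ => rfl, zero_mem _⟩
  obtain ⟨f, hf, rfl⟩ := hK hΘ
  have hs : ∀ w ∈ f.support, w ∈ Nw B v S0 S' := by
    intro w hw
    by_contra hcon
    exact (Finsupp.mem_support_iff.1 hw) ((hf w).1 hcon)
  refine ⟨f.support, f, hs, fun w _ => (hf w).2, rfl, ?_⟩
  intro w hw
  have hΦ : Φ f = ∑ w ∈ f.support, cs w (f w) := rfl
  rw [hΦ, map_sum, Finset.sum_eq_single w]
  · have hww := hs w hw
    have : pw B v w w = 0 := by simp [pw, hww.2.2]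
    rw [rho_cz _ this]
    refine (eq_on_sup (φ := chi (pw B v w)) (ψ := LinearMap.id) (fun l hl => ?_) (hf w).2).trans rfl
    rw [chi_id]; rfl
    intro x hx
    refine ⟨by simp [pw, (hl.2.1 x hx).2.1], ?_⟩
    rintro rfl
    exact h.zero (h.sub (hl.2.1 _ hx).1)
  · intro w' hw' hne
    have hww := hs w hw
    have hww' := hs w' hw'
    have h0 : pw B v w w' ≠ 0 := by
      rw [pw, hww'.2.2, one_smul, sub_ne_zero]; exact hne
    rw [rho_cnz _ h0, rho_S0 h hww (TL_mono (fun x hx => hx.1) le_rfl (hf w').2), map_zero, neg_zero]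
  · intro h'; exact absurd hw h'

lemma Th_cs (h : USet B v S0 S') {w : V} {r n : ℕ} {y : Z (List V)} (hw : w ∈ Nw B v S0 S')
    (hww : B w w = 0) (hy : y ∈ TL B (Lk B v w S0) n r) : cs w y ∈ TL B S' (n + 1) (n + 1) := by
  refine cs_mem (P := fun l => l ∈ TSet B (Lk B v w S0) n r)
    (Q := fun l => l ∈ TSet B S' (n + 1) (n + 1)) ?_ hy
  rintro l ⟨h1, h2, h3, h4⟩
  refine ⟨by simp [h1], ?_, Ok_cons h hww h3 (fun y hy => (h2 y hy).2.2),
    (rk_le_length _).trans (by simp [h1])⟩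
  rw [List.forall_mem_cons]
  exact ⟨hw.1, fun y hy => h.sub (h2 y hy).1⟩

lemma RR_split {n : ℕ} {z : Z (List V)} (hz : z ∈ RR B v S0 S' n) :
    ∃ a ∈ TL B S0 n n, ∃ Θ ∈ sup (ThSet B v S0 S' n), ∃ D1 ∈ sup (DepSet B S' n),
      ∃ D2 ∈ sup (DepSet B S' (n + 1)), z = a + Θ + D1 + d D2 := by
  obtain ⟨y, hy, z1, ⟨D2, h2, rfl⟩, rfl⟩ := Submodule.mem_sup.1 hz
  obtain ⟨y', hy', D1, h1, rfl⟩ := Submodule.mem_sup.1 hy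
  obtain ⟨a, ha, Θ, hΘ, rfl⟩ := Submodule.mem_sup.1 hy'
  exact ⟨a, ha, Θ, hΘ, D1, h1, D2, h2, rfl⟩

theorem Ex_up (h : USet B v S0 S') (hiso : ∀ w ∈ S', B w w = 0) {n : ℕ} (h0 : Ex B S0 n)
    (hLk : ∀ w ∈ Nw B v S0 S', ∀ k, n = k + 1 → Ex B (Lk B v w S0) k) : Ex B S' n := by
  intro z hz hdz
  cases n with
  | zero =>
    have hz0 : z ∈ TL B S0 0 0 := by
      refine sup_mono ?_ hz
      rintro l ⟨h1, h2, h3⟩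
      have : l = [] := List.length_eq_zero_iff.1 h1
      subst this
      exact ⟨h1, by simp, h3⟩
    obtain ⟨y, hy, hy2⟩ := h0 z hz0 hdz
    exact ⟨y, TL_mono h.sub le_rfl hy, hy2⟩
  | succ k =>
    obtain ⟨a, ha, Θ, hΘ, D1, hD1, D2, hD2, rfl⟩ := RR_split (Red h hz)
    rw [Dep_eq] at hD1 hD2
    obtain ⟨s, f, hs, hf, hΘs, hrho⟩ := Th_struct h hΘ
    have hcyc : d (a + Θ + D1) = 0 := by
      rw [map_add, d_d, add_zero] at hdz; exact hdz
    have hg : ∀ w ∈ s, ∃ y ∈ TL B (Lk B v w S0) (k + 1) (k + 1),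
        d y = f w + rho (pw B v w) D1 := by
      intro w hw
      refine hLk w (hs w hw) k rfl _ (Submodule.add_mem _ (hf w hw) (rho_Lk h (hs w hw) hD1)) ?_
      have h1 := rho_d (f := pw B v w) (a + Θ + D1)
      rw [hcyc, map_zero, map_add (rho _), map_add (rho _), rho_S0 h (hs w hw) ha, hrho w hw, zero_add] at h1
      exact neg_eq_zero.1 h1.symm
    choose! y hy hdy using hg
    have hX : ∑ w ∈ s, cs w (y w) ∈ TL B S' (k + 1 + 1) (k + 1 + 1) :=
      Submodule.sum_mem _ (fun w hw => Th_cs h (hs w hw) (hiso w (hs w hw).1) (hy w hw))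
    have hdX : d (∑ w ∈ s, cs w (y w)) =
        ∑ w ∈ s, y w - Θ - ∑ w ∈ s, cs w (rho (pw B v w) D1) := by
      rw [map_sum, hΘs, ← Finset.sum_sub_distrib, ← Finset.sum_sub_distrib]
      refine Finset.sum_congr rfl (fun w hw => ?_)
      rw [d_cs, hdy w hw, map_add]; abel
    set a' := a + ∑ w ∈ s, y w with ha'
    set D1' := D1 - ∑ w ∈ s, cs w (rho (pw B v w) D1) with hD1'
    have hsum : a' + D1' = a + Θ + D1 + d (∑ w ∈ s, cs w (y w)) := by
      rw [hdX, ha', hD1']; abel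
    have hcyc' : d a' = - d D1' := by
      have : d (a' + D1') = 0 := by rw [hsum, map_add, d_d, hcyc, add_zero]
      rw [map_add] at this
      exact eq_neg_of_add_eq_zero_left this
    have ma' : a' ∈ TL B S0 (k + 1) (k + 1) :=
      Submodule.add_mem _ ha (Submodule.sum_mem _ (fun w hw =>
        TL_mono (fun x hx => hx.1) le_rfl (hy w hw)))
    have mD' : D1' ∈ TL B S' (k + 1) k :=
      Submodule.sub_mem _ hD1 (Submodule.sum_mem _ (fun w hw => cs_rho h (hs w hw) hD1))
    have mda : d a' ∈ TL B S0 k k := by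
      refine sup_mono ?_ (d_TL ma')
      rintro l ⟨h1, h2, h3, h4⟩
      exact ⟨h1, h2, h3, (rk_le_length l).trans (by omega)⟩
    obtain ⟨y0, my0, hy0⟩ := EJ k S0 S' h.sub h.zero k (d a') mda (d_d _)
      (Or.inr ⟨rfl, -D1', Submodule.neg_mem _ mD', by rw [map_neg, hcyc']⟩)
    obtain ⟨y1, my1, hy1⟩ := h0 (a' - y0) (Submodule.sub_mem _ ma'
      (TL_mono (fun x hx => hx) (by omega) my0)) (by rw [map_sub, hy0, sub_self])
    obtain ⟨y2, my2, hy2⟩ := EJ k S' S' (fun x hx => hx) h.zero (k + 1) (y0 + D1')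
      (Submodule.add_mem _ (TL_mono h.sub le_rfl my0) mD')
      (by rw [map_add, hy0, hcyc', neg_add_cancel]) (Or.inl (by omega))
    refine ⟨y1 + y2 - ∑ w ∈ s, cs w (y w) + D2, ?_, ?_⟩
    · refine Submodule.add_mem _ (Submodule.sub_mem _ (Submodule.add_mem _
        (TL_mono h.sub le_rfl my1) (TL_mono (fun x hx => hx) (by omega) my2)) hX)
        (TL_mono (fun x hx => hx) (by omega) hD2)
    · rw [map_add, map_sub, map_add, hy1, hy2]
      have : a' - y0 + (y0 + D1') = a' + D1' := by abel
      rw [this, hsum]; abel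

theorem Ex_down (h : USet B v S0 S') (hv : v ∈ S0) (hvv : B v v = 0) {n : ℕ} (h0 : Ex B S' n) :
    Ex B S0 n := by
  intro z hz hdz
  obtain ⟨x, hx, hxz⟩ := h0 z (TL_mono h.sub le_rfl hz) hdz
  obtain ⟨a, ha, Θ, hΘ, D1, hD1, D2, hD2, rfl⟩ := RR_split (Red h hx)
  rw [Dep_eq] at hD1 hD2
  obtain ⟨s, f, hs, hf, hΘs, hrho⟩ := Th_struct h hΘ
  have hcyc : d (a + Θ + D1) = z := by
    rw [map_add, d_d, add_zero] at hxz; exact hxz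
  have hg : ∀ w ∈ s, d (f w + rho (pw B v w) D1) = 0 := by
    intro w hw
    have h1 := rho_d (f := pw B v w) (a + Θ + D1)
    rw [hcyc, rho_S0 h (hs w hw) hz, map_add (rho _), map_add (rho _), rho_S0 h (hs w hw) ha, hrho w hw,
      zero_add] at h1
    exact neg_eq_zero.1 h1.symm
  have mg : ∀ w ∈ s, f w + rho (pw B v w) D1 ∈ TL B (Lk B v w S0) n n := fun w hw =>
    Submodule.add_mem _ (hf w hw) (rho_Lk h (hs w hw) hD1)
  set D1' := D1 - ∑ w ∈ s, cs w (rho (pw B v w) D1) with hD1'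
  have mD' : D1' ∈ TL B S' (n + 1) n :=
    Submodule.sub_mem _ hD1 (Submodule.sum_mem _ (fun w hw => cs_rho h (hs w hw) hD1))
  have mX : ∑ w ∈ s, cs v (f w + rho (pw B v w) D1) ∈ TL B S0 (n + 1) (n + 1) := by
    refine Submodule.sum_mem _ (fun w hw => ?_)
    refine cs_mem (P := fun l => l ∈ TSet B (Lk B v w S0) n n)
      (Q := fun l => l ∈ TSet B S0 (n + 1) (n + 1)) ?_ (mg w hw)
    rintro l ⟨h1, h2, h3, h4⟩
    refine ⟨by simp [h1], ?_, Ok_cons h hvv h3 (fun y hy => (h2 y hy).2.1),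
      (rk_le_length _).trans (by simp [h1])⟩
    rw [List.forall_mem_cons]
    exact ⟨hv, fun y hy => (h2 y hy).1⟩
  have hdX : d (∑ w ∈ s, cs v (f w + rho (pw B v w) D1)) =
      ∑ w ∈ s, (f w + rho (pw B v w) D1) := by
    rw [map_sum]
    refine Finset.sum_congr rfl (fun w hw => ?_)
    rw [d_cs, hg w hw, map_zero, sub_zero]
  have hdX' : d (∑ w ∈ s, cs w (f w + rho (pw B v w) D1)) =
      ∑ w ∈ s, (f w + rho (pw B v w) D1) := by
    rw [map_sum]
    refine Finset.sum_congr rfl (fun w hw => ?_)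
    rw [d_cs, hg w hw, map_zero, sub_zero]
  have hsum : a + Θ + D1 = a + ∑ w ∈ s, cs w (f w + rho (pw B v w) D1) + D1' := by
    rw [hD1', hΘs]
    simp only [map_add, Finset.sum_add_distrib]; abel
  have hdD : d D1' = z - d a - d (∑ w ∈ s, cs v (f w + rho (pw B v w) D1)) := by
    rw [hdX, ← hcyc, hsum, map_add, map_add, hdX']; abel
  have mdD : d D1' ∈ TL B S0 n n := by
    have : d D1' ∈ TL B S0 n (n + 1) := by
      rw [hdD]
      exact Submodule.sub_mem _ (Submodule.sub_mem _ (TL_mono (fun x hx => hx) (by omega) hz)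
        (d_TL ha)) (d_TL mX)
    refine sup_mono ?_ this
    rintro l ⟨h1, h2, h3, h4⟩
    exact ⟨h1, h2, h3, (rk_le_length l).trans (by omega)⟩
  obtain ⟨y0, my0, hy0⟩ := EJ n S0 S' h.sub h.zero n (d D1') mdD (d_d _)
      (Or.inr ⟨rfl, D1', mD', rfl⟩)
  refine ⟨a + ∑ w ∈ s, cs v (f w + rho (pw B v w) D1) + y0, ?_, ?_⟩
  · exact Submodule.add_mem _ (Submodule.add_mem _ ha mX) (TL_mono (fun x hx => hx) (by omega) my0)
  · rw [map_add, map_add, hy0, hdD]; abel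

end Rho

end OStab

namespace OStab

section XA

set_option linter.unusedSectionVars false

variable {F V : Type} [Field F] [AddCommGroup V] [Module F V] [FiniteDimensional F V]
  {B : V →ₗ[F] V →ₗ[F] F}

/-- Nonzero isotropic vectors in `U`. -/
def IsoIn (B : V →ₗ[F] V →ₗ[F] F) (U : Submodule F V) : Set V := {x | x ∈ U ∧ x ≠ 0 ∧ B x x = 0}

/-- `U` contains an isotropic subspace of dimension at least `γ`. -/
def Genus (B : V →ₗ[F] V →ₗ[F] F) (U : Submodule F V) (γ : ℕ) : Prop :=
  ∃ W : Submodule F V, W ≤ U ∧ IsoSp B W ∧ γ ≤ Module.finrank F W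

/-- Orthogonal complement of a vector. -/
def pv (B : V →ₗ[F] V →ₗ[F] F) (w : V) : Submodule F V := LinearMap.ker (B w)

lemma mem_pv {w x : V} : x ∈ pv B w ↔ B w x = 0 := LinearMap.mem_ker

lemma finrank_inf_ker (W : Submodule F V) (φ : V →ₗ[F] F) :
    Module.finrank F W ≤ Module.finrank F (W ⊓ LinearMap.ker φ : Submodule F V) + 1 := by
  have h1 := Submodule.finrank_sup_add_finrank_inf_eq W (LinearMap.ker φ)
  have h2 := LinearMap.finrank_range_add_finrank_ker φ
  have h3 : Module.finrank F (LinearMap.range φ) ≤ 1 := by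
    simpa using Submodule.finrank_le (LinearMap.range φ)
  have h4 := Submodule.finrank_le (W ⊔ LinearMap.ker φ)
  omega

lemma Ex_cone (hs : ∀ x y, B x y = B y x) {S : Set V} {v : V} (hv : v ∈ S) (hvv : B v v = 0)
    (h : ∀ x ∈ S, B v x = 0) (n : ℕ) : Ex B S n := by
  intro z hz hd
  refine ⟨cs v z, ?_, by rw [d_cs, hd, map_zero, sub_zero]⟩
  refine cs_mem (P := fun l => l ∈ TSet B S n n)
      (Q := fun l => l ∈ TSet B S (n + 1) (n + 1)) ?_ hz
  rintro l ⟨h1, h2, h3, h4⟩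
  refine ⟨by simp [h1], ?_, ?_, (rk_le_length _).trans (by simp [h1])⟩
  · rw [List.forall_mem_cons]
    exact ⟨hv, h2⟩
  · intro a ha b hb
    rcases List.mem_cons.1 ha with k1 | k1
    · rcases List.mem_cons.1 hb with k2 | k2
      · rw [k1, k2]; exact hvv
      · rw [k1]; exact h b (h2 b k2)
    · rcases List.mem_cons.1 hb with k2 | k2
      · rw [k2, hs]; exact h a (h2 a k1)
      · exact h3 a k1 b k2

lemma iso_sub (hs : ∀ x y, B x y = B y x) {x w : V} (c : F) (hx : B x x = 0) (hw : B w w = 0)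
    (hwx : B w x = 0) : B (x - c • w) (x - c • w) = 0 := by
  have := hs x w
  simp [hx, hw, hwx, this]

theorem Ex_X (hs : ∀ x y, B x y = B y x) (γ : ℕ) : ∀ (U : Submodule F V), Genus B U γ →
    ∀ n, n < γ → Ex B (IsoIn B U) n := by
  induction γ with
  | zero => intro U _ n hn; omega
  | succ γ ih =>
    rintro U ⟨W, hWU, hW, hγ⟩ n hn
    obtain ⟨v, hv, hv0⟩ : ∃ v ∈ W, v ≠ 0 := by
      apply Submodule.exists_mem_ne_zero_of_ne_bot
      rintro rfl
      simp at hγ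
    have hvU : v ∈ IsoIn B U := ⟨hWU hv, hv0, hW v hv v hv⟩
    have hU : USet B v (IsoIn B U ∩ {x | B v x = 0}) (IsoIn B U) :=
      { symm := hs
        sub := fun x hx => hx.1
        zero := fun h => h.2.1 rfl
        sc0 := fun x hx c hc => ⟨⟨U.smul_mem _ hx.1.1, smul_ne_zero hc hx.1.2.1, by
          simp [hx.1.2.2]⟩, by have : B v x = 0 := hx.2; simp [this]⟩
        sc' := fun x hx c hc => ⟨U.smul_mem _ hx.1, smul_ne_zero hc hx.2.1, by simp [hx.2.2]⟩
        bv := fun w hw hw' h => hw' ⟨hw, h⟩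
        pi := by
          intro w hw hw' hvw x hx hwx
          by_cases h0 : x - B v x • w = 0
          · exact Or.inl h0
          · exact Or.inr ⟨⟨U.sub_mem hx.1 (U.smul_mem _ hw.1), h0,
              iso_sub hs _ hx.2.2 hw.2.2 hwx⟩, by simp [hvw]⟩ }
    refine Ex_up hU (fun w hw => hw.2.2) ?_ ?_
    · exact Ex_cone hs (v := v) (S := IsoIn B U ∩ {x | B v x = 0}) ⟨hvU, hvU.2.2⟩ hvU.2.2 (fun x hx => hx.2) n
    · intro w hw k hk
      have : Lk B v w (IsoIn B U ∩ {x | B v x = 0}) = IsoIn B (U ⊓ pv B v ⊓ pv B w) := by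
        ext y
        simp only [Lk, IsoIn, Set.mem_ofPred_eq, Set.mem_inter_iff, Submodule.mem_inf, mem_pv]
        tauto
      rw [this]
      refine ih _ ⟨W ⊓ pv B w, ?_, fun x hx y hy => hW x hx.1 y hy.1, ?_⟩ k (by omega)
      · exact fun x hx => ⟨⟨hWU hx.1, hW v hv x hx.1⟩, hx.2⟩
      · have := finrank_inf_ker W (B w)
        unfold pv
        omega

lemma genus_drop (hs : ∀ x y, B x y = B y x) {U : Submodule F V} {G : ℕ} (hG : Genus B U (G + 1))
    {b0 b : V} (hb0 : b0 ∈ U) (h0 : B b0 b0 = 0) (hb : B b b = 0) (hbb : B b0 b ≠ 0) :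
    Genus B (U ⊓ pv B b0 ⊓ pv B b) G := by
  obtain ⟨W, hWU, hW, hγ⟩ := hG
  by_cases hbW : b0 ∈ W
  · refine ⟨W ⊓ pv B b, fun x hx => ⟨⟨hWU hx.1, hW _ hbW x hx.1⟩, hx.2⟩,
      fun x hx y hy => hW x hx.1 y hy.1, ?_⟩
    have := finrank_inf_ker W (B b)
    unfold pv
    omega
  · let p : V →ₗ[F] V := LinearMap.id - ((B b0 b)⁻¹ • B b).smulRight b0
    have hp : ∀ x, p x = x - ((B b0 b)⁻¹ * B b x) • b0 := fun x => by simp [p]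
    let W1 := W ⊓ pv B b0
    refine ⟨W1.map p, ?_, ?_, ?_⟩
    · rintro _ ⟨x, hx, rfl⟩
      have hx1 : B b0 x = 0 := hx.2
      refine ⟨⟨?_, ?_⟩, ?_⟩
      · change p x ∈ U
        rw [hp]; exact U.sub_mem (hWU hx.1) (U.smul_mem _ hb0)
      · change p x ∈ pv B b0
        rw [mem_pv, hp]; simp [h0, hx1]
      · change p x ∈ pv B b
        have := hs b b0
        rw [mem_pv, hp]; simp [this]; field_simp; simp
    · rintro _ ⟨x, hx, rfl⟩ _ ⟨y, hy, rfl⟩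
      have hx1 : B b0 x = 0 := hx.2
      have hy1 : B b0 y = 0 := hy.2
      have hx2 : B x b0 = 0 := by rw [hs]; exact hx1
      rw [hp, hp]
      simp [h0, hy1, hx2, hW x hx.1 y hy.1]
    · have hinj : Function.Injective (p.domRestrict W1) := by
        rw [← LinearMap.ker_eq_bot, LinearMap.ker_eq_bot']
        rintro ⟨x, hx⟩ h
        have h' : x - ((B b0 b)⁻¹ * B b x) • b0 = 0 := by rw [← hp]; exact h
        have hxe := sub_eq_zero.1 h'
        by_cases hc : (B b0 b)⁻¹ * B b x = 0
        · rw [hc, zero_smul] at hxe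
          exact Subtype.ext hxe
        · exfalso
          apply hbW
          have : b0 = ((B b0 b)⁻¹ * B b x)⁻¹ • x := by
            nth_rewrite 2 [hxe]; rw [smul_smul, inv_mul_cancel₀ hc, one_smul]
          rw [this]
          exact W.smul_mem _ hx.1
      have h1 := LinearMap.finrank_range_of_inj hinj
      rw [LinearMap.range_domRestrict] at h1
      rw [h1]
      have := finrank_inf_ker W (B b0)
      change G ≤ Module.finrank F (W ⊓ LinearMap.ker (B b0) : Submodule F V)
      omega

lemma TSet_nn {S : Set V} {n : ℕ} {l : List V} : l ∈ TSet B S n n ↔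
    l.length = n ∧ (∀ x ∈ l, x ∈ S) ∧ Ok B l :=
  ⟨fun h => ⟨h.1, h.2.1, h.2.2.1⟩, fun h => ⟨h.1, h.2.1, h.2.2, (rk_le_length l).trans h.1.le⟩⟩

lemma mp_TL {S A : Set V} (f : V → V) (hf : ∀ x ∈ S, f x ∈ A)
    (hB : ∀ x ∈ S, ∀ y ∈ S, B x y = 0 → B (f x) (f y) = 0) {n : ℕ} {z : Z (List V)}
    (hz : z ∈ TL B S n n) : mp (List.map f) z ∈ TL B A n n := by
  refine mp_mem (fun l hl => ?_) hz
  rw [TSet_nn] at hl ⊢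
  obtain ⟨h1, h2, h3⟩ := hl
  refine ⟨by simp [h1], ?_, ?_⟩
  · intro x hx
    obtain ⟨a, ha, rfl⟩ := List.mem_map.1 hx
    exact hf a (h2 a ha)
  · intro x hx y hy
    obtain ⟨a, ha, rfl⟩ := List.mem_map.1 hx
    obtain ⟨b, hb, rfl⟩ := List.mem_map.1 hy
    exact hB a (h2 a ha) b (h2 b hb) (h3 a ha b hb)

lemma Ret1 {S A : Set V} (f : V → V) (hAS : A ⊆ S) (hf : ∀ x ∈ S, f x ∈ A) (hA : ∀ x ∈ A, f x = x)
    (hB : ∀ x ∈ S, ∀ y ∈ S, B x y = 0 → B (f x) (f y) = 0) {n : ℕ} (h : Ex B S n) : Ex B A n := by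
  intro z hz hd
  obtain ⟨y, hy, hyz⟩ := h z (TL_mono hAS le_rfl hz) hd
  refine ⟨mp (List.map f) y, mp_TL f hf hB hy, ?_⟩
  rw [d_map, hyz]
  refine (eq_on_sup (φ := mp (List.map f)) (ψ := LinearMap.id) (fun l hl => ?_) hz).trans rfl
  rw [mp_e]
  have : l.map f = l := by
    conv_rhs => rw [← List.map_id l]
    exact List.map_congr_left (fun x hx => hA x (hl.2.1 x hx))
  rw [this]; rfl

lemma Ret2 (hs : ∀ x y, B x y = B y x) {S A : Set V} (f : V → V) (hAS : A ⊆ S)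
    (hf : ∀ x ∈ S, f x ∈ A)
    (hB : ∀ x ∈ S, ∀ y ∈ S, B x y = 0 → B (f x) (f y) = 0 ∧ B (f x) y = 0) {n : ℕ}
    (h : Ex B A n) : Ex B S n := by
  intro z hz hd
  have h1 := pr_homotopy f z
  rw [hd, map_zero, add_zero] at h1
  obtain ⟨y, hy, hyz⟩ := h _ (mp_TL f hf (fun x hx y hy h => (hB x hx y hy h).1) hz)
    (by rw [d_map, hd, map_zero])
  refine ⟨y - pr f z, Submodule.sub_mem _ (TL_mono hAS le_rfl hy) ?_, by rw [map_sub, h1, hyz]; abel⟩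
  refine map_mem (pr f) (fun l hl => sup_mono (fun l' hl' => ?_) (pr_e_mem f l)) hz
  obtain ⟨k1, k2, k3⟩ := TSet_nn.1 hl
  obtain ⟨m1, m2, -⟩ := hl'
  rw [TSet_nn]
  refine ⟨by omega, ?_, ?_⟩
  · intro x hx
    rcases m2 x hx with h | ⟨a, ha, rfl⟩
    · exact k2 x h
    · exact hAS (hf a (k2 a ha))
  · intro x hx y hy
    rcases m2 x hx with hx | ⟨a, ha, rfl⟩ <;> rcases m2 y hy with hy | ⟨b, hb, rfl⟩
    · exact k3 x hx y hy
    · rw [hs]; exact (hB b (k2 b hb) x (k2 x hx) (k3 b hb x hx)).2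
    · exact (hB a (k2 a ha) y (k2 y hy) (k3 a ha y hy)).2
    · exact (hB a (k2 a ha) b (k2 b hb) (k3 a ha b hb)).1

/-- Nondegeneracy on a subspace. -/
def ND (B : V →ₗ[F] V →ₗ[F] F) (U : Submodule F V) : Prop :=
  ∀ x ∈ U, (∀ y ∈ U, B x y = 0) → x = 0

lemma ND.rep {U : Submodule F V} (h : ND B U) (φ : V →ₗ[F] F) :
    ∃ u ∈ U, ∀ y ∈ U, B u y = φ y := by
  let f : U →ₗ[F] Module.Dual F U := (B.compl₁₂ U.subtype U.subtype)
  have hf : ∀ x y : U, f x y = B x y := fun x y => rfl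
  have hinj : Function.Injective f := by
    rw [← LinearMap.ker_eq_bot, LinearMap.ker_eq_bot']
    rintro ⟨x, hx⟩ h0
    refine Subtype.ext (h x hx (fun y hy => ?_))
    have := congrArg (fun g => g ⟨y, hy⟩) h0
    simpa [hf] using this
  have hsur := (LinearMap.injective_iff_surjective_of_finrank_eq_finrank
    (Subspace.dual_finrank_eq (K := F) (V := U)).symm).1 hinj
  obtain ⟨u, hu⟩ := hsur (φ.comp U.subtype)
  refine ⟨u, u.2, fun y hy => ?_⟩
  have := congrArg (fun g => g ⟨y, hy⟩) hu
  simpa [hf] using this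

lemma ND.dual (hs : ∀ x y, B x y = B y x) (h2 : (2 : F) ≠ 0) {U : Submodule F V} (h : ND B U)
    (φ : V →ₗ[F] F) {p : V} (hp : p ∈ U) (hpp : B p p = 0) (hφ : φ p = 1) :
    ∃ u ∈ U, B u u = 0 ∧ ∀ y ∈ U, B p y = 0 → B u y = φ y := by
  obtain ⟨u, hu, hr⟩ := h.rep φ
  have h1 : B u p = 1 := by rw [hr p hp, hφ]
  have h1' : B p u = 1 := by rw [hs, h1]
  refine ⟨u - (B u u / 2) • p, U.sub_mem hu (U.smul_mem _ hp), ?_, ?_⟩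
  · simp [h1, h1', hpp]; field_simp; ring
  · intro y hy hpy
    simp [hpy, hr y hy]

lemma ND.drop (hs : ∀ x y, B x y = B y x) {U : Submodule F V} (h : ND B U) {w w' : V}
    (hw : w ∈ U) (hw' : w' ∈ U) (h1 : B w w = 0) (h2 : B w' w' = 0) (h3 : B w w' = 1) :
    ND B (U ⊓ pv B w ⊓ pv B w') := by
  rintro x ⟨⟨hxU, hxw⟩, hxw'⟩ hx
  have hxw1 : B w x = 0 := hxw
  have hxw2 : B w' x = 0 := hxw'
  refine h x hxU (fun y hy => ?_)
  have h3' : B w' w = 1 := by rw [hs, h3]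
  have := hx (y - B w' y • w - B w y • w') ⟨⟨?_, ?_⟩, ?_⟩
  · rw [hs w x] at hxw1
    rw [hs w' x] at hxw2
    simpa [hxw1, hxw2] using this
  · exact U.sub_mem (U.sub_mem hy (U.smul_mem _ hw)) (U.smul_mem _ hw')
  · exact mem_pv.2 (by simp [h1, h3])
  · exact mem_pv.2 (by simp [h2, h3'])

/-- Points opposite to `e0`, together with isotropic vectors in `D`. -/
def SD (B : V →ₗ[F] V →ₗ[F] F) (U : Submodule F V) (p : V) (D : Submodule F V) : Set V :=
  {b | b ∈ U ∧ B b b = 0 ∧ B p b ≠ 0} ∪ IsoIn B D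

section A

variable (hs : ∀ x y, B x y = B y x) (h2 : (2 : F) ≠ 0) {U : Submodule F V} (hU : ND B U)
  {p : V} (hp : p ∈ U) (hpp : B p p = 0) (hp0 : p ≠ 0)

include hs in
lemma SD_top {b0 : V} (hb0 : b0 ∈ U) (hb00 : B b0 b0 = 0) (hpb0 : B p b0 = 1)
    {G : ℕ} (hG : Genus B U G) {n : ℕ} (hn : n < G) :
    Ex B (SD B U p (U ⊓ pv B p ⊓ pv B b0)) n := by
  obtain ⟨G, rfl⟩ : ∃ G', G = G' + 1 := ⟨G - 1, by omega⟩
  have key : ∀ y, y ∈ SD B U p (U ⊓ pv B p ⊓ pv B b0) → y ∈ IsoIn B U := by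
    rintro y (⟨h1, h2, h3⟩ | ⟨⟨⟨h1, -⟩, -⟩, h3, h4⟩)
    · exact ⟨h1, by rintro rfl; simp at h3, h2⟩
    · exact ⟨h1, h3, h4⟩
  have key2 : ∀ y, y ∈ IsoIn B U → B b0 y = 0 → y ∈ SD B U p (U ⊓ pv B p ⊓ pv B b0) := by
    rintro y ⟨h1, h2, h3⟩ h4
    by_cases h : B p y = 0
    · exact Or.inr ⟨⟨⟨h1, h⟩, h4⟩, h2, h3⟩
    · exact Or.inl ⟨h1, h3, h⟩
  have hsc : ∀ x ∈ SD B U p (U ⊓ pv B p ⊓ pv B b0), ∀ c : F, c ≠ 0 →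
      c • x ∈ SD B U p (U ⊓ pv B p ⊓ pv B b0) := by
    rintro x (⟨k1, k2, k3⟩ | ⟨k1, k2, k3⟩) c hc
    · exact Or.inl ⟨U.smul_mem _ k1, by simp [k2], by simp [hc, k3]⟩
    · exact Or.inr ⟨Submodule.smul_mem _ _ k1, smul_ne_zero hc k2, by simp [k3]⟩
  have hb0S : b0 ∈ SD B U p (U ⊓ pv B p ⊓ pv B b0) := Or.inl ⟨hb0, hb00, by simp [hpb0]⟩
  have hU : USet B b0 (SD B U p (U ⊓ pv B p ⊓ pv B b0) ∩ {x | B b0 x = 0})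
      (SD B U p (U ⊓ pv B p ⊓ pv B b0)) :=
    { symm := hs
      sub := fun x hx => hx.1
      zero := fun h => (key _ h).2.1 rfl
      sc0 := fun x hx c hc => ⟨hsc x hx.1 c hc, by have : B b0 x = 0 := hx.2; simp [this]⟩
      sc' := hsc
      bv := fun w hw hw' h => hw' ⟨hw, h⟩
      pi := by
        intro w hw hw' hvw x hx hwx
        by_cases h0 : x - B b0 x • w = 0
        · exact Or.inl h0
        · have h1 : B b0 (x - B b0 x • w) = 0 := by simp [hvw]
          have kx := key x hx
          have kw := key w hw
          exact Or.inr ⟨key2 _ ⟨U.sub_mem kx.1 (U.smul_mem _ kw.1), h0,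
              iso_sub hs _ kx.2.2 kw.2.2 hwx⟩ h1, h1⟩ }
  refine Ex_up hU (fun w hw => (key w hw).2.2) ?_ ?_
  · exact Ex_cone hs (v := b0) (S := SD B U p (U ⊓ pv B p ⊓ pv B b0) ∩ {x | B b0 x = 0}) ⟨hb0S, hb00⟩ hb00 (fun x hx => hx.2) n
  · intro w hw k hk
    have kw := key w hw.1
    have : Lk B b0 w (SD B U p (U ⊓ pv B p ⊓ pv B b0) ∩ {x | B b0 x = 0}) =
        IsoIn B (U ⊓ pv B b0 ⊓ pv B w) := by
      ext y
      constructor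
      · rintro ⟨⟨h1, h2⟩, -, h3⟩
        have := key y h1
        exact ⟨⟨⟨this.1, h2⟩, h3⟩, this.2⟩
      · rintro ⟨⟨⟨k1, k2⟩, k3⟩, k4⟩
        exact ⟨⟨key2 y ⟨k1, k4⟩ k2, k2⟩, k2, k3⟩
    rw [this]
    exact Ex_X hs G _ (genus_drop hs hG hb0 hb00 kw.2.2 (by rw [hw.2.2]; exact one_ne_zero)) k
      (by omega)

include hs h2 hU hp hpp in
lemma SD_down {b0 : V} (hpb0 : B p b0 = 1) {n : ℕ}
    (hE : Ex B (SD B U p (U ⊓ pv B p ⊓ pv B b0)) n) (k : ℕ) :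
    ∀ D : Submodule F V, D ≤ U ⊓ pv B p ⊓ pv B b0 →
      Module.finrank F (U ⊓ pv B p ⊓ pv B b0 : Submodule F V) ≤ Module.finrank F D + k →
      Ex B (SD B U p D) n := by
  induction k with
  | zero =>
    intro D hD hk
    rw [Submodule.eq_of_le_of_finrank_le hD hk]; exact hE
  | succ k ih =>
    intro D hD hk
    by_cases hDE : D = U ⊓ pv B p ⊓ pv B b0
    · rw [hDE]; exact hE
    obtain ⟨w0, hw0, hw0D⟩ := SetLike.exists_of_lt (lt_of_le_of_ne hD hDE)
    have hD' : D ⊔ F ∙ w0 ≤ U ⊓ pv B p ⊓ pv B b0 :=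
      _root_.sup_le hD ((Submodule.span_singleton_le_iff_mem _ _).2 hw0)
    have hb0p : B b0 p = 1 := by rw [hs, hpb0]
    have hnot : w0 ∉ D ⊔ F ∙ (p - w0) := by
      intro hmem
      obtain ⟨y, hy, z, hz, hyz⟩ := Submodule.mem_sup.1 hmem
      obtain ⟨c, rfl⟩ := Submodule.mem_span_singleton.1 hz
      have e1 : B b0 w0 = 0 := hw0.2
      have e2 : B b0 y = 0 := (hD hy).2
      have e3 := congrArg (B b0) hyz
      simp [e1, e2, hb0p] at e3
      rw [e3, zero_smul, add_zero] at hyz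
      exact hw0D (hyz ▸ hy)
    obtain ⟨φ0, hφ0, hker⟩ := Submodule.exists_le_ker_of_notMem hnot
    let φ := (φ0 w0)⁻¹ • φ0
    have f1 : φ w0 = 1 := by simp [φ, hφ0]
    have f2 : ∀ y ∈ D, φ y = 0 := fun y hy => by
      have : φ0 y = 0 := hker (Submodule.mem_sup_left hy)
      simp [φ, this]
    have f3 : φ p = 1 := by
      have : φ0 (p - w0) = 0 := hker (Submodule.mem_sup_right (Submodule.mem_span_singleton_self _))
      have h3 : φ (p - w0) = 0 := by simp only [φ, LinearMap.smul_apply, this, smul_zero]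
      rw [map_sub, f1, sub_eq_zero] at h3
      exact h3
    obtain ⟨b, hbU, hbb, hb⟩ := hU.dual hs h2 φ hp hpp f3
    have b1 : B b p = 1 := by rw [hb p hp hpp, f3]
    have b1' : B p b = 1 := by rw [hs, b1]
    have b2 : ∀ y ∈ D, B b y = 0 := fun y hy => by
      rw [hb y (hD hy).1.1 (hD hy).1.2, f2 y hy]
    have b3 : B b w0 = 1 := by rw [hb w0 hw0.1.1 hw0.1.2, f1]
    have hdec : ∀ x ∈ D ⊔ F ∙ w0, x - B b x • w0 ∈ D := by
      intro x hx
      obtain ⟨y, hy, z, hz, rfl⟩ := Submodule.mem_sup.1 hx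
      obtain ⟨c, rfl⟩ := Submodule.mem_span_singleton.1 hz
      simpa [b2 y hy, b3] using hy
    have hsc : ∀ D : Submodule F V, ∀ x ∈ SD B U p D, ∀ c : F, c ≠ 0 → c • x ∈ SD B U p D := by
      rintro D x (⟨k1, k2, k3⟩ | ⟨k1, k2, k3⟩) c hc
      · exact Or.inl ⟨U.smul_mem _ k1, by simp [k2], by simp [hc, k3]⟩
      · exact Or.inr ⟨Submodule.smul_mem _ _ k1, smul_ne_zero hc k2, by simp [k3]⟩
    have hfr : Module.finrank F (U ⊓ pv B p ⊓ pv B b0 : Submodule F V) ≤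
        Module.finrank F (D ⊔ F ∙ w0 : Submodule F V) + k := by
      have : D < D ⊔ F ∙ w0 := lt_of_le_of_ne le_sup_left (fun h => hw0D (by
        rw [h]; exact Submodule.mem_sup_right (Submodule.mem_span_singleton_self _)))
      have := Submodule.finrank_lt_finrank_of_lt this
      omega
    refine Ex_down (v := b) ?_ (Or.inl ⟨hbU, hbb, by simp [b1']⟩) hbb (ih _ hD' hfr)
    have hnew : ∀ w ∈ SD B U p (D ⊔ F ∙ w0), w ∉ SD B U p D → w ∈ IsoIn B (D ⊔ F ∙ w0) := by
      rintro w (h | h) hw'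
      · exact absurd (Or.inl h) hw'
      · exact h
    exact
    { symm := hs
      sub := by
        rintro x (h | ⟨h1, h2⟩)
        · exact Or.inl h
        · exact Or.inr ⟨Submodule.mem_sup_left h1, h2⟩
      zero := by
        rintro (⟨-, -, h⟩ | ⟨-, h, -⟩)
        · simp at h
        · exact h rfl
      sc0 := hsc D
      sc' := hsc _
      bv := by
        intro w hw hw' h0
        obtain ⟨k1, k2, k3⟩ := hnew w hw hw'
        have := hdec w k1
        rw [h0, zero_smul, sub_zero] at this
        exact hw' (Or.inr ⟨this, k2, k3⟩)
      pi := by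
        intro w hw hw' hvw x hx hwx
        obtain ⟨k1, k2, k3⟩ := hnew w hw hw'
        have kE := hD' k1
        have kpw : B p w = 0 := kE.1.2
        by_cases h0 : x - B b x • w = 0
        · exact Or.inl h0
        · right
          rcases hx with ⟨m1, m2, m3⟩ | ⟨m1, m2, m3⟩
          · exact Or.inl ⟨U.sub_mem m1 (U.smul_mem _ kE.1.1), iso_sub hs _ m2 k3 hwx, by
              simpa [kpw] using m3⟩
          · refine Or.inr ⟨?_, h0, iso_sub hs _ m3 k3 hwx⟩
            have q1 := hdec x m1
            have q2 := hdec w k1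
            rw [hvw, one_smul] at q2
            have : x - B b x • w = (x - B b x • w0) - B b x • (w - w0) := by
              rw [smul_sub]; abel
            rw [this]
            exact D.sub_mem q1 (D.smul_mem _ q2) }

/-- The set of points. -/
def Pts (B : V →ₗ[F] V →ₗ[F] F) (U : Submodule F V) (p : V) (ws : List V) : Set V :=
  {b | b ∈ U ∧ B b b = 0 ∧ B p b = 1 ∧ ∀ w ∈ ws, B w b = 0}

include hs h2 hU hp hpp hp0 in
lemma Ex_A0 {G : ℕ} (hG : Genus B U G) {n : ℕ} (hn : n < G) : Ex B (Pts B U p []) n := by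
  have hnot : p ∉ (⊥ : Submodule F V) := by simpa using hp0
  obtain ⟨φ0, hφ0, -⟩ := Submodule.exists_le_ker_of_notMem hnot
  obtain ⟨b0, hb0, hb00, hb⟩ := hU.dual hs h2 ((φ0 p)⁻¹ • φ0) hp hpp (by simp [hφ0])
  have hpb0 : B p b0 = 1 := by
    rw [hs, hb p hp hpp]; simp [hφ0]
  have h1 := SD_down hs h2 hU hp hpp hpb0 (SD_top hs hb0 hb00 hpb0 hG hn) _ ⊥ bot_le
    (Nat.le_add_left _ _)
  refine Ret1 (fun b => (B p b)⁻¹ • b) ?_ ?_ ?_ ?_ h1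
  · rintro b ⟨k1, k2, k3, -⟩
    exact Or.inl ⟨k1, k2, by simp [k3]⟩
  · rintro b (⟨k1, k2, k3⟩ | ⟨k1, k2, k3⟩)
    · exact ⟨U.smul_mem _ k1, by simp [k2], by simp [k3], by simp⟩
    · exact absurd ((Submodule.mem_bot F).1 k1) k2
  · rintro b ⟨k1, k2, k3, -⟩
    simp [k3]
  · intro x _ y _ hxy
    simp [hxy]

end A

/-- Linear independence of a list. -/
def Ind (F : Type) {V : Type} [Field F] [AddCommGroup V] [Module F V] (t : List V) : Prop :=
  rk F t = t.length

lemma Ind.tail {x : V} {l : List V} (h : Ind F (x :: l)) : Ind F l := by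
  have h1 := rk_cons_le (F := F) x l
  have h2 := rk_le_length (F := F) l
  unfold Ind at *
  simp at h
  omega

lemma Ind.notMem {x : V} {l : List V} (h : Ind F (x :: l)) : x ∉ sp F l := by
  intro hx
  have := rk_lt (F := F) (t := x :: l) l (by
    rw [List.forall_mem_cons]; exact ⟨hx, fun y hy => mem_sp hy⟩) (by simp)
  unfold Ind at h
  omega

lemma Ind.congr {l l' : List V} (h : Ind F l) (hl : l.length = l'.length) (hm : ∀ x ∈ l, x ∈ sp F l') :
    Ind F l' := by
  have h1 := rk_le (F := F) hm
  have h2 := rk_le_length (F := F) l'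
  unfold Ind rk at *
  omega

lemma Ind.swap {x y : V} {l : List V} (h : Ind F (x :: y :: l)) : Ind F (y :: x :: l) :=
  h.congr rfl (fun z hz => mem_sp (by simp at hz ⊢; tauto))

theorem Ex_A (hs : ∀ x y, B x y = B y x) (h2 : (2 : F) ≠ 0) (ws : List V) :
    ∀ {U : Submodule F V}, ND B U → ∀ {p : V}, (∀ x ∈ p :: ws, x ∈ U) → Ok B (p :: ws) →
    Ind F (p :: ws) →
    ∀ {G n : ℕ}, Genus B U (G + ws.length) → n < G → Ex B (Pts B U p ws) n := by
  induction ws with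
  | nil =>
    intro U hU p hp hO hli G n hG hn
    exact Ex_A0 hs h2 hU (hp p (by simp)) (hO p (by simp) p (by simp)) (by
      rintro rfl; exact hli.notMem (zero_mem _)) hG hn
  | cons w ws ih =>
    intro U hU p hp hO hli G n hG hn
    have hnot : w ∉ sp F (p :: ws) := hli.swap.notMem
    obtain ⟨φ0, hφ0, hker⟩ := Submodule.exists_le_ker_of_notMem hnot
    have hwU : w ∈ U := hp w (by simp)
    have hww : B w w = 0 := hO w (by simp) w (by simp)
    obtain ⟨w', hw', hw'w', hr⟩ := hU.dual hs h2 ((φ0 w)⁻¹ • φ0) hwU hww (by simp [hφ0])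
    have hw'w : B w' w = 1 := by rw [hr w hwU hww]; simp [hφ0]
    have hww' : B w w' = 1 := by rw [hs, hw'w]
    have hort : ∀ x ∈ p :: ws, B w' x = 0 := by
      intro x hx
      have hx' : x ∈ p :: w :: ws := by
        rcases List.mem_cons.1 hx with rfl | hx <;> simp [*]
      rw [hr x (hp x hx') (hO w (by simp) x hx')]
      have : φ0 x = 0 := hker (Submodule.subset_span hx)
      simp [this]
    have hpw : B p w = 0 := hO p (by simp) w (by simp)
    have hEx := ih (hU.drop hs hwU hw' hww hw'w' hww') (p := p) (G := G) (n := n) ?_ ?_ ?_ ?_ hn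
    · refine Ret2 hs (fun b => b - B w' b • w) ?_ ?_ ?_ hEx
      · rintro b ⟨⟨⟨k1, k1'⟩, k1''⟩, k2, k3, k4⟩
        refine ⟨k1, k2, k3, ?_⟩
        rw [List.forall_mem_cons]
        exact ⟨k1', k4⟩
      · rintro b ⟨k1, k2, k3, k4⟩
        rw [List.forall_mem_cons] at k4
        refine ⟨⟨⟨U.sub_mem k1 (U.smul_mem _ hwU), ?_⟩, ?_⟩, iso_sub hs _ k2 hww k4.1, ?_, ?_⟩
        · exact mem_pv.2 (by simp [k4.1, hww])
        · exact mem_pv.2 (by simp [hw'w])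
        · simp [k3, hpw]
        · intro x hx
          simp [k4.2 x hx, hO x (by simp [hx]) w (by simp)]
      · rintro x ⟨-, -, -, kx⟩ y ⟨-, -, -, ky⟩ hxy
        have e1 := kx w (by simp)
        have e2 := ky w (by simp)
        have e3 : B x w = 0 := by rw [hs]; exact e1
        simp [hxy, e3, e2, hww]
    · intro x hx
      have hx' : x ∈ p :: w :: ws := by
        rcases List.mem_cons.1 hx with rfl | hx <;> simp [*]
      exact ⟨⟨hp x hx', hO w (by simp) x hx'⟩, hort x hx⟩
    · refine Ok_sub hO (fun x hx => ?_)
      rcases List.mem_cons.1 hx with rfl | hx <;> simp [*]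
    · exact hli.swap.tail
    · have hG' : Genus B U (G + ws.length + 1) := by simpa [add_assoc] using hG
      have := genus_drop hs hG' hwU hww hw'w' (by rw [hww']; exact one_ne_zero)
      exact this

end XA

end OStab

namespace OStab

section Generic

set_option linter.unusedSectionVars false

variable {G : Type} [Group G] {H Y Y' : Type} [MulAction G H] [MulAction G Y] [MulAction G Y']

/-- Bounding chains. -/
def Bdy (G : Type) [Group G] {H Y : Type} [MulAction G H] [MulAction G Y]
    (A : Set (Option H × Y)) (q : ℕ) (z : CC G H Y) : Prop :=
  ∃ w ∈ Ch G A (q + 1), D w = z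

/-- Vanishing of homology. -/
def Van (G : Type) [Group G] {H Y : Type} [MulAction G H] [MulAction G Y]
    (A : Set (Option H × Y)) (q : ℕ) : Prop :=
  ∀ z ∈ Ch G A q, D z = 0 → Bdy G A q z

lemma Bdy.zero {A : Set (Option H × Y)} {q : ℕ} : Bdy G A q 0 := ⟨0, zero_mem _, map_zero _⟩

lemma Bdy.add {A : Set (Option H × Y)} {q : ℕ} {z z' : CC G H Y} (h : Bdy G A q z)
    (h' : Bdy G A q z') : Bdy G A q (z + z') := by
  obtain ⟨w, hw, rfl⟩ := h
  obtain ⟨w', hw', rfl⟩ := h'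
  exact ⟨w + w', add_mem hw hw', map_add _ _ _⟩

lemma Bdy.neg {A : Set (Option H × Y)} {q : ℕ} {z : CC G H Y} (h : Bdy G A q z) :
    Bdy G A q (-z) := by
  obtain ⟨w, hw, rfl⟩ := h
  exact ⟨-w, Submodule.neg_mem _ hw, map_neg _ _⟩

lemma Bdy.sub {A : Set (Option H × Y)} {q : ℕ} {z z' : CC G H Y} (h : Bdy G A q z)
    (h' : Bdy G A q z') : Bdy G A q (z - z') := by
  rw [sub_eq_add_neg]; exact h.add h'.neg

lemma Bdy.sum {A : Set (Option H × Y)} {q : ℕ} {ι : Type} (s : Finset ι) (f : ι → CC G H Y)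
    (h : ∀ i ∈ s, Bdy G A q (f i)) : Bdy G A q (∑ i ∈ s, f i) := by
  classical
  induction s using Finset.induction_on with
  | empty => simpa using Bdy.zero
  | insert a s ha ih =>
    rw [Finset.sum_insert ha]
    exact (h a (by simp)).add (ih (fun i hi => h i (by simp [hi])))

lemma Bdy.cycle {A : Set (Option H × Y)} {q : ℕ} {z : CC G H Y} (h : Bdy G A q z) : D z = 0 := by
  obtain ⟨w, -, rfl⟩ := h; exact D_D w

/-- Equivariant functions. -/
def EF (G : Type) [Group G] {Y Y' : Type} [MulAction G Y] [MulAction G Y'] (f : Y → Y') : Prop :=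
  ∀ (g : G) (y : Y), f (g • y) = g • f y

/-- Pushforward by a function. -/
noncomputable abbrev TF (f : Y → Y') : CC G H Y →ₗ[ℤ] CC G H Y' := TY (fun y => e (f y))

lemma EF.eqv {f : Y → Y'} (h : EF G f) : Eqv G (fun y => e (f y)) := by
  intro g y; simp only [h g y, mp_e]

lemma TF_e (f : Y → Y') (o : Option H) (y : Y) (l : List G) :
    TF f (e ((o, y), l)) = e ((o, f y), l) := by rw [TF, TY_e, mp_e]

lemma TF_TF {Y'' : Type} [MulAction G Y''] (f : Y → Y') (f' : Y' → Y'') (z : CC G H Y) :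
    TF f' (TF f z) = TF (fun y => f' (f y)) z := by
  rw [TF, TF, TY_TY]; apply TY_congr; intro y; simp

lemma D_TF {f : Y → Y'} (h : EF G f) (z : CC G H Y) : D (TF f z) = TF f (D z) := D_TY h.eqv z

lemma TF_Ch {f : Y → Y'} {A : Set (Option H × Y)} {A' : Set (Option H × Y')}
    (h : ∀ o y, (o, y) ∈ A → (o, f y) ∈ A') {q : ℕ}
    {z : CC G H Y} (hz : z ∈ Ch G A q) : TF f z ∈ Ch G A' q :=
  TY_Ch (fun o y hy => e_mem (s := {y' | (o, y') ∈ A'}) (h o y hy)) hz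

lemma Bdy.map {f : Y → Y'} (hf : EF G f) {A : Set (Option H × Y)} {A' : Set (Option H × Y')}
    (h : ∀ o y, (o, y) ∈ A → (o, f y) ∈ A') {q : ℕ}
    {z : CC G H Y} (hz : Bdy G A q z) : Bdy G A' q (TF f z) := by
  obtain ⟨w, hw, rfl⟩ := hz
  exact ⟨TF f w, TF_Ch h hw, D_TF hf w⟩

lemma TF_eq_self {f : Y → Y} {A : Set (Option H × Y)} (h : ∀ o y, (o, y) ∈ A → f y = y) {q : ℕ}
    {z : CC G H Y} (hz : z ∈ Ch G A q) : TF f z = z := by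
  conv_rhs => rw [← TY_id z]
  exact TY_eq_on (fun o y hy => by rw [h o y hy]) hz

open Classical in
/-- Restriction to a set of base points. -/
noncomputable def rs (P : Y → Prop) : CC G H Y →ₗ[ℤ] CC G H Y :=
  TY (fun y => if P y then e y else 0)

lemma rs_eqv {P : Y → Prop} (hP : ∀ (g : G) y, P (g • y) ↔ P y) :
    Eqv G (fun y => open Classical in if P y then e y else 0) := by
  intro g y
  by_cases h : P y <;> simp [hP, h]

lemma D_rs {P : Y → Prop} (hP : ∀ (g : G) y, P (g • y) ↔ P y) (z : CC G H Y) :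
    D (rs P z) = rs P (D z) := D_TY (rs_eqv hP) z

lemma rs_Ch {P : Y → Prop} {A : Set (Option H × Y)} {q : ℕ} {z : CC G H Y} (hz : z ∈ Ch G A q) :
    rs P z ∈ Ch G {x | x ∈ A ∧ P x.2} q := by
  classical
  refine TY_Ch (fun o y hy => ?_) hz
  by_cases h : P y
  · simp only [h, if_true]; exact e_mem (s := {y' | (o, y') ∈ {x : Option H × Y | x ∈ A ∧ P x.2}}) ⟨hy, h⟩
  · simp [h]

lemma rs_add_not (P : Y → Prop) (z : CC G H Y) : rs P z + rs (fun y => ¬ P y) z = z := by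
  classical
  rw [rs, rs, ← TY_add]
  conv_rhs => rw [← TY_id z]
  apply TY_congr
  intro y
  by_cases h : P y <;> simp [h]

lemma rs_e (P : Y → Prop) (o : Option H) (y : Y) (l : List G) (h : P y) :
    rs P (e ((o, y), l)) = e ((o, y), l) := by
  classical
  rw [rs, TY_e]; simp [h]

lemma rs_e_not (P : Y → Prop) (o : Option H) (y : Y) (l : List G) (h : ¬ P y) :
    rs P (e ((o, y), l)) = 0 := by
  classical
  rw [rs, TY_e]; simp [h]

lemma sum_rs {ι : Type} (lab : Y → ι) (z : CC G H Y) :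
    ∃ s : Finset ι, z = ∑ i ∈ s, rs (fun y => lab y = i) z := by
  classical
  refine ⟨z.support.image (fun c => lab c.1.2), ?_⟩
  conv_lhs => rw [sum_res_fiber (fun c : (Option H × Y) × List G => lab c.1.2) z]
  refine Finset.sum_congr rfl (fun i _ => ?_)
  have : res {c : (Option H × Y) × List G | lab c.1.2 = i} = rs (fun y => lab y = i) := hom_ext (by
    rintro ⟨⟨o, y⟩, l⟩
    by_cases h : lab y = i
    · rw [rs_e (fun y => lab y = i) o y l h, res_e_of]; exact h
    · rw [rs_e_not (fun y => lab y = i) o y l h, res_e_not]; exact h)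
  rw [this]

/-- Vanishing by decomposing according to invariant labels. -/
lemma LabVan {ι : Type} {A A' : Set (Option H × Y)} {Y'' : Type} [MulAction G Y'']
    (P : ι → Y → Prop) (hP : ∀ i (g : G) y, P i (g • y) ↔ P i y)
    (A2 : ι → Set (Option H × Y'')) (β : ι → Y → Y'') (κ : ι → Y'' → Y)
    (hβ : ∀ i, EF G (β i)) (hκ : ∀ i, EF G (κ i))
    (hex : ∀ o y, (o, y) ∈ A → ∃ i, P i y)
    (hA : ∀ o y i, (o, y) ∈ A → P i y → (o, β i y) ∈ A2 i ∧ κ i (β i y) = y)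
    (hA' : ∀ i o y o' y', (o', y') ∈ A → P i y' → (o, y) ∈ A2 i → (o, κ i y) ∈ A')
    {q : ℕ} (hV : ∀ i o y, (o, y) ∈ A → P i y → Van G (A2 i) q)
    {z : CC G H Y} (hz : z ∈ Ch G A q) (hD : D z = 0) : Bdy G A' q z := by
  classical
  have hlab : ∃ lab : Y → Option ι, (∀ (g : G) y, lab (g • y) = lab y) ∧
      ∀ y, (∀ i, lab y = some i → P i y) ∧ (lab y = none → ¬ ∃ i, P i y) := by
    let c : (ι → Prop) → Option ι := fun p => if h : ∃ i, p i then some h.choose else none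
    refine ⟨fun y => c (fun i => P i y), ?_, ?_⟩
    · intro g y
      simp only [hP]
    · intro y
      by_cases h : ∃ i, P i y
      · have hc : c (fun i => P i y) = some h.choose := by simp only [c, h, dite_true]
        simp only [hc]
        refine ⟨?_, by simp⟩
        intro i hi
        have := Option.some.inj hi
        rw [← this]; exact h.choose_spec
      · have hc : c (fun i => P i y) = none := by simp only [c, h, dite_false]
        simp only [hc]
        exact ⟨by simp, fun _ => h⟩
  obtain ⟨lab, h1, h2⟩ := hlab
  obtain ⟨s, hs⟩ := sum_rs lab z
  rw [hs]
  refine Bdy.sum _ _ (fun oi _ => ?_)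
  have hz1 := rs_Ch (P := fun y => lab y = oi) hz
  have hD1 : D (rs (fun y => lab y = oi) z) = 0 := by
    rw [D_rs (by intro g y; rw [h1]), hD, map_zero]
  by_cases hne : ∃ x ∈ A, lab x.2 = oi
  · obtain ⟨⟨o, y⟩, hyA, hy⟩ := hne
    cases oi with
    | none => exact absurd (hex o y hyA) ((h2 y).2 hy)
    | some i =>
      have hPy := (h2 y).1 i hy
      have h3 : TF (κ i) (TF (β i) (rs (fun y => lab y = some i) z))
          = rs (fun y => lab y = some i) z := by
        rw [TF_TF]
        exact TF_eq_self (fun o y hy => (hA o y i hy.1 ((h2 y).1 i hy.2)).2) hz1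
      rw [← h3]
      apply Bdy.map (hκ i) (A := A2 i) (fun o' y' hy' => hA' i o' y' o y hyA hPy hy')
      apply hV i o y hyA hPy
      · exact TF_Ch (fun o y hy => (hA o y i hy.1 ((h2 y).1 i hy.2)).1) hz1
      · rw [D_TF (hβ i), hD1, map_zero]
  · have : rs (fun y => lab y = oi) z ∈ Ch G (∅ : Set (Option H × Y)) q :=
      Ch_mono (fun x hx => hne ⟨x, hx.1, hx.2⟩) q hz1
    have h0 : rs (fun y => lab y = oi) z = 0 := by
      have h := res_eq_zero (s := Set.univ) (t := CCell G (∅ : Set (Option H × Y)) q)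
        (by rintro a ⟨h, -⟩; exact absurd h (by simp)) this
      have h' := res_eq_self (sup_mono (Set.subset_univ _) this)
      rw [← h', h]
    rw [h0]; exact Bdy.zero

/-- Rowwise exactness. -/
lemma row_exact {K β τ : Type} (lab : K → β) (tt : K → τ) (mk : β → τ → K)
    (h1 : ∀ c, mk (lab c) (tt c) = c) (h2 : ∀ b t, lab (mk b t) = b) (h3 : ∀ b t, tt (mk b t) = t)
    (d0 : Z τ →ₗ[ℤ] Z τ) (dd : Z K →ₗ[ℤ] Z K)
    (hdd : ∀ c, dd (e c) = mp (mk (lab c)) (d0 (e (tt c))))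
    (C C' : Set K)
    (hex : ∀ b, ∀ z ∈ sup {t | mk b t ∈ C}, d0 z = 0 → ∃ y ∈ sup {t | mk b t ∈ C'}, d0 y = z)
    {z : Z K} (hz : z ∈ sup C) (hdz : dd z = 0) : ∃ y ∈ sup C', dd y = z := by
  classical
  let π : β → Z K →ₗ[ℤ] Z τ := fun b => L (fun c => if lab c = b then e (tt c) else 0)
  have hπ : ∀ b c, π b (e c) = if lab c = b then e (tt c) else 0 := fun b c => L_e _ _
  have hπmk : ∀ b b' (u : Z τ), π b (mp (mk b') u) = if b' = b then u else 0 := by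
    intro b b' u
    have : (π b).comp (mp (mk b')) = if b' = b then LinearMap.id else 0 := hom_ext (by
      intro t
      rw [LinearMap.comp_apply, mp_e, hπ, h2, h3]
      split <;> simp)
    have h := congrArg (fun φ => φ u) this
    simp only [LinearMap.comp_apply] at h
    rw [h]; split <;> simp
  have hcomm : ∀ b (z : Z K), d0 (π b z) = π b (dd z) := by
    intro b z
    have : d0.comp (π b) = (π b).comp dd := hom_ext (by
      intro c
      rw [LinearMap.comp_apply, LinearMap.comp_apply, hπ, hdd, hπmk]
      split <;> simp)
    exact congrArg (fun φ => φ z) this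
  have hπC : ∀ b, π b z ∈ sup {t | mk b t ∈ C} := by
    intro b
    refine map_mem _ (fun c hc => ?_) hz
    rw [hπ]
    split
    · next h =>
      apply e_mem
      show mk b (tt c) ∈ C
      rw [← h, h1]; exact hc
    · exact zero_mem _
  have hy : ∀ b, ∃ y ∈ sup {t | mk b t ∈ C'}, d0 y = π b z := fun b =>
    hex b _ (hπC b) (by rw [hcomm, hdz, map_zero])
  choose y hyC hyd using hy
  have hddmk : ∀ b (u : Z τ), dd (mp (mk b) u) = mp (mk b) (d0 u) := by
    intro b u
    have : dd.comp (mp (mk b)) = (mp (mk b)).comp d0 := hom_ext (by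
      intro t
      rw [LinearMap.comp_apply, LinearMap.comp_apply, mp_e, hdd, h2, h3])
    exact congrArg (fun φ => φ u) this
  refine ⟨∑ b ∈ z.support.image lab, mp (mk b) (y b), ?_, ?_⟩
  · refine Submodule.sum_mem _ (fun b _ => ?_)
    exact mp_mem (s := {t | mk b t ∈ C'}) (fun t (ht : mk b t ∈ C') => ht) (hyC b)
  · rw [map_sum]
    conv_rhs => rw [sum_res_fiber lab z]
    refine Finset.sum_congr rfl (fun b _ => ?_)
    rw [hddmk, hyd]
    have : (mp (mk b)).comp (π b) = res {c | lab c = b} := hom_ext (by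
      intro c
      rw [LinearMap.comp_apply, hπ]
      by_cases h : lab c = b
      · rw [res_e_of (s := {c | lab c = b}) h, if_pos h, mp_e, ← h, h1]
      · rw [res_e_not (s := {c | lab c = b}) h, if_neg h, map_zero])
    exact congrArg (fun φ => φ z) this

end Generic

end OStab

namespace OStab

section Frames

set_option linter.unusedSectionVars false

variable {F V : Type} [Field F] [AddCommGroup V] [Module F V] [FiniteDimensional F V]

/-- A group acting by isometries and containing all reflections. -/
structure IsoG (B : V →ₗ[F] V →ₗ[F] F) (G : Type) [Group G] [DistribMulAction G V] where
  inv : ∀ (g : G) x y, B (g • x) (g • y) = B x y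
  lin : ∀ (g : G) (c : F) (x : V), g • (c • x) = c • (g • x)
  R : V → G
  R_smul : ∀ v x, R v • x = x - (2 * B v x / B v v) • v
  R_conj : ∀ (k : G) v, R (k • v) = k * R v * k⁻¹
  R_neg : ∀ v, R (-v) = R v

/-- Orthogonal complement of a list of pairs. -/
def Up (B : V →ₗ[F] V →ₗ[F] F) : List (V × V) → Submodule F V
  | [] => ⊤
  | h :: hl => Up B hl ⊓ pv B h.1 ⊓ pv B h.2

/-- Hyperbolic frames. -/
def HF (B : V →ₗ[F] V →ₗ[F] F) : List (V × V) → Prop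
  | [] => True
  | h :: hl => B h.1 h.1 = 0 ∧ B h.2 h.2 = 0 ∧ B h.1 h.2 = 1 ∧ h.1 ∈ Up B hl ∧ h.2 ∈ Up B hl ∧ HF B hl

variable {B : V →ₗ[F] V →ₗ[F] F}

lemma mem_Up {hl : List (V × V)} {x : V} : x ∈ Up B hl ↔ ∀ h ∈ hl, B h.1 x = 0 ∧ B h.2 x = 0 := by
  induction hl with
  | nil => simp [Up]
  | cons h hl ih =>
    simp only [Up, Submodule.mem_inf, ih, mem_pv, List.forall_mem_cons]
    tauto

lemma Up_cons {h : V × V} {hl : List (V × V)} {x : V} :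
    x ∈ Up B (h :: hl) ↔ B h.1 x = 0 ∧ B h.2 x = 0 ∧ x ∈ Up B hl := by
  simp only [Up, Submodule.mem_inf, mem_pv]; tauto

lemma HF_ND (hs : ∀ x y, B x y = B y x) (hN : ND B (⊤ : Submodule F V)) {hl : List (V × V)}
    (h : HF B hl) : ND B (Up B hl) := by
  induction hl with
  | nil => exact hN
  | cons a hl ih =>
    obtain ⟨h1, h2, h3, h4, h5, h6⟩ := h
    exact (ih h6).drop hs h4 h5 h1 h2 h3

lemma Genus.mono {U : Submodule F V} {g g' : ℕ} (h : Genus B U g) (hg : g' ≤ g) : Genus B U g' := by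
  obtain ⟨W, h1, h2, h3⟩ := h
  exact ⟨W, h1, h2, hg.trans h3⟩

lemma HF_Genus (hs : ∀ x y, B x y = B y x) {g : ℕ} (hg : Genus B (⊤ : Submodule F V) g)
    {hl : List (V × V)} (h : HF B hl) : ∀ {γ : ℕ}, γ + hl.length ≤ g → Genus B (Up B hl) γ := by
  induction hl with
  | nil => intro γ hγ; exact hg.mono (by simpa using hγ)
  | cons a hl ih =>
    intro γ hγ
    obtain ⟨h1, h2, h3, h4, h5, h6⟩ := h
    simp only [List.length_cons] at hγ
    exact genus_drop hs (ih h6 (γ := γ + 1) (by omega)) h4 h1 h2 (by rw [h3]; exact one_ne_zero)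

lemma HF_swap (hs : ∀ x y, B x y = B y x) {a b : V × V} {hl : List (V × V)}
    (h : HF B (a :: b :: hl)) : HF B (b :: a :: hl) := by
  obtain ⟨h1, h2, h3, h4, h5, k1, k2, k3, k4, k5, k6⟩ := h
  rw [Up_cons] at h4 h5
  obtain ⟨h4a, h4b, h4c⟩ := h4
  obtain ⟨h5a, h5b, h5c⟩ := h5
  refine ⟨k1, k2, k3, ?_, ?_, h1, h2, h3, h4c, h5c, k6⟩
  · rw [Up_cons, hs, hs a.2]; exact ⟨h4a, h5a, k4⟩
  · rw [Up_cons, hs, hs a.2]; exact ⟨h4b, h5b, k5⟩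

lemma HF_ins (hs : ∀ x y, B x y = B y x) {o : Option (V × V)} {a : V × V} {hl : List (V × V)} :
    HF B (o.toList ++ a :: hl) ↔ HF B (a :: (o.toList ++ hl)) := by
  cases o with
  | none => rfl
  | some b => exact ⟨HF_swap hs, HF_swap hs⟩

lemma Up_ins {o : Option (V × V)} {a : V × V} {hl : List (V × V)} {x : V} :
    x ∈ Up B (o.toList ++ a :: hl) ↔ B a.1 x = 0 ∧ B a.2 x = 0 ∧ x ∈ Up B (o.toList ++ hl) := by
  cases o with
  | none => exact Up_cons
  | some b => 
    show x ∈ Up B (b :: a :: hl) ↔ _ ∧ _ ∧ x ∈ Up B (b :: hl)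
    simp only [Up_cons]; tauto

lemma HF_tail {a : V × V} {hl : List (V × V)} (h : HF B (a :: hl)) : HF B hl := h.2.2.2.2.2

lemma HF_down {o : Option (V × V)} {hl : List (V × V)} (h : HF B (o.toList ++ hl)) : HF B hl := by
  cases o with
  | none => exact h
  | some a => exact HF_tail h

lemma Up_down {o : Option (V × V)} {hl : List (V × V)} {x : V} (h : x ∈ Up B (o.toList ++ hl)) :
    x ∈ Up B hl := by
  rw [mem_Up] at h ⊢
  exact fun a ha => h a (by simp [ha])

lemma Up_opt {a : V × V} {hl : List (V × V)} {x : V} (h : x ∈ Up B ((some a).toList ++ hl)) :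
    B a.1 x = 0 ∧ B a.2 x = 0 := by
  rw [mem_Up] at h
  exact h a (by simp)

/-- Mixed frames. -/
structure Fr (B : V →ₗ[F] V →ₗ[F] F) (o : Option (V × V)) (hl : List (V × V)) (ws : List V) : Prop where
  hf : HF B (o.toList ++ hl)
  up : ∀ w ∈ ws, w ∈ Up B (o.toList ++ hl)
  ok : Ok B ws
  ind : Ind F ws

/-- Configurations. -/
abbrev Cf (V : Type) : Type := List (V × V) × List V × List V

/-- Frame configurations. -/
def FR (B : V →ₗ[F] V →ₗ[F] F) (r k : ℕ) : Set (Option (V × V) × Cf V) :=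
  {x | x.2.2.2 = [] ∧ x.2.1.length = r ∧ x.2.2.1.length = k ∧ Fr B x.1 x.2.1 x.2.2.1}

/-- Rows of the first kind. -/
def MQ (B : V →ₗ[F] V →ₗ[F] F) (r n : ℕ) : Set (Option (V × V) × Cf V) :=
  {x | x.2.2.1 = [] ∧ x.2.1.length = r ∧ HF B (x.1.toList ++ x.2.1) ∧
    x.2.2.2 ∈ TSet B (IsoIn B (Up B (x.1.toList ++ x.2.1))) n n}

/-- Rows of the second kind. -/
def MU (B : V →ₗ[F] V →ₗ[F] F) (r k n : ℕ) : Set (Option (V × V) × Cf V) :=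
  {x | ∃ p ws, x.2.2.1 = p :: ws ∧ ws.length = k ∧ x.2.1.length = r ∧ Fr B x.1 x.2.1 (p :: ws) ∧
    x.2.2.2 ∈ TSet B (Pts B (Up B (x.1.toList ++ x.2.1)) p ws) n n}

section Action

variable {G : Type} [Group G] [DistribMulAction G V] (I : IsoG B G)

include I

@[simp] lemma toList_smul (g : G) (o : Option (V × V)) : (g • o).toList = g • o.toList := by
  cases o <;> rfl

lemma Up_smul (g : G) {hl : List (V × V)} {x : V} (h : x ∈ Up B hl) : g • x ∈ Up B (g • hl) := by
  rw [mem_Up] at h ⊢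
  intro a ha
  obtain ⟨b, hb, rfl⟩ := (mem_smul_list _ _ _).1 ha
  simpa [I.inv] using h b hb

lemma HF_smul (g : G) {hl : List (V × V)} (h : HF B hl) : HF B (g • hl) := by
  induction hl with
  | nil => trivial
  | cons a hl ih =>
    obtain ⟨h1, h2, h3, h4, h5, h6⟩ := h
    refine ⟨?_, ?_, ?_, Up_smul I g h4, Up_smul I g h5, ih h6⟩ <;> simpa [I.inv]

/-- Action as a linear map. -/
def IsoG.toLin (g : G) : V →ₗ[F] V where
  toFun x := g • x
  map_add' := smul_add g
  map_smul' c x := I.lin g c x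

lemma rk_smul_le (g : G) (t : List V) : rk F (g • t) ≤ rk F t := by
  have : sp F (g • t) ≤ (sp F t).map (I.toLin g) := by
    apply sp_le
    intro x hx
    obtain ⟨y, hy, rfl⟩ := (mem_smul_list _ _ _).1 hx
    exact ⟨y, mem_sp hy, rfl⟩
  exact (Submodule.finrank_mono this).trans (Submodule.finrank_map_le _ _)

lemma rk_smul (g : G) (t : List V) : rk F (g • t) = rk F t := by
  apply le_antisymm (rk_smul_le I g t)
  have := rk_smul_le I g⁻¹ (g • t)
  rwa [inv_smul_smul] at this

lemma Ind_smul (g : G) (t : List V) : Ind F (g • t) ↔ Ind F t := by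
  unfold Ind; rw [rk_smul I, smul_list_length]

lemma Ok_smul (g : G) {t : List V} (h : Ok B t) : Ok B (g • t) := by
  intro x hx y hy
  obtain ⟨a, ha, rfl⟩ := (mem_smul_list _ _ _).1 hx
  obtain ⟨b, hb, rfl⟩ := (mem_smul_list _ _ _).1 hy
  rw [I.inv]; exact h a ha b hb

lemma Fr.smul (g : G) {o : Option (V × V)} {hl : List (V × V)} {ws : List V} (h : Fr B o hl ws) :
    Fr B (g • o) (g • hl) (g • ws) := by
  refine ⟨?_, ?_, Ok_smul I g h.ok, (Ind_smul I g ws).2 h.ind⟩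
  · rw [toList_smul I, ← smul_list_append]; exact HF_smul I g h.hf
  · intro w hw
    obtain ⟨a, ha, rfl⟩ := (mem_smul_list _ _ _).1 hw
    rw [toList_smul I, ← smul_list_append]; exact Up_smul I g (h.up a ha)

omit I in
lemma Fr.down {o : Option (V × V)} {hl : List (V × V)} {ws : List V} (h : Fr B o hl ws) :
    Fr B none hl ws := ⟨HF_down h.hf, fun w hw => Up_down (h.up w hw), h.ok, h.ind⟩

lemma FR_adm (r k : ℕ) : Adm G (FR B r k) where
  inv := by
    rintro g ⟨o, hl, ws, t⟩ ⟨h1, h2, h3, h4⟩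
    simp only at h1 h2 h3 h4
    refine ⟨?_, ?_, ?_, ?_⟩
    · simp [h1, Prod.smul_mk]
    · simp [h2, Prod.smul_mk]
    · simp [h3, Prod.smul_mk]
    · exact h4.smul I g
  down := by
    rintro o ⟨hl, ws, t⟩ ⟨h1, h2, h3, h4⟩
    exact ⟨h1, h2, h3, h4.down⟩

lemma MQ_adm (r n : ℕ) : Adm G (MQ B r n) where
  inv := by
    rintro g ⟨o, hl, ws, t⟩ ⟨h1, h2, h3, h4⟩
    rw [TSet_nn] at h4
    obtain ⟨h5, h6, h7⟩ := h4
    simp only at h1 h2 h3 h5 h6 h7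
    refine ⟨?_, ?_, ?_, TSet_nn.2 ⟨?_, ?_, ?_⟩⟩
    · simp [h1, Prod.smul_mk]
    · simp [h2, Prod.smul_mk]
    · simp only [Prod.smul_mk]
      rw [toList_smul I, ← smul_list_append]; exact HF_smul I g h3
    · simp [h5, Prod.smul_mk]
    · intro x hx
      obtain ⟨a, ha, rfl⟩ := (mem_smul_list g t _).1 hx
      obtain ⟨k1, k2, k3⟩ := h6 a ha
      refine ⟨?_, ?_, ?_⟩
      · simp only [Prod.smul_mk]
        rw [toList_smul I, ← smul_list_append]; exact Up_smul I g k1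
      · rwa [Ne, smul_eq_zero_iff_eq]
      · rw [I.inv, k3]
    · exact Ok_smul I g h7
  down := by
    rintro o ⟨hl, ws, t⟩ ⟨h1, h2, h3, h4⟩
    rw [TSet_nn] at h4
    obtain ⟨h5, h6, h7⟩ := h4
    refine ⟨h1, h2, HF_down h3, TSet_nn.2 ⟨h5, fun x hx => ⟨Up_down (h6 x hx).1, (h6 x hx).2⟩, h7⟩⟩

lemma MU_adm (r k n : ℕ) : Adm G (MU B r k n) where
  inv := by
    rintro g ⟨o, hl, ws, t⟩ ⟨p, ws', h1, h2, h3, h4, h5⟩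
    rw [TSet_nn] at h5
    obtain ⟨h5, h6, h7⟩ := h5
    simp only at h1 h2 h3 h4 h5 h6 h7
    refine ⟨g • p, g • ws', ?_, ?_, ?_, ?_, TSet_nn.2 ⟨?_, ?_, ?_⟩⟩
    · simp [h1, Prod.smul_mk]
    · simp [h2]
    · simp [h3, Prod.smul_mk]
    · exact h4.smul I g
    · simp [h5, Prod.smul_mk]
    · intro x hx
      obtain ⟨a, ha, rfl⟩ := (mem_smul_list g t _).1 hx
      obtain ⟨k1, k2, k3, k4⟩ := h6 a ha
      refine ⟨?_, ?_, ?_, ?_⟩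
      · simp only [Prod.smul_mk]
        rw [toList_smul I, ← smul_list_append]; exact Up_smul I g k1
      · rw [I.inv, k2]
      · rw [I.inv, k3]
      · intro w hw
        obtain ⟨b, hb, rfl⟩ := (mem_smul_list _ _ _).1 hw
        rw [I.inv]; exact k4 b hb
    · exact Ok_smul I g h7
  down := by
    rintro o ⟨hl, ws, t⟩ ⟨p, ws', h1, h2, h3, h4, h5⟩
    rw [TSet_nn] at h5
    obtain ⟨h5, h6, h7⟩ := h5
    exact ⟨p, ws', h1, h2, h3, h4.down,
      TSet_nn.2 ⟨h5, fun x hx => ⟨Up_down (h6 x hx).1, (h6 x hx).2⟩, h7⟩⟩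

end Action

/-- Linear combination of a list. -/
def lc (c : List F) (t : List V) : V := (List.zipWith (fun a x => a • x) c t).sum

@[simp] lemma lc_nil (t : List V) : lc ([] : List F) t = 0 := by simp [lc]
@[simp] lemma lc_nil' (c : List F) : lc c ([] : List V) = 0 := by simp [lc]
@[simp] lemma lc_cons (a : F) (c : List F) (x : V) (t : List V) :
    lc (a :: c) (x :: t) = a • x + lc c t := by simp [lc]

lemma lc_mem (c : List F) (t : List V) : lc c t ∈ sp F t := by
  induction t generalizing c with
  | nil => simp
  | cons x t ih =>
    cases c with
    | nil => simp
    | cons a c =>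
      rw [lc_cons]
      exact add_mem (Submodule.smul_mem _ _ (mem_sp (by simp)))
        (sp_mono' (fun y hy => by simp [hy]) (ih c))

lemma exists_lc {t : List V} {x : V} (h : x ∈ sp F t) : ∃ c : List F, lc c t = x := by
  induction t generalizing x with
  | nil =>
    refine ⟨[], ?_⟩
    have : sp F ([] : List V) = ⊥ := by simp [sp]
    rw [this, Submodule.mem_bot] at h
    simp [h]
  | cons y t ih =>
    have : sp F (y :: t) = Submodule.span F {y} ⊔ sp F t := by
      rw [sp, sp, ← Submodule.span_union]; congr 1; ext z; simp
    rw [this, Submodule.mem_sup] at h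
    obtain ⟨u, hu, v, hv, rfl⟩ := h
    obtain ⟨a, rfl⟩ := Submodule.mem_span_singleton.1 hu
    obtain ⟨c, rfl⟩ := ih hv
    exact ⟨a :: c, by simp⟩

lemma lc_smul {G : Type} [Group G] [DistribMulAction G V] (I : IsoG B G) (g : G) (c : List F)
    (t : List V) : lc c (g • t) = g • lc c t := by
  induction t generalizing c with
  | nil => simp
  | cons y t ih =>
    cases c with
    | nil => simp
    | cons a c => simp [ih, I.lin]

/-- Matrix applied to a list. -/
def mlc (N : List (List F)) (t : List V) : List V := N.map (fun c => lc c t)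

lemma mlc_smul {G : Type} [Group G] [DistribMulAction G V] (I : IsoG B G) (g : G)
    (N : List (List F)) (t : List V) : mlc N (g • t) = g • mlc N t := by
  simp [mlc, smul_list, Function.comp_def, ← lc_smul I g]

lemma exists_mlc {t s : List V} (h : ∀ x ∈ s, x ∈ sp F t) : ∃ N : List (List F), mlc N t = s := by
  induction s with
  | nil => exact ⟨[], rfl⟩
  | cons x s ih =>
    obtain ⟨N, rfl⟩ := ih (fun y hy => h y (by simp [hy]))
    obtain ⟨c, rfl⟩ := exists_lc (h x (by simp))
    exact ⟨c :: N, rfl⟩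

lemma Ind.cons {x : V} {l : List V} (h : Ind F l) (hx : x ∉ sp F l) : Ind F (x :: l) := by
  have h1 := rk_le_length (F := F) (x :: l)
  have h2 : rk F l < rk F (x :: l) := by
    apply Submodule.finrank_lt_finrank_of_lt
    refine lt_of_le_of_ne (sp_mono' (fun y hy => by simp [hy])) ?_
    intro h
    apply hx
    rw [h]; exact mem_sp (by simp)
  unfold Ind at *
  simp at h1 ⊢
  omega

/-- Extraction of a basis relative to an independent list. -/
lemma exists_sel {ws : List V} (hw : Ind F ws) (u : List V) :
    ∃ s : List V, Ind F (s ++ ws) ∧ (∀ x ∈ u, x ∈ sp F (s ++ ws)) ∧ (∀ x ∈ s, x ∈ u) ∧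
      (s.length ≤ u.length) ∧ (¬ Ind F (u ++ ws) → s.length < u.length) := by
  induction u with
  | nil => exact ⟨[], hw, by simp, by simp, le_rfl, fun h => absurd hw h⟩
  | cons x u ih =>
    obtain ⟨s, h1, h2, h3, h4, h5⟩ := ih
    by_cases hx : x ∈ sp F (s ++ ws)
    · refine ⟨s, h1, ?_, fun y hy => by simp [h3 y hy], by simp; omega, fun _ => by simp; omega⟩
      rw [List.forall_mem_cons]; exact ⟨hx, h2⟩
    · refine ⟨x :: s, Ind.cons h1 hx, ?_, ?_, by simpa using h4, ?_⟩
      · rw [List.forall_mem_cons]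
        exact ⟨mem_sp (by simp), fun y hy => sp_mono' (fun z hz => by simp at hz ⊢; tauto) (h2 y hy)⟩
      · rw [List.forall_mem_cons]; exact ⟨by simp, fun y hy => by simp [h3 y hy]⟩
      · intro h
        simp only [List.length_cons, add_lt_add_iff_right]
        apply h5
        intro h6
        apply h
        refine Ind.cons h6 ?_
        intro hx2
        apply hx
        refine (sp_le (F := F) ?_ : sp F (u ++ ws) ≤ sp F (s ++ ws)) hx2
        intro y hy
        rcases List.mem_append.1 hy with hy | hy
        · exact h2 y hy
        · exact mem_sp (by simp [hy])

end Frames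

end OStab

namespace OStab

section Rows

set_option linter.unusedSectionVars false

variable {F V : Type} [Field F] [AddCommGroup V] [Module F V] [FiniteDimensional F V]
  {B : V →ₗ[F] V →ₗ[F] F} {G : Type} [Group G] [DistribMulAction G V]

/-- Horizontal differential on configurations. -/
noncomputable def df (y : Cf V) : Z (Cf V) := mp (fun t => (y.1, y.2.1, t)) (d (e y.2.2))

lemma df_eqv : Eqv G (df (V := V)) := by
  rintro g ⟨hl, ws, t⟩
  simp only [df, Prod.smul_mk]
  rw [smul_list g t, ← mp_e, d_map, mp_mp, mp_mp]
  rfl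

/-- Horizontal differential. -/
noncomputable def dd : CC G (V × V) (Cf V) →ₗ[ℤ] CC G (V × V) (Cf V) := TY df

lemma dd_dd (z : CC G (V × V) (Cf V)) : dd (dd z) = 0 := by
  rw [dd, TY_TY]
  apply TY_zero
  rintro ⟨hl, ws, t⟩
  have : (L (df (V := V))).comp (mp (fun t => (hl, ws, t)))
      = (mp (fun t => (hl, ws, t))).comp d := hom_ext (by intro t; simp [df])
  have h := congrArg (fun φ => φ (d (e t))) this
  simp only [LinearMap.comp_apply] at h
  rw [df, h, d_d, map_zero]

lemma dd_D (z : CC G (V × V) (Cf V)) : dd (D z) = D (dd z) := (D_TY df_eqv z).symm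

lemma dd_Ch {A A' : Set (Option (V × V) × Cf V)}
    (h : ∀ o hl ws t t', (o, (hl, ws, t)) ∈ A → t'.Sublist t → t'.length + 1 = t.length →
      (o, (hl, ws, t')) ∈ A')
    {q : ℕ} {z : CC G (V × V) (Cf V)} (hz : z ∈ Ch G A q) : dd z ∈ Ch G A' q := by
  refine TY_Ch ?_ hz
  rintro o ⟨hl, ws, t⟩ hy
  refine mp_mem (fun t' ht' => ?_) (d_e_mem t)
  exact h o hl ws t t' hy ht'.1 ht'.2

lemma TSet_face {S : Set V} {n : ℕ} {t t' : List V} (h : t ∈ TSet B S (n + 1) (n + 1))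
    (h1 : t'.Sublist t) (h2 : t'.length + 1 = t.length) : t' ∈ TSet B S n n := by
  rw [TSet_nn] at h ⊢
  exact ⟨by omega, fun x hx => h.2.1 x (h1.subset hx), Ok_sub h.2.2 (fun x hx => h1.subset hx)⟩

lemma dd_MQ {r n q : ℕ} {z : CC G (V × V) (Cf V)} (hz : z ∈ Ch G (MQ B r (n + 1)) q) :
    dd z ∈ Ch G (MQ B r n) q :=
  dd_Ch (A := MQ B r (n + 1)) (by
    rintro o hl ws t t' ⟨h1, h2, h3, h4⟩ k1 k2
    exact ⟨h1, h2, h3, TSet_face h4 k1 k2⟩) hz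

lemma dd_MU {r k n q : ℕ} {z : CC G (V × V) (Cf V)} (hz : z ∈ Ch G (MU B r k (n + 1)) q) :
    dd z ∈ Ch G (MU B r k n) q :=
  dd_Ch (A := MU B r k (n + 1)) (by
    rintro o hl ws t t' ⟨p, ws', h1, h2, h3, h4, h5⟩ k1 k2
    exact ⟨p, ws', h1, h2, h3, h4, TSet_face h5 k1 k2⟩) hz

lemma dd_zero {A : Set (Option (V × V) × Cf V)} (h : ∀ x ∈ A, x.2.2.2 = [])
    {q : ℕ} {z : CC G (V × V) (Cf V)} (hz : z ∈ Ch G A q) : dd z = 0 := by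
  rw [dd, TY_eq_on (ψ := fun _ => 0) (A := A) ?_ hz]
  · exact TY_zero _ (fun _ => rfl) z
  · rintro o ⟨hl, ws, t⟩ hy
    have : t = [] := h _ hy
    subst this
    simp [df]

/-- Rows from exactness of list complexes. -/
lemma row_gen {A A' : Set (Option (V × V) × Cf V)} {q : ℕ}
    (hex : ∀ (o : Option (V × V)) hl ws, odeg o ≤ q →
      ∀ z ∈ sup {t | (o, (hl, ws, t)) ∈ A}, d z = 0 → ∃ y ∈ sup {t | (o, (hl, ws, t)) ∈ A'}, d y = z)
    {z : CC G (V × V) (Cf V)} (hz : z ∈ Ch G A q) (h : dd z = 0) : ∃ y ∈ Ch G A' q, dd y = z := by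
  refine row_exact (K := (Option (V × V) × Cf V) × List G)
    (β := Option (V × V) × List (V × V) × List V × List G) (τ := List V)
    (fun c => (c.1.1, c.1.2.1, c.1.2.2.1, c.2)) (fun c => c.1.2.2.2)
    (fun b t => ((b.1, (b.2.1, b.2.2.1, t)), b.2.2.2)) (fun _ => rfl) (fun _ _ => rfl)
    (fun _ _ => rfl) d dd ?_ (CCell G A q) (CCell G A' q) ?_ hz h
  · rintro ⟨⟨o, hl, ws, t⟩, l⟩
    rw [dd, TY_e, df, mp_mp]
    rfl
  · rintro ⟨o, hl, ws, l⟩ z hz hd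
    by_cases hq : l.length + odeg o = q
    · obtain ⟨y, hy, hyd⟩ := hex o hl ws (by omega) z (sup_mono (fun t ht => ht.1) hz) hd
      exact ⟨y, sup_mono (by intro t ht; exact ⟨ht, hq⟩) hy, hyd⟩
    · refine ⟨0, zero_mem _, ?_⟩
      have h := res_eq_zero (s := Set.univ) (t := {t | ((o, (hl, ws, t)), l) ∈ CCell G A q})
        (by rintro a ⟨_, h2⟩; exact absurd h2 hq) hz
      have h' := res_eq_self (sup_mono (Set.subset_univ _) hz)
      rw [map_zero, ← h', h]

lemma sup_empty_eq {α : Type} {s : Set α} (h : ∀ a, a ∉ s) {z : Z α} (hz : z ∈ sup s) : z = 0 := by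
  have h1 := res_eq_zero (s := Set.univ) (t := s) (by intro a ha; exact absurd ha (h a)) hz
  have h' := res_eq_self (sup_mono (Set.subset_univ _) hz)
  rw [← h', h1]

lemma odeg_toList (o : Option (V × V)) : o.toList.length = odeg o := by cases o <;> rfl

lemma row_Q (hs : ∀ x y, B x y = B y x) {g : ℕ} (hg : Genus B (⊤ : Submodule F V) g) {r n q : ℕ}
    (hq : n + q + 1 + r ≤ g) {z : CC G (V × V) (Cf V)} (hz : z ∈ Ch G (MQ B r n) q)
    (h : dd z = 0) : ∃ y ∈ Ch G (MQ B r (n + 1)) q, dd y = z := by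
  refine row_gen ?_ hz h
  intro o hl ws ho z hz hd
  by_cases hc : ws = [] ∧ hl.length = r ∧ HF B (o.toList ++ hl)
  · obtain ⟨h1, h2, h3⟩ := hc
    have hG := HF_Genus hs hg h3 (γ := n + 1) (by simp [odeg_toList, h2]; omega)
    obtain ⟨y, hy, hyd⟩ := Ex_X hs (n + 1) _ hG n (by omega) z
      (sup_mono (by intro t ht; exact ht.2.2.2) hz) hd
    exact ⟨y, sup_mono (by intro t ht; exact ⟨h1, h2, h3, ht⟩) hy, hyd⟩
  · refine ⟨0, zero_mem _, ?_⟩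
    rw [map_zero, sup_empty_eq ?_ hz]
    rintro t ⟨h1, h2, h3, -⟩
    exact hc ⟨h1, h2, h3⟩

lemma row_U (hs : ∀ x y, B x y = B y x) (h2 : (2 : F) ≠ 0) (hN : ND B (⊤ : Submodule F V)) {g : ℕ}
    (hg : Genus B (⊤ : Submodule F V) g) {r k n q : ℕ}
    (hq : n + q + 1 + k + r ≤ g) {z : CC G (V × V) (Cf V)} (hz : z ∈ Ch G (MU B r k n) q)
    (h : dd z = 0) : ∃ y ∈ Ch G (MU B r k (n + 1)) q, dd y = z := by
  refine row_gen ?_ hz h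
  intro o hl ws ho z hz hd
  by_cases hc : ∃ p ws', ws = p :: ws' ∧ ws'.length = k ∧ hl.length = r ∧ Fr B o hl (p :: ws')
  · obtain ⟨p, ws', h1, h3, h4, h5⟩ := hc
    subst h1
    have hG := HF_Genus hs hg h5.hf (γ := n + 1 + ws'.length)
      (by simp [odeg_toList]; omega)
    obtain ⟨y, hy, hyd⟩ := Ex_A hs h2 ws' (HF_ND hs hN h5.hf) h5.up h5.ok h5.ind hG (n := n)
      (by omega) z (sup_mono (by
        rintro t ⟨p', ws'', k1, -, -, -, k5⟩
        obtain ⟨rfl, rfl⟩ := List.cons.inj k1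
        exact k5) hz) hd
    exact ⟨y, sup_mono (by intro t ht; exact ⟨p, ws', rfl, h3, h4, h5, ht⟩) hy, hyd⟩
  · refine ⟨0, zero_mem _, ?_⟩
    rw [map_zero, sup_empty_eq ?_ hz]
    rintro t ⟨p, ws', h1, h2, h3, h4, -⟩
    exact hc ⟨p, ws', h1, h2, h3, h4⟩

end Rows

section KillS

set_option linter.unusedSectionVars false

variable {F V : Type} [Field F] [AddCommGroup V] [Module F V] [FiniteDimensional F V]
  {B : V →ₗ[F] V →ₗ[F] F} {G : Type} [Group G] [DistribMulAction G V] (I : IsoG B G)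

/-- The transvection scaling `a` by two and `a'` by one half. -/
def IsoG.E (a a' : V) : G := I.R (a - a') * I.R (a - (2 : F) • a')

lemma IsoG.E_smul (hs : ∀ x y, B x y = B y x) (h2 : (2 : F) ≠ 0) {a a' : V} (ha : B a a = 0)
    (ha' : B a' a' = 0) (h : B a a' = 1) (x : V) :
    I.E a a' • x = x + B a' x • a - (B a x / 2) • a' := by
  have h' : B a' a = 1 := by rw [hs, h]
  have e1 : B (a - a') (a - a') = -2 := by simp [ha, ha', h, h']; ring
  have e2 : B (a - (2 : F) • a') (a - (2 : F) • a') = -4 := by simp [ha, ha', h, h']; ring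
  have h4 : (4 : F) ≠ 0 := by
    have : (4 : F) = 2 * 2 := by norm_num
    rw [this]; exact mul_ne_zero h2 h2
  rw [IsoG.E, mul_smul, I.R_smul (a - (2 : F) • a'), I.R_smul, e1, e2]
  simp only [map_sub, map_smul, LinearMap.sub_apply, LinearMap.smul_apply, smul_eq_mul, ha, ha', h, h']
  match_scalars
  · ring
  · field_simp; ring
  · field_simp; ring

lemma IsoG.E_conj (k : G) (a a' : V) : I.E (k • a) (k • a') = k * I.E a a' * k⁻¹ := by
  rw [IsoG.E, IsoG.E, ← I.lin, ← smul_sub, ← smul_sub, I.R_conj, I.R_conj]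
  group

lemma smul_pair_fix {g : G} {h : V × V} (h1 : g • h.1 = h.1) (h2 : g • h.2 = h.2) : g • h = h := by
  rw [Prod.ext_iff]; exact ⟨h1, h2⟩

lemma smul_list_fix {X : Type} [MulAction G X] {g : G} {l : List X} (h : ∀ x ∈ l, g • x = x) :
    g • l = l := by
  rw [smul_list]
  conv_rhs => rw [← List.map_id l]
  exact List.map_congr_left h

/-- Data for the killing lemma. -/
structure KD (B : V →ₗ[F] V →ₗ[F] F) (o : Option (V × V)) (hl : List (V × V)) (ws rest : List V)
    (t1 t2 c1 c2 : V) : Prop where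
  t11 : B t1 t1 = 0
  t22 : B t2 t2 = 0
  t12 : B t1 t2 = 0
  c11 : B c1 c1 = 0
  c22 : B c2 c2 = 0
  c1t1 : B c1 t1 = 1
  c1t2 : B c1 t2 = 0
  c2t1 : B c2 t1 = 0
  c2t2 : B c2 t2 = 1
  hup : t2 - t1 ∈ Up B (o.toList ++ hl) ∧ c1 ∈ Up B (o.toList ++ hl) ∧ c2 ∈ Up B (o.toList ++ hl)
  wup : ∀ w ∈ ws ++ rest, B (t2 - t1) w = 0 ∧ B c1 w = 0 ∧ B c2 w = 0

/-- The midpoint. -/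
def md (F : Type) {V : Type} [Field F] [AddCommGroup V] [Module F V] (t1 t2 : V) : V :=
  ((2 : F)⁻¹) • (t1 + t2)

include I in
lemma Kill (hs : ∀ x y, B x y = B y x) (h2 : (2 : F) ≠ 0)
    {A A' : Set (Option (V × V) × Cf V)} (hA : Adm G A)
    (hlF : Cf V → List (V × V)) (wsF restF : Cf V → List V) (t1 t2 c1 c2 : Cf V → V)
    (e1 : EF G hlF) (e2 : EF G wsF) (e3 : EF G restF) (e4 : EF G t1) (e5 : EF G t2)
    (e6 : EF G c1) (e7 : EF G c2)
    (hK : ∀ o y, (o, y) ∈ A → KD B o (hlF y) (wsF y) (restF y) (t1 y) (t2 y) (c1 y) (c2 y))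
    (hA' : ∀ o y, (o, y) ∈ A → (o, (hlF y, wsF y, t1 y :: t2 y :: restF y)) ∈ A')
    {A'' : Set (Option (V × V) × Cf V)}
    (hA'' : ∀ o y l, (o, y) ∈ A → l.Sublist (restF y) → l.length + 1 = (restF y).length →
      (o, (hlF y, wsF y, t1 y :: md F (t1 y) (t2 y) :: t2 y :: l)) ∈ A'')
    {q : ℕ} {z : CC G (V × V) (Cf V)} (hz : z ∈ Ch G A q) (hD : D z = 0) :
    ∃ x' w R, w ∈ Ch G A' (q + 1) ∧ R ∈ Ch G A'' q ∧ D R = 0 ∧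
      TF (fun y => (hlF y, wsF y, t1 y :: t2 y :: restF y)) z = dd x' + D w + R := by
  have hκ : EF G (fun y => ((hlF y, wsF y, t1 y :: t2 y :: restF y) : Cf V)) := by
    intro g y
    simp only [e1 g y, e2 g y, e3 g y, e4 g y, e5 g y, Prod.smul_mk, smul_list_cons]
  -- the two motions
  have key : ∀ (c : Cf V → V), EF G c → ∀ f : Cf V → Cf V,
      (∀ o y, (o, y) ∈ A → B (t2 y - t1 y) (c y) = 1 ∧ B (c y) (c y) = 0 ∧
        c y ∈ Up B (o.toList ++ hlF y)) →
      (∀ o y, (o, y) ∈ A → I.E (t2 y - t1 y) (c y) • f y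
        = (hlF y, wsF y, t1 y :: t2 y :: restF y)) →
      ∃ w, w ∈ Ch G A' (q + 1) ∧
        D w = TF f z - TF (fun y => (hlF y, wsF y, t1 y :: t2 y :: restF y)) z := by
    intro c hc f hf1 hf2
    obtain ⟨w, hw, hDw⟩ := gamma (f := fun y => e ((hlF y, wsF y, t1 y :: t2 y :: restF y) : Cf V))
      (A' := A') hA (fun y => I.E (t2 y - t1 y) (c y))
      (by
        intro k y
        simp only [e4 k y, e5 k y, hc k y, ← smul_sub]
        exact I.E_conj k _ _)
      (by
        intro h y hy
        have hk := hK _ _ hy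
        obtain ⟨f1, f2, f3⟩ := hf1 _ _ hy
        have u1 := Up_opt hk.hup.1
        have u2 := Up_opt f3
        have haa : B (t2 y - t1 y) (t2 y - t1 y) = 0 := by
          simp [hk.t11, hk.t22, hk.t12, hs (t2 y) (t1 y)]
        apply smul_pair_fix
        · rw [I.E_smul hs h2 haa f2 f1, hs (c y), u2.1, hs (t2 y - t1 y), u1.1]; simp
        · rw [I.E_smul hs h2 haa f2 f1, hs (c y), u2.2, hs (t2 y - t1 y), u1.2]; simp)
      hκ.eqv (fun o y hy => e_mem (s := {y' | (o, y') ∈ A'}) (hA' o y hy)) hz hD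
    refine ⟨w, hw, ?_⟩
    rw [hDw]
    congr 1
    refine TY_eq_on (fun o y hy => ?_) hz
    congr 1
    have h3 := hκ (I.E (t2 y - t1 y) (c y))⁻¹ y
    refine h3.trans ?_
    rw [inv_smul_eq_iff]
    exact (hf2 o y hy).symm
  have fixw : ∀ o y (c : V), (o, y) ∈ A → B (t2 y - t1 y) c = 1 → B c c = 0 →
      c ∈ Up B (o.toList ++ hlF y) → (∀ w ∈ wsF y ++ restF y, B c w = 0) → ∀ x,
      I.E (t2 y - t1 y) c • ((hlF y, wsF y, x :: restF y) : Cf V)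
        = (hlF y, wsF y, I.E (t2 y - t1 y) c • x :: restF y) := by
    intro o y c hy f1 f2 f3 f4 x
    have hk := hK _ _ hy
    have haa : B (t2 y - t1 y) (t2 y - t1 y) = 0 := by
      simp [hk.t11, hk.t22, hk.t12, hs (t2 y) (t1 y)]
    have hw : ∀ w ∈ wsF y ++ restF y, I.E (t2 y - t1 y) c • w = w := by
      intro w hw
      rw [I.E_smul hs h2 haa f2 f1, (hk.wup w hw).1, f4 w hw]; simp
    simp only [Prod.smul_mk, smul_list_cons]
    rw [smul_list_fix (l := hlF y), smul_list_fix (l := wsF y), smul_list_fix (l := restF y)]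
    · intro w h; exact hw w (by simp [h])
    · intro w h; exact hw w (by simp [h])
    · intro h hh
      have u1 := mem_Up.1 hk.hup.1 h (by simp [hh])
      have u2 := mem_Up.1 f3 h (by simp [hh])
      apply smul_pair_fix
      · rw [I.E_smul hs h2 haa f2 f1, hs c, u2.1, hs (t2 y - t1 y), u1.1]; simp
      · rw [I.E_smul hs h2 haa f2 f1, hs c, u2.2, hs (t2 y - t1 y), u1.2]; simp
  have fix2 : ∀ o y (c : V), (o, y) ∈ A → B (t2 y - t1 y) c = 1 → B c c = 0 →
      c ∈ Up B (o.toList ++ hlF y) → (∀ w ∈ wsF y ++ restF y, B c w = 0) → ∀ x x',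
      I.E (t2 y - t1 y) c • ((hlF y, wsF y, x :: x' :: restF y) : Cf V)
        = (hlF y, wsF y, I.E (t2 y - t1 y) c • x :: I.E (t2 y - t1 y) c • x' :: restF y) := by
    intro o y c hy f1 f2 f3 f4 x x'
    have := fixw o y c hy f1 f2 f3 f4 x'
    simp only [Prod.smul_mk, smul_list_cons, Prod.mk.injEq, List.cons.injEq, true_and] at this ⊢
    exact ⟨this.1, this.2.1, this.2.2⟩
  obtain ⟨w1, hw1, hD1⟩ := key (fun y => - c1 y) (fun g y => by simp only [e6 g y, smul_neg])
    (fun y => (hlF y, wsF y, md F (t1 y) (t2 y) :: t2 y :: restF y))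
    (by
      intro o y hy
      have hk := hK _ _ hy
      refine ⟨?_, ?_, neg_mem hk.hup.2.1⟩
      · simp [hs _ (c1 y), hk.c1t1, hk.c1t2]
      · simp [hk.c11])
    (by
      intro o y hy
      have hk := hK _ _ hy
      have f1 : B (t2 y - t1 y) (- c1 y) = 1 := by simp [hs _ (c1 y), hk.c1t1, hk.c1t2]
      have f2 : B (-c1 y) (-c1 y) = 0 := by simp [hk.c11]
      have haa : B (t2 y - t1 y) (t2 y - t1 y) = 0 := by
        simp [hk.t11, hk.t22, hk.t12, hs (t2 y) (t1 y)]
      rw [fix2 o y _ hy f1 f2 (neg_mem hk.hup.2.1)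
        (fun w hw => by simp [(hk.wup w hw).2.1])]
      rw [I.E_smul hs h2 haa f2 f1, I.E_smul hs h2 haa f2 f1]
      simp only [md, map_smul, map_add, map_sub, map_neg, LinearMap.sub_apply, LinearMap.neg_apply,
        hk.t11, hk.t22, hk.t12, hs (t2 y) (t1 y), hk.c1t1, hk.c1t2]
      congr 3
      · simp only [smul_eq_mul]; match_scalars <;> field_simp <;> ring
      · congr 1; simp)
  obtain ⟨w2, hw2, hD2⟩ := key (fun y => c2 y) e7
    (fun y => (hlF y, wsF y, t1 y :: md F (t1 y) (t2 y) :: restF y))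
    (by
      intro o y hy
      have hk := hK _ _ hy
      refine ⟨?_, hk.c22, hk.hup.2.2⟩
      simp [hs _ (c2 y), hk.c2t1, hk.c2t2])
    (by
      intro o y hy
      have hk := hK _ _ hy
      have f1 : B (t2 y - t1 y) (c2 y) = 1 := by simp [hs _ (c2 y), hk.c2t1, hk.c2t2]
      have f2 : B (c2 y) (c2 y) = 0 := by simp [hk.c22]
      have haa : B (t2 y - t1 y) (t2 y - t1 y) = 0 := by
        simp [hk.t11, hk.t22, hk.t12, hs (t2 y) (t1 y)]
      rw [fix2 o y _ hy f1 f2 hk.hup.2.2 (fun w hw => (hk.wup w hw).2.2)]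
      rw [I.E_smul hs h2 haa f2 f1, I.E_smul hs h2 haa f2 f1]
      simp only [md, map_smul, map_add, map_sub, map_neg, LinearMap.sub_apply, LinearMap.neg_apply,
        hk.t11, hk.t22, hk.t12, hs (t2 y) (t1 y), hk.c2t1, hk.c2t2]
      congr 3
      · simp
      · congr 1; simp only [smul_eq_mul]; match_scalars <;> field_simp <;> ring)
  refine ⟨TF (fun y => ((hlF y, wsF y, t1 y :: md F (t1 y) (t2 y) :: t2 y :: restF y) : Cf V)) z,
    - w1 - w2, TY (fun y => mp (fun l => (hlF y, wsF y, t1 y :: md F (t1 y) (t2 y) :: t2 y :: l))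
          (d (e (restF y)))) z, Submodule.sub_mem _ (Submodule.neg_mem _ hw1) hw2, ?_, ?_, ?_⟩
  · refine TY_Ch (fun o y hy => ?_) hz
    refine mp_mem (fun l hl => ?_) (d_e_mem (restF y))
    exact hA'' o y l hy hl.1 hl.2
  · rw [D_TY, hD, map_zero]
    intro g y
    simp only [e1 g y, e2 g y, e3 g y, e4 g y, e5 g y]
    rw [smul_list g (restF y), ← mp_e, d_map, mp_mp, mp_mp]
    congr 2
    funext l
    simp only [Function.comp_apply, Prod.smul_mk, smul_list_cons, md, I.lin, smul_add]
    rfl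
  have hdd : dd (TF (fun y => ((hlF y, wsF y, t1 y :: md F (t1 y) (t2 y) :: t2 y :: restF y) : Cf V)) z)
      = TF (fun y => (hlF y, wsF y, md F (t1 y) (t2 y) :: t2 y :: restF y)) z
        - TF (fun y => (hlF y, wsF y, t1 y :: t2 y :: restF y)) z
        + TF (fun y => (hlF y, wsF y, t1 y :: md F (t1 y) (t2 y) :: restF y)) z
        - TY (fun y => mp (fun l => (hlF y, wsF y, t1 y :: md F (t1 y) (t2 y) :: t2 y :: l))
          (d (e (restF y)))) z := by
    rw [dd, TF, TY_TY, TF, TF, TF, ← TY_sub, ← TY_add, ← TY_sub]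
    apply TY_congr
    intro y
    simp only [L_e, df, d_cons, map_sub, mp_e, cs_e, cs, mp_mp]
    abel
  rw [hdd, map_sub, map_neg, hD1, hD2]
  abel

end KillS

end OStab

namespace OStab

section Setup

set_option linter.unusedSectionVars false

variable {F V : Type} [Field F] [AddCommGroup V] [Module F V] [FiniteDimensional F V]
  {B : V →ₗ[F] V →ₗ[F] F} {G : Type} [Group G] [DistribMulAction G V]

/-- Head with default zero. -/
def hd {X : Type} [Zero X] (l : List X) : X := l.headD 0

@[simp] lemma hd_cons {X : Type} [Zero X] (x : X) (l : List X) : hd (x :: l) = x := rfl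

@[simp] lemma hd_smul (g : G) (l : List V) : hd (g • l) = g • hd l := by
  cases l with
  | nil => simp [hd]
  | cons a l => rfl

@[simp] lemma hd_smul' (g : G) (l : List (V × V)) : hd (g • l) = g • hd l := by
  cases l with
  | nil => simp [hd]
  | cons a l => rfl

@[simp] lemma tail_smul {X : Type} [MulAction G X] (g : G) (l : List X) :
    (g • l).tail = g • l.tail := by
  cases l <;> rfl

@[simp] lemma drop_smul {X : Type} [MulAction G X] (g : G) (l : List X) (n : ℕ) :
    (g • l).drop n = g • l.drop n := by
  simp [smul_list]

@[simp] lemma take_smul {X : Type} [MulAction G X] (g : G) (l : List X) (n : ℕ) :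
    (g • l).take n = g • l.take n := by
  simp [smul_list]

lemma lc_zero {s : List V} (h : Ind F s) {c : List F} (hc : lc c s = 0) {s' : List V}
    (hl : s'.length = s.length) : lc c s' = 0 := by
  induction s generalizing c s' with
  | nil =>
    have : s' = [] := List.length_eq_zero_iff.1 hl
    simp [this]
  | cons x s ih =>
    cases c with
    | nil => simp
    | cons a c =>
      cases s' with
      | nil => simp
      | cons x' s' =>
        rw [lc_cons] at hc ⊢
        have ha : a = 0 := by
          by_contra ha
          apply h.notMem
          have : x = (-a⁻¹) • lc c s := by
            have h1 : a • x = - lc c s := eq_neg_of_add_eq_zero_left hc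
            rw [neg_smul, ← smul_neg, ← h1, smul_smul, inv_mul_cancel₀ ha, one_smul]
          rw [this]
          exact Submodule.smul_mem _ _ (lc_mem _ _)
        subst ha
        rw [zero_smul, zero_add] at hc ⊢
        exact ih h.tail hc (by simpa using hl)

lemma Ind.ne_zero {s : List V} (h : Ind F s) {x : V} (hx : x ∈ s) : x ≠ 0 := by
  induction s with
  | nil => simp at hx
  | cons y s ih =>
    rcases List.mem_cons.1 hx with rfl | hx
    · intro h0
      exact h.notMem (h0 ▸ zero_mem _)
    · exact ih h.tail hx

lemma Ind.drop {s : List V} (h : Ind F s) (n : ℕ) : Ind F (s.drop n) := by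
  induction s generalizing n with
  | nil => simpa using h
  | cons y s ih =>
    cases n with
    | zero => exact h
    | succ n => exact ih h.tail n

lemma Ind.single {x : V} (hx : x ≠ 0) : Ind F [x] := by
  have h0 : Ind F ([] : List V) := by
    have := rk_le_length (F := F) ([] : List V)
    unfold Ind; simpa using this
  refine Ind.cons h0 ?_
  intro h
  have : sp F ([] : List V) = ⊥ := by simp [sp]
  rw [this] at h
  exact hx (by simpa using h)

lemma Ind.nil : Ind F ([] : List V) := by
  have := rk_le_length (F := F) ([] : List V)
  unfold Ind; simpa using this

/-- Relations in a mixed frame. -/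
lemma Fr.rel (hs : ∀ x y, B x y = B y x) {o : Option (V × V)} {h : V × V} {hl : List (V × V)}
    {ws : List V} (hf : Fr B o (h :: hl) ws) :
    B h.1 h.1 = 0 ∧ B h.2 h.2 = 0 ∧ B h.1 h.2 = 1 ∧ h.1 ∈ Up B (o.toList ++ hl) ∧
    h.2 ∈ Up B (o.toList ++ hl) ∧ HF B (o.toList ++ hl) ∧
    (∀ x ∈ sp F ws, B h.1 x = 0 ∧ B h.2 x = 0 ∧ x ∈ Up B (o.toList ++ hl)) ∧
    ∀ x ∈ sp F ws, ∀ y ∈ sp F ws, B x y = 0 := by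
  obtain ⟨k1, k2, k3, k4, k5, k6⟩ := (HF_ins hs).1 hf.hf
  refine ⟨k1, k2, k3, k4, k5, k6, ?_, ?_⟩
  · intro x hx
    exact Up_ins.1 ((sp_le hf.up) hx)
  · intro x hx y hy
    exact Ok_of_sp hf.ok (t := [x, y]) (by simp [hx, hy]) x (by simp) y (by simp)

/-- Forgetting half of a hyperbolic pair. -/
def cm (y : Cf V) : Cf V := (y.1.tail, (hd y.1).1 :: y.2.1, y.2.2)

lemma cm_EF : EF G (cm (V := V)) := by
  rintro g ⟨hl, ws, t⟩
  simp [cm, Prod.smul_mk]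

lemma Fr.cm (hs : ∀ x y, B x y = B y x) {o : Option (V × V)} {h : V × V} {hl : List (V × V)}
    {ws : List V} (hf : Fr B o (h :: hl) ws) : Fr B o hl (h.1 :: ws) := by
  obtain ⟨k1, k2, k3, k4, k5, k6, k7, k8⟩ := hf.rel hs
  refine ⟨k6, ?_, ?_, ?_⟩
  · rw [List.forall_mem_cons]
    exact ⟨k4, fun w hw => (k7 w (mem_sp hw)).2.2⟩
  · intro x hx y hy
    rcases List.mem_cons.1 hx with rfl | hx <;> rcases List.mem_cons.1 hy with rfl | hy
    · exact k1
    · exact (k7 y (mem_sp hy)).1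
    · rw [hs]; exact (k7 x (mem_sp hx)).1
    · exact hf.ok x hx y hy
  · apply Ind.cons hf.ind
    intro hm
    have := (k7 _ hm).2.1
    rw [hs, k3] at this
    exact one_ne_zero this

lemma cm_FR (hs : ∀ x y, B x y = B y x) {r k : ℕ} (o : Option (V × V)) (y : Cf V)
    (h : (o, y) ∈ FR B (r + 1) k) : (o, cm y) ∈ FR B r (k + 1) := by
  obtain ⟨hl, ws, t⟩ := y
  obtain ⟨h1, h2, h3, h4⟩ := h
  simp only at h1 h2 h3 h4
  cases hl with
  | nil => simp at h2
  | cons a hl =>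
    exact ⟨h1, by simpa [OStab.cm] using h2, by simp [OStab.cm, h3], h4.cm hs⟩

variable (B G) in
/-- Vanishing statement. -/
def QS (g N : ℕ) : Prop := ∀ q, q + N < g → Van G (FR B N 0) q

variable (B G) in
/-- Lifting statement. -/
def US (g r k : ℕ) : Prop := ∀ q, q + r + k + 1 ≤ g → ∀ z ∈ Ch G (FR B r (k + 1)) q, D z = 0 →
  ∃ y ∈ Ch G (FR B (r + 1) k) q, D y = 0 ∧ Bdy G (FR B r (k + 1)) q (z - TF cm y)

lemma VanFR (hs : ∀ x y, B x y = B y x) {g N : ℕ} (hQ : QS B G g N) (k : ℕ) :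
    ∀ r, (∀ r' k', k' < k → r' + k' + 1 = N → US B G g r' k') → r + k = N → ∀ q, q + N < g →
      Van G (FR B r k) q := by
  induction k with
  | zero => intro r _ h q hq; obtain rfl : r = N := h; exact hQ q hq
  | succ k ih =>
    intro r hU h q hq z hz hD
    obtain ⟨y, hy, hDy, hb⟩ := hU r k (by omega) (by omega) q (by omega) z hz hD
    have := ih (r + 1) (fun r' k' hk h => hU r' k' (by omega) h) (by omega) q hq y hy hDy
    have h2 := hb.add (this.map cm_EF (cm_FR hs))
    rwa [sub_add_cancel] at h2

lemma lift2 (hs : ∀ x y, B x y = B y x) {g r m : ℕ} (h1 : US B G g r (m + 1))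
    (h2 : US B G g (r + 1) m) {q : ℕ} (hq : q + r + m + 2 ≤ g) {z : CC G (V × V) (Cf V)}
    (hz : z ∈ Ch G (FR B r (m + 2)) q) (hD : D z = 0) :
    ∃ y ∈ Ch G (FR B (r + 2) m) q, D y = 0 ∧
      Bdy G (FR B r (m + 2)) q (z - TF (fun y => cm (cm y)) y) := by
  obtain ⟨y, hy, hDy, hb⟩ := h1 q (by omega) z hz hD
  obtain ⟨y', hy', hDy', hb'⟩ := h2 q (by omega) y hy hDy
  refine ⟨y', hy', hDy', ?_⟩
  have h3 := hb.add (hb'.map cm_EF (cm_FR hs))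
  rwa [map_sub, TF_TF, sub_add_sub_cancel] at h3

end Setup

section QStep

set_option linter.unusedSectionVars false

variable {F V : Type} [Field F] [AddCommGroup V] [Module F V] [FiniteDimensional F V]
  {B : V →ₗ[F] V →ₗ[F] F} {G : Type} [Group G] [DistribMulAction G V] (I : IsoG B G)

include I in
lemma depQ {r n q : ℕ} (hn : 1 ≤ n)
    (hV : ∀ m, 1 ≤ m → m < n → Van G (FR B r m) q) {z : CC G (V × V) (Cf V)}
    (hz : z ∈ Ch G {x | x ∈ MQ B r n ∧ ¬ Ind F x.2.2.2} q) (hD : D z = 0) :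
    Bdy G (MQ B r n) q z := by
  refine LabVan (ι := List (List F) × List (List F))
    (A := {x | x ∈ MQ B r n ∧ ¬ Ind F x.2.2.2})
    (fun i y => mlc i.2 (mlc i.1 y.2.2) = y.2.2 ∧ Ind F (mlc i.1 y.2.2) ∧ 1 ≤ i.1.length ∧
      i.1.length < n) ?_ (fun i => FR B r i.1.length)
    (fun i y => (y.1, mlc i.1 y.2.2, [])) (fun i y => (y.1, [], mlc i.2 y.2.1)) ?_ ?_ ?_ ?_ ?_ ?_ hz hD
  · rintro ⟨N, M⟩ g ⟨hl, ws, t⟩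
    simp only [Prod.smul_mk, mlc_smul I, Ind_smul I, smul_left_cancel_iff]
  · rintro ⟨N, M⟩ g ⟨hl, ws, t⟩
    simp only [Prod.smul_mk, mlc_smul I, smul_list_nil]
  · rintro ⟨N, M⟩ g ⟨hl, ws, t⟩
    simp only [Prod.smul_mk, mlc_smul I, smul_list_nil]
  · rintro o ⟨hl, ws, t⟩ ⟨⟨h1, h2, h3, h4⟩, h5⟩
    simp only at h1 h2 h3 h4 h5
    rw [TSet_nn] at h4
    obtain ⟨s, k1, k2, k3, k4, k5⟩ := exists_sel (F := F) Ind.nil t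
    simp only [List.append_nil] at k1 k2 k5
    obtain ⟨N, hN⟩ := exists_mlc (F := F) (t := t) (s := s) (fun x hx => mem_sp (k3 x hx))
    obtain ⟨M, hM⟩ := exists_mlc (F := F) k2
    have hNl : N.length = s.length := by rw [← hN]; simp [mlc]
    refine ⟨(N, M), ?_⟩
    simp only [hN, hM, hNl]
    refine ⟨trivial, k1, ?_, ?_⟩
    · by_contra hc
      have hs0 : s = [] := List.length_eq_zero_iff.1 (by omega)
      cases t with
      | nil => simp at h4; omega
      | cons x t =>
        have hx := k2 x (by simp)
        have : sp F ([] : List V) = ⊥ := by simp [sp]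
        rw [hs0, this, Submodule.mem_bot] at hx
        exact (h4.2.1 x (by simp)).2.1 hx
    · have := k5 h5; omega
  · rintro o ⟨hl, ws, t⟩ ⟨N, M⟩ ⟨⟨h1, h2, h3, h4⟩, h5⟩ ⟨p1, p2, p3, p4⟩
    simp only at h1 h2 h3 h4 h5 p1 p2 p3 p4
    rw [TSet_nn] at h4
    have hsp : ∀ x ∈ mlc N t, x ∈ sp F t := by
      intro x hx
      simp only [mlc, List.mem_map] at hx
      obtain ⟨c, -, rfl⟩ := hx
      exact lc_mem _ _
    refine ⟨⟨rfl, h2, by simp [mlc], h3, ?_, Ok_of_sp h4.2.2 hsp, p2⟩, ?_⟩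
    · intro w hw
      exact (sp_le (fun x hx => (h4.2.1 x hx).1)) (hsp w hw)
    · simp only [p1, h1]
  · rintro ⟨N, M⟩ o ⟨hl, s, t⟩ o' ⟨hl', ws', t'⟩ ⟨⟨h1, h2, h3, h4⟩, h5⟩ ⟨p1, p2, p3, p4⟩ ⟨f1, f2, f3, f4⟩
    simp only at h1 h2 h3 h4 h5 p1 p2 p3 p4 f1 f2 f3 f4
    rw [TSet_nn] at h4
    have hsp : ∀ x ∈ mlc M s, x ∈ sp F s := by
      intro x hx
      simp only [mlc, List.mem_map] at hx
      obtain ⟨c, -, rfl⟩ := hx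
      exact lc_mem _ _
    have hok : Ok B (mlc M s) := Ok_of_sp f4.ok hsp
    refine ⟨rfl, f2, f4.hf, TSet_nn.2 ⟨?_, ?_, hok⟩⟩
    · rw [← h4.1, ← p1]; simp [mlc]
    · intro x hx
      refine ⟨(sp_le f4.up) (hsp x hx), ?_, hok x hx x hx⟩
      simp only [mlc, List.mem_map] at hx
      obtain ⟨c, hc, rfl⟩ := hx
      intro h0
      have h6 := lc_zero f4.ind h0 (s' := mlc N t') (by rw [f3]; simp [mlc])
      have h7 : lc c (mlc N t') ∈ t' := by
        have h8 : lc c (mlc N t') ∈ mlc M (mlc N t') := List.mem_map.2 ⟨c, hc, rfl⟩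
        rwa [p1] at h8
      exact (h4.2.1 _ h7).2.1 h6
  · rintro ⟨N, M⟩ o ⟨hl, ws, t⟩ _ ⟨p1, p2, p3, p4⟩
    exact hV _ p3 p4

lemma killQ_aux {A : Set (Option (V × V) × Cf V)} {q : ℕ} {x a b x' w : CC G (V × V) (Cf V)}
    (hx : Bdy G A q (x - a)) (ha : a = dd x' + D w + b) (hw : w ∈ Ch G A (q + 1)) (hb : Bdy G A q b) :
    ∃ x' y, y ∈ Ch G A (q + 1) ∧ x = dd x' + D y := by
  obtain ⟨w1, h1, h2⟩ := hx
  obtain ⟨w2, h3, h4⟩ := hb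
  refine ⟨x', w1 + w + w2, add_mem (add_mem h1 hw) h3, ?_⟩
  rw [map_add, map_add, h2, h4, ha]; abel

set_option maxHeartbeats 1600000 in
include I in
lemma killQ (hs : ∀ x y, B x y = B y x) (h2 : (2 : F) ≠ 0) {g r m q : ℕ} (hq : q + r + m + 2 ≤ g)
    (hV : ∀ m', 1 ≤ m' → m' < m + 2 → Van G (FR B r m') q)
    (hU1 : US B G g r (m + 1)) (hU2 : US B G g (r + 1) m)
    {z : CC G (V × V) (Cf V)} (hz : z ∈ Ch G (MQ B r (m + 2)) q) (hD : D z = 0) :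
    ∃ x' y, y ∈ Ch G (MQ B r (m + 2)) (q + 1) ∧ z = dd x' + D y := by
  have hP : ∀ (g : G) (y : Cf V), Ind F (g • y).2.2 ↔ Ind F y.2.2 := by
    rintro g ⟨hl, ws, t⟩; exact Ind_smul I g t
  have hz1 := rs_Ch (P := fun y : Cf V => Ind F y.2.2) hz
  have hz2 := rs_Ch (P := fun y : Cf V => ¬ Ind F y.2.2) hz
  have hD1 : D (rs (fun y : Cf V => Ind F y.2.2) z) = 0 := by rw [D_rs hP, hD, map_zero]
  have hD2 : D (rs (fun y : Cf V => ¬ Ind F y.2.2) z) = 0 := by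
    rw [D_rs (P := fun y : Cf V => ¬ Ind F y.2.2) (fun g y => not_congr (hP g y)), hD, map_zero]
  have hb2 := depQ I (by omega) hV hz2 hD2
  set z1 := rs (fun y : Cf V => Ind F y.2.2) z
  have eβ : EF G (fun y : Cf V => ((y.1, y.2.2, []) : Cf V)) := by
    rintro g ⟨hl, ws, t⟩; rfl
  have eκ : EF G (fun y : Cf V => ((y.1, [], y.2.1) : Cf V)) := by
    rintro g ⟨hl, ws, t⟩; rfl
  have hζ : TF (fun y : Cf V => ((y.1, y.2.2, []) : Cf V)) z1 ∈ Ch G (FR B r (m + 2)) q := by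
    refine TF_Ch ?_ hz1
    rintro o ⟨hl, ws, t⟩ ⟨⟨k1, k2, k3, k4⟩, k5⟩
    rw [TSet_nn] at k4
    exact ⟨rfl, k2, k4.1, k3, fun w hw => (k4.2.1 w hw).1, k4.2.2, k5⟩
  have hκA : ∀ (o : Option (V × V)) (y : Cf V), (o, y) ∈ FR B r (m + 2) →
      (o, ((y.1, [], y.2.1) : Cf V)) ∈ MQ B r (m + 2) := by
    rintro o ⟨hl, ws, t⟩ ⟨k1, k2, k3, k4⟩
    exact ⟨rfl, k2, k4.hf, TSet_nn.2 ⟨k3, fun x hx =>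
      ⟨k4.up x hx, k4.ind.ne_zero hx, k4.ok x hx x hx⟩, k4.ok⟩⟩
  obtain ⟨y, hy, hDy, hb⟩ := lift2 hs hU1 hU2 hq hζ (by rw [D_TF eβ, hD1, map_zero])
  have hb' := hb.map eκ hκA
  rw [map_sub, TF_TF, TF_TF, TF_eq_self (A := {x | x ∈ MQ B r (m + 2) ∧ Ind F x.2.2.2})
    (by rintro o ⟨hl, ws, t⟩ ⟨⟨k1, k2, k3, k4⟩, k5⟩; simp only at k1 ⊢; rw [k1]) hz1] at hb'
  have main : ∀ (o : Option (V × V)) (y : Cf V), (o, y) ∈ FR B (r + 2) m →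
      KD B o y.1.tail.tail [] y.2.1 (hd y.1.tail).1 (hd y.1).1 (hd y.1.tail).2 (hd y.1).2 := by
    rintro o ⟨hl, ws, t⟩ ⟨k1, k2, k3, k4⟩
    simp only at k1 k2 k3 k4
    match hl, k2, k4 with
    | a :: b :: hl, k2, k4 =>
      obtain ⟨a1, a2, a3, a4, a5, a6, a7, a8⟩ := k4.rel hs
      obtain ⟨b1, b2, b3, b4, b5, b6, b7, b8⟩ := (k4.cm hs).rel hs
      rw [Up_ins] at a4 a5
      simp only [hd_cons, List.tail_cons]
      refine ⟨b1, a1, a4.1, b2, a2, by rw [hs, b3], a4.2.1, by rw [hs]; exact a5.1, by rw [hs, a3],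
        ⟨sub_mem a4.2.2 b4, b5, a5.2.2⟩, ?_⟩
      intro w hw
      have hw' : w ∈ sp F ws := mem_sp (by simpa using hw)
      have h3 := b7 w (sp_mono' (fun x hx => by simp [hx]) hw')
      have h4 := a7 w hw'
      refine ⟨?_, h3.2.1, h4.2.1⟩
      rw [map_sub, LinearMap.sub_apply, h4.1, h3.1, sub_zero]
  obtain ⟨x', w, R, hw, hR, hDR, hE⟩ := Kill I hs h2 (FR_adm I (r + 2) m)
    (fun y => y.1.tail.tail) (fun _ => []) (fun y => y.2.1) (fun y => (hd y.1.tail).1)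
    (fun y => (hd y.1).1) (fun y => (hd y.1.tail).2) (fun y => (hd y.1).2)
    (A' := MQ B r (m + 2)) (A'' := {x | x ∈ MQ B r (m + 2) ∧ ¬ Ind F x.2.2.2})
    (by rintro g ⟨hl, ws, t⟩; simp [Prod.smul_mk]) (by rintro g ⟨hl, ws, t⟩; rfl)
    (by rintro g ⟨hl, ws, t⟩; rfl) (by rintro g ⟨hl, ws, t⟩; simp [Prod.smul_mk])
    (by rintro g ⟨hl, ws, t⟩; simp [Prod.smul_mk]) (by rintro g ⟨hl, ws, t⟩; simp [Prod.smul_mk])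
    (by rintro g ⟨hl, ws, t⟩; simp [Prod.smul_mk]) main
    (by
      intro o y hy
      exact hκA o _ (cm_FR hs o _ (cm_FR hs o _ hy)))
    (by
      intro o y l hy hl hll
      obtain ⟨j1, j2, j3, j4⟩ := hκA o _ (cm_FR hs o _ (cm_FR hs o _ hy))
      have hyf := cm_FR hs o _ (cm_FR hs o _ hy)
      rw [TSet_nn] at j4
      simp only [cm] at j1 j2 j3 j4 hyf
      have hI := hyf.2.2.2.ind
      simp only at hI
      set a := (hd y.1.tail).1
      set b := (hd y.1).1
      have hsub : ∀ x ∈ l, x ∈ a :: b :: y.2.1 := fun x hx => by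
        have := hl.subset hx; simp [this]
      have hmd : md F a b ∈ sp F [a, b] :=
        Submodule.smul_mem _ _ (add_mem (mem_sp (by simp)) (mem_sp (by simp)))
      have hsp : ∀ x ∈ a :: md F a b :: b :: l, x ∈ sp F (a :: b :: y.2.1) := by
        intro x hx
        simp only [List.mem_cons] at hx
        rcases hx with rfl | rfl | rfl | hx
        · exact mem_sp (by simp)
        · exact sp_mono' (by simp) hmd
        · exact mem_sp (by simp)
        · exact mem_sp (hsub x hx)
      have hok := Ok_of_sp j4.2.2 hsp
      refine ⟨⟨rfl, j2, j3, TSet_nn.2 ⟨?_, ?_, hok⟩⟩, ?_⟩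
      · have := j4.1
        simp only [List.length_cons] at this ⊢
        omega
      · intro x hx
        refine ⟨(sp_le (fun x hx => (j4.2.1 x hx).1)) (hsp x hx), ?_, hok x hx x hx⟩
        simp only [List.mem_cons] at hx
        rcases hx with rfl | rfl | rfl | hx
        · exact (j4.2.1 a (by simp)).2.1
        · intro h0
          have hab : a + b = 0 := by
            have := congrArg (fun v => (2 : F) • v) h0
            simpa [md, smul_smul, h2] using this
          apply hI.notMem
          rw [eq_neg_of_add_eq_zero_left hab]
          exact neg_mem (mem_sp (by simp))
        · exact (j4.2.1 b (by simp)).2.1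
        · exact (j4.2.1 x (hsub x hx)).2.1
      · intro hI2
        have hl2 := rk_lt (F := F) (t := a :: md F a b :: b :: l) (a :: b :: l) (by
          intro x hx
          simp only [List.mem_cons] at hx
          rcases hx with rfl | rfl | rfl | hx
          · exact mem_sp (by simp)
          · exact sp_mono' (by simp) hmd
          · exact mem_sp (by simp)
          · exact mem_sp (by simp [hx])) (by simp)
        exact absurd hI2 (by unfold Ind; exact hl2.ne))
    hy hDy
  refine killQ_aux (a := TF (fun y : Cf V => ((y.1.tail.tail, [], (hd y.1.tail).1 :: (hd y.1).1 :: y.2.1) : Cf V)) y)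
    (b := R) (x' := x') (w := w) ?_ hE hw (depQ I (by omega) hV hR hDR)
  have h5 := hb'.add hb2
  have h6 : z1 + rs (fun y : Cf V => ¬ Ind F y.2.2) z = z :=
    rs_add_not (fun y : Cf V => Ind F y.2.2) z
  rw [sub_add_eq_add_sub, h6] at h5
  exact h5

end QStep

end OStab

namespace OStab

section QEnd

set_option linter.unusedSectionVars false

variable {F V : Type} [Field F] [AddCommGroup V] [Module F V] [FiniteDimensional F V]
  {B : V →ₗ[F] V →ₗ[F] F} {G : Type} [Group G] [DistribMulAction G V] (I : IsoG B G)

variable (B G) in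
/-- Swap statement. -/
def SwapS : Prop := ∀ r q, ∀ z ∈ Ch G (FR B (r + 1) 0) q, D z = 0 →
  Bdy G (FR B r 0) q (TF (fun y : Cf V => ((y.1.tail, [], []) : Cf V)) z)

lemma MQ0 {r : ℕ} : FR B r 0 = MQ B r 0 := by
  ext ⟨o, hl, ws, t⟩
  constructor
  · rintro ⟨h1, h2, h3, h4⟩
    simp only at h1 h2 h3 h4
    subst h1
    refine ⟨List.length_eq_zero_iff.1 h3, h2, h4.hf, TSet_nn.2 ⟨rfl, by simp, ?_⟩⟩
    intro x hx; simp at hx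
  · rintro ⟨h1, h2, h3, h4⟩
    simp only at h1 h2 h3 h4
    subst h1
    rw [TSet_nn] at h4
    refine ⟨List.length_eq_zero_iff.1 h4.1, h2, rfl, h3, by simp, ?_, Ind.nil⟩
    intro x hx; simp at hx

lemma MU0 {r k : ℕ} : FR B r (k + 1) = MU B r k 0 := by
  ext ⟨o, hl, ws, t⟩
  constructor
  · rintro ⟨h1, h2, h3, h4⟩
    simp only at h1 h2 h3 h4
    subst h1
    cases ws with
    | nil => simp at h3
    | cons p ws =>
      refine ⟨p, ws, rfl, by simpa using h3, h2, h4, TSet_nn.2 ⟨rfl, by simp, ?_⟩⟩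
      intro x hx; simp at hx
  · rintro ⟨p, ws', h1, h2, h3, h4, h5⟩
    simp only at h1 h2 h3 h4 h5
    subst h1
    rw [TSet_nn] at h5
    exact ⟨List.length_eq_zero_iff.1 h5.1, h3, by simp [h2], h4⟩

lemma dd_one {A : Set (Option (V × V) × Cf V)} (h : ∀ x ∈ A, x.2.2.2.length = 1) {q : ℕ}
    {u : CC G (V × V) (Cf V)} (hu : u ∈ Ch G A q) :
    dd u = TF (fun y : Cf V => ((y.1, y.2.1, []) : Cf V)) u := by
  refine TY_eq_on ?_ hu
  rintro o ⟨hl, ws, t⟩ hy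
  obtain ⟨x, hx⟩ := List.length_eq_one_iff.1 (h _ hy)
  simp only at hx
  subst hx
  simp [df, d_cons]

include I in
lemma QStep (hs : ∀ x y, B x y = B y x) (h2 : (2 : F) ≠ 0) {g : ℕ}
    (hg : Genus B (⊤ : Submodule F V) g) (hSw : SwapS B G) {N : ℕ}
    (hQ : ∀ N', N < N' → QS B G g N') (hU : ∀ N', N < N' → ∀ r k, r + k + 1 = N' → US B G g r k) :
    QS B G g N := by
  intro q hq z hz hD
  obtain ⟨u, hu, hDu, hdu⟩ := DS dd D (fun n q => Ch G (MQ B N n) q)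
    (fun n q x hx => dd_MQ hx) (fun n q x hx => D_Ch (MQ_adm I N n) hx) (fun n x hx => D_Ch_zero hx)
    dd_dd D_D dd_D (q + 1)
    (fun n q' h x hx hx0 => row_Q hs hg (by omega) hx hx0)
    (by
      intro n q' h hn x hx hx0
      obtain ⟨m, rfl⟩ : ∃ m, n = m + 2 := ⟨n - 2, by omega⟩
      refine killQ I hs h2 (g := g) (by omega) ?_ (hU _ (by omega) _ _ rfl) (hU _ (by omega) _ _ rfl) hx hx0
      intro m' h1 h2'
      exact VanFR hs (hQ (N + m') (by omega)) m' N (fun r' k' _ h => hU (N + m') (by omega) r' k' h) rfl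
        q' (by omega))
    (by
      intro q' x hx
      refine dd_zero ?_ hx
      rintro ⟨o, hl, ws, t⟩ ⟨-, -, -, h4⟩
      exact List.length_eq_zero_iff.1 (TSet_nn.1 h4).1)
    q rfl z (by rwa [← MQ0]) hD
  have eβ : EF G (fun y : Cf V => ((y.1, y.2.2, []) : Cf V)) := by
    rintro g ⟨hl, ws, t⟩; rfl
  have eκ : EF G (fun y : Cf V => ((y.1, [], []) : Cf V)) := by
    rintro g ⟨hl, ws, t⟩; rfl
  have hζ : TF (fun y : Cf V => ((y.1, y.2.2, []) : Cf V)) u ∈ Ch G (FR B N 1) q := by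
    refine TF_Ch (A := MQ B N 1) ?_ hu
    rintro o ⟨hl, ws, t⟩ ⟨k1, k2, k3, k4⟩
    rw [TSet_nn] at k4
    refine ⟨rfl, k2, k4.1, k3, fun w hw => (k4.2.1 w hw).1, k4.2.2, ?_⟩
    obtain ⟨x, hx⟩ := List.length_eq_one_iff.1 k4.1
    simp only at hx
    subst hx
    exact Ind.single (k4.2.1 x (by simp)).2.1
  obtain ⟨y, hy, hDy, hb⟩ := hU (N + 1) (by omega) N 0 rfl q (by omega) _ hζ
    (by rw [D_TF eβ, hDu, map_zero])
  have hb' := hb.map eκ (A' := FR B N 0) (by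
    rintro o ⟨hl, ws, t⟩ ⟨k1, k2, k3, k4⟩
    refine ⟨rfl, k2, rfl, k4.hf, by simp, ?_, Ind.nil⟩
    intro x hx; simp at hx)
  rw [map_sub, TF_TF, TF_TF] at hb'
  have h3 := hb'.add (hSw N q y hy hDy)
  rw [← hdu, dd_one (A := MQ B N 1) (by
    rintro ⟨o, hl, ws, t⟩ ⟨-, -, -, h4⟩
    exact (TSet_nn.1 h4).1) hu]
  have h4 : TF (fun y : Cf V => ((y.1, y.2.1, []) : Cf V)) u
      = TF (fun y : Cf V => ((y.1, [], []) : Cf V)) u := by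
    refine TY_eq_on (A := MQ B N 1) ?_ hu
    rintro o ⟨hl, ws, t⟩ ⟨k1, -⟩
    simp only at k1
    rw [k1]
  rw [h4]
  have h5 := sub_add_cancel (TF (fun y : Cf V => ((y.1, [], []) : Cf V)) u)
    (TF (fun y : Cf V => ((y.1.tail, [], []) : Cf V)) y)
  rw [← h5]
  exact h3

end QEnd

section UStep

set_option linter.unusedSectionVars false

variable {F V : Type} [Field F] [AddCommGroup V] [Module F V] [FiniteDimensional F V]
  {B : V →ₗ[F] V →ₗ[F] F} {G : Type} [Group G] [DistribMulAction G V] (I : IsoG B G)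

/-- Difference vectors. -/
def du (y : Cf V) : List V := y.2.2.tail.map (fun x => x - hd y.2.2) ++ y.2.1.tail

lemma du_EF : EF G (du (V := V)) := by
  rintro g ⟨hl, ws, t⟩
  simp only [du, Prod.smul_mk, hd_smul, tail_smul, smul_list_append]
  congr 1
  simp only [smul_list, List.map_map]
  apply List.map_congr_left
  intro x _
  simp [smul_sub]

lemma map_add_smul (g : G) (a : V) (l : List V) :
    (g • l).map (fun x => g • a + x) = g • l.map (fun x => a + x) := by
  simp [smul_list, smul_add]

/-- Facts on cells of second kind. -/
lemma MU_du (hs : ∀ x y, B x y = B y x) {r k n : ℕ} {o : Option (V × V)} {hl : List (V × V)}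
    {p b : V} {ws t : List V} (h : (o, ((hl, p :: ws, b :: t) : Cf V)) ∈ MU B r k n) {u : List V}
    (hu : ∀ x ∈ u, x ∈ sp F (t.map (fun x => x - b) ++ ws)) (hI : Ind F u) :
    Fr B o ((p, b) :: hl) u := by
  obtain ⟨p', ws', h1, h2, h3, h4, h5⟩ := h
  obtain ⟨rfl, rfl⟩ := List.cons.inj h1
  rw [TSet_nn] at h5
  obtain ⟨h5, h6, h7⟩ := h5
  simp only at h2 h3 h4 h5 h6 h7
  obtain ⟨b1, b2, b3, b4⟩ := h6 b (by simp)
  have hU : ∀ x ∈ t.map (fun x => x - b) ++ ws, x ∈ Up B (o.toList ++ (p, b) :: hl) := by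
    intro x hx
    rw [Up_ins]
    rcases List.mem_append.1 hx with hx | hx
    · obtain ⟨y, hy, rfl⟩ := List.mem_map.1 hx
      obtain ⟨c1, c2, c3, c4⟩ := h6 y (by simp [hy])
      refine ⟨?_, ?_, sub_mem c1 b1⟩
      · simp [c3, b3]
      · simp [b2, h7 b (by simp) y (by simp [hy])]
    · refine ⟨h4.ok p (by simp) x (by simp [hx]), ?_, h4.up x (by simp [hx])⟩
      rw [hs]; exact b4 x hx
  have hO : Ok B (t.map (fun x => x - b) ++ ws) := by
    intro x hx y hy
    rcases List.mem_append.1 hx with hx | hx <;> rcases List.mem_append.1 hy with hy | hy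
    · obtain ⟨x', hx', rfl⟩ := List.mem_map.1 hx
      obtain ⟨y', hy', rfl⟩ := List.mem_map.1 hy
      simp [h7 x' (by simp [hx']) y' (by simp [hy']), h7 x' (by simp [hx']) b (by simp),
        h7 b (by simp) y' (by simp [hy']), b2]
    · obtain ⟨x', hx', rfl⟩ := List.mem_map.1 hx
      rw [hs]
      simp [(h6 x' (by simp [hx'])).2.2.2 y hy, b4 y hy]
    · obtain ⟨y', hy', rfl⟩ := List.mem_map.1 hy
      simp [(h6 y' (by simp [hy'])).2.2.2 x hx, b4 x hx]
    · exact h4.ok x (by simp [hx]) y (by simp [hy])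
  refine ⟨?_, ?_, Ok_of_sp hO hu, hI⟩
  · rw [HF_ins hs]
    exact ⟨h4.ok p (by simp) p (by simp), b2, b3, h4.up p (by simp), b1, h4.hf⟩
  · intro w hw
    exact sp_le hU (hu w hw)

/-- Building cells of second kind. -/
lemma MU_mk (hs : ∀ x y, B x y = B y x) {o : Option (V × V)} {h : V × V} {hl : List (V × V)}
    {u : List V} (hf : Fr B o (h :: hl) u) {ws t : List V} (hws : ∀ x ∈ ws, x ∈ u) (hI : Ind F ws)
    (ht : ∀ x ∈ t, ∃ y ∈ sp F u, x = h.2 + y) :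
    (o, ((hl, h.1 :: ws, t) : Cf V)) ∈ MU B hl.length ws.length t.length := by
  have hf' : Fr B o (h :: hl) ws :=
    ⟨hf.hf, fun w hw => hf.up w (hws w hw), Ok_sub hf.ok hws, hI⟩
  obtain ⟨k1, k2, k3, k4, k5, k6, k7, k8⟩ := hf.rel hs
  refine ⟨h.1, ws, rfl, rfl, rfl, hf'.cm hs, TSet_nn.2 ⟨rfl, ?_, ?_⟩⟩
  · intro x hx
    obtain ⟨y, hy, rfl⟩ := ht x hx
    obtain ⟨y1, y2, y3⟩ := k7 y hy
    refine ⟨add_mem k5 y3, ?_, ?_, ?_⟩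
    · simp [k2, y2, hs y h.2, k8 y hy y hy]
    · simp [k3, y1]
    · intro w hw
      have hw' := mem_sp (F := F) (hws w hw)
      rw [map_add, hs w h.2, (k7 w hw').2.1, k8 w hw' y hy, add_zero]
  · intro x hx x' hx'
    obtain ⟨y, hy, rfl⟩ := ht x hx
    obtain ⟨y', hy', rfl⟩ := ht x' hx'
    simp [k2, (k7 y' hy').2.1, hs y h.2, (k7 y hy).2.1, k8 y hy y' hy']

include I in
lemma depU (hs : ∀ x y, B x y = B y x) {r k n q : ℕ} (hn : 1 ≤ n)
    (hV : ∀ m, m + 2 ≤ n → Van G (FR B (r + 1) (m + k)) q) {z : CC G (V × V) (Cf V)}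
    (hz : z ∈ Ch G {x | x ∈ MU B r k n ∧ ¬ Ind F (du x.2)} q) (hD : D z = 0) :
    Bdy G (MU B r k n) q z := by
  refine LabVan (ι := List (List F) × List (List F))
    (A := {x | x ∈ MU B r k n ∧ ¬ Ind F (du x.2)})
    (fun i y => mlc i.2 (mlc i.1 (du y) ++ y.2.1.tail) = y.2.2.map (fun x => x - hd y.2.2) ∧
      Ind F (mlc i.1 (du y) ++ y.2.1.tail) ∧ i.1.length + 2 ≤ n)
    ?_ (fun i => FR B (r + 1) (i.1.length + k))
    (fun i y => ((hd y.2.1, hd y.2.2) :: y.1, mlc i.1 (du y) ++ y.2.1.tail, []))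
    (fun i y => (y.1.tail, (hd y.1).1 :: y.2.1.drop i.1.length,
      (mlc i.2 y.2.1).map (fun x => (hd y.1).2 + x))) ?_ ?_ ?_ ?_ ?_ ?_ hz hD
  · rintro ⟨N, M⟩ g y
    have h1 := du_EF g y
    obtain ⟨hl, ws, t⟩ := y
    have h2 : (g • t).map (fun x => x - g • hd t) = g • t.map (fun x => x - hd t) := by
      simp [smul_list, smul_sub]
    simp only [h1, mlc_smul I]
    simp only [Prod.smul_mk, tail_smul, hd_smul, ← smul_list_append, mlc_smul I, h2, Ind_smul I,
      smul_left_cancel_iff]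
  · rintro ⟨N, M⟩ g y
    have h1 := du_EF g y
    obtain ⟨hl, ws, t⟩ := y
    simp only [h1, mlc_smul I]
    simp [Prod.smul_mk]
  · rintro ⟨N, M⟩ g ⟨hl, ws, t⟩
    simp only [Prod.smul_mk, mlc_smul I, hd_smul', tail_smul, drop_smul, smul_list_cons]
    rw [← map_add_smul]
    rfl
  · rintro o ⟨hl, ws, t⟩ ⟨h1, h2⟩
    obtain ⟨p, ws', k1, k2, k3, k4, k5⟩ := h1
    simp only at k1 k2 k3 k4 k5
    subst k1
    rw [TSet_nn] at k5
    cases t with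
    | nil => simp at k5; omega
    | cons b t =>
      simp only [du, List.tail_cons, hd_cons] at h2 ⊢
      obtain ⟨s, s1, s2, s3, s4, s5⟩ := exists_sel (F := F) k4.ind.tail (t.map (fun x => x - b))
      obtain ⟨N, hN⟩ := exists_mlc (F := F) (t := t.map (fun x => x - b) ++ ws') (s := s)
        (fun x hx => mem_sp (by simp only [List.mem_append]; exact Or.inl (s3 x hx)))
      obtain ⟨M, hM⟩ := exists_mlc (F := F) (t := s ++ ws') (s := (b :: t).map (fun x => x - b)) (by
        intro x hx
        simp only [List.map_cons, List.mem_cons, sub_self] at hx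
        rcases hx with rfl | hx
        · exact zero_mem _
        · exact s2 x hx)
      have hNl : N.length = s.length := by rw [← hN]; simp [mlc]
      refine ⟨(N, M), ?_⟩
      simp only [hN, hM]
      refine ⟨trivial, s1, ?_⟩
      have := s5 h2
      have h6 := k5.1
      simp at this h6
      omega
  · rintro o ⟨hl, ws, t⟩ ⟨N, M⟩ ⟨h1, h2⟩ ⟨p1, p2, p3⟩
    have h1' := h1
    obtain ⟨p, ws', k1, k2, k3, k4, k5⟩ := h1
    simp only at k1 k2 k3 k4 k5
    subst k1
    rw [TSet_nn] at k5
    cases t with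
    | nil => simp at k5; omega
    | cons b t =>
      simp only [du, List.tail_cons, hd_cons] at p1 p2 p3 h2 ⊢
      have hl1 : (mlc N (t.map (fun x => x - b) ++ ws')).length = N.length := by simp [mlc]
      refine ⟨⟨rfl, by simp [k3], by simp [hl1, k2], MU_du hs h1' ?_ p2⟩, ?_⟩
      · intro x hx
        rcases List.mem_append.1 hx with hx | hx
        · simp only [mlc, List.mem_map] at hx
          obtain ⟨c, -, rfl⟩ := hx
          exact lc_mem _ _
        · exact mem_sp (by simp [hx])
      · rw [p1, ← hl1, List.drop_left]
        simp [Function.comp_def]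
  · rintro ⟨N, M⟩ o ⟨hl, u, t⟩ o' ⟨hl', ws', t'⟩ ⟨h1, h2⟩ ⟨p1, p2, p3⟩ ⟨f1, f2, f3, f4⟩
    simp only at f1 f2 f3 f4
    cases hl with
    | nil => simp at f2
    | cons h hl =>
      have hML : M.length = n := by
        obtain ⟨p, ws', k1, k2, k3, k4, k5⟩ := h1
        have h3 := congrArg List.length p1
        have h4 := (TSet_nn.1 k5).1
        simp [mlc] at h3 h4
        omega
      have := MU_mk hs f4 (ws := u.drop N.length) (t := (mlc M u).map (fun x => h.2 + x))
        (fun x hx => List.mem_of_mem_drop hx) (f4.ind.drop _) (by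
          intro x hx
          simp only [mlc, List.mem_map] at hx
          obtain ⟨a, ⟨c, -, rfl⟩, rfl⟩ := hx
          exact ⟨_, lc_mem _ _, rfl⟩)
      simp only [List.length_cons] at f2
      have e1 : hl.length = r := by omega
      have e2 : (u.drop N.length).length = k := by simp [f3]
      have e3 : ((mlc M u).map (fun x => h.2 + x)).length = n := by simp [mlc, hML]
      rw [e1, e2, e3] at this
      exact this
  · rintro ⟨N, M⟩ o ⟨hl, ws, t⟩ _ ⟨p1, p2, p3⟩
    exact hV _ p3

end UStep

end OStab

namespace OStab

section KillU

set_option linter.unusedSectionVars false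

variable {F V : Type} [Field F] [AddCommGroup V] [Module F V] [FiniteDimensional F V]
  {B : V →ₗ[F] V →ₗ[F] F} {G : Type} [Group G] [DistribMulAction G V] (I : IsoG B G)

include I in
lemma splitU (hs : ∀ x y, B x y = B y x) {r k n q : ℕ} (hn : 1 ≤ n)
    (hV : ∀ m, m + 2 ≤ n → Van G (FR B (r + 1) (m + k)) q) {z : CC G (V × V) (Cf V)}
    (hz : z ∈ Ch G (MU B r k n) q) (hD : D z = 0) :
    ∃ z1 ∈ Ch G {x | x ∈ MU B r k n ∧ Ind F (du x.2)} q, D z1 = 0 ∧ Bdy G (MU B r k n) q (z - z1) := by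
  have hP : ∀ (g : G) (y : Cf V), Ind F (du (g • y)) ↔ Ind F (du y) := by
    intro g y; rw [du_EF g y]; exact Ind_smul I g _
  have hz1 := rs_Ch (P := fun y : Cf V => Ind F (du y)) hz
  have hz2 := rs_Ch (P := fun y : Cf V => ¬ Ind F (du y)) hz
  have hD1 : D (rs (fun y : Cf V => Ind F (du y)) z) = 0 := by rw [D_rs hP, hD, map_zero]
  have hD2 : D (rs (fun y : Cf V => ¬ Ind F (du y)) z) = 0 := by
    rw [D_rs (P := fun y : Cf V => ¬ Ind F (du y)) (fun g y => not_congr (hP g y)), hD, map_zero]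
  have hb2 := depU I hs hn hV hz2 hD2
  refine ⟨_, hz1, hD1, ?_⟩
  have h6 : rs (fun y : Cf V => Ind F (du y)) z + rs (fun y : Cf V => ¬ Ind F (du y)) z = z :=
    rs_add_not (fun y : Cf V => Ind F (du y)) z
  rwa [show z - rs (fun y : Cf V => Ind F (du y)) z = rs (fun y : Cf V => ¬ Ind F (du y)) z by
    rw [sub_eq_iff_eq_add', h6]]

lemma MU_perm {r k n : ℕ} {o : Option (V × V)} {hl : List (V × V)} {ws t t' : List V}
    (h : (o, ((hl, ws, t) : Cf V)) ∈ MU B r k n) (hp : t.Perm t') :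
    (o, ((hl, ws, t') : Cf V)) ∈ MU B r k n := by
  obtain ⟨p, ws', h1, h2, h3, h4, h5⟩ := h
  rw [TSet_nn] at h5
  refine ⟨p, ws', h1, h2, h3, h4, TSet_nn.2 ⟨?_, ?_, ?_⟩⟩
  · rw [← h5.1]; exact hp.length_eq.symm
  · intro x hx; exact h5.2.1 x (hp.mem_iff.2 hx)
  · exact Ok_sub h5.2.2 (fun x hx => hp.mem_iff.2 hx)

set_option maxHeartbeats 1600000 in
include I in
lemma killU2 (hs : ∀ x y, B x y = B y x) (h2 : (2 : F) ≠ 0) {g r k q : ℕ} (hq : q + r + k + 2 ≤ g)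
    (hV : ∀ m, m + 2 ≤ 2 → Van G (FR B (r + 1) (m + k)) q)
    (hU1 : US B G g (r + 1) k)
    {z : CC G (V × V) (Cf V)} (hz : z ∈ Ch G (MU B r k 2) q) (hD : D z = 0) :
    ∃ x' y, y ∈ Ch G (MU B r k 2) (q + 1) ∧ z = dd x' + D y := by
  obtain ⟨z1, hz1, hD1, hb2⟩ := splitU I hs (by omega) hV hz hD
  have eβ : EF G (fun y : Cf V => (((hd y.2.1, hd y.2.2) :: y.1, du y, []) : Cf V)) := by
    intro g y
    have h1 := du_EF g y
    obtain ⟨hl, ws, t⟩ := y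
    simp only [h1]
    simp [Prod.smul_mk]
  have eκ : EF G (fun y : Cf V => ((y.1.tail, (hd y.1).1 :: y.2.1.tail,
      [(hd y.1).2, (hd y.1).2 + hd y.2.1]) : Cf V)) := by
    rintro g ⟨hl, ws, t⟩
    simp [Prod.smul_mk, smul_add]
  have hcase : ∀ (o : Option (V × V)) (y : Cf V), (o, y) ∈ MU B r k 2 →
      ∃ hl p ws t1 t2, y = (hl, p :: ws, [t1, t2]) ∧ ws.length = k ∧ hl.length = r := by
    rintro o ⟨hl, ws, t⟩ ⟨p, ws', k1, k2, k3, k4, k5⟩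
    simp only at k1 k2 k3 k4 k5
    subst k1
    obtain ⟨t1, t2, rfl⟩ := List.length_eq_two.1 (TSet_nn.1 k5).1
    exact ⟨hl, p, ws', t1, t2, rfl, k2, k3⟩
  have hζ : TF (fun y : Cf V => (((hd y.2.1, hd y.2.2) :: y.1, du y, []) : Cf V)) z1
      ∈ Ch G (FR B (r + 1) (k + 1)) q := by
    refine TF_Ch ?_ hz1
    rintro o y ⟨k1, k2⟩
    obtain ⟨hl, p, ws, t1, t2, rfl, l1, l2⟩ := hcase o y k1
    simp only [du, List.tail_cons, hd_cons] at k2 ⊢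
    refine ⟨rfl, by simp [l2], by simp [l1, add_comm], MU_du hs k1 (fun x hx => mem_sp hx) k2⟩
  have hκA : ∀ (o : Option (V × V)) (y : Cf V), (o, y) ∈ FR B (r + 1) (k + 1) →
      (o, ((y.1.tail, (hd y.1).1 :: y.2.1.tail,
      [(hd y.1).2, (hd y.1).2 + hd y.2.1]) : Cf V)) ∈ MU B r k 2 := by
    rintro o ⟨hl, ws, t⟩ ⟨k1, k2, k3, k4⟩
    simp only at k1 k2 k3 k4
    match hl, ws, k2, k3, k4 with
    | h :: hl, w :: ws, k2, k3, k4 =>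
      have := MU_mk hs k4 (ws := ws) (t := [h.2, h.2 + w]) (fun x hx => by simp [hx]) k4.ind.tail
        (by
          intro x hx
          simp only [List.mem_cons, List.not_mem_nil, or_false] at hx
          rcases hx with rfl | rfl
          · exact ⟨0, zero_mem _, by simp⟩
          · exact ⟨w, mem_sp (by simp), rfl⟩)
      simp only [List.length_cons, add_left_inj] at k2 k3
      rw [k2, k3] at this
      exact this
  obtain ⟨y, hy, hDy, hb⟩ := hU1 q (by omega) _ hζ (by rw [D_TF eβ, hD1, map_zero])
  have hb' := hb.map eκ hκA
  rw [map_sub, TF_TF, TF_TF, TF_eq_self (A := {x | x ∈ MU B r k 2 ∧ Ind F (du x.2)})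
    (by
      rintro o y ⟨k1, k2⟩
      obtain ⟨hl, p, ws, t1, t2, rfl, l1, l2⟩ := hcase o y k1
      simp [du]) hz1] at hb'
  obtain ⟨x', w, R, hw, hR, hDR, hE⟩ := Kill I hs h2 (FR_adm I (r + 2) k)
    (fun y => y.1.tail.tail) (fun y => (hd y.1.tail).1 :: y.2.1) (fun _ => [])
    (fun y => (hd y.1.tail).2)
    (fun y => (hd y.1.tail).2 + (hd y.1).1) (fun y => (hd y.1.tail).1 - (hd y.1).2) (fun y => (hd y.1).2)
    (A' := MU B r k 2) (A'' := ∅)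
    (by rintro g ⟨hl, ws, t⟩; simp [Prod.smul_mk]) (by rintro g ⟨hl, ws, t⟩; simp [Prod.smul_mk])
    (by rintro g ⟨hl, ws, t⟩; rfl) (by rintro g ⟨hl, ws, t⟩; simp [Prod.smul_mk])
    (by rintro g ⟨hl, ws, t⟩; simp [Prod.smul_mk, smul_add])
    (by rintro g ⟨hl, ws, t⟩; simp [Prod.smul_mk, smul_sub])
    (by rintro g ⟨hl, ws, t⟩; simp [Prod.smul_mk])
    (by
      rintro o ⟨hl, ws, t⟩ ⟨k1, k2, k3, k4⟩
      simp only at k1 k2 k3 k4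
      match hl, k2, k4 with
      | a :: b :: hl, k2, k4 =>
        obtain ⟨a1, a2, a3, a4, a5, a6, a7, a8⟩ := k4.rel hs
        obtain ⟨b1, b2, b3, b4, b5, b6, b7, b8⟩ := (k4.cm hs).rel hs
        rw [Up_ins] at a4 a5
        obtain ⟨c1, c2, c3⟩ := a4
        obtain ⟨d1, d2, d3⟩ := a5
        have b3' : B b.2 b.1 = 1 := by rw [hs, b3]
        have a3' : B a.2 a.1 = 1 := by rw [hs, a3]
        have c1' : B a.1 b.1 = 0 := by rw [hs, c1]
        have c2' : B a.1 b.2 = 0 := by rw [hs, c2]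
        have d1' : B a.2 b.1 = 0 := by rw [hs, d1]
        have d2' : B a.2 b.2 = 0 := by rw [hs, d2]
        simp only [hd_cons, List.tail_cons]
        refine ⟨b2, ?_, ?_, ?_, a2, ?_, ?_, ?_, ?_, ⟨?_, sub_mem b4 d3, d3⟩, ?_⟩
        · simp [*]
        · simp [*]
        · simp [*]
        · simp [*]
        · simp [*]
        · simp [*]
        · simp [*]
        · rw [add_sub_cancel_left]; exact c3
        · intro w hw
          simp only [List.append_nil, List.mem_cons] at hw
          rcases hw with rfl | hw
          · simp [*]
          · have h3 := b7 w (mem_sp (by simp [hw]))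
            have h4 := a7 w (mem_sp hw)
            simp [h3.1, h3.2.1, h4.1, h4.2.1])
    (by
      intro o y hy
      exact hκA o _ (cm_FR hs o _ hy))
    (by
      intro o y l hy hl hll
      simp at hll)
    hy hDy
  refine killQ_aux (b := R) (x' := x') (w := w) ?_ hE hw ?_
  · have h5 := hb2.add hb'
    rw [sub_add_sub_cancel] at h5
    exact h5
  · have : R ∈ Ch G {x | x ∈ MU B r k 2 ∧ ¬ Ind F (du x.2)} q := Ch_mono (Set.empty_subset _) q hR
    exact depU I hs (by omega) hV this hDR

end KillU

end OStab

namespace OStab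

section KillU3

set_option linter.unusedSectionVars false

variable {F V : Type} [Field F] [AddCommGroup V] [Module F V] [FiniteDimensional F V]
  {B : V →ₗ[F] V →ₗ[F] F} {G : Type} [Group G] [DistribMulAction G V] (I : IsoG B G)

/-- Encoding map based at the third vertex. -/
def bt (y : Cf V) : Cf V :=
  ((hd y.2.1, hd (y.2.2.drop 2)) :: y.1,
    (hd y.2.2 - hd (y.2.2.drop 2)) :: (hd y.2.2.tail - hd (y.2.2.drop 2)) ::
      ((y.2.2.drop 3).map (fun x => x - hd (y.2.2.drop 2)) ++ y.2.1.tail), [])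

/-- Decoding map. -/
def kp (m : ℕ) (y : Cf V) : Cf V :=
  (y.1.tail, (hd y.1).1 :: y.2.1.drop (m + 2),
    ((hd y.1).2 + hd y.2.1) :: ((hd y.1).2 + hd y.2.1.tail) :: (hd y.1).2 ::
      ((y.2.1.drop 2).take m).map (fun x => (hd y.1).2 + x))

lemma bt_EF : EF G (bt (V := V)) := by
  rintro g ⟨hl, ws, t⟩
  have h2 : ∀ (a : V) (t : List V), (g • t).map (fun x => x - g • a) = g • t.map (fun x => x - a) := by
    intro a t
    simp [smul_list, smul_sub]
  simp [bt, Prod.smul_mk, smul_sub, h2]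

lemma kp_EF (m : ℕ) : EF G (kp (V := V) m) := by
  rintro g ⟨hl, ws, t⟩
  simp [kp, Prod.smul_mk, smul_add, map_add_smul]

lemma kp_MU (hs : ∀ x y, B x y = B y x) {r k m : ℕ} (o : Option (V × V)) (y : Cf V)
    (h : (o, y) ∈ FR B (r + 1) (k + m + 2)) : (o, kp m y) ∈ MU B r k (m + 3) := by
  obtain ⟨hl, ws, t⟩ := y
  obtain ⟨k1, k2, k3, k4⟩ := h
  simp only at k1 k2 k3 k4
  match hl, ws, k2, k3, k4 with
  | h :: hl, a :: b :: ws, k2, k3, k4 =>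
    have := MU_mk hs k4 (ws := ws.drop m)
      (t := (h.2 + a) :: (h.2 + b) :: h.2 :: (ws.take m).map (fun x => h.2 + x))
      (fun x hx => by simp [List.mem_of_mem_drop hx]) (k4.ind.tail.tail.drop m)
      (by
        intro x hx
        simp only [List.mem_cons, List.mem_map] at hx
        rcases hx with rfl | rfl | rfl | ⟨y, hy, rfl⟩
        · exact ⟨a, mem_sp (by simp), rfl⟩
        · exact ⟨b, mem_sp (by simp), rfl⟩
        · exact ⟨0, zero_mem _, by simp⟩
        · exact ⟨y, mem_sp (by simp [List.mem_of_mem_take hy]), rfl⟩)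
    simp only [List.length_cons, List.length_drop, List.length_map, List.length_take,
      add_left_inj] at k2 k3 this
    have e1 : ws.length - m = k := by omega
    have e2 : min m ws.length + 1 + 1 + 1 = m + 3 := by omega
    rw [k2, e1, e2] at this
    exact this

set_option maxHeartbeats 1600000 in
include I in
lemma killU3 (hs : ∀ x y, B x y = B y x) (h2 : (2 : F) ≠ 0) {g r k m q : ℕ}
    (hq : q + r + k + m + 3 ≤ g)
    (hV : ∀ m', m' + 2 ≤ m + 3 → Van G (FR B (r + 1) (m' + k)) q)
    (hU1 : US B G g (r + 1) (k + m + 1)) (hU2 : US B G g (r + 2) (k + m))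
    {z : CC G (V × V) (Cf V)} (hz : z ∈ Ch G (MU B r k (m + 3)) q) (hD : D z = 0) :
    ∃ x' y, y ∈ Ch G (MU B r k (m + 3)) (q + 1) ∧ z = dd x' + D y := by
  obtain ⟨z1, hz1, hD1, hb2⟩ := splitU I hs (by omega) hV hz hD
  have hcase : ∀ (o : Option (V × V)) (y : Cf V), (o, y) ∈ MU B r k (m + 3) →
      ∃ hl p ws t1 t2 b t, y = (hl, p :: ws, t1 :: t2 :: b :: t) ∧ ws.length = k ∧ hl.length = r ∧
        t.length = m := by
    rintro o ⟨hl, ws, t⟩ ⟨p, ws', k1, k2, k3, k4, k5⟩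
    simp only at k1 k2 k3 k4 k5
    subst k1
    have := (TSet_nn.1 k5).1
    match t, this with
    | t1 :: t2 :: b :: t, this =>
      exact ⟨hl, p, ws', t1, t2, b, t, rfl, k2, k3, by simpa using this⟩
  have hζ : TF bt z1 ∈ Ch G (FR B (r + 1) (k + m + 2)) q := by
    refine TF_Ch ?_ hz1
    rintro o y ⟨k1, k2⟩
    obtain ⟨hl, p, ws, t1, t2, b, t, rfl, l1, l2, l3⟩ := hcase o y k1
    simp only [du, List.tail_cons, hd_cons, List.map_cons, List.cons_append] at k2
    have k1' := MU_perm k1 (t' := b :: t1 :: t2 :: t) (by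
      refine List.Perm.trans ?_ (List.Perm.swap _ _ _)
      exact List.Perm.cons _ (List.Perm.swap _ _ _))
    refine ⟨rfl, by simp [bt, l2], by simp [bt, l1, l3]; omega, MU_du hs k1' (fun x hx => ?_) (k2.congr ?_ ?_)⟩
    · exact mem_sp hx
    · simp [bt]
    · have m1 : t1 - b ∈ sp F ((t1 - b) :: (t2 - b) :: (t.map (fun x => x - b) ++ ws)) := mem_sp (by simp)
      have m2 : t2 - b ∈ sp F ((t1 - b) :: (t2 - b) :: (t.map (fun x => x - b) ++ ws)) := mem_sp (by simp)
      intro x hx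
      simp only [List.mem_cons, List.mem_append, List.mem_map] at hx
      show x ∈ sp F ((t1 - b) :: (t2 - b) :: (t.map (fun x => x - b) ++ ws))
      rcases hx with rfl | rfl | ⟨y, hy, rfl⟩ | hx
      · rw [show t2 - t1 = (t2 - b) - (t1 - b) by abel]; exact sub_mem m2 m1
      · rw [show b - t1 = - (t1 - b) by abel]; exact neg_mem m1
      · rw [show y - t1 = (y - b) - (t1 - b) by abel]
        refine sub_mem (mem_sp ?_) m1
        simp only [List.mem_cons, List.mem_append, List.mem_map]
        exact Or.inr (Or.inr (Or.inl ⟨y, hy, rfl⟩))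
      · exact mem_sp (by simp [hx])
  obtain ⟨y, hy, hDy, hb⟩ := lift2 hs hU1 hU2 (by omega) hζ (by rw [D_TF bt_EF, hD1, map_zero])
  have hb' := hb.map (kp_EF m) (kp_MU hs (r := r) (k := k))
  rw [map_sub, TF_TF, TF_TF, TF_eq_self (A := {x | x ∈ MU B r k (m + 3) ∧ Ind F (du x.2)})
    (by
      rintro o y ⟨k1, k2⟩
      obtain ⟨hl, p, ws, t1, t2, b, t, rfl, l1, l2, l3⟩ := hcase o y k1
      simp [bt, kp, ← l3, Function.comp_def]) hz1] at hb'
  obtain ⟨x', w, R, hw, hR, hDR, hE⟩ := Kill I hs h2 (FR_adm I (r + 3) (k + m))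
    (fun y => y.1.tail.tail.tail) (fun y => (hd y.1.tail.tail).1 :: y.2.1.drop m)
    (fun y => (hd y.1.tail.tail).2 :: (y.2.1.take m).map (fun x => (hd y.1.tail.tail).2 + x))
    (fun y => (hd y.1.tail.tail).2 + (hd y.1.tail).1)
    (fun y => (hd y.1.tail.tail).2 + (hd y.1).1) (fun y => (hd y.1.tail).2) (fun y => (hd y.1).2)
    (A' := MU B r k (m + 3)) (A'' := {x | x ∈ MU B r k (m + 3) ∧ ¬ Ind F (du x.2)})
    (by rintro g ⟨hl, ws, t⟩; simp [Prod.smul_mk]) (by rintro g ⟨hl, ws, t⟩; simp [Prod.smul_mk])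
    (by rintro g ⟨hl, ws, t⟩; simp [Prod.smul_mk, map_add_smul])
    (by rintro g ⟨hl, ws, t⟩; simp [Prod.smul_mk, smul_add])
    (by rintro g ⟨hl, ws, t⟩; simp [Prod.smul_mk, smul_add])
    (by rintro g ⟨hl, ws, t⟩; simp [Prod.smul_mk])
    (by rintro g ⟨hl, ws, t⟩; simp [Prod.smul_mk])
    (by
      rintro o ⟨hl, ws, t⟩ ⟨k1, k2, k3, k4⟩
      simp only at k1 k2 k3 k4
      match hl, k2, k4 with
      | a :: b :: c :: hl, k2, k4 =>
        obtain ⟨a1, a2, a3, a4, a5, a6, a7, a8⟩ := k4.rel hs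
        obtain ⟨b1, b2, b3, b4, b5, b6, b7, b8⟩ := (k4.cm hs).rel hs
        obtain ⟨c1, c2, c3, c4, c5, c6, c7, c8⟩ := ((k4.cm hs).cm hs).rel hs
        rw [Up_ins, Up_ins] at a4 a5
        rw [Up_ins] at b4 b5
        obtain ⟨d1, d2, d3, d4, d5⟩ := a4
        obtain ⟨e1, e2, e3, e4, e5⟩ := a5
        obtain ⟨f1, f2, f3⟩ := b4
        obtain ⟨g1, g2, g3⟩ := b5
        have a3' : B a.2 a.1 = 1 := by rw [hs, a3]
        have b3' : B b.2 b.1 = 1 := by rw [hs, b3]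
        have d1' : B a.1 b.1 = 0 := by rw [hs, d1]
        have d2' : B a.1 b.2 = 0 := by rw [hs, d2]
        have d3' : B a.1 c.1 = 0 := by rw [hs, d3]
        have d4' : B a.1 c.2 = 0 := by rw [hs, d4]
        have e1' : B a.2 b.1 = 0 := by rw [hs, e1]
        have e2' : B a.2 b.2 = 0 := by rw [hs, e2]
        have e3' : B a.2 c.1 = 0 := by rw [hs, e3]
        have e4' : B a.2 c.2 = 0 := by rw [hs, e4]
        have f1' : B b.1 c.1 = 0 := by rw [hs, f1]
        have f2' : B b.1 c.2 = 0 := by rw [hs, f2]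
        have g1' : B b.2 c.1 = 0 := by rw [hs, g1]
        have g2' : B b.2 c.2 = 0 := by rw [hs, g2]
        simp only [hd_cons, List.tail_cons]
        refine ⟨?_, ?_, ?_, b2, a2, ?_, ?_, ?_, ?_, ⟨?_, g3, e5⟩, ?_⟩
        · simp [*]
        · simp [*]
        · simp [*]
        · simp [*]
        · simp [*]
        · simp [*]
        · simp [*]
        · rw [add_sub_add_left_eq_sub]; exact sub_mem d5 f3
        · intro w hw
          have hu : ∀ w ∈ ws, B b.1 w = 0 ∧ B b.2 w = 0 ∧ B a.1 w = 0 ∧ B a.2 w = 0 := by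
            intro w hw
            have h3 := b7 w (mem_sp (by simp [hw]))
            have h4 := a7 w (mem_sp hw)
            exact ⟨h3.1, h3.2.1, h4.1, h4.2.1⟩
          simp only [List.cons_append, List.mem_cons, List.mem_append, List.mem_map] at hw
          rcases hw with rfl | hw | rfl | ⟨x, hx, rfl⟩
          · simp [*]
          · obtain ⟨i1, i2, i3, i4⟩ := hu w (List.mem_of_mem_drop hw)
            simp [i1, i2, i3, i4]
          · simp [*]
          · obtain ⟨i1, i2, i3, i4⟩ := hu x (List.mem_of_mem_take hx)
            simp [i1, i2, i3, i4, f2', d4', g2', e4'])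
    (by
      intro o y hy
      exact kp_MU hs o _ (cm_FR hs o _ (cm_FR hs o _ hy)))
    (by
      intro o y l hy hl hll
      have hF := cm_FR hs o _ (cm_FR hs o _ hy)
      obtain ⟨hL, ws, t⟩ := y
      simp only [cm] at hF hl hll ⊢
      obtain ⟨k1, k2, k3, k4⟩ := hF
      simp only at k1 k2 k3 k4
      obtain ⟨-, k2', k3', -⟩ := hy
      simp only at k2' k3'
      match hL, k2', k4, k2, hl, hll with
      | a :: b :: c :: hL, k2', k4, k2, hl, hll =>
        simp only [hd_cons, List.tail_cons] at k4 hl hll ⊢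
        have hmd : md F (c.2 + b.1) (c.2 + a.1) = c.2 + (2 : F)⁻¹ • (b.1 + a.1) := by
          have : c.2 = (2 : F)⁻¹ • (c.2 + c.2) := by rw [← two_smul F, smul_smul, inv_mul_cancel₀ h2, one_smul]
          conv_rhs => rw [this]
          rw [md, ← smul_add]; congr 1; abel
        constructor
        · have := MU_mk hs k4 (ws := ws.drop m)
            (t := (c.2 + b.1) :: md F (c.2 + b.1) (c.2 + a.1) :: (c.2 + a.1) :: l)
            (fun x hx => by simp [List.mem_of_mem_drop hx]) (k4.ind.tail.tail.drop m)
            (by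
              intro x hx
              simp only [List.mem_cons] at hx
              rcases hx with rfl | rfl | rfl | hx
              · exact ⟨b.1, mem_sp (by simp), rfl⟩
              · exact ⟨_, Submodule.smul_mem _ _ (add_mem (mem_sp (by simp)) (mem_sp (by simp))), hmd⟩
              · exact ⟨a.1, mem_sp (by simp), rfl⟩
              · have := hl.subset hx
                simp only [List.mem_cons, List.mem_map] at this
                rcases this with rfl | ⟨y, hy, rfl⟩
                · exact ⟨0, zero_mem _, by simp⟩
                · exact ⟨y, mem_sp (by simp [List.mem_of_mem_take hy]), rfl⟩)
          simp only [List.length_cons, List.length_drop, List.length_map, List.length_take] at k2' hll this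
          have e0 : hL.length = r := by omega
          have e1 : ws.length - m = k := by omega
          have e2 : l.length + 1 + 1 + 1 = m + 3 := by omega
          rw [e0, e1, e2] at this
          exact this
        · intro hI2
          simp only [du, hd_cons, List.tail_cons, List.map_cons, List.cons_append] at hI2
          apply hI2.notMem
          rw [show md F (c.2 + b.1) (c.2 + a.1) - (c.2 + b.1)
            = (2 : F)⁻¹ • ((c.2 + a.1) - (c.2 + b.1)) by
              rw [hmd, ← sub_eq_zero]
              have : b.1 = (2 : F)⁻¹ • (b.1 + b.1) := by
                rw [← two_smul F, smul_smul, inv_mul_cancel₀ h2, one_smul]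
              have h3 : (2 : F)⁻¹ • (b.1 + a.1) = b.1 + (2 : F)⁻¹ • (a.1 - b.1) := by
                conv_rhs => rw [this, ← smul_add]
                rw [← this]; congr 1; abel
              rw [h3, add_sub_add_left_eq_sub]; abel]
          exact Submodule.smul_mem _ _ (mem_sp (by simp)))
    hy hDy
  refine killQ_aux (b := R) (x' := x') (w := w) ?_ hE hw (depU I hs (by omega) hV hR hDR)
  have h5 := hb2.add hb'
  rw [sub_add_sub_cancel] at h5
  exact h5

end KillU3

end OStab

namespace OStab

section Main

set_option linter.unusedSectionVars false

variable {F V : Type} [Field F] [AddCommGroup V] [Module F V] [FiniteDimensional F V]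
  {B : V →ₗ[F] V →ₗ[F] F} {G : Type} [Group G] [DistribMulAction G V] (I : IsoG B G)

include I in
lemma UStep (hs : ∀ x y, B x y = B y x) (h2 : (2 : F) ≠ 0) (hN : ND B (⊤ : Submodule F V)) {g : ℕ}
    (hg : Genus B (⊤ : Submodule F V) g) {r k : ℕ} (hQ0 : QS B G g (r + k + 1))
    (hU0 : ∀ r' k', k' < k → r' + k' + 1 = r + k + 1 → US B G g r' k')
    (hQ : ∀ N', r + k + 1 < N' → QS B G g N')
    (hU : ∀ N', r + k + 1 < N' → ∀ r k, r + k + 1 = N' → US B G g r k) :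
    US B G g r k := by
  intro q hq z hz hD
  have hV : ∀ n q', n + q' = q + 1 → ∀ m, m + 2 ≤ n → Van G (FR B (r + 1) (m + k)) q' := by
    intro n q' h m hm
    rcases Nat.eq_zero_or_pos m with rfl | hm0
    · rw [Nat.zero_add]
      exact VanFR hs hQ0 k (r + 1) hU0 (by omega) q' (by omega)
    · exact VanFR hs (hQ (r + k + 1 + m) (by omega)) (m + k) (r + 1)
        (fun r' k' _ h => hU (r + k + 1 + m) (by omega) r' k' h) (by omega) q' (by omega)
  obtain ⟨u, hu, hDu, hdu⟩ := DS dd D (fun n q => Ch G (MU B r k n) q)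
    (fun n q x hx => dd_MU hx) (fun n q x hx => D_Ch (MU_adm I r k n) hx) (fun n x hx => D_Ch_zero hx)
    dd_dd D_D dd_D (q + 1)
    (fun n q' h x hx hx0 => row_U hs h2 hN hg (by omega) hx hx0)
    (by
      intro n q' h hn x hx hx0
      rcases Nat.lt_or_ge 2 n with hn2 | hn2
      · obtain ⟨m, rfl⟩ : ∃ m, n = m + 3 := ⟨n - 3, by omega⟩
        exact killU3 I hs h2 (g := g) (by omega) (hV _ _ h) (hU _ (by omega) _ _ rfl)
          (hU _ (by omega) _ _ rfl) hx hx0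
      · obtain rfl : n = 2 := by omega
        exact killU2 I hs h2 (g := g) (by omega) (hV _ _ h) (hU _ (by omega) _ _ rfl) hx hx0)
    (by
      intro q' x hx
      refine dd_zero ?_ hx
      rintro ⟨o, hl, ws, t⟩ ⟨p, ws', -, -, -, -, h4⟩
      exact List.length_eq_zero_iff.1 (TSet_nn.1 h4).1)
    q rfl z (by rwa [← MU0]) hD
  have eβ : EF G (fun y : Cf V => (((hd y.2.1, hd y.2.2) :: y.1, y.2.1.tail, []) : Cf V)) := by
    rintro g ⟨hl, ws, t⟩; simp [Prod.smul_mk]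
  refine ⟨TF (fun y : Cf V => (((hd y.2.1, hd y.2.2) :: y.1, y.2.1.tail, []) : Cf V)) u, ?_, ?_, ?_⟩
  · refine TF_Ch (A := MU B r k 1) ?_ hu
    rintro o ⟨hl, ws, t⟩ h
    have h' := h
    obtain ⟨p, ws', k1, k2, k3, k4, k5⟩ := h
    simp only at k1 k2 k3 k4 k5
    subst k1
    obtain ⟨b, rfl⟩ := List.length_eq_one_iff.1 (TSet_nn.1 k5).1
    exact ⟨rfl, by simp [k3], by simp [k2], MU_du hs h' (fun x hx => mem_sp (by simpa using hx)) k4.ind.tail⟩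
  · rw [D_TF eβ, hDu, map_zero]
  · rw [TF_TF, ← hdu, dd_one (A := MU B r k 1) (by
      rintro ⟨o, hl, ws, t⟩ ⟨p, ws', -, -, -, -, h4⟩
      exact (TSet_nn.1 h4).1) hu]
    have h4 : TF (fun y : Cf V => ((y.1, y.2.1, []) : Cf V)) u
        = TF (fun y : Cf V => cm (((hd y.2.1, hd y.2.2) :: y.1, y.2.1.tail, []) : Cf V)) u := by
      refine TY_eq_on (A := MU B r k 1) ?_ hu
      rintro o ⟨hl, ws, t⟩ ⟨p, ws', k1, -⟩
      simp only at k1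
      subst k1
      simp [cm]
    rw [h4, sub_self]
    exact Bdy.zero

include I in
lemma mainInd (hs : ∀ x y, B x y = B y x) (h2 : (2 : F) ≠ 0) (hN : ND B (⊤ : Submodule F V)) {g : ℕ}
    (hg : Genus B (⊤ : Submodule F V) g) (hSw : SwapS B G) :
    ∀ j N, g < N + j → QS B G g N ∧ ∀ r k, r + k + 1 = N → US B G g r k := by
  intro j
  induction j with
  | zero =>
    intro N h
    exact ⟨fun q hq => absurd hq (by omega), fun r k h' q hq => absurd hq (by omega)⟩
  | succ j ih =>
    intro N h
    have hQ : ∀ N', N < N' → QS B G g N' := fun N' h' => (ih N' (by omega)).1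
    have hU : ∀ N', N < N' → ∀ r k, r + k + 1 = N' → US B G g r k := fun N' h' => (ih N' (by omega)).2
    have hQN : QS B G g N := QStep I hs h2 hg hSw hQ hU
    refine ⟨hQN, ?_⟩
    have key : ∀ k r, r + k + 1 = N → US B G g r k := by
      intro k
      induction k using Nat.strong_induction_on with
      | _ k ihk =>
        rintro r rfl
        exact UStep I hs h2 hN hg hQN (fun r' k' hk h => ihk k' hk r' h) hQ hU
    exact fun r k => key k r

include I in
theorem QS_zero (hs : ∀ x y, B x y = B y x) (h2 : (2 : F) ≠ 0) (hN : ND B (⊤ : Submodule F V)) {g : ℕ}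
    (hg : Genus B (⊤ : Submodule F V) g) (hSw : SwapS B G) : QS B G g 0 :=
  (mainInd I hs h2 hN hg hSw (g + 1) 0 (by omega)).1

end Main

end OStab

namespace OStab

section Refl

set_option linter.unusedSectionVars false

variable {G : Type} [Group G] {H X Y W : Type} [MulAction G H] [MulAction G X] [MulAction G Y]

lemma T_eq_on [MulAction G W] {φ ψ : X → Z W} {A : Set X} (h : ∀ x ∈ A, φ x = ψ x) {n : ℕ}
    {z : Z (X × List G)} (hz : z ∈ sup (Cells G A n)) : T G φ z = T G ψ z := by
  refine eq_on_sup ?_ hz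
  rintro ⟨x, l⟩ ⟨h1, h2⟩
  rw [T_e, T_e, h x h1]

lemma ef_eqv {f : X → Y} (h : EF G f) : Eqv G (fun x => e (f x)) := by
  intro g y; simp only [h g y, mp_e]

lemma conj_EF {γ : X → G} (h : ∀ (k : G) (x : X), γ (k • x) = k * γ x * k⁻¹) :
    EF G (fun x => (γ x)⁻¹ • x) := by
  intro g x
  simp [h, mul_smul]

lemma conj_EF' {γ : X → G} (h : ∀ (k : G) (x : X), γ (k • x) = k * γ x * k⁻¹) :
    EF G (fun x => γ x • x) := by
  intro g x
  simp [h, mul_smul]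

lemma refl {A : Set X} (hA : ∀ (g : G) x, x ∈ A → g • x ∈ A) {A' : Set (Option H × Y)}
    (f : X → Option H × Y) (hf : EF G f) (hfA : ∀ x ∈ A, f x ∈ A' ∧ odeg (f x).1 = 1)
    (γ γ0 k : X → G) (c1 : ∀ (g : G) (x : X), γ (g • x) = g * γ x * g⁻¹)
    (c2 : ∀ (g : G) (x : X), γ0 (g • x) = g * γ0 x * g⁻¹)
    (c3 : ∀ (g : G) (x : X), k (g • x) = g * k x * g⁻¹)
    (h1 : ∀ x, γ0 (k x • x) = γ x) (h2 : ∀ x ∈ A, f ((γ0 x)⁻¹ • x) = f x)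
    (h3 : ∀ x ∈ A, dlt (f (k x • x)) = dlt (f x)) {n : ℕ} {a : Z (X × List G)}
    (ha : a ∈ sup (Cells G A n)) (hb : bd a = 0) :
    Bdy G A' (n + 1) (T G (fun x => e (f ((γ x)⁻¹ • x))) a - T G (fun x => e (f x)) a) := by
  have ek := conj_EF' c3
  set ak := T G (fun x => e (k x • x)) a with hak
  have hak' : ak ∈ sup (Cells G A n) := T_mem (fun x hx => e_mem (hA _ _ hx)) ha
  have hbak : bd ak = 0 := by rw [hak, bd_T (ef_eqv ek), hb, map_zero]
  set W := T G (fun x => e (f x)) (Pv γ a) with hW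
  set Y0 := T G (fun x => e (f x)) (Pv γ0 ak) with hY0
  have hP : Pv γ0 ak = T G (fun x => e (k x • x)) (Pv γ a) := by
    refine Pv_T (ef_eqv ek) γ γ0 (fun x => e_mem ?_) a
    intro g
    rw [c2, h1, c1]
  have hPm := Pv_mem hA γ ha
  have hWm : W ∈ sup (Cells G {x | x ∈ A' ∧ odeg x.1 = 1} (n + 1)) :=
    T_mem (fun x hx => e_mem (hfA x hx)) hPm
  have hYm : Y0 ∈ sup (Cells G {x | x ∈ A' ∧ odeg x.1 = 1} (n + 1)) :=
    T_mem (fun x hx => e_mem (hfA x hx)) (Pv_mem hA γ0 hak')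
  have hbW : bd W = T G (fun x => e (f ((γ x)⁻¹ • x))) a - T G (fun x => e (f x)) a := by
    have := Pv_homotopy γ a
    rw [hb, map_zero, add_zero] at this
    rw [hW, bd_T (ef_eqv hf), this, map_sub, Mv_conj c1, T_T]
    simp
  have hbY : bd Y0 = 0 := by
    have := Pv_homotopy γ0 ak
    rw [hbak, map_zero, add_zero] at this
    rw [hY0, bd_T (ef_eqv hf), this, map_sub, Mv_conj c2, T_T, sub_eq_zero]
    refine T_eq_on (A := A) ?_ hak'
    intro x hx
    simp [h2 x hx]
  have hdl : T G dlt W = T G dlt Y0 := by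
    rw [hW, hY0, hP, T_T, T_T, T_T]
    refine T_eq_on (A := A) ?_ hPm
    intro x hx
    simp [h3 x hx]
  have hDs : ∀ w : CC G H Y, D (T G sg w) = - T G dlt w + bd w := by
    intro w
    rw [D_apply, dlt_sg, bd_T sg_eqv, sg_sg]
  refine ⟨T G sg W - T G sg Y0, sub_mem ?_ ?_, ?_⟩
  · exact sg_Ch (Ch_of_cells 1 (fun x h => h) rfl hWm)
  · exact sg_Ch (Ch_of_cells 1 (fun x h => h) rfl hYm)
  · rw [map_sub, hDs, hDs, hdl, hbY, hbW]; abel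

/-- Projections on the two parts of the cone. -/
noncomputable def pN : Option H × Y → Z (Option H × Y)
  | (none, y) => e (none, y)
  | (some _, _) => 0

/-- Projections on the two parts of the cone. -/
noncomputable def pS : Option H × Y → Z (Option H × Y)
  | (none, _) => 0
  | (some h, y) => e (some h, y)

lemma pN_eqv : Eqv G (pN (H := H) (Y := Y)) := by
  rintro g ⟨o, y⟩
  cases o <;> simp [pN, Prod.smul_mk]

lemma pS_eqv : Eqv G (pS (H := H) (Y := Y)) := by
  rintro g ⟨o, y⟩
  cases o <;> simp [pS, Prod.smul_mk]

lemma pS_bd {z : CC G H Y} (h : D z = 0) : bd (T G pS z) = 0 := by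
  have h1 := congrArg (T G pS) h
  rw [D_apply, map_add, map_zero, T_T, T_T, T_zero' _ ?_, zero_add] at h1
  · rw [bd_T pS_eqv, ← neg_eq_zero, ← h1, ← T_neg]
    apply T_congr
    rintro ⟨o, y⟩
    cases o <;> simp [pS, sg]
  · rintro ⟨o, y⟩
    cases o <;> simp [pS, dlt]

lemma pN_bd {z : CC G H Y} (h : D z = 0) : T G pN (bd z) = - T G dlt z := by
  have h1 := congrArg (T G pN) h
  rw [D_apply, map_add, map_zero, T_T, T_T] at h1
  have h2 : T G (fun x => L pN (dlt x)) z = T G dlt z := by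
    apply T_congr
    rintro ⟨o, y⟩
    cases o <;> simp [pN, dlt]
  have h3 : T G (fun x => L pN (sg x)) (bd z) = T G pN (bd z) := by
    apply T_congr
    rintro ⟨o, y⟩
    cases o <;> simp [pN, sg]
  rw [h2, h3] at h1
  exact eq_neg_of_add_eq_zero_right h1

lemma pS_mem {A : Set (Option H × Y)} {q : ℕ} {z : CC G H Y} (hz : z ∈ Ch G A (q + 1)) :
    T G pS z ∈ sup (Cells G {x | x ∈ A ∧ odeg x.1 = 1} q) := by
  refine map_mem _ ?_ hz
  rintro ⟨⟨o, y⟩, l⟩ ⟨h1, h2⟩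
  rw [T_e]
  cases o with
  | none => simp [pS]
  | some h => 
    simp only [pS, mp_e]
    exact e_mem ⟨⟨h1, rfl⟩, by simpa using h2⟩

lemma pS_zero {A : Set (Option H × Y)} {z : CC G H Y} (hz : z ∈ Ch G A 0) :
    T G pS z = 0 := by
  have := eq_on_sup (φ := T G pS) (ψ := (0 : CC G H Y →ₗ[ℤ] CC G H Y)) (s := CCell G A 0) (by
    rintro ⟨⟨o, y⟩, l⟩ ⟨h1, h2⟩
    cases o with
    | some h => simp at h2
    | none => simp [T_e, pS]) hz
  simpa using this

end Refl

end OStab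

namespace OStab

section SwapProof

set_option linter.unusedSectionVars false

variable {F V : Type} [Field F] [AddCommGroup V] [Module F V] [FiniteDimensional F V]
  {B : V →ₗ[F] V →ₗ[F] F} {G : Type} [Group G] [DistribMulAction G V] (I : IsoG B G)

open Classical in
/-- Reflection in a vector depending on the cell. -/
noncomputable def ri (A : Set (Option (V × V) × Cf V)) (v : Option (V × V) × Cf V → V)
    (x : Option (V × V) × Cf V) : G := if x ∈ A then I.R (v x) else 1

lemma ri_conj {A : Set (Option (V × V) × Cf V)} (hA : ∀ (g : G) x, x ∈ A → g • x ∈ A)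
    {v : Option (V × V) × Cf V → V} (hv : EF G v) (g : G) (x : Option (V × V) × Cf V) :
    ri I A v (g • x) = g * ri I A v x * g⁻¹ := by
  have h : g • x ∈ A ↔ x ∈ A := ⟨fun h => by simpa using hA g⁻¹ _ h, hA g x⟩
  unfold ri
  rw [h]
  split_ifs
  · rw [hv, I.R_conj]
  · simp

/-- The map forgetting the head pair. -/
def ft (x : Option (V × V) × Cf V) : Option (V × V) × Cf V := (x.1, (x.2.1.tail, [], []))

lemma ft_EF : EF G (ft (V := V)) := by
  rintro g ⟨o, hl, ws, t⟩
  simp [ft, Prod.smul_mk]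

/-- Frames with cone coordinate. -/
def FS (B : V →ₗ[F] V →ₗ[F] F) (r : ℕ) : Set (Option (V × V) × Cf V) :=
  {x | x ∈ FR B (r + 1) 0 ∧ odeg x.1 = 1}

include I in
lemma FS_inv (r : ℕ) (g : G) (x : Option (V × V) × Cf V) (h : x ∈ FS B r) : g • x ∈ FS B r :=
  inv_fib (FR_adm I (r + 1) 0) 1 g x h

lemma FS_form {r : ℕ} {x : Option (V × V) × Cf V} (h : x ∈ FS B r) :
    ∃ a b hl, x = (some a, (b :: hl, [], [])) ∧ hl.length = r ∧ HF B (a :: b :: hl) := by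
  obtain ⟨o, hl, ws, t⟩ := x
  obtain ⟨⟨h1, h2, h3, h4⟩, h5⟩ := h
  simp only at h1 h2 h3 h4 h5
  cases o with
  | none => simp at h5
  | some a =>
    cases hl with
    | nil => simp at h2
    | cons b hl =>
      refine ⟨a, b, hl, ?_, by simpa using h2, h4.hf⟩
      rw [h1, List.length_eq_zero_iff.1 h3]

lemma R_fix {v x : V} (h : B v x = 0) : I.R v • x = x := by
  rw [I.R_smul, h]; simp

lemma R_fix_inv {v x : V} (h : B v x = 0) : (I.R v)⁻¹ • x = x := by
  rw [inv_smul_eq_iff, R_fix I h]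

lemma R_fix_list (hs : ∀ x y, B x y = B y x) {v : V} {hl : List (V × V)} (h : v ∈ Up B hl) : I.R v • hl = hl := by
  apply smul_list_fix
  intro p hp
  have := mem_Up.1 h p hp
  exact smul_pair_fix (R_fix I (by rw [hs]; exact this.1)) (R_fix I (by rw [hs]; exact this.2))

lemma HF_ft {a b : V × V} {hl : List (V × V)} (hs : ∀ x y, B x y = B y x)
    (h : HF B (a :: b :: hl)) : (some a, ((hl, [], []) : Cf V)) ∈ FR B hl.length 0 := by
  refine ⟨rfl, rfl, rfl, HF_tail (HF_swap hs h), by simp, ?_, Ind.nil⟩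
  intro x hx; simp at hx

lemma reflV (hs : ∀ x y, B x y = B y x) (r : ℕ) (yf zf : Option (V × V) × Cf V → V)
    (hy : EF G yf) (hz : EF G zf)
    (h1 : ∀ x ∈ FS B r, I.R (yf x + zf x) • yf x = - zf x)
    (h2 : ∀ x ∈ FS B r, yf x ∈ Up B (x.1.toList ++ x.2.1.tail))
    (h3 : ∀ x ∈ FS B r, yf x + zf x ∈ Up B x.2.1.tail) {n : ℕ}
    {a : Z ((Option (V × V) × Cf V) × List G)}
    (ha : a ∈ sup (Cells G (FS B r) n)) (hb : bd a = 0) :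
    Bdy G (FR B r 0) (n + 1) (T G (fun x => e (ft ((ri I (FS B r) zf x)⁻¹ • x))) a -
      T G (fun x => e (ft x)) a) := by
  have hyz : EF G (fun x => yf x + zf x) := by intro g x; simp only [hy g x, hz g x, smul_add]
  have hA := FS_inv I r
  refine refl hA ft ft_EF ?_ (ri I (FS B r) zf) (ri I (FS B r) yf)
    (ri I (FS B r) (fun x => yf x + zf x)) (ri_conj I hA hz) (ri_conj I hA hy) (ri_conj I hA hyz)
    ?_ ?_ ?_ ha hb
  · intro x hx
    obtain ⟨p, q, hl, rfl, rfl, hh⟩ := FS_form hx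
    exact ⟨HF_ft hs hh, rfl⟩
  · intro x
    by_cases hx : x ∈ FS B r
    · have hx' := hA (I.R (yf x + zf x)) x hx
      have hk : ri I (FS B r) (fun x => yf x + zf x) x = I.R (yf x + zf x) := if_pos hx
      rw [hk, ri, ri, if_pos hx, if_pos hx', hy, h1 x hx, I.R_neg]
    · simp [ri, hx]
  · intro x hx
    have k2 := h2 x hx
    simp only [ri, if_pos hx]
    obtain ⟨p, q, hl, rfl, rfl, hh⟩ := FS_form hx
    rw [ft_EF, inv_smul_eq_iff]
    simp only [ft, Prod.smul_mk, List.tail_cons, smul_some', smul_list_nil] at k2 ⊢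
    have k3 : yf (some p, q :: hl, [], []) ∈ Up B (p :: hl) := k2
    have := R_fix_list I hs k3
    rw [smul_list_cons, List.cons.injEq] at this
    rw [this.1, this.2]
  · intro x hx
    have k3 := h3 x hx
    simp only [ri, if_pos hx]
    obtain ⟨p, q, hl, rfl, rfl, hh⟩ := FS_form hx
    rw [ft_EF]
    simp only [ft, Prod.smul_mk, List.tail_cons, smul_some', smul_list_nil, dlt] at k3 ⊢
    rw [R_fix_list I hs k3]

/-- first pair -/
def P1 (x : Option (V × V) × Cf V) : V × V := x.1.getD 0
/-- second pair -/
def P2 (x : Option (V × V) × Cf V) : V × V := hd x.2.1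

lemma P1_EF : EF G (P1 (V := V)) := by
  rintro g ⟨o, y⟩
  cases o <;> simp [P1, Prod.smul_mk]

lemma P2_EF : EF G (P2 (V := V)) := by
  rintro g ⟨o, hl, y⟩
  simp [P2, Prod.smul_mk]

def Z1 (x : Option (V × V) × Cf V) : V := ((P1 x).1 + (P1 x).2) - ((P2 x).1 + (P2 x).2)
def Z2 (x : Option (V × V) × Cf V) : V := ((P1 x).1 - (P1 x).2) - ((P2 x).1 - (P2 x).2)
def Y1 (x : Option (V × V) × Cf V) : V := (P2 x).1 + ((P2 x).2 + (P2 x).2)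
def Y2 (x : Option (V × V) × Cf V) : V := (P2 x).1 - ((P2 x).2 + (P2 x).2)

lemma Z1_EF : EF G (Z1 (V := V)) := by
  intro g x; simp [Z1, P1_EF g x, P2_EF g x, smul_sub, smul_add]
lemma Z2_EF : EF G (Z2 (V := V)) := by
  intro g x; simp [Z2, P1_EF g x, P2_EF g x, smul_sub]
lemma Y1_EF : EF G (Y1 (V := V)) := by
  intro g x; simp [Y1, P2_EF g x, smul_add]
lemma Y2_EF : EF G (Y2 (V := V)) := by
  intro g x; simp [Y2, P2_EF g x, smul_sub, smul_add]

lemma R_swap {y z : V} (hs : ∀ x y, B x y = B y x) (h : B y y = B z z) (h0 : B (y + z) (y + z) ≠ 0) :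
    I.R (y + z) • y = - z := by
  have : 2 * B (y + z) y / B (y + z) (y + z) = 1 := by
    rw [div_eq_one_iff_eq h0]
    simp only [map_add, LinearMap.add_apply]
    rw [← h, hs z y]; ring
  rw [I.R_smul, this]; simp

/-- The swap. -/
def sw (x : Option (V × V) × Cf V) : Option (V × V) × Cf V := (some (P2 x), (x.2.1.tail, [], []))

lemma sw_EF : EF G (sw (V := V)) := by
  rintro g ⟨o, hl, ws, t⟩
  simp [sw, P2, Prod.smul_mk]

structure Two (B : V →ₗ[F] V →ₗ[F] F) (p q : V × V) (hl : List (V × V)) : Prop where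
  a1 : B p.1 p.1 = 0
  a2 : B p.2 p.2 = 0
  a3 : B p.1 p.2 = 1
  a4 : B p.2 p.1 = 1
  b1 : B q.1 q.1 = 0
  b2 : B q.2 q.2 = 0
  b3 : B q.1 q.2 = 1
  b4 : B q.2 q.1 = 1
  c1 : B p.1 q.1 = 0
  c2 : B p.1 q.2 = 0
  c3 : B p.2 q.1 = 0
  c4 : B p.2 q.2 = 0
  d1 : B q.1 p.1 = 0
  d2 : B q.2 p.1 = 0
  d3 : B q.1 p.2 = 0
  d4 : B q.2 p.2 = 0
  u1 : p.1 ∈ Up B hl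
  u2 : p.2 ∈ Up B hl
  u3 : q.1 ∈ Up B hl
  u4 : q.2 ∈ Up B hl

lemma HF.two (hs : ∀ x y, B x y = B y x) {p q : V × V} {hl : List (V × V)}
    (h : HF B (p :: q :: hl)) : Two B p q hl := by
  obtain ⟨h1, h2, h3, h4, h5, k1, k2, k3, k4, k5, k6⟩ := h
  rw [Up_cons] at h4 h5
  obtain ⟨h4a, h4b, h4c⟩ := h4
  obtain ⟨h5a, h5b, h5c⟩ := h5
  exact ⟨h1, h2, h3, by rw [hs, h3], k1, k2, k3, by rw [hs, k3], by rw [hs, h4a],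
    by rw [hs, h4b], by rw [hs, h5a], by rw [hs, h5b], h4a, h4b, h5a, h5b, h4c, h5c, k4, k5⟩

lemma swap_calc (h2 : (2 : F) ≠ 0) {p q : V × V} {hl : List (V × V)} (t : Two B p q hl) :
    I.R (p.1 - p.2 - (q.1 - q.2)) • I.R (p.1 + p.2 - (q.1 + q.2)) • q = p := by
  obtain ⟨a1, a2, a3, a4, b1, b2, b3, b4, c1, c2, c3, c4, d1, d2, d3, d4, -⟩ := t
  have h4 : (4 : F) ≠ 0 := by
    have : (4 : F) = 2 * 2 := by norm_num
    rw [this]; exact mul_ne_zero h2 h2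
  have e1 : (2 : F) / 4 = 1 / 2 := by field_simp; norm_num
  ext
  · simp only [Prod.smul_fst, I.R_smul]
    simp only [map_add, map_sub, map_smul, LinearMap.add_apply, LinearMap.sub_apply, smul_eq_mul, a1, a2, a3, a4, b1, b2, b3, b4, c1, c2, c3, c4, d1, d2, d3, d4]
    have k1 : ∀ x : F, x = -1 / 2 → p.1 = p.1 + x • 0 := by simp
    match_scalars <;> norm_num <;> field_simp <;> norm_num
  · simp only [Prod.smul_snd, I.R_smul]
    simp only [map_add, map_sub, map_smul, LinearMap.add_apply, LinearMap.sub_apply, smul_eq_mul, a1, a2, a3, a4, b1, b2, b3, b4, c1, c2, c3, c4, d1, d2, d3, d4]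
    match_scalars <;> norm_num <;> field_simp <;> norm_num

include I in
lemma swap2 (hs : ∀ x y, B x y = B y x) (h2 : (2 : F) ≠ 0) (r : ℕ) {n : ℕ}
    {a : Z ((Option (V × V) × Cf V) × List G)}
    (ha : a ∈ sup (Cells G (FS B r) n)) (hb : bd a = 0) :
    Bdy G (FR B r 0) (n + 1) (T G (fun x => e (sw x)) a - T G (fun x => e (ft x)) a) := by
  have hA := FS_inv I r
  have q1 := reflV I hs r Y1 Z1 Y1_EF Z1_EF (n := n) (a := a) (by
      intro x hx
      obtain ⟨p, q, hl, rfl, rfl, hh⟩ := FS_form hx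
      obtain ⟨a1, a2, a3, a4, b1, b2, b3, b4, c1, c2, c3, c4, d1, d2, d3, d4, -⟩ := hh.two hs
      apply R_swap I hs
      · simp only [Y1, Z1, P1, P2, hd_cons, Option.getD_some]
        simp [a1, a2, a3, a4, b1, b2, b3, b4, c1, c2, c3, c4, d1, d2, d3, d4]
        norm_num
      · simp only [Y1, Z1, P1, P2, hd_cons, Option.getD_some]
        simp [a1, a2, a3, a4, b1, b2, b3, b4, c1, c2, c3, c4, d1, d2, d3, d4]
        norm_num [h2]) (by
      intro x hx
      obtain ⟨p, q, hl, rfl, rfl, hh⟩ := FS_form hx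
      obtain ⟨a1, a2, a3, a4, b1, b2, b3, b4, c1, c2, c3, c4, d1, d2, d3, d4, u1, u2, u3, u4⟩ := hh.two hs
      show _ ∈ Up B (p :: hl)
      rw [Up_cons]
      refine ⟨?_, ?_, ?_⟩
      · simp [Y1, P2, *]
      · simp [Y1, P2, *]
      · exact add_mem u3 (add_mem u4 u4)) (by
      intro x hx
      obtain ⟨p, q, hl, rfl, rfl, hh⟩ := FS_form hx
      obtain ⟨a1, a2, a3, a4, b1, b2, b3, b4, c1, c2, c3, c4, d1, d2, d3, d4, u1, u2, u3, u4⟩ := hh.two hs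
      exact add_mem (add_mem u3 (add_mem u4 u4)) (sub_mem (add_mem u1 u2) (add_mem u3 u4))) ha hb
  have eg := conj_EF (ri_conj I hA Z1_EF)
  have q2 := reflV I hs r Y2 Z2 Y2_EF Z2_EF (n := n)
      (a := T G (fun x => e ((ri I (FS B r) Z1 x)⁻¹ • x)) a) (by
      intro x hx
      obtain ⟨p, q, hl, rfl, rfl, hh⟩ := FS_form hx
      obtain ⟨a1, a2, a3, a4, b1, b2, b3, b4, c1, c2, c3, c4, d1, d2, d3, d4, -⟩ := hh.two hs
      apply R_swap I hs
      · simp only [Y2, Z2, P1, P2, hd_cons, Option.getD_some]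
        simp [a1, a2, a3, a4, b1, b2, b3, b4, c1, c2, c3, c4, d1, d2, d3, d4]
        norm_num
      · simp only [Y2, Z2, P1, P2, hd_cons, Option.getD_some]
        simp [a1, a2, a3, a4, b1, b2, b3, b4, c1, c2, c3, c4, d1, d2, d3, d4]
        norm_num [h2]) (by
      intro x hx
      obtain ⟨p, q, hl, rfl, rfl, hh⟩ := FS_form hx
      obtain ⟨a1, a2, a3, a4, b1, b2, b3, b4, c1, c2, c3, c4, d1, d2, d3, d4, u1, u2, u3, u4⟩ := hh.two hs
      show _ ∈ Up B (p :: hl)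
      rw [Up_cons]
      refine ⟨?_, ?_, ?_⟩
      · simp [Y2, P2, *]
      · simp [Y2, P2, *]
      · exact sub_mem u3 (add_mem u4 u4)) (by
      intro x hx
      obtain ⟨p, q, hl, rfl, rfl, hh⟩ := FS_form hx
      obtain ⟨a1, a2, a3, a4, b1, b2, b3, b4, c1, c2, c3, c4, d1, d2, d3, d4, u1, u2, u3, u4⟩ := hh.two hs
      exact add_mem (sub_mem u3 (add_mem u4 u4)) (sub_mem (sub_mem u1 u2) (sub_mem u3 u4)))
      (T_mem (fun x hx => e_mem (hA _ _ hx)) ha) (by rw [bd_T (ef_eqv eg), hb, map_zero])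
  have q3 := q2.add q1
  rw [T_T, T_T] at q3
  simp only [L_e] at q3
  rw [sub_add_sub_cancel] at q3
  convert q3 using 2
  refine T_eq_on (A := FS B r) ?_ ha
  intro x hx
  congr 1
  rw [ri_conj I hA Z2_EF]
  simp only [mul_inv_rev, inv_inv, mul_smul, smul_inv_smul]
  simp only [ri, if_pos hx]
  obtain ⟨p, q, hl, rfl, rfl, hh⟩ := FS_form hx
  have t := hh.two hs
  have k1 := swap_calc I h2 t
  have k2 : I.R (p.1 - p.2 - (q.1 - q.2)) • I.R (p.1 + p.2 - (q.1 + q.2)) • hl = hl := by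
    rw [R_fix_list I hs (v := p.1 + p.2 - (q.1 + q.2)), R_fix_list I hs]
    · exact sub_mem (sub_mem t.u1 t.u2) (sub_mem t.u3 t.u4)
    · exact sub_mem (add_mem t.u1 t.u2) (add_mem t.u3 t.u4)
  rw [ft_EF, ft_EF, eq_inv_smul_iff, eq_inv_smul_iff]
  simp only [sw, ft, P2, hd_cons, Prod.smul_mk, smul_some', smul_list_nil, List.tail_cons, Z1, Z2, P1, Option.getD_some]
  rw [k1, k2]

/-- The cone map. -/
noncomputable def Sm : Option (V × V) × Cf V → Z (Option (V × V) × Cf V)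
  | (none, y) => e (some (hd y.1), (y.1.tail, [], []))
  | (some _, _) => 0

lemma Sm_eqv : Eqv G (Sm (V := V)) := by
  rintro g ⟨o, hl, ws, t⟩
  cases o <;> simp [Sm, Prod.smul_mk]

include I in
lemma swapS (hs : ∀ x y, B x y = B y x) (h2 : (2 : F) ≠ 0) : SwapS B G := by
  intro r q z hz hD
  have hid : TF (fun y : Cf V => ((y.1.tail, [], []) : Cf V)) z - D (T G Sm z) =
      T G (fun x => e (ft x)) (T G pS z) - T G (fun x => e (sw x)) (T G pS z) := by
    have s1 : TF (fun y : Cf V => ((y.1.tail, [], []) : Cf V)) z =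
        T G (fun x => e (ft x)) (T G pN z) + T G (fun x => e (ft x)) (T G pS z) := by
      rw [T_T, T_T]
      have : TF (fun y : Cf V => ((y.1.tail, [], []) : Cf V)) (G := G) (H := V × V) =
        T G (fun x => L (fun x => e (ft x)) (pN x)) + T G (fun x => L (fun x => e (ft x)) (pS x)) := by
        apply hom_ext
        rintro ⟨⟨o, y⟩, l⟩
        rw [TF_e, LinearMap.add_apply, T_e, T_e]
        cases o <;> simp [pN, pS, ft]
      rw [this]; rfl
    have s2 : T G dlt (T G Sm z) = T G (fun x => e (ft x)) (T G pN z) := by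
      rw [T_T, T_T]
      apply T_congr
      rintro ⟨o, y⟩
      cases o <;> simp [Sm, dlt, pN, ft]
    have s3 : T G sg (T G Sm (bd z)) = - T G Sm (T G pN (bd z)) := by
      rw [T_T, T_T, ← T_neg]
      apply T_congr
      rintro ⟨o, y⟩
      cases o <;> simp [Sm, sg, pN]
    have s4 : T G Sm (T G dlt z) = T G (fun x => e (sw x)) (T G pS z) := by
      rw [T_T, T_T]
      apply T_congr
      rintro ⟨o, y⟩
      cases o <;> simp [Sm, dlt, pS, sw, P2]
    rw [s1, D_apply, s2, bd_T Sm_eqv, s3, pN_bd hD, map_neg, neg_neg, s4]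
    abel
  have hB : Bdy G (FR B r 0) q (D (T G Sm z)) := by
    refine ⟨_, ?_, rfl⟩
    refine map_mem _ ?_ hz
    rintro ⟨⟨o, hl, ws, t⟩, l⟩ ⟨⟨h1, h3, h4, h5⟩, h6⟩
    simp only at h1 h3 h4 h5 h6
    rw [T_e]
    cases o with
    | some a => simp [Sm]
    | none =>
      simp only [Sm, mp_e]
      cases hl with
      | nil => simp at h3
      | cons b hl =>
        refine e_mem ⟨⟨rfl, by simpa using h3, rfl, h5.hf, by simp, ?_, Ind.nil⟩, ?_⟩
        · intro x hx; simp at hx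
        · simpa using h6
  have hgoal : Bdy G (FR B r 0) q (TF (fun y : Cf V => ((y.1.tail, [], []) : Cf V)) z - D (T G Sm z)) := by
    rw [hid]
    cases q with
    | zero => rw [pS_zero hz]; simpa using Bdy.zero
    | succ n => 
      rw [← neg_sub]
      exact (swap2 I hs h2 r (pS_mem hz) (pS_bd hD)).neg
  simpa using hgoal.add hB

end SwapProof

end OStab

namespace OStab

section Shapiro

set_option linter.unusedSectionVars false

variable {G : Type} [Group G] {H Y : Type} [MulAction G H] [MulAction G Y]

/-- Base cells of the simple cone. -/
def PA (HP : Set H) (y0 : Y) : Set (Option H × Y) := {x | x.2 = y0 ∧ ∀ h, x.1 = some h → h ∈ HP}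

/-- Cells supported on tuples satisfying a predicate -/
def FixL {X : Type} (A : Set X) (S : Set G) (n : ℕ) : Set (X × List G) :=
  {c | c.1 ∈ A ∧ c.2.length = n ∧ ∀ g ∈ c.2, g ∈ S}

lemma FixL_sub {X : Type} (A : Set X) (S : Set G) (n : ℕ) : FixL A S n ⊆ Cells G A n :=
  fun _ h => ⟨h.1, h.2.1⟩

lemma Mv_bd {X : Type} [MulAction G X] (s : X → G) (z : Z (X × List G)) :
    bd (Mv s z) = Mv s (bd z) := by
  have h1 := Pv_homotopy s z
  have h2 := Pv_homotopy s (bd z)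
  rw [bd_bd, map_zero, add_zero] at h2
  have h3 := congrArg bd h1
  rw [map_add, map_sub, bd_bd, zero_add, h2] at h3
  exact (sub_left_injective h3).symm

/-- Equivariant constant map to a point. -/
noncomputable def pt {X : Type} : X → Z Unit := fun _ => e ()

lemma pt_eqv {X : Type} [MulAction G X] : Eqv G (pt (X := X)) := by
  intro g x; simp [pt]

lemma FixL_pt {X : Type} [MulAction G X] {A : Set X} {S : Set G} {n : ℕ} {z : Z (X × List G)}
    (hz : z ∈ sup (FixL A S n)) : T G pt z ∈ sup (FixL (Set.univ : Set Unit) S n) := by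
  refine map_mem _ ?_ hz
  rintro ⟨x, l⟩ ⟨h1, h2⟩
  rw [T_e, pt, mp_e]
  exact e_mem ⟨trivial, h2⟩

variable {HP : Set H} {y0 : Y} (hy0 : ∀ g : G, g • y0 = y0)
  (hHP : ∀ (g : G) h, h ∈ HP → g • h ∈ HP)

/-- Constant map to the apex. -/
noncomputable def apex (y0 : Y) : Unit → Z (Option H × Y) := fun _ => e (none, y0)

include hy0 in
lemma apex_eqv : Eqv G (apex (H := H) y0) := by
  intro g x; simp [apex, Prod.smul_mk, hy0]

/-- Inclusion of pairs -/
noncomputable def inc (y0 : Y) : H → Z (Option H × Y) := fun h => e (some h, y0)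

include hy0 in
lemma inc_eqv : Eqv G (inc (H := H) y0) := by
  intro g x; simp [inc, Prod.smul_mk, hy0]

/-- Projection to pairs. -/
noncomputable def pH : Option H × Y → Z H
  | (none, _) => 0
  | (some h, _) => e h

lemma pH_eqv : Eqv G (pH (H := H) (Y := Y)) := by
  rintro g ⟨o, y⟩
  cases o <;> simp [pH, Prod.smul_mk]

/-- Projection to the apex. -/
noncomputable def pU : Option H × Y → Z Unit
  | (none, _) => e ()
  | (some _, _) => 0

lemma pU_eqv : Eqv G (pU (H := H) (Y := Y)) := by
  rintro g ⟨o, y⟩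
  cases o <;> simp [pU, Prod.smul_mk]

lemma pH_D (w : CC G H Y) : T G pH (D w) = - bd (T G pH w) := by
  rw [D_apply, map_add, T_T, T_T, T_zero' _ ?_, zero_add, bd_T pH_eqv, ← T_neg]
  · apply T_congr
    rintro ⟨o, y⟩
    cases o <;> simp [pH, sg]
  · rintro ⟨o, y⟩
    cases o <;> simp [pH, dlt]

lemma pU_D (w : CC G H Y) : T G pU (D w) = T G pt (T G pH w) + bd (T G pU w) := by
  rw [D_apply, map_add, T_T, T_T, T_T, bd_T pU_eqv]
  congr 1
  · apply T_congr
    rintro ⟨o, y⟩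
    cases o <;> simp [pU, pH, dlt, pt]
  · apply T_congr
    rintro ⟨o, y⟩
    cases o <;> simp [pU, sg]

lemma pH_mem {n : ℕ} {w : CC G H Y} (hw : w ∈ Ch G (PA HP y0) (n + 1)) :
    T G pH w ∈ sup (Cells G HP n) := by
  refine map_mem _ ?_ hw
  rintro ⟨⟨o, y⟩, l⟩ ⟨h1, h2⟩
  rw [T_e]
  cases o with
  | none => simp [pH]
  | some h =>
    simp only [pH, mp_e]
    exact e_mem ⟨h1.2 h rfl, by simpa using h2⟩

lemma pU_mem {n : ℕ} {w : CC G H Y} (hw : w ∈ Ch G (PA HP y0) n) :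
    T G pU w ∈ sup (Cells G (Set.univ : Set Unit) n) := by
  refine map_mem _ ?_ hw
  rintro ⟨⟨o, y⟩, l⟩ ⟨h1, h2⟩
  rw [T_e]
  cases o with
  | some h => simp [pU]
  | none =>
    simp only [pU, mp_e]
    exact e_mem ⟨trivial, by simpa using h2⟩

lemma apex_mem {n : ℕ} {z : Z (Unit × List G)} (hz : z ∈ sup (Cells G (Set.univ : Set Unit) n)) :
    T G (apex (H := H) y0) z ∈ Ch G (PA HP y0) n := by
  refine map_mem _ ?_ hz
  rintro ⟨x, l⟩ ⟨h1, h2⟩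
  rw [T_e, apex, mp_e]
  exact e_mem ⟨⟨rfl, by simp⟩, by simpa using h2⟩

lemma inc_mem {n : ℕ} {z : Z (H × List G)} (hz : z ∈ sup (Cells G HP n)) :
    T G (inc (H := H) y0) z ∈ Ch G (PA HP y0) (n + 1) := by
  refine map_mem _ ?_ hz
  rintro ⟨x, l⟩ ⟨h1, h2⟩
  rw [T_e, inc, mp_e]
  refine e_mem ⟨⟨rfl, ?_⟩, by simpa using h2⟩
  rintro h ⟨⟩
  exact h1

include hy0 in
lemma D_apex (z : Z (Unit × List G)) : D (T G (apex (H := H) y0) z) = T G (apex y0) (bd z) := by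
  rw [D_apply, bd_T (apex_eqv hy0), T_T, T_T, T_zero' _ (by intro x; simp [apex, dlt]), zero_add]
  apply T_congr
  intro x; simp [apex, sg]

include hy0 in
lemma D_inc (z : Z (H × List G)) :
    D (T G (inc (H := H) y0) z) = T G (apex y0) (T G pt z) - T G (inc y0) (bd z) := by
  rw [D_apply, bd_T (inc_eqv hy0), T_T, T_T, T_T, sub_eq_add_neg, ← T_neg]
  congr 1
  · apply T_congr
    intro x; simp [inc, dlt, apex, pt]
  · apply T_congr
    intro x; simp [inc, sg]

lemma pU_apex (z : Z (Unit × List G)) : T G pU (T G (apex (H := H) y0) z) = z := by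
  rw [T_T]; conv_rhs => rw [← T_id z]
  apply T_congr; intro x; simp [apex, pU]

lemma pH_inc (z : Z (H × List G)) : T G pH (T G (inc y0) z) = z := by
  rw [T_T]; conv_rhs => rw [← T_id z]
  apply T_congr; intro x; simp [inc, pH]

lemma pH_apex (z : Z (Unit × List G)) : T G pH (T G (apex (H := H) y0) z) = 0 := by
  rw [T_T]; apply T_zero'; intro x; simp [apex, pH]

include hy0 in
/-- Transitivity from vanishing. -/
lemma trans_of_van (hV : Van G (PA HP y0) 1) {h0 h : H} (hh0 : h0 ∈ HP) (hh : h ∈ HP) :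
    ∃ g : G, g⁻¹ • h = h0 := by
  classical
  have hm : ∀ k ∈ HP, (e (k, []) : Z (H × List G)) ∈ sup (Cells G HP 0) := fun k hk => e_mem ⟨hk, rfl⟩
  have hz := sub_mem (inc_mem (y0 := y0) (hm h hh)) (inc_mem (y0 := y0) (hm h0 hh0))
  obtain ⟨w, hw, hDw⟩ := hV _ hz (by
    rw [map_sub, D_inc hy0, D_inc hy0, bd_zero (hm h hh), bd_zero (hm h0 hh0)]
    simp [T_e, pt])
  have h1 := congrArg (T G pH) hDw
  rw [pH_D, map_sub, pH_inc, pH_inc] at h1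
  have h2 : ∀ v ∈ sup (Cells G HP 1), L (fun c : H × List G => if ∃ g : G, g⁻¹ • h = c.1 then (1 : ℤ) else 0) (bd v) = 0 := by
    intro v hv
    have := eq_on_sup (s := Cells G HP 1) (φ := (L (fun c : H × List G => if ∃ g : G, g⁻¹ • h = c.1 then (1 : ℤ) else 0)).comp bd) (ψ := 0) (by
      rintro ⟨k, l⟩ ⟨_, hl⟩
      obtain ⟨a, rfl⟩ := List.length_eq_one_iff.1 hl
      rw [LinearMap.comp_apply, bd_e, d_cons, d_cons, d_nil, map_zero, sub_zero, cs_e, map_sub,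
        nu_one, nu_cons, map_sub, L_e, L_e]
      have : (∃ g : G, g⁻¹ • h = a⁻¹ • k) ↔ ∃ g : G, g⁻¹ • h = k := by
        constructor
        · rintro ⟨g, hg⟩
          exact ⟨g * a⁻¹, by simp [mul_smul, hg]⟩
        · rintro ⟨g, hg⟩
          exact ⟨g * a, by simp [mul_smul, hg]⟩
      simp [this]) hv
    simpa using this
  have h3 := h2 _ (pH_mem hw)
  rw [neg_eq_iff_eq_neg.1 h1, map_neg] at h3
  by_contra hcon
  rw [neg_eq_zero, map_sub, L_e, L_e, if_neg hcon, if_pos ⟨1, by simp⟩] at h3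
  simp at h3

lemma Mv_fix {s : H → G} {h0 : H} (hs : ∀ h ∈ HP, (s h)⁻¹ • h = h0)
    (hHP : ∀ (g : G) h, h ∈ HP → g • h ∈ HP) {n : ℕ}
    {z : Z (H × List G)} (hz : z ∈ sup (Cells G HP n)) :
    Mv s z ∈ sup (FixL {h0} {g : G | g • h0 = h0} n) := by
  refine map_mem _ ?_ hz
  rintro ⟨h, l⟩ ⟨h1, h2⟩
  simp only at h1 h2
  rw [Mv_e, nu_cons]
  have hst : st s h 1 = s h := by simp [st]
  refine e_mem ⟨?_, ?_, ?_⟩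
  · show _ = _
    rw [hst, hs h h1]
  · simpa using h2
  · intro g hg
    simp only [List.map_map, List.mem_map, Function.comp_apply] at hg
    obtain ⟨p, hp, rfl⟩ := hg
    show _ • h0 = h0
    have h3 := hs (p⁻¹ • h) (hHP _ _ h1)
    rw [inv_smul_eq_iff] at h3
    rw [hst, st, mul_smul, mul_smul, ← h3, smul_inv_smul, hs h h1]

lemma Mv_id {s : H → G} {h0 : H} (hs1 : s h0 = 1) {n : ℕ}
    {z : Z (H × List G)} (hz : z ∈ sup (FixL {h0} {g : G | g • h0 = h0} n)) : Mv s z = z := by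
  have := eq_on_sup (φ := Mv s) (ψ := LinearMap.id) (s := FixL {h0} {g : G | g • h0 = h0} n) (by
    rintro ⟨h, l⟩ ⟨h1, h2, h3⟩
    have h1' : h = h0 := h1
    subst h1'
    simp only at h3
    have h4 : ∀ p ∈ l, st s h p = p := by
      intro p hp
      have : p⁻¹ • h = h := by rw [inv_smul_eq_iff]; exact (h3 p hp).symm
      rw [st, this, hs1, mul_one]
    rw [Mv_e, List.map_congr_left h4, st]
    simp [hs1, nu_one]) hz
  simpa using this

include hy0 in
lemma exists_s (hV : Van G (PA HP y0) 1) {h0 : H} (hh0 : h0 ∈ HP) :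
    ∃ s : H → G, s h0 = 1 ∧ ∀ h ∈ HP, (s h)⁻¹ • h = h0 := by
  classical
  have := fun h : HP => trans_of_van hy0 hV hh0 h.2
  choose s hs using this
  refine ⟨fun h => if h = h0 then 1 else if hh : h ∈ HP then s ⟨h, hh⟩ else 1, by simp, ?_⟩
  intro h hh
  by_cases h1 : h = h0
  · simp [h1]
  · simp only [h1, if_false, hh, dif_pos]
    exact hs ⟨h, hh⟩

include hy0 hHP in
/-- Surjectivity at the level of chains. -/
theorem surjS {g : ℕ} (hV : ∀ q, q < g → Van G (PA HP y0) q) {h0 : H} (hh0 : h0 ∈ HP) {q : ℕ}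
    (hq : q < g) {z : Z (Unit × List G)} (hz : z ∈ sup (Cells G (Set.univ : Set Unit) q))
    (hb : bd z = 0) :
    ∃ w ∈ sup (FixL (Set.univ : Set Unit) {g : G | g • h0 = h0} q), bd w = 0 ∧
      ∃ u ∈ sup (Cells G (Set.univ : Set Unit) (q + 1)), bd u = z - w := by
  cases q with
  | zero =>
    refine ⟨z, sup_mono ?_ hz, hb, 0, zero_mem _, by simp⟩
    rintro ⟨x, l⟩ ⟨h1, h2⟩
    have : l = [] := List.length_eq_zero_iff.1 h2
    subst this
    exact ⟨h1, h2, by simp⟩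
  | succ q =>
    obtain ⟨s, hs1, hs⟩ := exists_s hy0 (hV 1 (by omega)) hh0
    obtain ⟨w, hw, hDw⟩ := hV _ hq _ (apex_mem (HP := HP) (y0 := y0) hz)
      (by rw [D_apex hy0, hb, map_zero])
    have k1 := congrArg (T G pU) hDw
    have k2 := congrArg (T G pH) hDw
    rw [pU_D, pU_apex] at k1
    rw [pH_D, pH_apex, neg_eq_zero] at k2
    have hv := pH_mem hw
    set v := T G pH w with hvdef
    have hhom := Pv_homotopy s v
    rw [k2, map_zero, add_zero] at hhom
    refine ⟨T G pt (Mv s v), FixL_pt (Mv_fix hs hHP hv), ?_,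
      T G pU w - T G pt (Pv s v), sub_mem (pU_mem hw) (T_mem (A := HP) (fun x _ => e_mem (a := ()) (Set.mem_univ _)) (Pv_mem hHP s hv)), ?_⟩
    · rw [bd_T pt_eqv, Mv_bd, k2, map_zero, map_zero]
    · rw [map_sub, bd_T pt_eqv, hhom, map_sub, ← k1]; abel

include hy0 hHP in
/-- Injectivity at the level of chains. -/
theorem injS {g : ℕ} (hV : ∀ q, q < g → Van G (PA HP y0) q) {h0 : H} (hh0 : h0 ∈ HP) {q : ℕ}
    (hq : q + 1 < g) {z : Z (Unit × List G)}
    (hz : z ∈ sup (FixL (Set.univ : Set Unit) {g : G | g • h0 = h0} q))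
    {u : Z (Unit × List G)} (hu : u ∈ sup (Cells G (Set.univ : Set Unit) (q + 1))) (hzu : bd u = z) :
    ∃ w ∈ sup (FixL (Set.univ : Set Unit) {g : G | g • h0 = h0} (q + 1)), bd w = z := by
  obtain ⟨s, hs1, hs⟩ := exists_s hy0 (hV 1 (by omega)) hh0
  set zh : Z (H × List G) := T G (fun _ => e h0) z with hzh
  have hm : zh ∈ sup (FixL {h0} {g : G | g • h0 = h0} q) := by
    refine map_mem _ ?_ hz
    rintro ⟨x, l⟩ ⟨h1, h2⟩
    rw [T_e, mp_e]
    exact e_mem ⟨rfl, h2⟩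
  have hm2 : zh ∈ sup (Cells G HP q) := by
    refine sup_mono ?_ hm
    rintro ⟨x, l⟩ ⟨h1, h2, h3⟩
    exact ⟨by rw [show x = h0 from h1]; exact hh0, h2⟩
  have hpt : T G pt zh = z := by
    rw [hzh, T_T]; conv_rhs => rw [← T_id z]
    apply T_congr; intro x; simp [pt]
  have hbz : bd z = 0 := by rw [← hzu, bd_bd]
  have hbzh : bd zh = 0 := by
    have : ∀ z ∈ sup (FixL (Set.univ : Set Unit) {g : G | g • h0 = h0} q),
        bd (T G (fun _ : Unit => (e h0 : Z H)) z) = T G (fun _ => e h0) (bd z) := by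
      intro z hz
      refine eq_on_sup (φ := bd.comp (T G (fun _ : Unit => (e h0 : Z H))))
        (ψ := (T G (fun _ => e h0)).comp bd) ?_ hz
      rintro ⟨x, l⟩ ⟨h1, h2, h3⟩
      simp only [LinearMap.comp_apply, T_e, mp_e, bd_e, d_cons, map_sub]
      congr 1
      · cases l with
        | nil => simp
        | cons a l =>
          simp only [nu_cons, T_e, mp_e]
          have : a⁻¹ • h0 = h0 := by rw [inv_smul_eq_iff]; exact (h3 a (by simp)).symm
          rw [this]
      · have k := fun u => hom_ext_apply (φ := (nu h0).comp (cs (1 : G)))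
          (ψ := ((T G (fun _ : Unit => (e h0 : Z H))).comp (nu x)).comp (cs (1 : G))) (by
          intro l
          simp only [LinearMap.comp_apply, cs_e, nu_one, T_e, mp_e]) u
        exact k _
    rw [hzh, this z hz, hbz, map_zero]
  have hζ := sub_mem (inc_mem (y0 := y0) hm2) (apex_mem (HP := HP) (y0 := y0) hu)
  obtain ⟨w, hw, hDw⟩ := hV _ hq _ hζ (by
    rw [map_sub, D_inc hy0, D_apex hy0, hbzh, hpt, hzu]; simp)
  have k2 := congrArg (T G pH) hDw
  rw [pH_D, map_sub, pH_apex, pH_inc, sub_zero] at k2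
  have hv := pH_mem hw
  set v := T G pH w with hvdef
  refine ⟨T G pt (Mv s (-v)), FixL_pt (Mv_fix hs hHP (Submodule.neg_mem _ hv)), ?_⟩
  rw [bd_T pt_eqv, Mv_bd, map_neg, k2, Mv_id hs1 hm, hpt]

end Shapiro

section FRzero

variable {F V : Type} [Field F] [AddCommGroup V] [Module F V] [FiniteDimensional F V]
  {B : V →ₗ[F] V →ₗ[F] F}

/-- Hyperbolic pairs. -/
def HPs (B : V →ₗ[F] V →ₗ[F] F) : Set (V × V) := {h | B h.1 h.1 = 0 ∧ B h.2 h.2 = 0 ∧ B h.1 h.2 = 1}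

lemma FR00 : FR B 0 0 = PA (HPs B) (([], [], []) : Cf V) := by
  ext ⟨o, hl, ws, t⟩
  constructor
  · rintro ⟨h1, h2, h3, h4⟩
    simp only at h1 h2 h3 h4
    have h2' := List.length_eq_zero_iff.1 h2
    have h3' := List.length_eq_zero_iff.1 h3
    subst h1 h2' h3'
    refine ⟨rfl, ?_⟩
    rintro h hh
    simp only at hh
    subst hh
    obtain ⟨a, b, c, -⟩ := h4.hf
    exact ⟨a, b, c⟩
  · rintro ⟨h1, h2⟩
    simp only [Prod.mk.injEq] at h1 h2
    obtain ⟨rfl, rfl, rfl⟩ := h1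
    refine ⟨rfl, rfl, rfl, ?_, by simp, ?_, Ind.nil⟩
    · cases o with
      | none => trivial
      | some h =>
        obtain ⟨a, b, c⟩ := h2 h rfl
        exact ⟨a, b, c, trivial, trivial, trivial⟩
    · intro x hx; simp at hx

lemma van_all {G : Type} [Group G] [DistribMulAction G V] (I : IsoG B G)
    (hs : ∀ x y, B x y = B y x) (h2 : (2 : F) ≠ 0) (hN : ND B (⊤ : Submodule F V)) {g : ℕ}
    (hg : Genus B (⊤ : Submodule F V) g) (q : ℕ) (hq : q < g) :
    Van G (PA (HPs B) (([], [], []) : Cf V)) q := by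
  rw [← FR00]
  exact QS_zero I hs h2 hN hg (swapS I hs h2) q (by simpa using hq)

end FRzero

end OStab

namespace OStab

section Translate

set_option linter.unusedSectionVars false

variable {G : Type} [Group G]

/-- Partial products. -/
def pp : {n : ℕ} → (Fin n → G) → List G
  | 0, _ => []
  | _ + 1, v => v 0 :: (pp (Fin.tail v)).map (fun p => v 0 * p)

lemma pp_zero (v : Fin 0 → G) : pp v = [] := rfl

lemma pp_succ {n : ℕ} (v : Fin (n + 1) → G) :
    pp v = v 0 :: (pp (Fin.tail v)).map (fun p => v 0 * p) := rfl

lemma pp_cons {n : ℕ} (g : G) (v : Fin n → G) :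
    pp (Fin.cons g v : Fin (n + 1) → G) = g :: (pp v).map (fun p => g * p) := by
  rw [pp_succ]; simp

lemma pp_length {n : ℕ} (v : Fin n → G) : (pp v).length = n := by
  induction n with
  | zero => rfl
  | succ n ih => simp [pp_succ, ih]

lemma pp_inj {n : ℕ} : Function.Injective (pp (G := G) (n := n)) := by
  induction n with
  | zero => intro v v' _; exact Subsingleton.elim _ _
  | succ n ih =>
    intro v v' h
    rw [pp_succ, pp_succ, List.cons.injEq] at h
    obtain ⟨h1, h2⟩ := h
    rw [← h1] at h2
    have h3 := ih (List.map_injective_iff.2 (mul_right_injective (v 0)) h2)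
    rw [← Fin.cons_self_tail v, ← Fin.cons_self_tail v', h1, h3]

lemma pp_surj {n : ℕ} : ∀ l : List G, l.length = n → ∃ v : Fin n → G, pp v = l := by
  induction n with
  | zero => intro l hl; exact ⟨fun _ => 1, by rw [List.length_eq_zero_iff.1 hl]; rfl⟩
  | succ n ih =>
    intro l hl
    cases l with
    | nil => simp at hl
    | cons g l =>
      obtain ⟨v, hv⟩ := ih (l.map (fun p => g⁻¹ * p)) (by simpa using hl)
      refine ⟨Fin.cons g v, ?_⟩
      rw [pp_cons, hv]
      simp [Function.comp_def]

lemma pp_map {K : Type} [Group K] (φ : K →* G) {n : ℕ} (v : Fin n → K) :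
    pp (φ ∘ v) = (pp v).map φ := by
  induction n with
  | zero => rfl
  | succ n ih =>
    rw [pp_succ, pp_succ, ← Fin.comp_tail, ih]
    simp [Function.comp_def]

lemma contract_zero {n : ℕ} (g : G) (v : Fin (n + 1) → G) :
    Fin.contractNth 0 (· * ·) (Fin.cons g v : Fin (n + 2) → G) = Fin.cons (g * v 0) (Fin.tail v) := by
  funext k
  refine Fin.cases ?_ (fun k => ?_) k
  · rfl
  · simp [Fin.contractNth, Fin.tail]

lemma contract_succ {n : ℕ} (g : G) (v : Fin (n + 1) → G) (j : Fin (n + 1)) :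
    Fin.contractNth j.succ (· * ·) (Fin.cons g v : Fin (n + 2) → G) =
      Fin.cons g (Fin.contractNth j (· * ·) v) := by
  funext k
  refine Fin.cases ?_ (fun k => ?_) k
  · simp [Fin.contractNth]
  · simp only [Fin.contractNth, Fin.val_succ, Fin.cons_succ, add_lt_add_iff_right,
      add_left_inj, ← Fin.succ_castSucc]

lemma d_pp {n : ℕ} (v : Fin (n + 1) → G) :
    d (e (pp v)) = ∑ j : Fin (n + 1), ((-1 : ℤ) ^ (j : ℕ)) • e (pp (Fin.contractNth j (· * ·) v)) := by
  induction n with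
  | zero =>
    rw [pp_succ, pp_zero]
    simp [d_cons, pp_zero]
  | succ n ih =>
    obtain ⟨g, v, rfl⟩ : ∃ g v', v = Fin.cons g v' := ⟨_, _, (Fin.cons_self_tail v).symm⟩
    rw [pp_cons, d_cons, Fin.sum_univ_succ, contract_zero]
    have h1 : (e (List.map (fun p => g * p) (pp v))) = mp (List.map (fun p => g * p)) (e (pp v)) := by
      rw [mp_e]
    conv_lhs => rw [h1, d_map, ih]
    rw [sub_eq_add_neg]
    congr 1
    · rw [mp_e, pp_cons, pp_succ v]
      simp [Function.comp_def, mul_assoc]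
    · rw [map_sum, map_sum, ← Finset.sum_neg_distrib]
      refine Finset.sum_congr rfl (fun j _ => ?_)
      rw [contract_succ, pp_cons, map_smul, map_smul, mp_e, cs_e, Fin.val_succ, pow_succ]
      simp

/-- Translation from inhomogeneous chains. -/
noncomputable def Th (n : ℕ) : GroupHomologyBar.chains G ℤ n →ₗ[ℤ] Z (Unit × List G) :=
  mp (fun v => ((), pp v))

lemma nu_cs (u : Z (List G)) : nu () (cs 1 u) = mp (fun l => ((), l)) u := by
  have k := fun u => hom_ext_apply (φ := (nu (() : Unit)).comp (cs (1 : G)))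
    (ψ := mp (fun l : List G => ((() : Unit), l)))
    (by intro l; simp only [LinearMap.comp_apply, cs_e, nu_one, mp_e]) u
  exact k u

lemma Th_d {n : ℕ} (x : GroupHomologyBar.chains G ℤ (n + 1)) :
    Th n (GroupHomologyBar.d G ℤ n x) = bd (Th (n + 1) x) := by
  refine hom_ext_apply (φ := (Th n).comp (GroupHomologyBar.d G ℤ n)) (ψ := bd.comp (Th (n + 1))) ?_ x
  intro v
  have hv : GroupHomologyBar.d G ℤ n (e v) = e (Fin.tail v) + ∑ j : Fin (n + 1),
      ((-1 : ℤ) ^ ((j : ℕ) + 1)) • e (Fin.contractNth j (· * ·) v) :=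
    GroupHomologyBar.d_single ℤ v 1
  simp only [LinearMap.comp_apply]
  rw [hv]
  simp only [Th, map_add, map_sum, map_smul, mp_e]
  rw [bd_e, d_cons, map_sub, nu_cs, d_pp, sub_eq_add_neg]
  congr 1
  · rw [pp_succ, nu_cons]; simp [Function.comp_def]
  · rw [map_sum, ← Finset.sum_neg_distrib]
    refine Finset.sum_congr rfl (fun j _ => ?_)
    rw [map_smul, mp_e, pow_succ]; simp

lemma Th_mem {n : ℕ} (x : GroupHomologyBar.chains G ℤ n) :
    Th n x ∈ sup (Cells G (Set.univ : Set Unit) n) := by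
  have : x ∈ sup (Set.univ : Set (Fin n → G)) := mem_sup_iff.2 (fun a _ => Set.mem_univ a)
  exact mp_mem (t := Cells G (Set.univ : Set Unit) n) (fun v _ => ⟨Set.mem_univ _, pp_length v⟩) this

lemma Th_inj {n : ℕ} : Function.Injective (Th (G := G) n) := by
  have h : Function.Injective (fun v : Fin n → G => ((), pp v)) := by
    intro v v' h
    exact pp_inj (Prod.ext_iff.1 h).2
  have : Th (G := G) n = Finsupp.lmapDomain ℤ ℤ (fun v : Fin n → G => ((), pp v)) := by
    apply hom_ext
    intro v
    rw [Th, mp_e]; simp [e, Finsupp.mapDomain_single]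
  rw [this]
  exact Finsupp.mapDomain_injective h

lemma chainsMap_inj {K : Type} [Group K] {φ : K →* G} (hφ : Function.Injective φ) (n : ℕ) :
    Function.Injective (GroupHomologyBar.chainsMap ℤ φ n) :=
  Finsupp.mapDomain_injective (fun _ _ h => funext (fun i => hφ (congrFun h i)))

lemma Th_range {K : Type} [Group K] (φ : K →* G) {S : Set G} (hS : ∀ g ∈ S, g ∈ φ.range) {n : ℕ}
    {w : Z (Unit × List G)} (hw : w ∈ sup (FixL (Set.univ : Set Unit) S n)) :
    ∃ y, Th n (GroupHomologyBar.chainsMap ℤ φ n y) = w := by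
  have : w ∈ LinearMap.range ((Th n).comp (GroupHomologyBar.chainsMap ℤ φ n)) := by
    refine map_mem (N := LinearMap.range ((Th n).comp (GroupHomologyBar.chainsMap ℤ φ n)))
      LinearMap.id ?_ hw
    rintro ⟨x, l⟩ ⟨-, h2, h3⟩
    simp only at h2 h3
    have : ∃ l' : List K, l'.map φ = l := by
      have : l ∈ Set.range (List.map φ) := by
        rw [Set.range_list_map]
        intro g hg; exact hS g (h3 g hg)
      exact this
    obtain ⟨l', rfl⟩ := this
    obtain ⟨v, rfl⟩ := pp_surj l' (by simpa using h2)
    refine ⟨e v, ?_⟩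
    have h4 : GroupHomologyBar.chainsMap ℤ φ n (e v) = e (φ ∘ v) :=
      GroupHomologyBar.chainsMap_single ℤ φ v 1
    rw [LinearMap.comp_apply, h4, Th, mp_e, pp_map]
    rfl
  obtain ⟨y, hy⟩ := this
  exact ⟨y, hy⟩

lemma Th_fix {K : Type} [Group K] (φ : K →* G) {S : Set G} (hS : ∀ k, φ k ∈ S) {n : ℕ}
    (x : GroupHomologyBar.chains K ℤ n) :
    Th n (GroupHomologyBar.chainsMap ℤ φ n x) ∈ sup (FixL (Set.univ : Set Unit) S n) := by
  have : x ∈ sup (Set.univ : Set (Fin n → K)) := mem_sup_iff.2 (fun a _ => Set.mem_univ a)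
  refine map_mem ((Th n).comp (GroupHomologyBar.chainsMap ℤ φ n)) ?_ this
  intro v _
  have h4 : GroupHomologyBar.chainsMap ℤ φ n (e v) = e (φ ∘ v) :=
    GroupHomologyBar.chainsMap_single ℤ φ v 1
  rw [LinearMap.comp_apply, h4, Th, mp_e, pp_map]
  refine e_mem ⟨Set.mem_univ _, by simp [pp_length], ?_⟩
  intro g hg
  simp only [List.mem_map] at hg
  obtain ⟨k, -, rfl⟩ := hg
  exact hS k

lemma Th_surj {n : ℕ} {w : Z (Unit × List G)} (hw : w ∈ sup (Cells G (Set.univ : Set Unit) n)) :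
    ∃ y, Th n y = w := by
  obtain ⟨y, hy⟩ := Th_range (MonoidHom.id G) (S := Set.univ) (fun g _ => ⟨g, rfl⟩) (n := n) (w := w)
    (sup_mono (by rintro ⟨x, l⟩ ⟨h1, h2⟩; exact ⟨h1, h2, fun _ _ => Set.mem_univ _⟩) hw)
  exact ⟨_, hy⟩

lemma mem_cycles_iff {n : ℕ} (x : GroupHomologyBar.chains G ℤ n) :
    x ∈ GroupHomologyBar.cycles G ℤ n ↔ bd (Th n x) = 0 := by
  cases n with
  | zero =>
    simp only [GroupHomologyBar.cycles, Submodule.mem_top, true_iff]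
    exact bd_zero (Th_mem x)
  | succ n =>
    simp only [GroupHomologyBar.cycles, LinearMap.mem_ker]
    rw [← Th_d]
    constructor
    · intro h; rw [h, map_zero]
    · intro h; exact Th_inj (by rw [h, map_zero])

lemma d_chainsMap_apply {K : Type} [Group K] (φ : K →* G) (n : ℕ) (x : GroupHomologyBar.chains K ℤ (n + 1)) :
    GroupHomologyBar.d G ℤ n (GroupHomologyBar.chainsMap ℤ φ (n + 1) x) =
      GroupHomologyBar.chainsMap ℤ φ n (GroupHomologyBar.d K ℤ n x) :=
  congrArg (fun L : GroupHomologyBar.chains K ℤ (n + 1) →ₗ[ℤ] GroupHomologyBar.chains G ℤ n => L x)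
    (GroupHomologyBar.d_chainsMap ℤ φ n)

lemma cycles_of_map {K : Type} [Group K] {φ : K →* G} (hφ : Function.Injective φ) {n : ℕ}
    {y : GroupHomologyBar.chains K ℤ n}
    (h : GroupHomologyBar.chainsMap ℤ φ n y ∈ GroupHomologyBar.cycles G ℤ n) :
    y ∈ GroupHomologyBar.cycles K ℤ n := by
  cases n with
  | zero => trivial
  | succ n =>
    simp only [GroupHomologyBar.cycles, LinearMap.mem_ker] at h ⊢
    rw [d_chainsMap_apply] at h
    exact chainsMap_inj hφ n (by rw [h, map_zero])

theorem surj_ind {K : Type} [Group K] {φ : K →* G} (hφ : Function.Injective φ) {S : Set G}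
    (hS : ∀ g ∈ S, g ∈ φ.range) {q : ℕ}
    (h : ∀ z ∈ sup (Cells G (Set.univ : Set Unit) q), bd z = 0 →
      ∃ w ∈ sup (FixL (Set.univ : Set Unit) S q), bd w = 0 ∧
        ∃ u ∈ sup (Cells G (Set.univ : Set Unit) (q + 1)), bd u = z - w) :
    Function.Surjective (GroupHomologyBar.inducedMap ℤ φ q) := by
  intro y
  obtain ⟨⟨x, hx⟩, rfl⟩ := Submodule.Quotient.mk_surjective _ y
  obtain ⟨w, hw, hbw, u, hu, hbu⟩ := h _ (Th_mem x) ((mem_cycles_iff x).1 hx)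
  obtain ⟨y, rfl⟩ := Th_range φ hS hw
  obtain ⟨u, rfl⟩ := Th_surj hu
  have hy := cycles_of_map hφ ((mem_cycles_iff _).2 hbw)
  refine ⟨Submodule.Quotient.mk ⟨y, hy⟩, ?_⟩
  refine Eq.symm ((Submodule.Quotient.eq _).2 ?_)
  show (_ : GroupHomologyBar.chains G ℤ q) ∈ LinearMap.range _
  refine ⟨u, ?_⟩
  apply Th_inj
  rw [Th_d, hbu, ← map_sub]
  rfl

theorem inj_ind {K K' : Type} [Group K] [Group K'] {φ : K →* K'} {ψ : K' →* G}
    (hφ : Function.Injective (ψ.comp φ)) {S : Set G}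
    (hS : ∀ g ∈ S, g ∈ (ψ.comp φ).range) (hS' : ∀ k, ψ (φ k) ∈ S) {q : ℕ}
    (h : ∀ z ∈ sup (FixL (Set.univ : Set Unit) S q),
      ∀ u ∈ sup (Cells G (Set.univ : Set Unit) (q + 1)), bd u = z →
      ∃ w ∈ sup (FixL (Set.univ : Set Unit) S (q + 1)), bd w = z) :
    Function.Injective (GroupHomologyBar.inducedMap ℤ φ q) := by
  rw [injective_iff_map_eq_zero]
  intro y hy
  obtain ⟨⟨x, hx⟩, rfl⟩ := Submodule.Quotient.mk_surjective _ y
  have hy' := (Submodule.Quotient.mk_eq_zero _).1 hy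
  obtain ⟨u, hu⟩ : ∃ u, GroupHomologyBar.d K' ℤ q u = GroupHomologyBar.chainsMap ℤ φ q x := hy'
  have hcomp : ∀ {n : ℕ} (x : GroupHomologyBar.chains K ℤ n), GroupHomologyBar.chainsMap ℤ ψ n (GroupHomologyBar.chainsMap ℤ φ n x) =
      GroupHomologyBar.chainsMap ℤ (ψ.comp φ) n x := by
    intro n x
    refine hom_ext_apply (φ := (GroupHomologyBar.chainsMap ℤ ψ n).comp (GroupHomologyBar.chainsMap ℤ φ n)) (ψ := GroupHomologyBar.chainsMap ℤ (ψ.comp φ) n) ?_ x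
    intro v
    simp only [LinearMap.comp_apply, e, GroupHomologyBar.chainsMap_single]
    rfl
  have hu2 : bd (Th (q + 1) (GroupHomologyBar.chainsMap ℤ ψ (q + 1) u)) =
      Th q (GroupHomologyBar.chainsMap ℤ (ψ.comp φ) q x) := by
    rw [← Th_d, d_chainsMap_apply, hu, hcomp]
  obtain ⟨w, hw, hbw⟩ := h _ (Th_fix (ψ.comp φ) hS' x) _ (Th_mem _) hu2
  obtain ⟨y, rfl⟩ := Th_range (ψ.comp φ) hS hw
  refine (Submodule.Quotient.mk_eq_zero _).2 ?_
  show x ∈ LinearMap.range _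
  refine ⟨y, ?_⟩
  rw [← Th_d, d_chainsMap_apply] at hbw
  exact chainsMap_inj hφ q (Th_inj hbw)

end Translate

end OStab

namespace OStab

section Final

variable {F : Type} [Field F]

section Gen

variable {V : Type} [AddCommGroup V] [Module F V]

/-- The reflection as a linear map. -/
noncomputable def reflL (B : V →ₗ[F] V →ₗ[F] F) (v : V) : V →ₗ[F] V :=
  LinearMap.id - ((2 / B v v) • B v).smulRight v

lemma reflL_apply (B : V →ₗ[F] V →ₗ[F] F) (v x : V) :
    reflL B v x = x - (2 * B v x / B v v) • v := by
  simp only [reflL, LinearMap.sub_apply, LinearMap.id_apply, LinearMap.smulRight_apply,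
    LinearMap.smul_apply, smul_eq_mul]
  congr 2
  ring

lemma reflL_invol (B : V →ₗ[F] V →ₗ[F] F) (v x : V) : reflL B v (reflL B v x) = x := by
  rw [reflL_apply, reflL_apply, map_sub, map_smul, smul_eq_mul]
  by_cases h : B v v = 0
  · simp [h]
  · rw [sub_sub, ← add_smul]
    have : 2 * B v x / B v v + 2 * (B v x - 2 * B v x / B v v * B v v) / B v v = 0 := by
      field_simp
      ring
    rw [this, zero_smul, sub_zero]

/-- The reflection as a linear equivalence. -/
noncomputable def rfn (B : V →ₗ[F] V →ₗ[F] F) (v : V) : V ≃ₗ[F] V :=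
  LinearEquiv.ofInvolutive (reflL B v) (reflL_invol B v)

lemma rfn_apply (B : V →ₗ[F] V →ₗ[F] F) (v x : V) :
    rfn B v x = x - (2 * B v x / B v v) • v := reflL_apply B v x

lemma polar {B : V →ₗ[F] V →ₗ[F] F} (hs : ∀ x y, B x y = B y x) (h2 : (2 : F) ≠ 0) {g : V → V}
    (hadd : ∀ x y, g (x + y) = g x + g y) (hg : ∀ v, B (g v) (g v) = B v v) (x y : V) :
    B (g x) (g y) = B x y := by
  have h := hg (x + y)
  rw [hadd] at h
  simp only [map_add, LinearMap.add_apply] at h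
  rw [hg x, hg y, hs (g y) (g x), hs y x] at h
  have : (2 : F) * B (g x) (g y) = 2 * B x y := by linear_combination h
  exact mul_left_cancel₀ h2 this

variable {Q : V → F}

lemma sm_def (g : quadIsoms F Q) (v : V) : g • v = (g : V ≃ₗ[F] V) v := rfl

lemma q_inv {B : V →ₗ[F] V →ₗ[F] F} (hs : ∀ x y, B x y = B y x) (h2 : (2 : F) ≠ 0)
    (hQ : ∀ v, Q v = B v v) (g : quadIsoms F Q) (x y : V) : B (g • x) (g • y) = B x y :=
  polar hs h2 (g := fun v => g • v) (fun x y => smul_add g x y)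
    (fun v => by have := g.2 v; rw [hQ, hQ] at this; exact this) x y

lemma q_ext {g h : quadIsoms F Q} (H : ∀ x : V, g • x = h • x) : g = h :=
  Subtype.ext (LinearEquiv.ext H)

/-- The reflection as an isometry. -/
noncomputable def Rq {B : V →ₗ[F] V →ₗ[F] F} (hs : ∀ x y, B x y = B y x)
    (hQ : ∀ v, Q v = B v v) (v : V) : quadIsoms F Q :=
  ⟨rfn B v, fun x => by
    rw [hQ, hQ, rfn_apply]
    simp only [map_sub, map_smul, LinearMap.sub_apply, LinearMap.smul_apply, smul_eq_mul]
    rw [hs x v]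
    by_cases h : B v v = 0
    · simp [h]
    · field_simp
      ring⟩

lemma Rq_smul {B : V →ₗ[F] V →ₗ[F] F} (hs : ∀ x y, B x y = B y x)
    (hQ : ∀ v, Q v = B v v) (v x : V) : Rq hs hQ v • x = x - (2 * B v x / B v v) • v :=
  rfn_apply B v x

lemma sm_lin (g : quadIsoms F Q) (c : F) (x : V) : g • (c • x) = c • (g • x) :=
  (g : V ≃ₗ[F] V).map_smul c x

lemma Rq_conj {B : V →ₗ[F] V →ₗ[F] F} (hs : ∀ x y, B x y = B y x) (h2 : (2 : F) ≠ 0)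
    (hQ : ∀ v, Q v = B v v) (k : quadIsoms F Q) (v : V) :
    Rq hs hQ (k • v) = k * Rq hs hQ v * k⁻¹ := by
  rw [eq_mul_inv_iff_mul_eq]
  refine q_ext (fun x => ?_)
  rw [mul_smul, mul_smul, Rq_smul, Rq_smul, q_inv hs h2 hQ, q_inv hs h2 hQ, smul_sub, sm_lin]

lemma Rq_neg {B : V →ₗ[F] V →ₗ[F] F} (hs : ∀ x y, B x y = B y x)
    (hQ : ∀ v, Q v = B v v) (v : V) : Rq hs hQ (-v) = Rq hs hQ v := by
  refine q_ext (fun x => ?_)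
  rw [Rq_smul, Rq_smul]
  simp [neg_div]

/-- The isometry group datum. -/
noncomputable def isoG {B : V →ₗ[F] V →ₗ[F] F} (hs : ∀ x y, B x y = B y x) (h2 : (2 : F) ≠ 0)
    (hQ : ∀ v, Q v = B v v) : IsoG B (quadIsoms F Q) where
  inv := q_inv hs h2 hQ
  lin := sm_lin
  R := Rq hs hQ
  R_smul := Rq_smul hs hQ
  R_conj := Rq_conj hs h2 hQ
  R_neg := Rq_neg hs hQ

end Gen

/-- Splitting off a fixed vector. -/
lemma split_fix {A : Type} [AddCommGroup A] [Module F A] {Q : A → F} {c : F} (hc : c ≠ 0)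
    {B : A × F →ₗ[F] A × F →ₗ[F] F} (hB : ∀ x, B x x = Q x.1 + c * x.2 ^ 2)
    (hB1 : ∀ x, B (0, 1) x = c * x.2)
    {g : (A × F) ≃ₗ[F] (A × F)} (hg : ∀ x y, B (g x) (g y) = B x y) (h1 : g (0, 1) = (0, 1)) :
    ∃ g1 : quadIsoms F Q, ∀ a l, g (a, l) = ((g1 : A ≃ₗ[F] A) a, l) := by
  have key : ∀ (g : (A × F) ≃ₗ[F] (A × F)), (∀ x y, B (g x) (g y) = B x y) → g (0, 1) = (0, 1) →
      ∀ a, g (a, 0) = ((g (a, 0)).1, 0) := by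
    intro g hg h1 a
    refine Prod.ext rfl ?_
    have := hg (0, 1) (a, 0)
    rw [h1, hB1, hB1] at this
    exact mul_left_cancel₀ hc this
  have hg' : ∀ x y, B (g.symm x) (g.symm y) = B x y := fun x y => by
    rw [← hg, g.apply_symm_apply, g.apply_symm_apply]
  have h1' : g.symm (0, 1) = (0, 1) := by rw [LinearEquiv.symm_apply_eq, h1]
  let f : ((A × F) ≃ₗ[F] (A × F)) → (A →ₗ[F] A) := fun g =>
    (LinearMap.fst F A F).comp (g.toLinearMap.comp (LinearMap.inl F A F))
  have hf : ∀ g a, f g a = (g (a, 0)).1 := fun g a => rfl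
  let g1 : A ≃ₗ[F] A := LinearEquiv.ofLinearMap (f g) (f g.symm)
    (by ext a; simp only [LinearMap.comp_apply, hf, LinearMap.id_apply]
        rw [← key _ hg' h1', g.apply_symm_apply])
    (by ext a; simp only [LinearMap.comp_apply, hf, LinearMap.id_apply]
        rw [← key _ hg h1, g.symm_apply_apply])
  have hg1 : ∀ a, g (a, 0) = (g1 a, 0) := key g hg h1
  refine ⟨⟨g1, fun a => ?_⟩, fun a l => ?_⟩
  · have := hg (a, 0) (a, 0)
    rw [hg1, hB, hB] at this
    simpa using this
  · have : ((a, l) : A × F) = (a, 0) + l • (0, 1) := by simp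
    rw [this, map_add, map_smul, h1, hg1]
    simp

/-- The dot product. -/
noncomputable def Bd (F : Type) [Field F] (N : ℕ) : (Fin N → F) →ₗ[F] (Fin N → F) →ₗ[F] F :=
  LinearMap.mk₂ F (fun x y => ∑ i, x i * y i)
    (fun x y z => by simp [add_mul, Finset.sum_add_distrib])
    (fun c x y => by simp [Finset.mul_sum, mul_assoc])
    (fun x y z => by simp [mul_add, Finset.sum_add_distrib])
    (fun c x y => by simp [Finset.mul_sum, mul_left_comm])

lemma Bd_apply {N : ℕ} (x y : Fin N → F) : Bd F N x y = ∑ i, x i * y i := rfl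

lemma Bd_symm {N : ℕ} (x y : Fin N → F) : Bd F N x y = Bd F N y x := by
  simp only [Bd_apply, mul_comm]

lemma Bd_Q {N : ℕ} (x : Fin N → F) : sumForm F (fun x : F => x ^ 2) N x = Bd F N x x := by
  simp only [Bd_apply, sumForm, sq]

lemma Bd_ND (N : ℕ) : ND (Bd F N) ⊤ := by
  intro x _ h
  funext i
  have := h (Pi.single i 1) trivial
  simpa [Bd_apply, Pi.single_apply] using this

/-- The extended form: `A × F` with `c` in the last place. -/
noncomputable def Be {A : Type} [AddCommGroup A] [Module F A] (B : A →ₗ[F] A →ₗ[F] F) (c : F) :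
    A × F →ₗ[F] A × F →ₗ[F] F :=
  LinearMap.mk₂ F (fun x y => B x.1 y.1 + c * (x.2 * y.2))
    (fun x y z => by simp; ring)
    (fun c x y => by simp; ring)
    (fun x y z => by simp; ring)
    (fun c x y => by simp; ring)

lemma Be_apply {A : Type} [AddCommGroup A] [Module F A] (B : A →ₗ[F] A →ₗ[F] F) (c : F)
    (x y : A × F) : Be B c x y = B x.1 y.1 + c * (x.2 * y.2) := rfl

lemma Be_ND {A : Type} [AddCommGroup A] [Module F A] {B : A →ₗ[F] A →ₗ[F] F} {c : F} (hc : c ≠ 0)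
    (h : ND B ⊤) : ND (Be B c) ⊤ := by
  rintro ⟨a, l⟩ _ hx
  have h1 : a = 0 := h a trivial (fun y _ => by simpa [Be_apply] using hx (y, 0) trivial)
  have h2 : l = 0 := by simpa [Be_apply, hc] using hx (0, 1) trivial
  rw [h1, h2]; rfl

lemma Bd_snoc {n : ℕ} (x y : (Fin n → F) × F) :
    Bd F (n + 1) ((lastSplit F n).symm x) ((lastSplit F n).symm y) = Be (Bd F n) 1 x y := by
  obtain ⟨p, w⟩ := x
  obtain ⟨p', w'⟩ := y
  simp [Be_apply, Bd_apply, lastSplit_symm_apply, Fin.sum_univ_castSucc]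

/-- The stabilising vector. -/
noncomputable def ep (F : Type) [Field F] (n : ℕ) : Fin (n + 1) → F := (lastSplit F n).symm (0, 1)

lemma quadStab_apply {n : ℕ} (g : quadIsoms F (sumForm F (fun x : F => x ^ 2) n))
    (p : Fin n → F) (w : F) :
    ((quadStab F (fun x : F => x ^ 2) n g : quadIsoms F _) : (Fin (n + 1) → F) ≃ₗ[F] (Fin (n + 1) → F))
      ((lastSplit F n).symm (p, w)) = (lastSplit F n).symm ((g : (Fin n → F) ≃ₗ[F] _) p, w) :=
  stabAut_symm_apply F n g.1 p w

lemma quadStab_inj {n : ℕ} : Function.Injective (quadStab F (fun x : F => x ^ 2) n) := by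
  intro g h H
  refine q_ext (fun x => ?_)
  have h1 := quadStab_apply g x 0
  rw [H, quadStab_apply] at h1
  exact (Prod.ext_iff.1 ((lastSplit F n).symm.injective h1)).1.symm

lemma quadStab_ep {n : ℕ} (g : quadIsoms F (sumForm F (fun x : F => x ^ 2) n)) :
    (quadStab F (fun x : F => x ^ 2) n g) • ep F n = ep F n := by
  rw [sm_def, ep, quadStab_apply, map_zero]

lemma fix_range (h2 : (2 : F) ≠ 0) {n : ℕ}
    (g : quadIsoms F (sumForm F (fun x : F => x ^ 2) (n + 1))) (hg : g • ep F n = ep F n) :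
    g ∈ (quadStab F (fun x : F => x ^ 2) n).range := by
  obtain ⟨g1, hg1⟩ := split_fix (A := Fin n → F) (Q := sumForm F (fun x : F => x ^ 2) n) (c := 1)
    one_ne_zero (B := Be (Bd F n) 1) (fun x => by rw [Be_apply, Bd_Q]; ring)
    (fun x => by simp [Be_apply])
    (g := (lastSplit F n).symm.trans ((g : (Fin (n + 1) → F) ≃ₗ[F] _).trans (lastSplit F n)))
    (fun x y => by
      rw [← Bd_snoc, ← Bd_snoc]
      simp only [LinearEquiv.trans_apply, LinearEquiv.symm_apply_apply]
      exact q_inv Bd_symm h2 Bd_Q g _ _)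
    (by
      simp only [LinearEquiv.trans_apply]
      change lastSplit F n (g • ep F n) = _
      rw [hg, ep, LinearEquiv.apply_symm_apply])
  refine ⟨g1, q_ext (fun v => ?_)⟩
  obtain ⟨⟨p, w⟩, rfl⟩ := (lastSplit F n).symm.surjective v
  rw [sm_def, quadStab_apply, ← hg1]
  simp only [LinearEquiv.trans_apply, LinearEquiv.symm_apply_apply]
  rfl

/-- Acting on the first component. -/
noncomputable def psi (N : ℕ) : quadIsoms F (sumForm F (fun x : F => x ^ 2) N) →*
    quadIsoms F (fun v : (Fin N → F) × F => Be (Bd F N) (-1) v v) where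
  toFun g := ⟨(g : (Fin N → F) ≃ₗ[F] _).prodCongr (LinearEquiv.refl F F), fun v => by
    have := g.2 v.1
    rw [Bd_Q, Bd_Q] at this
    simp only [Be_apply, LinearEquiv.prodCongr_apply, LinearEquiv.refl_apply]
    rw [this]⟩
  map_one' := rfl
  map_mul' _ _ := rfl

lemma psi_apply {N : ℕ} (g : quadIsoms F (sumForm F (fun x : F => x ^ 2) N)) (a : Fin N → F) (l : F) :
    psi N g • (a, l) = (g • a, l) := rfl

lemma psi_inj {N : ℕ} : Function.Injective (psi (F := F) N) := by
  intro g h H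
  refine q_ext (fun x => ?_)
  have h1 := psi_apply g x 0
  rw [H, psi_apply] at h1
  exact (Prod.ext_iff.1 h1).1.symm

lemma Be_symm {N : ℕ} {c : F} (x y : (Fin N → F) × F) : Be (Bd F N) c x y = Be (Bd F N) c y x := by
  rw [Be_apply, Be_apply, Bd_symm, mul_comm x.2]

lemma psi_range (h2 : (2 : F) ≠ 0) {N : ℕ}
    (g : quadIsoms F (fun v : (Fin N → F) × F => Be (Bd F N) (-1) v v))
    (hg : g • ((0, 1) : (Fin N → F) × F) = (0, 1)) : ∃ g1, psi N g1 = g := by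
  have hi : ∀ x y : (Fin N → F) × F, Be (Bd F N) (-1) (g.1 x) (g.1 y) = Be (Bd F N) (-1) x y :=
    fun x y => q_inv (Q := fun v : (Fin N → F) × F => Be (Bd F N) (-1) v v)
      (B := Be (Bd F N) (-1)) Be_symm h2 (fun _ => rfl) g x y
  have hg' : g.1 ((0, 1) : (Fin N → F) × F) = (0, 1) := hg
  have hc : (-1 : F) ≠ 0 := by simp
  have hB : ∀ x : (Fin N → F) × F,
      Be (Bd F N) (-1) x x = sumForm F (fun x : F => x ^ 2) N x.1 + (-1) * x.2 ^ 2 :=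
    fun x => by rw [Be_apply, Bd_Q]; ring
  have hB1 : ∀ x : (Fin N → F) × F, Be (Bd F N) (-1) (0, 1) x = (-1) * x.2 :=
    fun x => by simp [Be_apply]
  obtain ⟨g1, hg1⟩ := split_fix hc hB hB1 hi hg'
  refine ⟨g1, q_ext (fun v => ?_)⟩
  obtain ⟨a, l⟩ := v
  rw [psi_apply, sm_def, sm_def]
  exact (hg1 a l).symm

/-! ### Genus -/

/-- Blocks give isotropic subspaces. -/
lemma genus_block {r s : ℕ} (b : (Fin r → F) →ₗ[F] (Fin s → F)) (hb : Function.Injective b)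
    (hi : ∀ x y, Bd F s (b x) (b y) = 0) {m N : ℕ} (hN : m * s ≤ N) :
    Genus (Bd F N) ⊤ (m * r) := by
  let f0 : (Fin m → Fin r → F) →ₗ[F] (Fin m × Fin s → F) :=
    LinearMap.pi (fun p => (LinearMap.proj p.2).comp (b.comp (LinearMap.proj p.1)))
  have hf0 : ∀ x p, f0 x p = b (x p.1) p.2 := fun x p => rfl
  obtain ⟨em⟩ : Nonempty (Fin m × Fin s ↪ Fin N) :=
    Function.Embedding.nonempty_of_card_le (by simpa using hN)
  let f : (Fin m → Fin r → F) →ₗ[F] (Fin N → F) := (Function.ExtendByZero.linearMap F em).comp f0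
  have hf : ∀ x p, f x (em p) = b (x p.1) p.2 := fun x p => by
    change Function.extend em (f0 x) 0 (em p) = _
    rw [em.injective.extend_apply, hf0]
  have hf' : ∀ x i, (¬ ∃ p, em p = i) → f x i = 0 := fun x i h => by
    change Function.extend em (f0 x) 0 i = _
    rw [Function.extend_apply' _ _ _ h]; rfl
  have hinj : Function.Injective f := by
    intro x y h
    funext j
    apply hb
    funext k
    have := congrFun h (em (j, k))
    rwa [hf, hf] at this
  have hiso : ∀ x y, Bd F N (f x) (f y) = 0 := by
    intro x y
    rw [Bd_apply, ← Fintype.sum_of_injective em em.injective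
      (fun p => b (x p.1) p.2 * b (y p.1) p.2) _ ?_ ?_]
    · rw [Fintype.sum_prod_type]
      exact Finset.sum_eq_zero (fun j _ => hi (x j) (y j))
    · intro i h
      rw [hf' x i h, zero_mul]
    · intro p
      rw [hf, hf]
  refine ⟨LinearMap.range f, le_top, ?_, ?_⟩
  · rintro _ ⟨x, rfl⟩ _ ⟨y, rfl⟩
    exact hiso x y
  · rw [LinearMap.finrank_range_of_inj hinj]
    simp [Module.finrank_pi_fintype]

lemma genus_le {N : ℕ} {k l : ℕ} (h : Genus (Bd F N) ⊤ k) (hl : l ≤ k) : Genus (Bd F N) ⊤ l := by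
  obtain ⟨W, h1, h2, h3⟩ := h
  exact ⟨W, h1, h2, hl.trans h3⟩

lemma genus_sq {a : F} (ha : a ^ 2 = -1) {m N : ℕ} (hN : 2 * m ≤ N) : Genus (Bd F N) ⊤ m := by
  let b : (Fin 1 → F) →ₗ[F] (Fin 2 → F) :=
    LinearMap.pi ![LinearMap.proj 0, a • LinearMap.proj 0]
  have h0 : ∀ x, b x 0 = x 0 := fun x => rfl
  have h1 : ∀ x, b x 1 = a * x 0 := fun x => rfl
  have := genus_block b (m := m) (N := N) ?_ ?_ (by omega)
  · simpa using this
  · intro x y h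
    funext i
    have := congrFun h 0
    rw [h0, h0] at this
    rwa [Subsingleton.elim i 0]
  · intro x y
    rw [Bd_apply, Fin.sum_univ_two, h0, h0, h1, h1]
    linear_combination (x 0 * y 0) * ha

lemma genus_ab {a b : F} (hab : a ^ 2 + b ^ 2 = -1) {d N : ℕ} (hN : 2 * d + 4 ≤ N) :
    Genus (Bd F N) ⊤ (d + 1) := by
  let f : (Fin 2 → F) →ₗ[F] (Fin 4 → F) :=
    LinearMap.pi ![LinearMap.proj 0, LinearMap.proj 1,
      a • LinearMap.proj 0 - b • LinearMap.proj 1, b • LinearMap.proj 0 + a • LinearMap.proj 1]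
  have h0 : ∀ x, f x 0 = x 0 := fun x => rfl
  have h1 : ∀ x, f x 1 = x 1 := fun x => rfl
  have h2 : ∀ x, f x 2 = a * x 0 - b * x 1 := fun x => rfl
  have h3 : ∀ x, f x 3 = b * x 0 + a * x 1 := fun x => rfl
  refine genus_le (genus_block f (m := (d + 2) / 2) (N := N) ?_ ?_ (by omega)) (by omega)
  · intro x y h
    funext i
    have e0 := congrFun h 0
    have e1 := congrFun h 1
    rw [h0, h0] at e0
    rw [h1, h1] at e1
    fin_cases i
    · exact e0
    · exact e1
  · intro x y
    rw [Bd_apply, Fin.sum_univ_four, h0, h0, h1, h1, h2, h2, h3, h3]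
    linear_combination (x 0 * y 0 + x 1 * y 1) * hab

lemma genus_ext {n k : ℕ} (h : Genus (Bd F n) ⊤ k) : Genus (Be (Bd F (n + 1)) (-1)) ⊤ (k + 1) := by
  obtain ⟨W, -, h2, h3⟩ := h
  let f : (W × F) →ₗ[F] ((Fin (n + 1) → F) × F) :=
    LinearMap.prod ((lastSplit F n).symm.toLinearMap.comp (W.subtype.prodMap LinearMap.id))
      (LinearMap.snd F W F)
  have hf : ∀ w l, f (w, l) = ((lastSplit F n).symm (w.1, l), l) := fun w l => rfl
  have hinj : Function.Injective f := by
    rintro ⟨w, l⟩ ⟨w', l'⟩ h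
    rw [hf, hf] at h
    have h1 := (lastSplit F n).symm.injective (Prod.ext_iff.1 h).1
    exact Prod.ext (Subtype.ext (Prod.ext_iff.1 h1).1) (Prod.ext_iff.1 h).2
  refine ⟨LinearMap.range f, le_top, ?_, ?_⟩
  · rintro _ ⟨⟨x, l⟩, rfl⟩ _ ⟨⟨y, l'⟩, rfl⟩
    rw [hf, hf, Be_apply]
    simp only
    rw [Bd_snoc, Be_apply, h2 x.1 x.2 y.1 y.2]
    ring
  · rw [LinearMap.finrank_range_of_inj hinj, Module.finrank_prod, Module.finrank_self]
    omega

/-! ### The two halves -/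

lemma HPs_smul {V : Type} [AddCommGroup V] [Module F V] [FiniteDimensional F V]
    {B : V →ₗ[F] V →ₗ[F] F} {G : Type} [Group G]
    [DistribMulAction G V] (I : IsoG B G) (g : G) (h : V × V) (hh : h ∈ HPs B) : g • h ∈ HPs B := by
  obtain ⟨h1, h2, h3⟩ := hh
  exact ⟨(I.inv g _ _).trans h1, (I.inv g _ _).trans h2, (I.inv g _ _).trans h3⟩

theorem surj_half (h2 : (2 : F) ≠ 0) {n d : ℕ} (hg : Genus (Bd F (n + 1)) ⊤ (d + 1))
    {y : Fin n → F} (hy : Bd F n y y = -1) :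
    Function.Surjective (GroupHomologyBar.inducedMap ℤ (quadStab F (fun x : F => x ^ 2) n) d) := by
  set I := isoG (Q := sumForm F (fun x : F => x ^ 2) (n + 1)) (B := Bd F (n + 1)) Bd_symm h2 Bd_Q
  let h0 : (Fin (n + 1) → F) × (Fin (n + 1) → F) :=
    ((lastSplit F n).symm (y, 1), (2 : F)⁻¹ • (lastSplit F n).symm (-y, 1))
  have hh0 : h0 ∈ HPs (Bd F (n + 1)) := by
    refine ⟨?_, ?_, ?_⟩
    · simp only [h0, Bd_snoc, Be_apply, hy]; ring
    · simp only [h0, map_smul, LinearMap.smul_apply, Bd_snoc, Be_apply, map_neg,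
        LinearMap.neg_apply, hy, smul_eq_mul]; ring
    · simp only [h0, map_smul, Bd_snoc, Be_apply, map_neg, hy, smul_eq_mul]
      field_simp; ring
  refine surj_ind (S := {g | g • h0 = h0}) quadStab_inj ?_ ?_
  · intro g hgh
    refine fix_range h2 g ?_
    have e1 : g • h0.1 = h0.1 := (Prod.ext_iff.1 hgh).1
    have e2 : g • h0.2 = h0.2 := (Prod.ext_iff.1 hgh).2
    have : ep F n = (2 : F)⁻¹ • h0.1 + h0.2 := by
      simp only [h0, ep]
      rw [← smul_add, ← map_add, ← map_smul]
      congr 1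
      refine Prod.ext ?_ ?_
      · simp
      · simp only [Prod.smul_snd, Prod.snd_add, smul_eq_mul]; field_simp; ring
    rw [this, smul_add, I.lin, e1, e2]
  · intro z hz hb
    exact surjS (fun g => rfl) (HPs_smul I) (van_all I Bd_symm h2 (Bd_ND _) hg) hh0
      (Nat.lt_succ_self d) hz hb

theorem inj_half (h2 : (2 : F) ≠ 0) {n d : ℕ} (hg : Genus (Bd F n) ⊤ (d + 1)) :
    Function.Injective (GroupHomologyBar.inducedMap ℤ (quadStab F (fun x : F => x ^ 2) n) d) := by
  set I := isoG (Q := fun v : (Fin (n + 1) → F) × F => Be (Bd F (n + 1)) (-1) v v)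
    (B := Be (Bd F (n + 1)) (-1)) Be_symm h2 (fun _ => rfl)
  let h0 : ((Fin (n + 1) → F) × F) × ((Fin (n + 1) → F) × F) :=
    ((ep F n, 1), (2 : F)⁻¹ • (ep F n, -1))
  have hep : Bd F (n + 1) (ep F n) (ep F n) = 1 := by
    rw [ep, Bd_snoc, Be_apply]; simp
  have hh0 : h0 ∈ HPs (Be (Bd F (n + 1)) (-1)) := by
    refine ⟨?_, ?_, ?_⟩
    · simp only [h0, Be_apply, hep]; ring
    · simp only [h0, map_smul, LinearMap.smul_apply, Be_apply, hep, smul_eq_mul]; ring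
    · simp only [h0, map_smul, Be_apply, hep, smul_eq_mul]
      field_simp; ring
  refine inj_ind (ψ := psi (n + 1)) (S := {g | g • h0 = h0}) ?_ ?_ ?_ ?_
  · exact psi_inj.comp quadStab_inj
  · intro g hgh
    have e1 : g • h0.1 = h0.1 := (Prod.ext_iff.1 hgh).1
    have e2 : g • h0.2 = h0.2 := (Prod.ext_iff.1 hgh).2
    have t1 : ((0, 1) : (Fin (n + 1) → F) × F) = (2 : F)⁻¹ • h0.1 + (-1 : F) • h0.2 := by
      refine Prod.ext ?_ ?_
      · simp [h0]
      · simp only [h0, Prod.smul_snd, Prod.snd_add, smul_eq_mul]; field_simp; ring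
    have t2 : ((ep F n, 0) : (Fin (n + 1) → F) × F) = (2 : F)⁻¹ • h0.1 + h0.2 := by
      refine Prod.ext ?_ ?_
      · simp only [h0, Prod.smul_fst, Prod.fst_add]
        rw [← add_smul]
        have : (2 : F)⁻¹ + 2⁻¹ = 1 := by field_simp; ring
        rw [this, one_smul]
      · simp only [h0, Prod.smul_snd, Prod.snd_add, smul_eq_mul]; ring
    obtain ⟨g1, rfl⟩ := psi_range h2 g (by rw [t1, smul_add, I.lin, I.lin, e1, e2])
    have e3 : psi (n + 1) g1 • ((ep F n, 0) : (Fin (n + 1) → F) × F) = (ep F n, 0) := by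
      rw [t2, smul_add, I.lin, e1, e2]
    rw [psi_apply] at e3
    obtain ⟨k, rfl⟩ := fix_range h2 g1 (Prod.ext_iff.1 e3).1
    exact ⟨k, rfl⟩
  · intro k
    have hk := quadStab_ep k
    have e1 : ∀ l : F, psi (n + 1) (quadStab F (fun x : F => x ^ 2) n k) • (ep F n, l) =
        (ep F n, l) := fun l => by rw [psi_apply, hk]
    refine Prod.ext (e1 1) ?_
    change psi (n + 1) (quadStab F (fun x : F => x ^ 2) n k) • ((2 : F)⁻¹ • (ep F n, -1)) = _
    rw [I.lin, e1]
  · intro z hz u hu hzu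
    exact injS (fun g => rfl) (HPs_smul I)
      (van_all I Be_symm h2 (Be_ND (by simp) (Bd_ND _)) (genus_ext hg)) hh0
      (Nat.lt_succ_self _) hz hu hzu

theorem final (h2 : (2 : F) ≠ 0) (hab : ∃ a b : F, a ^ 2 + b ^ 2 = -1) (n d : ℕ) :
    (2 * d + 4 ≤ n →
        Function.Bijective (GroupHomologyBar.inducedMap ℤ (quadStab F (fun x : F => x ^ 2) n) d)) ∧
    (2 * d + 3 ≤ n →
        Function.Surjective (GroupHomologyBar.inducedMap ℤ (quadStab F (fun x : F => x ^ 2) n) d)) ∧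
    ((∃ a : F, a ^ 2 = -1) →
      (2 * d + 2 ≤ n →
        Function.Bijective (GroupHomologyBar.inducedMap ℤ (quadStab F (fun x : F => x ^ 2) n) d)) ∧
      (2 * d + 1 ≤ n →
        Function.Surjective (GroupHomologyBar.inducedMap ℤ (quadStab F (fun x : F => x ^ 2) n) d))) := by
  obtain ⟨a, b, hab⟩ := hab
  have S1 : 2 * d + 3 ≤ n →
      Function.Surjective (GroupHomologyBar.inducedMap ℤ (quadStab F (fun x : F => x ^ 2) n) d) := by
    intro hn
    obtain ⟨m, rfl⟩ : ∃ m, n = m + 1 + 1 := ⟨n - 2, by omega⟩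
    refine surj_half h2 (genus_ab hab (by omega)) (y := Fin.cons a (Fin.cons b (fun _ => 0))) ?_
    rw [Bd_apply, Fin.sum_univ_succ, Fin.sum_univ_succ]
    simp only [Fin.cons_zero, Fin.cons_succ]
    simp only [mul_zero, Finset.sum_const_zero]
    linear_combination hab
  refine ⟨fun hn => ⟨inj_half h2 (genus_ab hab hn), S1 (by omega)⟩, S1, ?_⟩
  rintro ⟨a, ha⟩
  have S2 : 2 * d + 1 ≤ n →
      Function.Surjective (GroupHomologyBar.inducedMap ℤ (quadStab F (fun x : F => x ^ 2) n) d) := by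
    intro hn
    obtain ⟨m, rfl⟩ : ∃ m, n = m + 1 := ⟨n - 1, by omega⟩
    refine surj_half h2 (genus_sq ha (by omega)) (y := Fin.cons a (fun _ => 0)) ?_
    rw [Bd_apply, Fin.sum_univ_succ]
    simp only [Fin.cons_zero, Fin.cons_succ]
    simp only [mul_zero, Finset.sum_const_zero]
    linear_combination ha
  exact ⟨fun hn => ⟨inj_half h2 (genus_sq ha (by omega)), S2 (by omega)⟩, S2⟩

end Final

end OStab

open GroupHomologyBar in
/-- Homological stability for the Euclidean orthogonal groups `O(n,F)` over a field of
characteristic `≠ 2` in which `-1` is a sum of two squares.  Here `O(n,F)` is realized as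
the group `quadIsoms F (sumForm F (fun x => x²) n)` of linear automorphisms of `Fⁿ`
preserving the quadratic form `q(x) = ∑ᵢ xᵢ²`, and the stabilization map
`O(n,F) → O(n+1,F)` extends an isometry by the identity on an added coordinate.  It
induces an isomorphism on integral group homology `H_d` whenever `2d ≤ n - 4` and a
surjection whenever `2d ≤ n - 3`; moreover, if `-1` is a square in `F`, an isomorphism
whenever `2d ≤ n - 2` and a surjection whenever `2d ≤ n - 1`. -/
theorem O_euclidean_homology_stability (F : Type) [Field F] (hchar : (2 : F) ≠ 0)
    (hab : ∃ a b : F, a ^ 2 + b ^ 2 = -1) (n d : ℕ) :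
    (2 * d + 4 ≤ n →
      Function.Bijective (inducedMap ℤ (quadStab F (fun x : F => x ^ 2) n) d)) ∧
    (2 * d + 3 ≤ n →
      Function.Surjective (inducedMap ℤ (quadStab F (fun x : F => x ^ 2) n) d)) ∧
    ((∃ a : F, a ^ 2 = -1) →
      (2 * d + 2 ≤ n →
        Function.Bijective (inducedMap ℤ (quadStab F (fun x : F => x ^ 2) n) d)) ∧
      (2 * d + 1 ≤ n →
        Function.Surjective (inducedMap ℤ (quadStab F (fun x : F => x ^ 2) n) d))) := by
  exact OStab.final hchar hab n d
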